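/- Let G be a group, k a commutative G-ring, and ε ∈ k invertible. The morphism Tor_q^{GBR_{n-1}(ε)}(𝟙,𝟙) → Tor_q^{GBR_n(ε)}(𝟙,𝟙) induced by the inclusion GBR_{n-1}(ε) → GBR_n(ε) is an isomorphism for n ≥ 2q+2. -/

import Mathlib

open scoped TensorProduct

noncomputable section

/-! ### Bar-complex homology of an augmented algebra

For a `k`-algebra `A` with augmentation `ε : A →ₐ[k] k` (the algebra map corresponding to
the trivial module `𝟙 = k`), we form the (unnormalized) bar complex `C_q = A^{⊗ q}`
(tensors over `k`), with the usual differential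
`d(a₁⊗…⊗a_q) = ε(a₁)(a₂⊗…) + Σ (-1)^i (…a_i a_{i+1}…) + (-1)^q ε(a_q)(a₁⊗…)`,
whose homology is `Tor_*^A(𝟙,𝟙)`. -/

/-- The modules `A^{⊗ q}` of the bar complex. -/
def barC (k : Type) [CommRing k] (A : Type) [Ring A] [Algebra k A] : ℕ → ModuleCat k
  | 0 => ModuleCat.of k k
  | (q + 1) => ModuleCat.of k (A ⊗[k] (barC k A q))

variable (k : Type) [CommRing k] (A : Type) [Ring A] [Algebra k A] (ε : A →ₐ[k] k)

/-- Left multiplication of `A` on the leftmost bar factor (via `ε` in degree `0`). -/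
def barAct : ∀ q : ℕ, A →ₗ[k] ((barC k A q : Type) →ₗ[k] (barC k A q : Type))
  | 0 => (LinearMap.lsmul k k).comp ε.toLinearMap
  | (q + 1) =>
    show A →ₗ[k] ((A ⊗[k] (barC k A q : Type)) →ₗ[k] (A ⊗[k] (barC k A q : Type))) from
    { toFun := fun a => TensorProduct.map (LinearMap.mulLeft k a) LinearMap.id
      map_add' := by
        intro a b
        refine TensorProduct.ext' fun x y => ?_
        simp [add_mul, TensorProduct.add_tmul]
      map_smul' := by
        intro c a
        refine TensorProduct.ext' fun x y => ?_
        simp [TensorProduct.smul_tmul', smul_mul_assoc] }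

/-- All terms of the bar differential except the first face. -/
def barB : ∀ q : ℕ, ((A ⊗[k] (barC k A q : Type)) →ₗ[k] (barC k A q : Type))
  | 0 => - TensorProduct.lift ((LinearMap.lsmul k (barC k A 0 : Type)).comp ε.toLinearMap)
  | (q + 1) =>
    show (A ⊗[k] (A ⊗[k] (barC k A q : Type))) →ₗ[k] (A ⊗[k] (barC k A q : Type)) from
    TensorProduct.lift (LinearMap.mk₂ k
      (fun (a : A) (x : A ⊗[k] (barC k A q : Type)) =>
        -((show A →ₗ[k] ((A ⊗[k] (barC k A q : Type)) →ₗ[k] (A ⊗[k] (barC k A q : Type))) from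
            barAct k A ε (q + 1)) a x) - a ⊗ₜ[k] (barB q x))
      (by intro a b x
          have key : ∀ f : A →ₗ[k] ((A ⊗[k] (barC k A q : Type)) →ₗ[k] (A ⊗[k] (barC k A q : Type))),
              -(f (a + b) x) - (a + b) ⊗ₜ[k] (barB q x)
                = (-(f a x) - a ⊗ₜ[k] (barB q x)) + (-(f b x) - b ⊗ₜ[k] (barB q x)) := by
            intro f
            simp only [map_add, LinearMap.add_apply, TensorProduct.add_tmul]
            try abel
          exact key (barAct k A ε (q + 1)))
      (by intro c a x
          have key : ∀ f : A →ₗ[k] ((A ⊗[k] (barC k A q : Type)) →ₗ[k] (A ⊗[k] (barC k A q : Type))),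
              -(f (c • a) x) - (c • a) ⊗ₜ[k] (barB q x)
                = c • (-(f a x) - a ⊗ₜ[k] (barB q x)) := by
            intro f
            simp only [map_smul, LinearMap.smul_apply, smul_sub, smul_neg,
              TensorProduct.smul_tmul']
          exact key (barAct k A ε (q + 1)))
      (by intro a x y
          simp only [map_add, LinearMap.map_add, TensorProduct.tmul_add]
          try abel)
      (by intro c a x
          simp only [map_smul, LinearMap.map_smul, TensorProduct.tmul_smul, smul_sub, smul_neg]
          try abel))

/-- The bar differential `C_{q+1} = A ⊗ C_q → C_q`. -/
def bard (q : ℕ) : (A ⊗[k] (barC k A q : Type)) →ₗ[k] (barC k A q : Type) :=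
  TensorProduct.lift ((LinearMap.lsmul k (barC k A q : Type)).comp ε.toLinearMap)
  + barB k A ε q

/-- Cycles of the bar complex. -/
def barCycles : ∀ q : ℕ, Submodule k (barC k A q : Type)
  | 0 => ⊤
  | (q + 1) =>
    show Submodule k (barC k A (q + 1) : Type) from LinearMap.ker (bard k A ε q)

/-- `Tor_q^A(𝟙, 𝟙)`, the homology of the algebra `A` with augmentation (trivial module) `ε`,
computed by the bar complex. -/
def barTor (q : ℕ) : Type :=
  (barCycles k A ε q) ⧸
    (Submodule.comap (barCycles k A ε q).subtype (LinearMap.range (bard k A ε q)))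

instance (q : ℕ) : AddCommGroup (barTor k A ε q) :=
  inferInstanceAs (AddCommGroup ((barCycles k A ε q) ⧸
    (Submodule.comap (barCycles k A ε q).subtype (LinearMap.range (bard k A ε q)))))

instance (q : ℕ) : Module k (barTor k A ε q) :=
  inferInstanceAs (Module k ((barCycles k A ε q) ⧸
    (Submodule.comap (barCycles k A ε q).subtype (LinearMap.range (bard k A ε q)))))

/-- The augmentation of a group algebra `k[G]`, corresponding to the trivial action of `G`
on `k`. -/
def groupAug (G : Type) [Group G] : MonoidAlgebra k G →ₐ[k] k :=
  MonoidAlgebra.lift k k G 1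

/-- Group homology `H_*(G; k) = Tor_*^{k[G]}(k, k)` (with the trivial action on `k`). -/
abbrev groupTor (G : Type) [Group G] (q : ℕ) : Type :=
  barTor k (MonoidAlgebra k G) (groupAug k G) q

section TorFunctoriality

variable (k : Type) [CommRing k]

/-- `barAct` in positive degrees, with its domain and codomain presented as tensor
products. -/
noncomputable abbrev barActT (A : Type) [Ring A] [Algebra k A] (ε : A →ₐ[k] k) (q : ℕ) :
    A →ₗ[k] ((A ⊗[k] (barC k A q : Type)) →ₗ[k] (A ⊗[k] (barC k A q : Type))) :=
  barAct k A ε (q + 1)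

theorem barActT_tmul (A : Type) [Ring A] [Algebra k A] (ε : A →ₐ[k] k) (q : ℕ)
    (a b : A) (x : (barC k A q : Type)) :
    barActT k A ε q a (b ⊗ₜ[k] x) = (a * b) ⊗ₜ[k] x := rfl

theorem barB_zero_apply (A : Type) [Ring A] [Algebra k A] (ε : A →ₐ[k] k)
    (a : A) (c : (barC k A 0 : Type)) :
    barB k A ε 0 (a ⊗ₜ[k] c) = -(ε a • c) := rfl

theorem barB_succ_apply (A : Type) [Ring A] [Algebra k A] (ε : A →ₐ[k] k) (q : ℕ)
    (a : A) (x : A ⊗[k] (barC k A q : Type)) :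
    barB k A ε (q + 1) (a ⊗ₜ[k] x)
      = -(barActT k A ε q a x) - a ⊗ₜ[k] (barB k A ε q x) := by
  rfl

variable {A₁ A₂ : Type} [Ring A₁] [Algebra k A₁] [Ring A₂] [Algebra k A₂]

/-- The chain map between bar complexes induced by an algebra map. -/
noncomputable def barMap (φ : A₁ →ₐ[k] A₂) :
    ∀ q : ℕ, (barC k A₁ q : Type) →ₗ[k] (barC k A₂ q : Type)
  | 0 => LinearMap.id
  | (q + 1) =>
    show (A₁ ⊗[k] (barC k A₁ q : Type)) →ₗ[k] (A₂ ⊗[k] (barC k A₂ q : Type)) from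
      TensorProduct.map φ.toLinearMap (barMap φ q)

theorem barActT_comm (ε₁ : A₁ →ₐ[k] k) (ε₂ : A₂ →ₐ[k] k) (φ : A₁ →ₐ[k] A₂)
    (q : ℕ) (a : A₁) :
    (barActT k A₂ ε₂ q (φ a)).comp (TensorProduct.map φ.toLinearMap (barMap k φ q))
      = (TensorProduct.map φ.toLinearMap (barMap k φ q)).comp (barActT k A₁ ε₁ q a) := by
  refine TensorProduct.ext' fun b y => ?_
  simp only [LinearMap.coe_comp, Function.comp_apply, TensorProduct.map_tmul]
  rw [barActT_tmul, barActT_tmul, TensorProduct.map_tmul]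
  simp [map_mul]

theorem barB_comm (ε₁ : A₁ →ₐ[k] k) (ε₂ : A₂ →ₐ[k] k) (φ : A₁ →ₐ[k] A₂)
    (hφ : ε₂.comp φ = ε₁) : ∀ q : ℕ,
    (barB k A₂ ε₂ q).comp (TensorProduct.map φ.toLinearMap (barMap k φ q))
      = (barMap k φ q).comp (barB k A₁ ε₁ q)
  | 0 => by
    have key : ∀ a : A₁, ε₂ (φ a) = ε₁ a := fun a => by
      have := AlgHom.congr_fun hφ a
      simpa using this
    refine TensorProduct.ext' fun a c => ?_
    simp only [LinearMap.coe_comp, Function.comp_apply, TensorProduct.map_tmul]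
    rw [barB_zero_apply]
    show -(ε₂ (φ.toLinearMap a) • (barMap k φ 0 c)) = barMap k φ 0 (barB k A₁ ε₁ 0 (a ⊗ₜ[k] c))
    rw [barB_zero_apply]
    show -(ε₂ (φ a) • c) = -(ε₁ a • c)
    rw [key a]
  | (q + 1) => by
    refine TensorProduct.ext' fun a (x : A₁ ⊗[k] (barC k A₁ q : Type)) => ?_
    have h1 := LinearMap.congr_fun (barActT_comm k ε₁ ε₂ φ q a) x
    simp only [LinearMap.coe_comp, Function.comp_apply] at h1
    have h2 := LinearMap.congr_fun (barB_comm ε₁ ε₂ φ hφ q) x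
    simp only [LinearMap.coe_comp, Function.comp_apply] at h2
    refine (barB_succ_apply k A₂ ε₂ q (φ.toLinearMap a)
      (TensorProduct.map φ.toLinearMap (barMap k φ q) x)).trans ?_
    refine Eq.trans ?_ (congrArg (barMap k φ (q + 1)) (barB_succ_apply k A₁ ε₁ q a x)).symm
    show -(barActT k A₂ ε₂ q (φ.toLinearMap a)
            ((TensorProduct.map φ.toLinearMap (barMap k φ q)) x))
        - (φ.toLinearMap a) ⊗ₜ[k]
            (barB k A₂ ε₂ q ((TensorProduct.map φ.toLinearMap (barMap k φ q)) x))
      = TensorProduct.map φ.toLinearMap (barMap k φ q)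
          (-(barActT k A₁ ε₁ q a x) - a ⊗ₜ[k] (barB k A₁ ε₁ q x))
    rw [map_sub, map_neg, TensorProduct.map_tmul]
    simp only [AlgHom.toLinearMap_apply]
    rw [h1, h2]

/-- The chain map induced by an augmentation-preserving algebra map commutes with the
bar differential. -/
theorem barMap_comm (ε₁ : A₁ →ₐ[k] k) (ε₂ : A₂ →ₐ[k] k) (φ : A₁ →ₐ[k] A₂)
    (hφ : ε₂.comp φ = ε₁) (q : ℕ) :
    (bard k A₂ ε₂ q).comp (TensorProduct.map φ.toLinearMap (barMap k φ q))
      = (barMap k φ q).comp (bard k A₁ ε₁ q) := by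
  have key : ∀ a : A₁, ε₂ (φ a) = ε₁ a := fun a => by
    have := AlgHom.congr_fun hφ a
    simpa using this
  unfold bard
  rw [LinearMap.add_comp, LinearMap.comp_add, barB_comm k ε₁ ε₂ φ hφ q]
  congr 1
  refine TensorProduct.ext' fun a x => ?_
  simp only [LinearMap.coe_comp, Function.comp_apply, TensorProduct.map_tmul,
    TensorProduct.lift.tmul, LinearMap.lsmul_apply, AlgHom.toLinearMap_apply,
    LinearMap.map_smul]
  rw [key a]

theorem barMap_cycles (ε₁ : A₁ →ₐ[k] k) (ε₂ : A₂ →ₐ[k] k) (φ : A₁ →ₐ[k] A₂)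
    (hφ : ε₂.comp φ = ε₁) (q : ℕ) :
    ∀ x ∈ barCycles k A₁ ε₁ q, barMap k φ q x ∈ barCycles k A₂ ε₂ q := by
  intro x hx
  cases q with
  | zero => trivial
  | succ q =>
    show barMap k φ (q+1) x ∈ LinearMap.ker (bard k A₂ ε₂ q)
    have hx' : bard k A₁ ε₁ q x = 0 := hx
    have h := LinearMap.congr_fun (barMap_comm k ε₁ ε₂ φ hφ q) x
    simp only [LinearMap.coe_comp, Function.comp_apply] at h
    show bard k A₂ ε₂ q (TensorProduct.map φ.toLinearMap (barMap k φ q) x) = 0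
    exact h.trans ((congrArg (barMap k φ q) hx').trans (map_zero _))

/-- The map on `Tor_q(𝟙,𝟙)` induced by an augmentation-preserving algebra map. -/
noncomputable def torMap (ε₁ : A₁ →ₐ[k] k) (ε₂ : A₂ →ₐ[k] k) (φ : A₁ →ₐ[k] A₂)
    (hφ : ε₂.comp φ = ε₁) (q : ℕ) :
    barTor k A₁ ε₁ q →ₗ[k] barTor k A₂ ε₂ q := by
  refine Submodule.mapQ _ _
    ((barMap k φ q).restrict (barMap_cycles k ε₁ ε₂ φ hφ q)) ?_
  intro x hx
  simp only [Submodule.mem_comap, LinearMap.mem_range] at hx ⊢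
  obtain ⟨y, hy⟩ := hx
  refine ⟨TensorProduct.map φ.toLinearMap (barMap k φ q) y, ?_⟩
  have h := LinearMap.congr_fun (barMap_comm k ε₁ ε₂ φ hφ q) y
  simp only [LinearMap.coe_comp, Function.comp_apply] at h
  rw [h, hy]
  rfl

end TorFunctoriality

section GBRsection

/-! The `G`-equivariant braided rook algebra `GBR_n(ε)`: generators `b i`/`bi i`
(over/under crossings), `p j` (deleted strand) and `t g j` (label `g : G` on strand `j`);
a contractible middle component contributes the factor `ε`. -/

inductive GBRGen (n : ℕ) (G : Type) : Type
  | b : Fin (n - 1) → GBRGen n G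
  | bi : Fin (n - 1) → GBRGen n G
  | p : Fin n → GBRGen n G
  | t : G → Fin n → GBRGen n G

variable (k G : Type) [CommRing k] [Group G] (n : ℕ) (ε : k)

abbrev GBRb (i : Fin (n - 1)) : FreeAlgebra k (GBRGen n G) := FreeAlgebra.ι k (GBRGen.b i)
abbrev GBRbi (i : Fin (n - 1)) : FreeAlgebra k (GBRGen n G) := FreeAlgebra.ι k (GBRGen.bi i)
abbrev GBRp (j : Fin n) : FreeAlgebra k (GBRGen n G) := FreeAlgebra.ι k (GBRGen.p j)
abbrev GBRt (g : G) (j : Fin n) : FreeAlgebra k (GBRGen n G) := FreeAlgebra.ι k (GBRGen.t g j)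

/-- The diagrammatic relations. -/
inductive GBRRel : FreeAlgebra k (GBRGen n G) → FreeAlgebra k (GBRGen n G) → Prop
  | b_inv_r (i : Fin (n - 1)) :
      GBRRel (GBRb k G n i * GBRbi k G n i) (1)
  | b_inv_l (i : Fin (n - 1)) :
      GBRRel (GBRbi k G n i * GBRb k G n i) (1)
  | b_braid (i j : Fin (n - 1)) (h : (j : ℕ) = (i : ℕ) + 1) :
      GBRRel (GBRb k G n i * GBRb k G n j * GBRb k G n i) (GBRb k G n j * GBRb k G n i * GBRb k G n j)
  | bb_comm (i j : Fin (n - 1)) (h : (i : ℕ) + 1 < (j : ℕ)) :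
      GBRRel (GBRb k G n i * GBRb k G n j) (GBRb k G n j * GBRb k G n i)
  | p_sq (j : Fin n) :
      GBRRel (GBRp k G n j * GBRp k G n j) (ε • GBRp k G n j)
  | pp_comm (j l : Fin n) (h : (j : ℕ) < (l : ℕ)) :
      GBRRel (GBRp k G n j * GBRp k G n l) (GBRp k G n l * GBRp k G n j)
  | bp_comm (i : Fin (n - 1)) (l : Fin n) (h : (l : ℕ) ≠ (i : ℕ) ∧ (l : ℕ) ≠ (i : ℕ) + 1) :
      GBRRel (GBRb k G n i * GBRp k G n l) (GBRp k G n l * GBRb k G n i)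
  | bp_slide (i : Fin (n - 1)) (j j' : Fin n) (h : (j : ℕ) = (i : ℕ)) (h' : (j' : ℕ) = (i : ℕ) + 1) :
      GBRRel (GBRb k G n i * GBRp k G n j) (GBRp k G n j' * GBRb k G n i)
  | bp_slide' (i : Fin (n - 1)) (j j' : Fin n) (h : (j : ℕ) = (i : ℕ)) (h' : (j' : ℕ) = (i : ℕ) + 1) :
      GBRRel (GBRb k G n i * GBRp k G n j') (GBRp k G n j * GBRb k G n i)
  | pbp (i : Fin (n - 1)) (j j' : Fin n) (h : (j : ℕ) = (i : ℕ)) (h' : (j' : ℕ) = (i : ℕ) + 1) :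
      GBRRel (GBRp k G n j * GBRb k G n i * GBRp k G n j) (GBRp k G n j * GBRp k G n j')
  | pbb (i : Fin (n - 1)) (j : Fin n) (h : (j : ℕ) = (i : ℕ)) :
      GBRRel (GBRp k G n j * GBRb k G n i * GBRb k G n i) (GBRp k G n j)
  | pbb' (i : Fin (n - 1)) (j' : Fin n) (h' : (j' : ℕ) = (i : ℕ) + 1) :
      GBRRel (GBRp k G n j' * GBRb k G n i * GBRb k G n i) (GBRp k G n j')
  | t_mul (g h' : G) (j : Fin n) :
      GBRRel (GBRt k G n g j * GBRt k G n h' j) (GBRt k G n (g * h') j)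
  | t_one (j : Fin n) :
      GBRRel (GBRt k G n 1 j) (1)
  | tt_comm (g h' : G) (j l : Fin n) (h : j ≠ l) :
      GBRRel (GBRt k G n g j * GBRt k G n h' l) (GBRt k G n h' l * GBRt k G n g j)
  | bt_comm (g : G) (i : Fin (n - 1)) (l : Fin n) (h : (l : ℕ) ≠ (i : ℕ) ∧ (l : ℕ) ≠ (i : ℕ) + 1) :
      GBRRel (GBRb k G n i * GBRt k G n g l) (GBRt k G n g l * GBRb k G n i)
  | bt_slide (g : G) (i : Fin (n - 1)) (j j' : Fin n) (h : (j : ℕ) = (i : ℕ)) (h' : (j' : ℕ) = (i : ℕ) + 1) :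
      GBRRel (GBRb k G n i * GBRt k G n g j) (GBRt k G n g j' * GBRb k G n i)
  | bt_slide' (g : G) (i : Fin (n - 1)) (j j' : Fin n) (h : (j : ℕ) = (i : ℕ)) (h' : (j' : ℕ) = (i : ℕ) + 1) :
      GBRRel (GBRb k G n i * GBRt k G n g j') (GBRt k G n g j * GBRb k G n i)
  | tp_absorb (g : G) (j : Fin n) :
      GBRRel (GBRt k G n g j * GBRp k G n j) (GBRp k G n j)
  | pt_absorb (g : G) (j : Fin n) :
      GBRRel (GBRp k G n j * GBRt k G n g j) (GBRp k G n j)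
  | tp_comm (g : G) (j l : Fin n) (h : j ≠ l) :
      GBRRel (GBRt k G n g j * GBRp k G n l) (GBRp k G n l * GBRt k G n g j)

/-- The diagram algebra: the quotient of the free algebra on the diagram generators by
the diagrammatic relations. -/
abbrev GBRAlg : Type := RingQuot (GBRRel k G n ε)

/-- The augmentation corresponding to the trivial module `𝟙`: a diagram acts by `1`
if it has `n` left-to-right connections, and by `0` otherwise. -/
noncomputable def GBRaug : GBRAlg k G n ε →ₐ[k] k :=
  RingQuot.liftAlgHom k ⟨FreeAlgebra.lift k
      (fun x => match x with
        | GBRGen.b _ => (1 : k)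
        | GBRGen.bi _ => (1 : k)
        | GBRGen.p _ => (0 : k)
        | GBRGen.t _ _ => (1 : k)),
    by rintro x y h
       induction h <;>
         simp [GBRb, GBRbi, GBRp, GBRt, FreeAlgebra.lift_ι_apply]⟩

end GBRsection

section GBRinclsection

variable (k G : Type) [CommRing k] [Group G] (n : ℕ) (ε : k)

/-- Extending a diagram by an extra horizontal strand at the bottom, on generators. -/
def GBRGenMap : GBRGen (n - 1) G → GBRGen n G
  | .b i => .b (Fin.castLE (by omega) i)
  | .bi i => .bi (Fin.castLE (by omega) i)
  | .p i => .p (Fin.castLE (by omega) i)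
  | .t g j => .t g (Fin.castLE (by omega) j)

/-- The diagrammatic relations are preserved by the extension of diagrams. -/
theorem GBRRel_map {x y : FreeAlgebra k (GBRGen (n - 1) G)} (h : GBRRel k G (n - 1) ε x y) :
    GBRRel k G n ε
      ((FreeAlgebra.lift k fun g => FreeAlgebra.ι k (GBRGenMap G n g)) x)
      ((FreeAlgebra.lift k fun g => FreeAlgebra.ι k (GBRGenMap G n g)) y) := by
  induction h with
  | b_inv_r i =>
    simp only [map_mul, map_one, map_smul, FreeAlgebra.lift_ι_apply, GBRGenMap]
    exact GBRRel.b_inv_r _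
  | b_inv_l i =>
    simp only [map_mul, map_one, map_smul, FreeAlgebra.lift_ι_apply, GBRGenMap]
    exact GBRRel.b_inv_l _
  | b_braid i j h =>
    simp only [map_mul, map_one, map_smul, FreeAlgebra.lift_ι_apply, GBRGenMap]
    exact GBRRel.b_braid _ _ (by simp_all [Fin.ext_iff, Fin.coe_castLE] <;> omega)
  | bb_comm i j h =>
    simp only [map_mul, map_one, map_smul, FreeAlgebra.lift_ι_apply, GBRGenMap]
    exact GBRRel.bb_comm _ _ (by simp_all [Fin.ext_iff, Fin.coe_castLE] <;> omega)
  | p_sq j =>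
    simp only [map_mul, map_one, map_smul, FreeAlgebra.lift_ι_apply, GBRGenMap]
    exact GBRRel.p_sq _
  | pp_comm j l h =>
    simp only [map_mul, map_one, map_smul, FreeAlgebra.lift_ι_apply, GBRGenMap]
    exact GBRRel.pp_comm _ _ (by simp_all [Fin.ext_iff, Fin.coe_castLE] <;> omega)
  | bp_comm i l h =>
    simp only [map_mul, map_one, map_smul, FreeAlgebra.lift_ι_apply, GBRGenMap]
    exact GBRRel.bp_comm _ _ (by simp_all [Fin.ext_iff, Fin.coe_castLE] <;> omega)
  | bp_slide i j j' h h' =>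
    simp only [map_mul, map_one, map_smul, FreeAlgebra.lift_ι_apply, GBRGenMap]
    exact GBRRel.bp_slide _ _ _ (by simp_all [Fin.ext_iff, Fin.coe_castLE] <;> omega) (by simp_all [Fin.ext_iff, Fin.coe_castLE] <;> omega)
  | bp_slide' i j j' h h' =>
    simp only [map_mul, map_one, map_smul, FreeAlgebra.lift_ι_apply, GBRGenMap]
    exact GBRRel.bp_slide' _ _ _ (by simp_all [Fin.ext_iff, Fin.coe_castLE] <;> omega) (by simp_all [Fin.ext_iff, Fin.coe_castLE] <;> omega)
  | pbp i j j' h h' =>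
    simp only [map_mul, map_one, map_smul, FreeAlgebra.lift_ι_apply, GBRGenMap]
    exact GBRRel.pbp _ _ _ (by simp_all [Fin.ext_iff, Fin.coe_castLE] <;> omega) (by simp_all [Fin.ext_iff, Fin.coe_castLE] <;> omega)
  | pbb i j h =>
    simp only [map_mul, map_one, map_smul, FreeAlgebra.lift_ι_apply, GBRGenMap]
    exact GBRRel.pbb _ _ (by simp_all [Fin.ext_iff, Fin.coe_castLE] <;> omega)
  | pbb' i j' h' =>
    simp only [map_mul, map_one, map_smul, FreeAlgebra.lift_ι_apply, GBRGenMap]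
    exact GBRRel.pbb' _ _ (by simp_all [Fin.ext_iff, Fin.coe_castLE] <;> omega)
  | t_mul g h' j =>
    simp only [map_mul, map_one, map_smul, FreeAlgebra.lift_ι_apply, GBRGenMap]
    exact GBRRel.t_mul _ _ _
  | t_one j =>
    simp only [map_mul, map_one, map_smul, FreeAlgebra.lift_ι_apply, GBRGenMap]
    exact GBRRel.t_one _
  | tt_comm g h' j l h =>
    simp only [map_mul, map_one, map_smul, FreeAlgebra.lift_ι_apply, GBRGenMap]
    exact GBRRel.tt_comm _ _ _ _ (by simp_all [Fin.ext_iff, Fin.coe_castLE] <;> omega)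
  | bt_comm g i l h =>
    simp only [map_mul, map_one, map_smul, FreeAlgebra.lift_ι_apply, GBRGenMap]
    exact GBRRel.bt_comm _ _ _ (by simp_all [Fin.ext_iff, Fin.coe_castLE] <;> omega)
  | bt_slide g i j j' h h' =>
    simp only [map_mul, map_one, map_smul, FreeAlgebra.lift_ι_apply, GBRGenMap]
    exact GBRRel.bt_slide _ _ _ _ (by simp_all [Fin.ext_iff, Fin.coe_castLE] <;> omega) (by simp_all [Fin.ext_iff, Fin.coe_castLE] <;> omega)
  | bt_slide' g i j j' h h' =>
    simp only [map_mul, map_one, map_smul, FreeAlgebra.lift_ι_apply, GBRGenMap]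
    exact GBRRel.bt_slide' _ _ _ _ (by simp_all [Fin.ext_iff, Fin.coe_castLE] <;> omega) (by simp_all [Fin.ext_iff, Fin.coe_castLE] <;> omega)
  | tp_absorb g j =>
    simp only [map_mul, map_one, map_smul, FreeAlgebra.lift_ι_apply, GBRGenMap]
    exact GBRRel.tp_absorb _ _
  | pt_absorb g j =>
    simp only [map_mul, map_one, map_smul, FreeAlgebra.lift_ι_apply, GBRGenMap]
    exact GBRRel.pt_absorb _ _
  | tp_comm g j l h =>
    simp only [map_mul, map_one, map_smul, FreeAlgebra.lift_ι_apply, GBRGenMap]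
    exact GBRRel.tp_comm _ _ _ (by simp_all [Fin.ext_iff, Fin.coe_castLE] <;> omega)

/-- The inclusion of diagram algebras given by adding an extra horizontal strand
(labelled by `1 ∈ G` in the equivariant case) at the bottom of a diagram. -/
noncomputable def GBRincl : GBRAlg k G (n - 1) ε →ₐ[k] GBRAlg k G n ε :=
  RingQuot.liftAlgHom k ⟨(RingQuot.mkAlgHom k (GBRRel k G n ε)).comp
      (FreeAlgebra.lift k (fun x => FreeAlgebra.ι k (GBRGenMap G n x))),
    by intro x y h
       simp only [AlgHom.coe_comp, Function.comp_apply]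
       exact RingQuot.mkAlgHom_rel k (GBRRel_map k G n ε h)⟩

/-- The inclusion is compatible with the augmentations (trivial modules). -/
theorem GBRaug_incl : (GBRaug k G n ε).comp (GBRincl k G n ε) = GBRaug k G (n - 1) ε := by
  apply RingQuot.ringQuot_ext'
  apply FreeAlgebra.hom_ext
  funext x
  cases x <;>
    simp [GBRincl, GBRaug, GBRGenMap, Function.comp, RingQuot.liftAlgHom_mkAlgHom_apply,
      FreeAlgebra.lift_ι_apply]

end GBRinclsection

end

noncomputable section

namespace BR

def Adj (i j : ℕ) : Prop := i = j + 1 ∨ j = i + 1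
def Far (i j : ℕ) : Prop := i + 1 < j ∨ j + 1 < i

theorem Adj.symm {i j : ℕ} (h : Adj i j) : Adj j i := Or.symm h
theorem Far.symm {i j : ℕ} (h : Far i j) : Far j i := Or.symm h

theorem tri (i j : ℕ) : i = j ∨ Adj i j ∨ Far i j := by
  unfold Adj Far; omega

/-- The braid relations. -/
structure BRel {N : Type} [Monoid N] (s : ℕ → N) : Prop where
  comm : ∀ i j, Far i j → s i * s j = s j * s i
  braid : ∀ i j, Adj i j → s i * s j * s i = s j * s i * s j

namespace BRel
variable {N : Type} [Monoid N] {s : ℕ → N} (H : BRel s)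
include H
theorem comm' (i j : ℕ) (h : Far i j) (t : N) : t * s i * s j = t * s j * s i := by
  rw [mul_assoc, H.comm i j h, mul_assoc]
theorem braid' (i j : ℕ) (h : Adj i j) (t : N) :
    t * s i * s j * s i = t * s j * s i * s j := by
  have := H.braid i j h
  simp only [mul_assoc] at *
  rw [this]
end BRel

/-- The Garside-type conclusion. -/
def GC {N : Type} [Monoid N] (s : ℕ → N) (i j : ℕ) (x y : N) : Prop :=
  (i = j → x = y) ∧ (Adj i j → ∃ z, x = z * s i * s j ∧ y = z * s j * s i) ∧
    (Far i j → ∃ z, x = z * s j ∧ y = z * s i)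

theorem GC.symm {N : Type} [Monoid N] {s : ℕ → N} {i j : ℕ} {x y : N} (h : GC s i j x y) :
    GC s j i y x := by
  refine ⟨fun e => (h.1 e.symm).symm, fun e => ?_, fun e => ?_⟩
  · obtain ⟨z, a, b⟩ := h.2.1 e.symm; exact ⟨z, b, a⟩
  · obtain ⟨z, a, b⟩ := h.2.2 e.symm; exact ⟨z, b, a⟩

theorem GC.smul {N : Type} [Monoid N] {s : ℕ → N} {i j : ℕ} {x y : N} (w : N)
    (h : GC s i j x y) : GC s i j (w * x) (w * y) := by
  refine ⟨fun e => by rw [h.1 e], fun e => ?_, fun e => ?_⟩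
  · obtain ⟨z, rfl, rfl⟩ := h.2.1 e; exact ⟨w * z, by simp only [mul_assoc], by simp only [mul_assoc]⟩
  · obtain ⟨z, rfl, rfl⟩ := h.2.2 e; exact ⟨w * z, by simp only [mul_assoc], by simp only [mul_assoc]⟩

theorem GC.self {N : Type} [Monoid N] (s : ℕ → N) (i : ℕ) (x : N) : GC s i i x x := by
  refine ⟨fun _ => rfl, fun e => ?_, fun e => ?_⟩
  · unfold Adj at e; omega
  · unfold Far at e; omega

section
variable {N : Type} [Monoid N] {s : ℕ → N} (H : BRel s) (len : N → ℕ)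
  (hm : ∀ x y, len (x * y) = len x + len y) (hs : ∀ i, len (s i) = 1)
include H hm hs

theorem GC_trans_far (L : ℕ)
    (IH : ∀ x y i j, len x < L → x * s i = y * s j → GC s i j x y)
    {i j m : ℕ} {x w y : N} (hw : len w ≤ L) (hij : Far i j) (hmi : m ≠ i) (hmj : m ≠ j)
    (h1 : GC s i m x w) (h2 : GC s m j w y) : ∃ z, x = z * s j ∧ y = z * s i := by
  rcases tri i m with e | him | him
  · exact absurd e.symm hmi
  · obtain ⟨a, hx, hw1⟩ := h1.2.1 him
    rcases tri m j with e | hj | hj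
    · exact absurd e hmj
    · -- case 7
      obtain ⟨b, hw2, hy⟩ := h2.2.1 hj
      have la := congrArg len hw1
      have lb := congrArg len hw2
      simp only [hm, hs] at la lb
      obtain ⟨z, e1, e2⟩ := (IH _ _ i j (by rw [hm, hs]; omega) (hw1.symm.trans hw2)).2.2 hij
      have lz := congrArg len e1
      simp only [hm, hs] at lz
      obtain ⟨u, f1, f2⟩ := (IH _ _ m j (by omega) e1).2.1 hj
      obtain ⟨v, g1, g2⟩ := (IH _ _ m i (by omega) e2).2.1 him.symm
      have lu := congrArg len f1
      simp only [hm, hs] at lu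
      have k1 := (IH _ _ m m (by rw [hm, hs]; omega) (f2.symm.trans g2)).1 rfl
      obtain ⟨r, p1, p2⟩ := (IH _ _ j i (by omega) k1).2.2 hij.symm
      subst p1 p2 f1 g1
      refine ⟨r * s m * s i * s j * s m, ?_, ?_⟩
      · rw [hx, H.comm' j i hij.symm, H.braid' i m him, H.braid' m j hj]
      · rw [hy, H.comm' i j hij, H.braid' j m hj.symm, H.braid' m i him.symm,
          H.comm' j i hij.symm]
    · -- case 3
      obtain ⟨b, hw2, hy⟩ := h2.2.2 hj
      have la := congrArg len hw1
      simp only [hm, hs] at la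
      obtain ⟨z, e1, e2⟩ := (IH _ _ i j (by rw [hm, hs]; omega) (hw1.symm.trans hw2)).2.2 hij
      obtain ⟨u, f1, f2⟩ := (IH _ _ m j (by omega) e1).2.2 hj
      subst f1 f2 e2
      refine ⟨u * s i * s m, ?_, ?_⟩
      · rw [hx, H.comm' j i hij.symm, H.comm' j m hj.symm]
      · rw [hy, H.braid' m i him.symm]
  · obtain ⟨a, hx, hw1⟩ := h1.2.2 him
    rcases tri m j with e | hj | hj
    · exact absurd e hmj
    · -- case 4
      obtain ⟨b, hw2, hy⟩ := h2.2.1 hj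
      have la := congrArg len hw1
      simp only [hm, hs] at la
      obtain ⟨z, e1, e2⟩ := (IH _ _ i j (by omega) (hw1.symm.trans hw2)).2.2 hij
      have lz := congrArg len e1
      simp only [hm, hs] at lz
      obtain ⟨u, f1, f2⟩ := (IH _ _ i m (by omega) e2.symm).2.2 him
      subst f1 f2 e1
      refine ⟨u * s j * s m, ?_, ?_⟩
      · rw [hx, H.braid' m j hj]
      · rw [hy, H.comm' i j hij, H.comm' i m him]
    · -- case 1
      obtain ⟨b, hw2, hy⟩ := h2.2.2 hj
      have la := congrArg len hw1
      simp only [hm, hs] at la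
      obtain ⟨z, e1, e2⟩ := (IH _ _ i j (by omega) (hw1.symm.trans hw2)).2.2 hij
      subst e1 e2
      exact ⟨z * s m, by rw [hx, H.comm' j m hj.symm], by rw [hy, H.comm' i m him]⟩

theorem GC_trans_adj_aux (L : ℕ)
    (IH : ∀ x y i j, len x < L → x * s i = y * s j → GC s i j x y)
    {i j m : ℕ} {x w y : N} (hw : len w ≤ L) (hij : Adj i j) (him : Adj i m) (hj : Far m j)
    (h1 : GC s i m x w) (h2 : GC s m j w y) :
    ∃ z, x = z * s i * s j ∧ y = z * s j * s i := by
  obtain ⟨a, hx, hw1⟩ := h1.2.1 him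
  obtain ⟨b, hw2, hy⟩ := h2.2.2 hj
  have la := congrArg len hw1
  simp only [hm, hs] at la
  obtain ⟨z, e1, e2⟩ := (IH _ _ i j (by rw [hm, hs]; omega) (hw1.symm.trans hw2)).2.1 hij
  have lz := congrArg len e1
  simp only [hm, hs] at lz
  obtain ⟨u, f1, f2⟩ := (IH _ _ m j (by omega) e1).2.2 hj
  obtain ⟨t, g1, g2⟩ := (IH _ _ i m (by omega) f2).2.1 him
  subst f1 e2 g1 g2
  refine ⟨t * s j * s i * s m, ?_, ?_⟩
  · rw [hx, H.braid' i j hij, H.comm' m j hj, H.comm' j m hj.symm, H.braid' m i him.symm]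
  · rw [hy, H.comm' m j hj, H.braid' m i him.symm, H.braid' i j hij, H.comm' j m hj.symm]

theorem GC_trans (L : ℕ)
    (IH : ∀ x y i j, len x < L → x * s i = y * s j → GC s i j x y)
    {i j m : ℕ} {x w y : N} (hw : len w ≤ L) 
    (h1 : GC s i m x w) (h2 : GC s m j w y) : GC s i j x y := by
  by_cases e1 : m = i
  · subst e1; rw [h1.1 rfl]; exact h2
  by_cases e2 : m = j
  · subst e2; rw [← h2.1 rfl]; exact h1
  refine ⟨?_, ?_, fun h => GC_trans_far H len hm hs L IH hw h e1 e2 h1 h2⟩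
  · rintro rfl
    rcases tri i m with e | him | him
    · exact absurd e.symm e1
    · obtain ⟨a, hx, hw1⟩ := h1.2.1 him
      obtain ⟨b, hw2, hy⟩ := h2.2.1 him.symm
      have la := congrArg len hw1
      simp only [hm, hs] at la
      have k1 := (IH _ _ i i (by rw [hm, hs]; omega) (hw1.symm.trans hw2)).1 rfl
      have k2 := (IH _ _ m m (by omega) k1).1 rfl
      rw [hx, hy, k2]
    · obtain ⟨a, hx, hw1⟩ := h1.2.2 him
      obtain ⟨b, hw2, hy⟩ := h2.2.2 him.symm
      have la := congrArg len hw1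
      simp only [hm, hs] at la
      have k1 := (IH _ _ i i (by omega) (hw1.symm.trans hw2)).1 rfl
      rw [hx, hy, k1]
  · intro hij
    rcases tri i m with e | him | him
    · exact absurd e.symm e1
    · rcases tri m j with e | hj | hj
      · exact absurd e e2
      · unfold Adj at *; omega
      · exact GC_trans_adj_aux H len hm hs L IH hw hij him hj h1 h2
    · rcases tri m j with e | hj | hj
      · exact absurd e e2
      · have lw : len w ≤ L := hw
        obtain ⟨z, p, q⟩ := GC_trans_adj_aux H len hm hs L IH hw hij.symm hj.symm him.symm
          h2.symm h1.symm
        exact ⟨z, q, p⟩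
      · obtain ⟨a, hx, hw1⟩ := h1.2.2 him
        obtain ⟨b, hw2, hy⟩ := h2.2.2 hj
        have la := congrArg len hw1
        simp only [hm, hs] at la
        obtain ⟨z, e1, e2⟩ := (IH _ _ i j (by omega) (hw1.symm.trans hw2)).2.1 hij
        subst e1 e2
        refine ⟨z * s m, ?_, ?_⟩
        · rw [hx, H.comm' j m hj.symm, H.comm' i m him]
        · rw [hy, H.comm' i m him, H.comm' j m hj.symm]
end

/-- Defining relations of the braid monoid on infinitely many strands. -/
inductive BMRel : FreeMonoid ℕ → FreeMonoid ℕ → Prop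
  | comm (i j : ℕ) (h : Far i j) :
      BMRel (FreeMonoid.of i * FreeMonoid.of j) (FreeMonoid.of j * FreeMonoid.of i)
  | braid (i j : ℕ) (h : Adj i j) :
      BMRel (FreeMonoid.of i * FreeMonoid.of j * FreeMonoid.of i)
        (FreeMonoid.of j * FreeMonoid.of i * FreeMonoid.of j)

/-- The braid monoid on infinitely many strands. -/
abbrev BM : Type := PresentedMonoid BMRel

def bs (i : ℕ) : BM := PresentedMonoid.of BMRel i

theorem bs_rel : BRel bs where
  comm i j h := PresentedMonoid.mk_eq_mk_of_rel (BMRel.comm i j h)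
  braid i j h := PresentedMonoid.mk_eq_mk_of_rel (BMRel.braid i j h)

/-- Lift to a monoid. -/
def bmLift {N : Type} [Monoid N] (s : ℕ → N) (H : BRel s) : BM →* N :=
  PresentedMonoid.lift s (by
    intro a b h
    cases h with
    | comm i j h => simpa using H.comm i j h
    | braid i j h => simpa using H.braid i j h)

@[simp] theorem bmLift_bs {N : Type} [Monoid N] (s : ℕ → N) (H : BRel s) (i : ℕ) :
    bmLift s H (bs i) = s i := by simp [bmLift, bs]

theorem bm_induction {p : BM → Prop} (h1 : p 1) (hs : ∀ x i, p x → p (x * bs i)) (x : BM) :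
    p x := by
  obtain ⟨w, rfl⟩ := PresentedMonoid.surjective_mk (rels := BMRel) x
  have : ∀ l : List ℕ, p (PresentedMonoid.mk BMRel (FreeMonoid.ofList l)) := by
    intro l
    induction l using List.reverseRecOn with
    | nil => exact h1
    | append_singleton l a ih => exact hs _ a ih
  exact this w.toList

def bmLen (x : BM) : ℕ :=
  Multiplicative.toAdd (bmLift (fun _ => Multiplicative.ofAdd 1) ⟨fun _ _ _ => rfl, fun _ _ _ => rfl⟩ x)

@[simp] theorem bmLen_mul (x y : BM) : bmLen (x * y) = bmLen x + bmLen y := by simp [bmLen]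
@[simp] theorem bmLen_bs (i : ℕ) : bmLen (bs i) = 1 := by simp [bmLen]
@[simp] theorem bmLen_one : bmLen 1 = 0 := by simp [bmLen]

theorem bmRel_length {a b : FreeMonoid ℕ} (h : ConGen.Rel BMRel a b) :
    a.length = b.length := by
  induction h with
  | of x y h => cases h <;> simp [FreeMonoid.length_mul]
  | refl x => rfl
  | symm _ ih => exact ih.symm
  | trans _ _ ih1 ih2 => exact ih1.trans ih2
  | mul _ _ ih1 ih2 => simp [FreeMonoid.length_mul, ih1, ih2]

theorem bmLen_mk (a : FreeMonoid ℕ) : bmLen (PresentedMonoid.mk BMRel a) = a.length := by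
  induction a using FreeMonoid.recOn with
  | one => exact bmLen_one
  | of_mul x xs h =>
    rw [map_mul, bmLen_mul, h]
    rw [FreeMonoid.length_mul]
    exact congrArg (· + xs.length) (bmLen_bs x)

theorem fm_cases (a : FreeMonoid ℕ) : a = 1 ∨ ∃ u i, a = u * FreeMonoid.of i := by
  rcases List.eq_nil_or_concat a.toList with h | ⟨l, i, h⟩
  · exact Or.inl h
  · exact Or.inr ⟨FreeMonoid.ofList l, i, by
      apply FreeMonoid.toList.injective; simpa using h⟩

theorem fm_inj {u v : FreeMonoid ℕ} {i j : ℕ} (h : u * FreeMonoid.of i = v * FreeMonoid.of j) :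
    u = v ∧ i = j := by
  have h' := congrArg FreeMonoid.toList h
  simp only [FreeMonoid.toList_mul, FreeMonoid.toList_of] at h'
  have := List.append_inj' h' rfl
  exact ⟨FreeMonoid.toList.injective this.1, by simpa using this.2⟩

theorem bm_inner (L : ℕ)
    (IH : ∀ x y i j, bmLen x < L → x * bs i = y * bs j → GC bs i j x y)
    {a b : FreeMonoid ℕ} (h : ConGen.Rel BMRel a b) : 
    ∀ u v i j, a = u * FreeMonoid.of i → b = v * FreeMonoid.of j → a.length ≤ L + 1 → 
      GC bs i j (PresentedMonoid.mk BMRel u) (PresentedMonoid.mk BMRel v) := by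
  induction h with
  | of x y h =>
    intro u v i j hu hv _
    cases h with
    | comm i' j' h =>
      obtain ⟨rfl, rfl⟩ := fm_inj hu
      obtain ⟨rfl, rfl⟩ := fm_inj hv
      refine ⟨fun e => ?_, fun e => ?_, fun _ => ⟨1, by rw [one_mul]; rfl, by rw [one_mul]; rfl⟩⟩
      · unfold Far at h; omega
      · unfold Far at h; unfold Adj at e; omega
    | braid i' j' h =>
      obtain ⟨rfl, rfl⟩ := fm_inj hu
      obtain ⟨rfl, rfl⟩ := fm_inj hv
      refine ⟨fun e => ?_, fun _ => ⟨1, by rw [one_mul]; rfl, by rw [one_mul]; rfl⟩, fun e => ?_⟩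
      · unfold Adj at h; omega
      · unfold Adj at h; unfold Far at e; omega
  | refl x =>
    rintro u v i j rfl hv _
    obtain ⟨rfl, rfl⟩ := fm_inj hv
    exact GC.self _ _ _
  | symm h ih =>
    intro u v i j hu hv hl
    exact (ih v u j i hv hu (by rw [bmRel_length h]; exact hl)).symm
  | trans h1 h2 ih1 ih2 =>
    rename_i x y z
    intro u v i j hu hv hl
    have l1 := bmRel_length h1
    rcases fm_cases y with hy | ⟨w, m, hy⟩
    · rw [hy, hu] at l1
      simp [FreeMonoid.length_mul] at l1
    · refine GC_trans bs_rel bmLen bmLen_mul bmLen_bs L IH ?_ (ih1 u w i m hu hy hl)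
        (ih2 w v m j hy hv (by omega))
      rw [bmLen_mk]
      rw [l1, hy, FreeMonoid.length_mul, FreeMonoid.length_of] at hl
      omega
  | mul h1 h2 ih1 ih2 =>
    rename_i w x y z
    intro u v i j hu hv hl
    have l2 := bmRel_length h2
    rw [FreeMonoid.length_mul] at hl
    rcases fm_cases y with hy | ⟨u', i', hy⟩
    · have hz : z = 1 := by
        rw [hy] at l2
        exact FreeMonoid.length_eq_zero.mp (by simpa using l2.symm)
      rw [hy, mul_one] at hu
      rw [hz, mul_one] at hv
      exact ih1 u v i j hu hv (by omega)
    · rcases fm_cases z with hz | ⟨v', j', hz⟩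
      · rw [hz, hy] at l2
        simp [FreeMonoid.length_mul] at l2
      · have := ih2 u' v' i' j' hy hz (by omega)
        rw [hy, ← mul_assoc] at hu
        rw [hz, ← mul_assoc] at hv
        obtain ⟨rfl, rfl⟩ := fm_inj hu
        obtain ⟨rfl, rfl⟩ := fm_inj hv
        have e : PresentedMonoid.mk BMRel w = PresentedMonoid.mk BMRel x :=
          PresentedMonoid.mk_eq_mk_iff.mpr h1
        rw [map_mul, map_mul, e]
        exact this.smul _

theorem bm_garside_aux (L : ℕ) : ∀ x y i j, bmLen x < L → x * bs i = y * bs j →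
    GC bs i j x y := by
  induction L with
  | zero => intro x y i j h; omega
  | succ L IH =>
    intro x y i j h e
    obtain ⟨u, rfl⟩ := PresentedMonoid.surjective_mk (rels := BMRel) x
    obtain ⟨v, rfl⟩ := PresentedMonoid.surjective_mk (rels := BMRel) y
    have e' : PresentedMonoid.mk BMRel (u * FreeMonoid.of i)
        = PresentedMonoid.mk BMRel (v * FreeMonoid.of j) := by rw [map_mul, map_mul]; exact e
    rw [bmLen_mk] at h
    exact bm_inner L IH (PresentedMonoid.mk_eq_mk_iff.mp e') u v i j rfl rfl
      (by rw [FreeMonoid.length_mul, FreeMonoid.length_of]; omega)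

theorem bm_garside (x y : BM) (i j : ℕ) (h : x * bs i = y * bs j) : GC bs i j x y :=
  bm_garside_aux (bmLen x + 1) x y i j (Nat.lt_succ_self _) h

end BR
end

noncomputable section

namespace BR

/-- Braid relations together with labels. -/
structure BTRel {N G : Type} [Monoid N] [Group G] (s : ℕ → N) (t : G → ℕ → N) : Prop
    extends BRel s where
  t_mul : ∀ g h j, t g j * t h j = t (g * h) j
  t_one : ∀ j, t 1 j = 1
  tt_comm : ∀ g h j l, j ≠ l → t g j * t h l = t h l * t g j
  st_comm : ∀ g i l, l ≠ i → l ≠ i + 1 → s i * t g l = t g l * s i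
  slide : ∀ g i, s i * t g i = t g (i + 1) * s i
  slide' : ∀ g i, s i * t g (i + 1) = t g i * s i

section elements
variable {N : Type} [Monoid N] (s : ℕ → N)

/-- `cc p q = s (p+q-1) ⋯ s p`. -/
def cc (p : ℕ) : ℕ → N
  | 0 => 1
  | q + 1 => s (p + q) * cc p q

/-- Block crossing. -/
def bcr (p : ℕ) : ℕ → ℕ → N
  | 0, _ => 1
  | a + 1, b => bcr p a b * cc s (p + a) b

/-- Half twist on `q` strands starting at `p`. -/
def dl : ℕ → ℕ → N
  | _, 0 => 1
  | p, q + 1 => cc s p q * dl (p + 1) q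

@[simp] theorem cc_zero (p : ℕ) : cc s p 0 = 1 := rfl
theorem cc_succ (p q : ℕ) : cc s p (q + 1) = s (p + q) * cc s p q := rfl
theorem dl_zero (p : ℕ) : dl s p 0 = 1 := rfl
theorem dl_succ (p q : ℕ) : dl s p (q + 1) = cc s p q * dl s (p + 1) q := by rw [dl]
@[simp] theorem dl_one (p : ℕ) : dl s p 1 = 1 := by simp [dl_succ, dl_zero]

theorem cc_add (p a b : ℕ) : cc s p (a + b) = cc s (p + a) b * cc s p a := by
  induction b with
  | zero => simp
  | succ b ih => rw [← add_assoc, cc_succ, ih, cc_succ, mul_assoc, add_assoc]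

@[simp] theorem cc_one (p : ℕ) : cc s p 1 = s p := by simp [cc_succ]

theorem cc_succ' (p q : ℕ) : cc s p (q + 1) = cc s (p + 1) q * s p := by
  rw [add_comm, cc_add, cc_one]

theorem cc_intertwine {z : N} {p p' q : ℕ} (h : ∀ i, i < q → z * s (p' + i) = s (p + i) * z) :
    z * cc s p' q = cc s p q * z := by
  induction q with
  | zero => simp
  | succ q ih =>
    rw [cc_succ, cc_succ, ← mul_assoc, h q (Nat.lt_succ_self _), mul_assoc,
      ih fun i hi => h i (by omega), mul_assoc]

theorem dl_intertwine {z : N} {q : ℕ} : ∀ {p p' : ℕ},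
    (∀ i, i + 1 < q → z * s (p' + i) = s (p + i) * z) →
    z * dl s p' q = dl s p q * z := by
  induction q with
  | zero => intro p p' _; simp [dl_zero]
  | succ q ih =>
    intro p p' h
    rw [dl_succ, dl_succ, ← mul_assoc, cc_intertwine s (fun i hi => h i (by omega)), mul_assoc,
      ih (p := p + 1) (p' := p' + 1) ?_, mul_assoc]
    intro i hi
    have := h (i + 1) (by omega)
    rwa [← add_assoc, ← add_assoc, add_right_comm, add_right_comm p] at this

variable {s} (H : BRel s)
include H

theorem cc_s {p q i : ℕ} (h1 : p ≤ i) (h2 : i + 1 < p + q) :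
    cc s p q * s (i + 1) = s i * cc s p q := by
  obtain ⟨a, rfl⟩ := Nat.exists_eq_add_of_le h1
  obtain ⟨b, rfl⟩ : ∃ b, q = a + 2 + b := ⟨q - a - 2, by omega⟩
  have e1 : cc s p a * s (p + a + 1) = s (p + a + 1) * cc s p a := by
    refine (cc_intertwine s (z := s (p + a + 1)) (p := p) (p' := p) fun i hi => ?_).symm
    exact H.comm _ _ (Or.inr (by omega))
  have e2 : s (p + a) * cc s (p + a + 2) b = cc s (p + a + 2) b * s (p + a) := by
    refine cc_intertwine s (z := s (p + a)) fun i hi => ?_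
    exact H.comm _ _ (Or.inl (by omega))
  have e3 : cc s p (a + 2 + b) = cc s (p + a + 2) b * s (p + a + 1) * s (p + a) * cc s p a := by
    rw [cc_add, ← add_assoc, cc_succ, cc_succ]
    simp only [mul_assoc, ← add_assoc]
  rw [e3, mul_assoc, e1, ← mul_assoc, ← mul_assoc, ← mul_assoc, ← mul_assoc, e2,
    H.braid' (p + a + 1) (p + a) (Or.inl rfl)]

theorem cc_dl (p q : ℕ) : cc s p q * dl s (p + 1) q = dl s p q * cc s p q := by
  refine dl_intertwine s fun i hi => ?_
  rw [add_right_comm]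
  exact cc_s H (by omega) (by omega)

theorem dl_succ' (p q : ℕ) : dl s p (q + 1) = dl s p q * cc s p q := by
  rw [dl_succ, cc_dl H]

theorem cc_comm_dl {p q p' q' : ℕ} (h : p + q < p' ∨ p' + q' ≤ p) :
    cc s p q * dl s p' q' = dl s p' q' * cc s p q := by
  refine dl_intertwine s fun i hi => ?_
  refine (cc_intertwine s fun j hj => ?_).symm
  refine H.comm _ _ ?_
  unfold Far; omega

theorem bcr_dl (p a b : ℕ) : bcr s p a b * dl s p a * dl s (p + a) b = dl s p (a + b) := by
  induction a with
  | zero => simp [bcr, dl_zero]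
  | succ a ih =>
    have e : a + 1 + b = a + b + 1 := by omega
    rw [e, dl_succ' H p (a + b), ← ih, cc_add, bcr, dl_succ' H]
    have e1 : cc s p a * dl s (p + a + 1) b = dl s (p + a + 1) b * cc s p a :=
      cc_comm_dl H (by omega)
    have e2 : cc s (p + a) b * dl s p a = dl s p a * cc s (p + a) b := cc_comm_dl H (by omega)
    calc bcr s p a b * cc s (p + a) b * (dl s p a * cc s p a) * dl s (p + (a + 1)) b
        = bcr s p a b * (cc s (p + a) b * dl s p a) * (cc s p a * dl s (p + a + 1) b) := by
          simp only [mul_assoc, add_assoc]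
      _ = bcr s p a b * dl s p a * (cc s (p + a) b * dl s (p + a + 1) b) * cc s p a := by
          rw [e1, e2]; simp only [mul_assoc]
      _ = _ := by rw [cc_dl H]; simp only [mul_assoc]

theorem s_dl (n : ℕ) : ∀ p i, i + 1 < n → s (p + i) * dl s p n = dl s p n * s (p + (n - 2 - i)) := by
  induction n with
  | zero => intro p i h; omega
  | succ n ih =>
    intro p i h
    by_cases hi : i + 1 < n
    · rw [dl_succ, ← mul_assoc, ← cc_s H (by omega) (by omega), mul_assoc, add_right_comm,
        ih (p + 1) i hi, mul_assoc]
      congr 3; omega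
    · obtain rfl : n = i + 1 := by omega
      have e0 : i + 1 + 1 - 2 - i = 0 := by omega
      rw [e0, add_zero, dl_succ s p (i + 1), dl_succ s (p + 1) i]
      have e1 : s p * dl s (p + 1 + 1) i = dl s (p + 1 + 1) i * s p := by
        refine dl_intertwine s fun j hj => H.comm _ _ (Or.inl (by omega))
      have e2 : cc s p (i + 1) * cc s (p + 1) i = cc s p i * cc s p (i + 1) := by
        refine cc_intertwine s fun j hj => ?_
        rw [add_right_comm]
        exact cc_s H (by omega) (by omega)
      calc s (p + i) * (cc s p (i + 1) * (cc s (p + 1) i * dl s (p + 1 + 1) i))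
          = s (p + i) * (cc s p (i + 1) * cc s (p + 1) i) * dl s (p + 1 + 1) i := by
            simp only [mul_assoc]
        _ = (s (p + i) * cc s p i) * cc s p (i + 1) * dl s (p + 1 + 1) i := by
            rw [e2]; simp only [mul_assoc]
        _ = cc s p (i + 1) * (cc s (p + 1) i * s p) * dl s (p + 1 + 1) i := by
            rw [← cc_succ, ← cc_succ' s p i]
        _ = cc s p (i + 1) * cc s (p + 1) i * (s p * dl s (p + 1 + 1) i) := by
            simp only [mul_assoc]
        _ = _ := by rw [e1]; simp only [mul_assoc]

/-- `s p` right-divides the half twist. -/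
theorem dl_div (p q : ℕ) : ∃ z, dl s p (q + 2) = z * s p := by
  refine ⟨dl s p (q + 1) * cc s (p + 1) q, ?_⟩
  rw [dl_succ' H, cc_succ', mul_assoc]

end elements

section labels
variable {N G : Type} [Monoid N] [Group G] {s : ℕ → N} {t : G → ℕ → N} (H : BTRel s t)
include H

theorem cc_t_far (g : G) {p q j : ℕ} (h : j < p ∨ p + q < j) :
    cc s p q * t g j = t g j * cc s p q := by
  refine (cc_intertwine s fun i hi => ?_).symm
  exact (H.st_comm _ _ _ (by omega) (by omega)).symm

theorem cc_t (g : G) (p q : ℕ) : cc s p q * t g p = t g (p + q) * cc s p q := by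
  induction q with
  | zero => simp
  | succ q ih =>
    rw [cc_succ, mul_assoc, ih, ← mul_assoc, H.slide, mul_assoc, add_assoc]

theorem cc_t' (g : G) {p q j : ℕ} (h1 : p ≤ j) (h2 : j < p + q) :
    cc s p q * t g (j + 1) = t g j * cc s p q := by
  induction q with
  | zero => omega
  | succ q ih =>
    rw [cc_succ]
    by_cases hj : j < p + q
    · rw [mul_assoc, ih hj, ← mul_assoc, H.st_comm _ _ _ (by omega) (by omega), mul_assoc]
    · obtain rfl : j = p + q := by omega
      rw [mul_assoc, cc_t_far H _ (by omega), ← mul_assoc, H.slide', mul_assoc]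

theorem dl_t (g : G) (n : ℕ) : ∀ p i, i < n →
    dl s p n * t g (p + i) = t g (p + (n - 1 - i)) * dl s p n := by
  induction n with
  | zero => intro p i h; omega
  | succ n ih =>
    intro p i h
    rw [dl_succ]
    rcases i with _ | i
    · have : t g p * dl s (p + 1) n = dl s (p + 1) n * t g p := by
        refine dl_intertwine s fun j hj => (H.st_comm _ _ _ (by omega) (by omega)).symm
      rw [add_zero, mul_assoc, ← this, ← mul_assoc, cc_t H, mul_assoc]
      congr 2
    · rw [mul_assoc, ← add_assoc, add_right_comm, ih (p + 1) i (by omega), ← mul_assoc,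
        add_right_comm, cc_t' H g (by omega) (by omega), mul_assoc]
      congr 3
      omega
end labels

section peel
variable {N : Type} [Monoid N] {s : ℕ → N} (H : BRel s)
  (GG : ∀ x y i j, x * s i = y * s j → GC s i j x y)

/-- Peeling property. -/
def Peel (s : ℕ → N) (k : ℕ) (e : N) : Prop :=
  ∀ X Y, X * e = Y * s k → ∃ Z, X = Z * s k ∧ Y = Z * e

theorem Peel.one (k : ℕ) : Peel s k 1 := fun X Y h => ⟨Y, by rw [← h, mul_one], (mul_one _).symm⟩

theorem Peel.mul {k : ℕ} {e f : N} (he : Peel s k e) (hf : Peel s k f) : Peel s k (e * f) := by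
  intro X Y h
  rw [← mul_assoc] at h
  obtain ⟨Z, h1, h2⟩ := hf _ _ h
  obtain ⟨Z', h3, h4⟩ := he _ _ h1
  exact ⟨Z', h3, by rw [h2, h4, mul_assoc]⟩

include GG
theorem Peel.ss {k j : ℕ} (h : Far j k) : Peel s k (s j) := fun X Y e => by
  obtain ⟨z, h1, h2⟩ := (GG X Y j k e).2.2 h
  exact ⟨z, h1, h2⟩

theorem Peel.cc {k p q : ℕ} (h : ∀ i, i < q → Far (p + i) k) : Peel s k (cc s p q) := by
  induction q with
  | zero => exact Peel.one k
  | succ q ih => exact (Peel.ss GG (h q (by omega))).mul (ih fun i hi => h i (by omega))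

theorem Peel.dl {k q : ℕ} : ∀ {p}, (∀ i, i + 1 < q → Far (p + i) k) → Peel s k (dl s p q) := by
  induction q with
  | zero => intro p _; exact Peel.one k
  | succ q ih =>
    intro p h
    rw [dl_succ]
    refine (Peel.cc GG fun i hi => h i (by omega)).mul (ih fun i hi => ?_)
    have := h (i + 1) (by omega)
    rwa [← add_assoc, add_right_comm] at this

theorem s_cancel {x y : N} (i : ℕ) (h : x * s i = y * s i) : x = y := (GG x y i i h).1 rfl

theorem cc_cancel {x y : N} {p q : ℕ} (h : x * cc s p q = y * cc s p q) : x = y := by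
  induction q generalizing x y with
  | zero => simpa using h
  | succ q ih =>
    rw [cc_succ, ← mul_assoc, ← mul_assoc] at h
    exact s_cancel GG _ (ih h)

theorem dl_cancel {x y : N} {q : ℕ} : ∀ {p : ℕ}, x * dl s p q = y * dl s p q → x = y := by
  induction q generalizing x y with
  | zero => intro p h; simpa [dl_zero] using h
  | succ q ih =>
    intro p h
    rw [dl_succ, ← mul_assoc, ← mul_assoc] at h
    exact cc_cancel GG (ih h)

theorem merge_L1 (p : ℕ) (j : ℕ) : ∀ X Y, X * cc s (p + 1) j = Y * s p →
    ∃ Z, X = Z * cc s p (j + 1) := by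
  induction j with
  | zero => intro X Y h; exact ⟨Y, by simpa using h⟩
  | succ j ih =>
    intro X Y h
    rw [cc_succ, ← mul_assoc] at h
    obtain ⟨Z, hZ⟩ := ih _ _ h
    rw [cc_succ, ← mul_assoc] at hZ
    have : Peel s (p + 1 + j) (BR.cc s p j) := Peel.cc GG fun i hi => Or.inl (by omega)
    obtain ⟨X', h1, h2⟩ := this _ _ hZ.symm
    obtain ⟨T, -, h4⟩ := (GG _ _ _ _ h1).2.1 (Or.inr (by omega))
    refine ⟨T, ?_⟩
    rw [h2, h4, cc_succ, cc_succ, add_right_comm, add_assoc]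
    simp only [mul_assoc]

theorem merge_L2 (p q k : ℕ) (h1 : p < k) (h2 : k < p + q) : ∀ X Z, X * s k = Z * cc s p q →
    ∃ Z', X = Z' * cc s p q := by
  intro X Z h
  obtain ⟨a, rfl⟩ : ∃ a, k = p + a + 1 := ⟨k - p - 1, by omega⟩
  obtain ⟨b, rfl⟩ : ∃ b, q = a + 2 + b := ⟨q - a - 2, by omega⟩
  have e3 : cc s p (a + 2 + b) = cc s (p + a + 2) b * s (p + a + 1) * s (p + a) * cc s p a := by
    rw [cc_add, ← add_assoc, cc_succ, cc_succ]
    simp only [mul_assoc, ← add_assoc]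
  rw [e3, ← mul_assoc] at h
  have P1 : Peel s (p + a + 1) (BR.cc s p a) := Peel.cc GG fun i hi => Or.inl (by omega)
  obtain ⟨X', f1, f2⟩ := P1 _ _ h.symm
  rw [← mul_assoc] at f1
  obtain ⟨T, g1, g2⟩ := (GG _ _ _ _ f1).2.1 (Or.inr rfl)
  rw [← mul_assoc] at g1
  have g3 := s_cancel GG _ g1
  have P2 : Peel s (p + a) (BR.cc s (p + a + 2) b) := Peel.cc GG fun i hi => Or.inr (by omega)
  obtain ⟨Z', k1, k2⟩ := P2 _ _ g3
  refine ⟨Z', ?_⟩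
  rw [f2, g2, k2, e3]
  simp only [mul_assoc]

theorem merge_L2_cc (p q : ℕ) (a b : ℕ) (h1 : p < a) (h2 : a + b ≤ p + q) :
    ∀ X Z, X * cc s a b = Z * cc s p q → ∃ Z', X = Z' * cc s p q := by
  induction b with
  | zero => intro X Z h; exact ⟨Z, by simpa using h⟩
  | succ b ih =>
    intro X Z h
    rw [cc_succ, ← mul_assoc] at h
    obtain ⟨Z', h'⟩ := ih (by omega) _ _ h
    exact merge_L2 GG p q _ (by omega) (by omega) _ _ h'

theorem merge_L2_dl (p q : ℕ) (b : ℕ) : ∀ a, p < a → a + b ≤ p + q + 1 →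
    ∀ X Z, X * dl s a b = Z * cc s p q → ∃ Z', X = Z' * cc s p q := by
  induction b with
  | zero => intro a _ _ X Z h; exact ⟨Z, by simpa [dl_zero] using h⟩
  | succ b ih =>
    intro a h1 h2 X Z h
    rw [dl_succ, ← mul_assoc] at h
    obtain ⟨Z', h'⟩ := ih (a + 1) (by omega) (by omega) _ _ h
    exact merge_L2_cc GG p q _ _ h1 (by omega) _ _ h'

include H
/-- The merge lemma. -/
theorem merge (p q : ℕ) (hq : 0 < q) (X Y : N) (h : X * dl s (p + 1) q = Y * s p) :
    ∃ Z, X = Z * cc s p q := by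
  obtain ⟨q, rfl⟩ : ∃ r, q = r + 1 := ⟨q - 1, by omega⟩
  rw [dl_succ' H, ← mul_assoc] at h
  obtain ⟨Z, hZ⟩ := merge_L1 GG p q _ _ h
  exact merge_L2_dl GG p (q + 1) q (p + 1) (by omega) (by omega) _ _ hZ

end peel
end BR
end

noncomputable section

namespace BR

theorem swap_braid (i : ℕ) : Equiv.swap i (i + 1) * Equiv.swap (i + 1) (i + 1 + 1)
    * Equiv.swap i (i + 1) = Equiv.swap (i + 1) (i + 1 + 1) * Equiv.swap i (i + 1)
    * Equiv.swap (i + 1) (i + 1 + 1) := by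
  rw [Equiv.swap_mul_swap_mul_swap (x := i) (y := i + 1) (z := i + 1 + 1) (by omega) (by omega),
    Equiv.swap_comm i (i + 1), Equiv.swap_comm (i + 1) (i + 1 + 1),
    Equiv.swap_mul_swap_mul_swap (x := i + 1 + 1) (y := i + 1) (z := i) (by omega) (by omega),
    Equiv.swap_comm]

/-- The permutation underlying a braid. -/
def swp : BM →* Equiv.Perm ℕ := bmLift (fun i => Equiv.swap i (i + 1)) (by
  constructor
  · intro i j h
    refine Equiv.ext fun x => ?_
    unfold Far at h
    simp only [Equiv.Perm.coe_mul, Function.comp_apply, Equiv.swap_apply_def]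
    split_ifs <;> omega
  · rintro i j (rfl | rfl)
    · exact (swap_braid j).symm
    · exact swap_braid i)

theorem swp_bs (i : ℕ) : swp (bs i) = Equiv.swap i (i + 1) := bmLift_bs _ _ i

/-- The monoid of labelled positive braids. -/
@[ext] structure LB (G : Type) where
  g : ℕ → G
  x : BM

variable {G : Type} [Group G]

instance : Mul (LB G) := ⟨fun a b => ⟨fun j => a.g j * b.g ((swp a.x).symm j), a.x * b.x⟩⟩
instance : One (LB G) := ⟨⟨fun _ => 1, 1⟩⟩

@[simp] theorem LB.mul_g (a b : LB G) (j : ℕ) : (a * b).g j = a.g j * b.g ((swp a.x).symm j) := rfl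
@[simp] theorem LB.mul_x (a b : LB G) : (a * b).x = a.x * b.x := rfl
@[simp] theorem LB.one_g (j : ℕ) : (1 : LB G).g j = 1 := rfl
@[simp] theorem LB.one_x : (1 : LB G).x = 1 := rfl

instance : Monoid (LB G) where
  mul_assoc a b c := by
    ext j
    · simp only [LB.mul_g, LB.mul_x, map_mul, mul_assoc]
      rfl
    · simp [mul_assoc]
  one_mul a := by
    ext j
    · simp
      rfl
    · simp
  mul_one a := by
    ext j
    · simp
    · simp

/-- Embedding of unlabelled braids. -/
def lbx : BM →* LB G where
  toFun x := ⟨fun _ => 1, x⟩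
  map_one' := rfl
  map_mul' x y := by ext j <;> simp

@[simp] theorem lbx_g (x : BM) (j : ℕ) : (lbx x : LB G).g j = 1 := rfl
@[simp] theorem lbx_x (x : BM) : (lbx x : LB G).x = x := rfl

/-- Embedding of labels. -/
def lbg : (ℕ → G) →* LB G where
  toFun g := ⟨g, 1⟩
  map_one' := rfl
  map_mul' x y := by
    ext j <;> simp
    rfl

@[simp] theorem lbg_g (g : ℕ → G) : (lbg g : LB G).g = g := rfl
@[simp] theorem lbg_x (g : ℕ → G) : (lbg g : LB G).x = 1 := rfl

theorem lb_eq (a : LB G) : a = lbg a.g * lbx a.x := by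
  ext j <;> simp

theorem lbx_lbg (x : BM) (g : ℕ → G) :
    lbx x * lbg g = lbg (fun j => g ((swp x).symm j)) * lbx x := by
  ext j <;> simp

def ls (i : ℕ) : LB G := lbx (bs i)
def lt (g : G) (j : ℕ) : LB G := lbg (Pi.mulSingle j g)

@[simp] theorem ls_g (i j : ℕ) : (ls i : LB G).g j = 1 := rfl
@[simp] theorem ls_x (i : ℕ) : (ls i : LB G).x = bs i := rfl
@[simp] theorem lt_g (g : G) (j : ℕ) : (lt g j : LB G).g = Pi.mulSingle j g := rfl
@[simp] theorem lt_x (g : G) (j : ℕ) : (lt g j : LB G).x = 1 := rfl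

theorem ls_lbg (i : ℕ) (f : ℕ → G) :
    ls i * lbg f = lbg (fun j => f (Equiv.swap i (i + 1) j)) * ls i := by
  unfold ls
  rw [lbx_lbg]
  simp [swp_bs]

theorem mulSingle_swap (i l : ℕ) (g : G) :
    (fun j => Pi.mulSingle (M := fun _ => G) l g (Equiv.swap i (i + 1) j))
      = Pi.mulSingle (Equiv.swap i (i + 1) l) g := by
  funext j
  by_cases h : j = Equiv.swap i (i + 1) l
  · subst h; simp
  · have : Equiv.swap i (i + 1) j ≠ l := fun e => h (by rw [← e]; simp)
    rw [Pi.mulSingle_eq_of_ne this, Pi.mulSingle_eq_of_ne h]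

theorem lb_rel : BTRel (ls : ℕ → LB G) lt where
  comm i j h := by unfold ls; rw [← map_mul, bs_rel.comm i j h, map_mul]
  braid i j h := by unfold ls; rw [← map_mul, ← map_mul, bs_rel.braid i j h, map_mul, map_mul]
  t_mul g h j := by unfold lt; rw [← map_mul, ← Pi.mulSingle_mul]
  t_one j := by unfold lt; rw [Pi.mulSingle_one, map_one]
  tt_comm g h j l hjl := by
    unfold lt; rw [← map_mul, ← map_mul]
    rw [(Pi.mulSingle_commute (f := fun _ => G) hjl g h).eq]
  st_comm g i l h1 h2 := by
    unfold lt
    rw [ls_lbg, mulSingle_swap, Equiv.swap_apply_of_ne_of_ne h1 h2]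
  slide g i := by
    unfold lt
    rw [ls_lbg, mulSingle_swap, Equiv.swap_apply_left]
  slide' g i := by
    unfold lt
    rw [ls_lbg, mulSingle_swap, Equiv.swap_apply_right]

def llen (a : LB G) : ℕ := bmLen a.x
@[simp] theorem llen_mul (a b : LB G) : llen (a * b) = llen a + llen b := by simp [llen]
@[simp] theorem llen_ls (i : ℕ) : llen (ls i : LB G) = 1 := by simp [llen]
@[simp] theorem llen_lt (g : G) (i : ℕ) : llen (lt g i : LB G) = 0 := by simp [llen]
@[simp] theorem llen_one : llen (1 : LB G) = 0 := by simp [llen]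

theorem bm_len_pos (x : BM) : x = 1 ∨ ∃ i y, x = y * bs i := by
  induction x using bm_induction with
  | h1 => exact Or.inl rfl
  | hs x i _ => exact Or.inr ⟨i, x, rfl⟩

theorem lb_len_pos (a : LB G) (h : llen a ≠ 0) : ∃ i b, a = b * ls i := by
  rcases bm_len_pos a.x with e | ⟨i, y, e⟩
  · simp [llen, e] at h
  · refine ⟨i, ⟨a.g, y⟩, ?_⟩
    ext j
    · simp
    · simpa using e

theorem lb_len_zero (a : LB G) (h : llen a = 0) : a = lbg a.g := by
  rcases bm_len_pos a.x with e | ⟨i, y, e⟩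
  · ext j
    · simp
    · simpa using e
  · simp [llen, e] at h

theorem lb_garside (a b : LB G) (i j : ℕ) (h : a * ls i = b * ls j) : GC ls i j a b := by
  have hg : a.g = b.g := by
    funext l
    have := congrFun (congrArg LB.g h) l
    simpa using this
  have hx : a.x * bs i = b.x * bs j := congrArg LB.x h
  obtain ⟨c1, c2, c3⟩ := bm_garside _ _ _ _ hx
  refine ⟨fun e => ?_, fun e => ?_, fun e => ?_⟩
  · ext l
    · rw [hg]
    · rw [c1 e]
  · obtain ⟨z, h1, h2⟩ := c2 e
    refine ⟨⟨a.g, z⟩, ?_, ?_⟩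
    · ext l <;> simp [h1]
    · ext l <;> simp [h2, hg]
  · obtain ⟨z, h1, h2⟩ := c3 e
    refine ⟨⟨a.g, z⟩, ?_, ?_⟩
    · ext l <;> simp [h1]
    · ext l <;> simp [h2, hg]

/-- Detects whether only letters `< m` occur. -/
def chi (m : ℕ) : BM →* ℕ := bmLift (fun i => if i < m then 1 else 0) (by
  constructor
  · intro i j _; exact mul_comm _ _
  · intro i j _; split_ifs <;> rfl)

theorem chi_bs (m i : ℕ) : chi m (bs i) = if i < m then 1 else 0 := bmLift_bs _ _ i

theorem chi_swp (n : ℕ) (x : BM) (h : chi (n - 1) x = 1) (j : ℕ) (hj : n ≤ j) :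
    (swp x).symm j = j := by
  induction x using bm_induction with
  | h1 => simp; rfl
  | hs x i ih =>
    rw [map_mul, mul_eq_one, chi_bs] at h
    have hi : i < n - 1 := by
      by_contra hc
      rw [if_neg hc] at h; simp at h
    have : (swp (x * bs i)).symm j = (swp (bs i)).symm ((swp x).symm j) := by
      rw [map_mul]; rfl
    rw [this, ih h.1, swp_bs, Equiv.symm_swap, Equiv.swap_apply_of_ne_of_ne (by omega) (by omega)]

/-- The labelled braids on `n` strands. -/
def Nn (G : Type) [Group G] (n : ℕ) : Submonoid (LB G) where
  carrier := {a | chi (n - 1) a.x = 1 ∧ ∀ j, n ≤ j → a.g j = 1}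
  one_mem' := by simp
  mul_mem' := by
    rintro a b ⟨ha1, ha2⟩ ⟨hb1, hb2⟩
    refine ⟨by simp [ha1, hb1], fun j hj => ?_⟩
    rw [LB.mul_g, chi_swp n _ ha1 j hj, ha2 j hj, hb2 j hj, one_mul]

theorem mem_Nn {n : ℕ} {a : LB G} :
    a ∈ Nn G n ↔ chi (n - 1) a.x = 1 ∧ ∀ j, n ≤ j → a.g j = 1 := Iff.rfl

theorem ls_mem {n i : ℕ} : (ls i : LB G) ∈ Nn G n ↔ i + 1 < n := by
  rw [mem_Nn, ls_x, chi_bs]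
  constructor
  · rintro ⟨h, -⟩
    split_ifs at h
    omega
  · intro h
    rw [if_pos (by omega)]
    simp

theorem lt_mem {n i : ℕ} (g : G) (h : i < n) : (lt g i : LB G) ∈ Nn G n := by
  rw [mem_Nn]
  refine ⟨by simp, fun j hj => ?_⟩
  rw [lt_g, Pi.mulSingle_eq_of_ne (by omega)]

theorem mem_of_mul_ls {n i : ℕ} {a : LB G} (h : a * ls i ∈ Nn G n) : a ∈ Nn G n ∧ i + 1 < n := by
  rw [mem_Nn] at h
  rw [LB.mul_x, map_mul, mul_eq_one] at h
  have h2 : (ls i : LB G) ∈ Nn G n := ⟨h.1.2, by simp⟩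
  refine ⟨⟨h.1.1, fun j hj => by simpa using h.2 j hj⟩, ls_mem.mp h2⟩

theorem mem_of_mul_lbx {n : ℕ} {a : LB G} {x : BM} (h : a * lbx x ∈ Nn G n) : a ∈ Nn G n := by
  induction x using bm_induction with
  | h1 => simpa using h
  | hs x i ih =>
    rw [map_mul, ← mul_assoc] at h
    exact ih (mem_of_mul_ls h).1

theorem cc_mem {N : Type} [Monoid N] {s : ℕ → N} (S : Submonoid N) {p q : ℕ}
    (h : ∀ i, i < q → s (p + i) ∈ S) : cc s p q ∈ S := by
  induction q with
  | zero => exact S.one_mem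
  | succ q ih => exact S.mul_mem (h q (by omega)) (ih fun i hi => h i (by omega))

theorem dl_mem {N : Type} [Monoid N] {s : ℕ → N} (S : Submonoid N) {q : ℕ} : ∀ {p : ℕ},
    (∀ i, i + 1 < q → s (p + i) ∈ S) → dl s p q ∈ S := by
  induction q with
  | zero => intro p _; exact S.one_mem
  | succ q ih =>
    intro p h
    rw [dl_succ]
    refine S.mul_mem (cc_mem S fun i hi => h i (by omega)) (ih fun i hi => ?_)
    have := h (i + 1) (by omega)
    rwa [← add_assoc, add_right_comm] at this

/-- The full twist. -/
def ztw (G : Type) [Group G] (n : ℕ) : LB G := dl ls 0 n * dl ls 0 n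

theorem ztw_mem (n : ℕ) : ztw G n ∈ Nn G n := by
  have : (dl ls 0 n : LB G) ∈ Nn G n := dl_mem _ fun i hi => ls_mem.mpr (by omega)
  exact mul_mem this this

theorem ztw_ls (n i : ℕ) (h : i + 1 < n) : ztw G n * ls i = ls i * ztw G n := by
  unfold ztw
  have e1 := s_dl (lb_rel (G := G)).toBRel n 0 i h
  have e2 := s_dl (lb_rel (G := G)).toBRel n 0 (n - 2 - i) (by omega)
  simp only [zero_add] at e1 e2
  have : n - 2 - (n - 2 - i) = i := by omega
  rw [this] at e2
  rw [mul_assoc, ← e2, ← mul_assoc, ← e1, mul_assoc]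

theorem ztw_lt (n i : ℕ) (g : G) (h : i < n) : ztw G n * lt g i = lt g i * ztw G n := by
  unfold ztw
  have e1 := dl_t (lb_rel (G := G)) g n 0 i h
  have e2 := dl_t (lb_rel (G := G)) g n 0 (n - 1 - i) (by omega)
  simp only [zero_add] at e1 e2
  have : n - 1 - (n - 1 - i) = i := by omega
  rw [this] at e2
  rw [mul_assoc, e1, ← mul_assoc, e2, mul_assoc]

theorem lbg_induction (p : LB G → Prop) (m : ℕ) (h1 : p 1)
    (ht : ∀ a g j, j < m → p a → p (a * lt g j)) (g : ℕ → G) (hg : ∀ j, m ≤ j → g j = 1) :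
    p (lbg g) := by
  suffices ∀ l, l ≤ m → ∀ g : ℕ → G, (∀ j, l ≤ j → g j = 1) → p (lbg g) from this m le_rfl g hg
  intro l
  induction l with
  | zero =>
    intro _ g hg
    have : g = 1 := by funext j; exact hg j (Nat.zero_le _)
    rw [this, map_one]; exact h1
  | succ l ih =>
    intro hl g hg
    have e : g = Function.update g l 1 * Pi.mulSingle l (g l) := by
      funext j
      by_cases hj : j = l
      · subst hj; simp
      · simp [hj]
    rw [e, map_mul]
    refine ht _ _ _ (by omega) (ih (by omega) _ fun j hj => ?_)
    by_cases hj' : j = l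
    · subst hj'; simp
    · simp only [Function.update_of_ne hj']
      exact hg j (by omega)

theorem Nn_induction (n : ℕ) (p : LB G → Prop) (h1 : p 1)
    (ht : ∀ a g j, j < n → p a → p (a * lt g j)) (hs : ∀ a i, i + 1 < n → p a → p (a * ls i))
    (a : LB G) (ha : a ∈ Nn G n) : p a := by
  rw [lb_eq a]
  have hg : p (lbg a.g) := lbg_induction p n h1 ht a.g ha.2
  have : ∀ x : BM, chi (n - 1) x = 1 → p (lbg a.g * lbx x) := by
    intro x
    induction x using bm_induction with
    | h1 => intro _; simpa using hg
    | hs x i ih =>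
      intro h
      rw [map_mul, mul_eq_one, chi_bs] at h
      rw [map_mul, ← mul_assoc]
      refine hs _ i ?_ (ih h.1)
      have := h.2
      split_ifs at this
      omega
  exact this _ ha.1

theorem ztw_central (n : ℕ) (a : LB G) (ha : a ∈ Nn G n) : ztw G n * a = a * ztw G n := by
  refine Nn_induction n (fun a => ztw G n * a = a * ztw G n) (by simp) ?_ ?_ a ha
  · intro a g j hj h
    rw [← mul_assoc, h, mul_assoc, ztw_lt n j g hj, mul_assoc]
  · intro a j hj h
    rw [← mul_assoc, h, mul_assoc, ztw_ls n j hj, mul_assoc]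

theorem ztw_cancel (n : ℕ) (a b : LB G) (h : a * ztw G n = b * ztw G n) : a = b := by
  unfold ztw at h
  rw [← mul_assoc, ← mul_assoc] at h
  exact dl_cancel lb_garside (dl_cancel lb_garside h)

end BR
end

noncomputable section

namespace BR

/-! Linear-algebra preliminaries on free modules. -/
section lin
variable {B : Type} [Ring B] {α β γ : Type}

/-- `B`-linear extension. -/
abbrev LC {M : Type} [AddCommGroup M] [Module B M] (f : α → M) : (α →₀ B) →ₗ[B] M :=
  Finsupp.linearCombination B f

/-- Induced map on free modules. -/
abbrev mp (f : α → β) : (α →₀ B) →ₗ[B] (β →₀ B) := Finsupp.lmapDomain B B f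

/-- basis element -/
abbrev bb (a : α) : α →₀ B := Finsupp.single a 1

/-- right multiplication of coefficients. -/
def Rm (z : B) : (α →₀ B) →ₗ[B] (α →₀ B) := LC fun a => Finsupp.single a z

theorem LC_single {M : Type} [AddCommGroup M] [Module B M] (f : α → M) (a : α) (b : B) :
    LC f (Finsupp.single a b) = b • f a := by simp [LC]

theorem mp_single (f : α → β) (a : α) (b : B) :
    mp f (Finsupp.single a b) = Finsupp.single (f a) b := by simp [mp]

theorem Rm_single (z : B) (a : α) (b : B) :
    Rm z (Finsupp.single a b) = Finsupp.single a (b * z) := by simp [Rm]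

theorem Rm_apply (z : B) (X : α →₀ B) (a : α) : Rm z X a = X a * z := by
  induction X using Finsupp.induction_linear with
  | zero => simp
  | add f g hf hg => simp [hf, hg, add_mul]
  | single b x =>
    rw [Rm_single]
    by_cases h : b = a
    · subst h; simp
    · simp [Finsupp.single_apply, h]

theorem lin_ext {M : Type} [AddCommGroup M] [Module B M] {f g : (α →₀ B) →ₗ[B] M}
    (h : ∀ a, f (bb a) = g (bb a)) : f = g := by
  refine Finsupp.lhom_ext' fun a => LinearMap.ext_ring ?_
  simpa using h a

theorem LC_mp {M : Type} [AddCommGroup M] [Module B M] (f : β → M) (g : α → β) (X : α →₀ B) :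
    LC f (mp g X) = LC (fun a => f (g a)) X := by
  simp [LC, mp, Finsupp.linearCombination_mapDomain]; rfl

theorem mp_eq_LC (g : α → β) (X : α →₀ B) : mp g X = LC (fun a => bb (g a)) X := by
  refine LinearMap.congr_fun (lin_ext fun a => ?_) X
  simp

theorem LC_LC {M : Type} [AddCommGroup M] [Module B M] (f : β → M) (g : α → (β →₀ B))
    (X : α →₀ B) : LC f (LC g X) = LC (fun a => LC f (g a)) X := by
  rw [← LinearMap.comp_apply]
  refine LinearMap.congr_fun (lin_ext fun a => ?_) X
  simp

theorem map_LC {M M' : Type} [AddCommGroup M] [Module B M] [AddCommGroup M'] [Module B M']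
    (F : M →ₗ[B] M') (g : α → M) (X : α →₀ B) : F (LC g X) = LC (fun a => F (g a)) X := by
  rw [← LinearMap.comp_apply]
  refine LinearMap.congr_fun (lin_ext fun a => ?_) X
  simp

theorem LC_Rm {M : Type} [AddCommGroup M] [Module B M] (f : α → M) (z : B) (X : α →₀ B) :
    LC f (Rm z X) = LC (fun a => z • f a) X := by
  rw [Rm, LC_LC]
  simp [LC]

theorem LC_id (X : α →₀ B) : LC (fun a => bb a) X = X := by
  have : LC (fun a => (bb a : α →₀ B)) = LinearMap.id := lin_ext fun a => by simp
  rw [this]; rfl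

theorem LC_add {M : Type} [AddCommGroup M] [Module B M] (f g : α → M) (X : α →₀ B) :
    LC (fun a => f a + g a) X = LC f X + LC g X := by
  rw [← LinearMap.add_apply]
  refine LinearMap.congr_fun (lin_ext fun a => ?_) X
  simp

theorem LC_neg {M : Type} [AddCommGroup M] [Module B M] (f : α → M) (X : α →₀ B) :
    LC (fun a => - f a) X = - LC f X := by
  rw [← LinearMap.neg_apply]
  refine LinearMap.congr_fun (lin_ext fun a => ?_) X
  simp

theorem LC_zero {M : Type} [AddCommGroup M] [Module B M] (X : α →₀ B) :
    LC (fun _ => (0 : M)) X = 0 := by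
  simp [LC, Finsupp.linearCombination_apply]

theorem LC_sub {M : Type} [AddCommGroup M] [Module B M] (f g : α → M) (X : α →₀ B) :
    LC (fun a => f a - g a) X = LC f X - LC g X := by
  simp only [sub_eq_add_neg]
  rw [LC_add, LC_neg]

theorem LC_zsmul {M : Type} [AddCommGroup M] [Module B M] (c : ℤ) (f : α → M) (X : α →₀ B) :
    LC (fun a => c • f a) X = c • LC f X := by
  rw [← LinearMap.smul_apply]
  refine LinearMap.congr_fun (lin_ext fun a => ?_) X
  simp

theorem LC_congr {M : Type} [AddCommGroup M] [Module B M] {S : Set α} {X : α →₀ B}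
    (hX : X ∈ Finsupp.supported B B S) {f g : α → M} (h : ∀ a ∈ S, f a = g a) :
    LC f X = LC g X := by
  simp only [LC, Finsupp.linearCombination_apply]
  refine Finsupp.sum_congr fun a ha => ?_
  rw [h a (hX ha)]

theorem LC_mem {M : Type} [AddCommGroup M] [Module B M] {S : Set α} {X : α →₀ B}
    (hX : X ∈ Finsupp.supported B B S) {f : α → M} (P : Submodule B M) (h : ∀ a ∈ S, f a ∈ P) :
    LC f X ∈ P := by
  simp only [LC, Finsupp.linearCombination_apply]
  exact Submodule.sum_mem _ fun a ha => P.smul_mem _ (h a (hX ha))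

theorem mp_mem {S : Set α} {X : α →₀ B} (hX : X ∈ Finsupp.supported B B S) {T : Set β}
    {f : α → β} (h : ∀ a ∈ S, f a ∈ T) : mp f X ∈ Finsupp.supported B B T := by
  rw [mp_eq_LC]
  exact LC_mem hX _ fun a ha => Finsupp.single_mem_supported B _ (h a ha)

theorem LC_swap {M : Type} [AddCommGroup M] [Module B M] {X : α →₀ B} {Y : β →₀ B}
    (h : ∀ b, Y b • X = Rm (Y b) X) (F : α → β → M) :
    LC (fun a => LC (fun b => F a b) Y) X = LC (fun b => LC (fun a => F a b) X) Y := by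
  have : ∀ b, Y b • LC (fun a => F a b) X = LC (fun a => Y b • F a b) X := by
    intro b
    rw [← map_smul, h, LC_Rm]
  simp only [LC, Finsupp.linearCombination_apply, Finsupp.sum] at this ⊢
  rw [Finset.sum_congr rfl fun b _ => this b]
  simp only [Finset.smul_sum]
  exact Finset.sum_comm

theorem Rm_comm_apply {z : B} {Y : α →₀ B} (h : z • Y = Rm z Y) (b : α) : z * Y b = Y b * z := by
  rw [← Rm_apply, ← h]; simp

theorem Rm_LC (z z' : B) (f g : α → (β →₀ B)) (X : α →₀ B) (h : ∀ a, z • f a = Rm z (g a)) :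
    LC f (Rm z X) = Rm z (LC g X) := by
  rw [LC_Rm, map_LC]
  simp only [h]

theorem Rm_mp (z : B) (f : α → β) (X : α →₀ B) : mp f (Rm z X) = Rm z (mp f X) := by
  rw [mp_eq_LC, mp_eq_LC, LC_Rm, map_LC]
  simp [Rm_single]

end lin

def sg (m : ℕ) : ℤ := (-1) ^ m
theorem sg_add (a b : ℕ) : sg (a + b) = sg a * sg b := pow_add _ _ _
theorem sg_succ (a : ℕ) : sg (a + 1) = - sg a := by simp [sg, pow_succ]
@[simp] theorem sg_zero : sg 0 = 1 := rfl
@[simp] theorem sg_one : sg 1 = -1 := rfl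
@[simp] theorem sg_sq (a : ℕ) : sg a * sg a = 1 := by
  rw [← sg_add, sg, Even.neg_one_pow ⟨a, rfl⟩]

/-! Words and configurations. -/

abbrev Wd (G : Type) := List (List G)
abbrev Cf (G : Type) := List (Wd G)

variable {G : Type}

def ldeg (a : List G) : ℕ := a.length + 1
def wdeg : Wd G → ℕ
  | [] => 0
  | a :: w => ldeg a + wdeg w
@[simp] theorem wdeg_nil : wdeg ([] : Wd G) = 0 := rfl
@[simp] theorem wdeg_cons (a : List G) (w : Wd G) : wdeg (a :: w) = ldeg a + wdeg w := rfl

variable {B : Type} [Ring B] [Group G] (s : ℕ → B) (t : G → ℕ → B)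

/-- One step of the coproduct. -/
def copL (p : ℕ) (a : List G) (x : Wd G × Wd G) : Wd G × Wd G →₀ B :=
  sg (ldeg a * wdeg x.2) • Finsupp.single (a :: x.1, x.2) (cc s (p + x.1.length) x.2.length)
    + bb (x.1, a :: x.2)

/-- The braided coproduct. -/
def cop (p : ℕ) : Wd G → (Wd G × Wd G →₀ B)
  | [] => bb ([], [])
  | a :: w => LC (copL s p a) (cop p w)

/-- Inner part of the boundary of a letter. -/
def lr : List G → (List G →₀ B)
  | [] => 0
  | [_] => - bb []
  | g :: h :: a => - bb ((g * h) :: a) - mp (fun x => g :: x) (lr (h :: a))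

/-- Boundary of a letter on strand `j`. -/
def lb (j : ℕ) : List G → (List G →₀ B)
  | [] => 0
  | g :: a => Finsupp.single a (t g j) + lr (g :: a)

/-- Boundary of a word. -/
def wb (p : ℕ) : Wd G → (Wd G →₀ B)
  | [] => 0
  | a :: w => mp (fun x => a :: x) (wb p w) + sg (wdeg w) • mp (fun x => x :: w) (lb t (p + w.length) a)

/-- Cut term. -/
def cutT (W : Cf G) (x : Wd G × Wd G) : Wd G × Cf G →₀ B :=
  if x.2 = [] then 0 else sg (wdeg x.1) • bb (x.1, x.2 :: W)

/-- Gluing. -/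
def qm : (Wd G × Cf G →₀ B) →ₗ[B] (Cf G →₀ B) :=
  LC fun x => if x.1 = [] then 0 else bb (x.1 :: x.2)

def dEb (p : ℕ) (w : Wd G) (W : Cf G) (X : Cf G →₀ B) : Wd G × Cf G →₀ B :=
  mp (fun x => (x, W)) (wb t p w) - LC (cutT W) (cop s p w) + sg (wdeg w) • mp (fun y => (w, y)) X

/-- The differential on configurations. -/
def dC (p : ℕ) : Cf G → (Cf G →₀ B)
  | [] => 0
  | w :: W => - qm (dEb s t p w W (dC (p + w.length) W))

def dE (p : ℕ) (x : Wd G × Cf G) : Wd G × Cf G →₀ B :=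
  dEb s t p x.1 x.2 (dC s t (p + x.1.length) x.2)

theorem dC_cons (p : ℕ) (w : Wd G) (W : Cf G) : dC s t p (w :: W) = - qm (dE s t p (w, W)) := by
  rw [dC]; rfl

/-! Supports -/

theorem cop_supp (p : ℕ) (w : Wd G) : cop s p w ∈ Finsupp.supported B B
    {x : Wd G × Wd G | x.1.length + x.2.length = w.length ∧ wdeg x.1 + wdeg x.2 = wdeg w} := by
  induction w with
  | nil => exact Finsupp.single_mem_supported B _ (by simp)
  | cons a w ih =>
    rw [cop]
    refine LC_mem ih _ fun x hx => ?_
    obtain ⟨h1, h2⟩ := hx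
    refine Submodule.add_mem _ (Submodule.smul_of_tower_mem _ _ ?_) ?_
    · refine Finsupp.single_mem_supported B _ ?_
      simp only [Set.mem_setOf_eq, List.length_cons, wdeg_cons]; omega
    · refine Finsupp.single_mem_supported B _ ?_
      simp only [Set.mem_setOf_eq, List.length_cons, wdeg_cons]; omega

theorem lr_supp (a : List G) : (lr a : List G →₀ B) ∈ Finsupp.supported B B
    {x : List G | x.length + 1 = a.length} := by
  induction a with
  | nil => exact Submodule.zero_mem _
  | cons g a ih =>
    cases a with
    | nil => exact Submodule.neg_mem _ (Finsupp.single_mem_supported B _ (by simp))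
    | cons h a =>
      rw [lr]
      refine Submodule.sub_mem _ (Submodule.neg_mem _ (Finsupp.single_mem_supported B _ (by simp))) ?_
      exact mp_mem ih fun x hx => by simpa using hx

theorem lb_supp (j : ℕ) (a : List G) : lb t j a ∈ Finsupp.supported B B
    {x : List G | x.length + 1 = a.length} := by
  cases a with
  | nil => exact Submodule.zero_mem _
  | cons g a =>
    exact Submodule.add_mem _ (Finsupp.single_mem_supported B _ (by simp)) (lr_supp _)

theorem wb_supp (p : ℕ) (w : Wd G) : wb t p w ∈ Finsupp.supported B B
    {x : Wd G | x.length = w.length ∧ wdeg x + 1 = wdeg w} := by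
  induction w with
  | nil => exact Submodule.zero_mem _
  | cons a w ih =>
    rw [wb]
    refine Submodule.add_mem _ (mp_mem ih fun x hx => ?_)
      (Submodule.smul_of_tower_mem _ _ (mp_mem (lb_supp t _ a) fun x hx => ?_))
    · simp only [Set.mem_setOf_eq, List.length_cons, wdeg_cons] at *; omega
    · change x.length + 1 = a.length at hx
      refine ⟨by simp, ?_⟩
      change (x.length + 1 + wdeg w) + 1 = (a.length + 1) + wdeg w
      omega

/-! Intertwining -/

/-- `z` moves offset `p'` to `p` on `m` strands. -/
structure Inter (z : B) (p' p m : ℕ) : Prop where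
  hs : ∀ i, i + 1 < m → z * s (p' + i) = s (p + i) * z
  ht : ∀ g i, i < m → z * t g (p' + i) = t g (p + i) * z

variable {s t}

theorem Inter.mono {z : B} {p' p m m' : ℕ} (h : Inter s t z p' p m) (hm : m' ≤ m) :
    Inter s t z p' p m' := ⟨fun i hi => h.hs i (by omega), fun g i hi => h.ht g i (by omega)⟩

theorem Inter.shift {z : B} {p' p m m' : ℕ} (h : Inter s t z p' p m) (a : ℕ) (hm : a + m' ≤ m) :
    Inter s t z (p' + a) (p + a) m' :=
  ⟨fun i hi => by rw [add_assoc, add_assoc]; exact h.hs _ (by omega),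
   fun g i hi => by rw [add_assoc, add_assoc]; exact h.ht _ _ (by omega)⟩

theorem smul_bb {α : Type} (z : B) (a : α) : z • (bb a : α →₀ B) = Rm z (bb a) := by
  rw [Rm_single]; simp

theorem lr_inter (z : B) (a : List G) : z • (lr a : List G →₀ B) = Rm z (lr a) := by
  induction a with
  | nil => simp [lr]
  | cons g a ih =>
    cases a with
    | nil => simp only [lr, smul_neg, map_neg, smul_bb]
    | cons h a =>
      rw [lr, smul_sub, map_sub, smul_neg, map_neg, smul_bb, ← map_smul, ih, Rm_mp]

theorem lb_inter {z : B} {p' p : ℕ} (h : ∀ g, z * t g p' = t g p * z) (a : List G) :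
    z • lb t p' a = Rm z (lb t p a) := by
  cases a with
  | nil => simp [lb]
  | cons g a =>
    rw [lb, lb, smul_add, map_add, lr_inter, Rm_single, Finsupp.smul_single, smul_eq_mul, h]

theorem wb_inter {z : B} {p' p : ℕ} (w : Wd G) (h : ∀ g i, i < w.length →
    z * t g (p' + i) = t g (p + i) * z) : z • wb t p' w = Rm z (wb t p w) := by
  induction w with
  | nil => simp [wb]
  | cons a w ih =>
    rw [wb, wb, smul_add, map_add, smul_comm, map_zsmul, ← map_smul, ← map_smul,
      ih fun g i hi => h g i (by simp; omega), Rm_mp, lb_inter fun g => h g _ (by simp), Rm_mp]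

theorem cop_inter {z : B} {p' p : ℕ} (w : Wd G) (h : ∀ i, i + 1 < w.length →
    z * s (p' + i) = s (p + i) * z) : z • cop s p' w = Rm z (cop s p w) := by
  induction w with
  | nil => exact smul_bb _ _
  | cons a w ih =>
    rw [cop, cop, ← map_smul, ih fun i hi => h i (by simp; omega), LC_Rm, map_LC]
    refine LC_congr (cop_supp s p w) fun x hx => ?_
    rw [copL, copL, smul_add, smul_bb, map_add, smul_comm, map_zsmul,
      Finsupp.smul_single, smul_eq_mul]
    congr 2
    rw [Rm_single]
    refine congrArg _ (cc_intertwine s fun i hi => ?_)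
    rw [add_assoc, add_assoc]
    refine h _ ?_
    have := hx.1
    simp; omega

def wt : Cf G → ℕ
  | [] => 0
  | w :: W => w.length + wt W
@[simp] theorem wt_nil : wt ([] : Cf G) = 0 := rfl
@[simp] theorem wt_cons (w : Wd G) (W : Cf G) : wt (w :: W) = w.length + wt W := rfl

theorem dEb_inter {z : B} {p' p : ℕ} (w : Wd G) (W : Cf G) (h : Inter s t z p' p w.length)
    (X X' : Cf G →₀ B) (hX : z • X' = Rm z X) :
    z • dEb s t p' w W X' = Rm z (dEb s t p w W X) := by
  rw [dEb, dEb, smul_add, map_add, smul_sub, map_sub, smul_comm z, map_zsmul, ← map_smul,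
    wb_inter w h.ht, Rm_mp, ← map_smul, cop_inter w h.hs, ← map_smul, hX, Rm_mp, LC_Rm, map_LC]
  congr 3
  refine congrArg _ ?_
  funext x
  rw [cutT]
  split_ifs
  · simp
  · rw [smul_comm, map_zsmul, smul_bb]

theorem qm_Rm (z : B) (X : Wd G × Cf G →₀ B) : qm (Rm z X) = Rm z (qm X) := by
  rw [qm, LC_Rm, map_LC]
  congr 1
  refine congrArg _ ?_
  funext x
  split_ifs
  · simp
  · rw [smul_bb]

theorem dC_inter {z : B} (W : Cf G) : ∀ {p' p : ℕ}, Inter s t z p' p (wt W) →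
    z • dC s t p' W = Rm z (dC s t p W) := by
  induction W with
  | nil => intro p' p h; simp [dC]
  | cons w W ih =>
    intro p' p h
    rw [dC, dC, smul_neg, map_neg, ← map_smul, dEb_inter w W (h.mono (by simp)) _ _
      (ih (h.shift _ (by simp))), qm_Rm]

end BR
end

noncomputable section

namespace BR

variable {G : Type} [Group G] {B : Type} [Ring B] {s : ℕ → B} {t : G → ℕ → B}

theorem lr_lr (b : List G) : ∀ g h : G,
    (lr ((g * h) :: b) : List G →₀ B) + LC (B := B) (fun x => (lr (g :: x) : List G →₀ B)) (lr (h :: b)) = 0 := by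
  induction b with
  | nil => intro g h; simp [lr]
  | cons c b ih =>
    intro g h
    rw [lr, lr, map_sub, map_neg, LC_single, one_smul, LC_mp]
    have : (fun x => (lr (g :: h :: x) : List G →₀ B)) =
        fun x => - bb ((g * h) :: x) - mp (fun x => g :: x) (lr (h :: x)) := by
      funext x; rw [lr]
    rw [this, LC_sub, LC_neg, ← mp_eq_LC, ← map_LC, lr, mul_assoc]
    have := congrArg (mp (B := B) fun x => g :: x) (ih h c)
    rw [map_add, map_zero] at this
    rw [← this]; abel

theorem lb_lb (H : BTRel s t) (j : ℕ) (a : List G) : LC (lb t j) (lb t j a) = 0 := by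
  have key : ∀ (a : List G) g, LC (B := B) (lb t j) (lr (g :: a)) = - (t g j • lb t j a) := by
    intro a g
    cases a with
    | nil => simp [lr, lb]
    | cons h b =>
      have e : (fun x => lb t j (g :: x)) = fun x => t g j • bb x + lr (g :: x) := by
        funext x; rw [lb, Finsupp.smul_single, smul_eq_mul, mul_one]
      rw [lr, map_sub, map_neg, LC_single, one_smul, LC_mp, e, LC_add, ← LC_Rm, LC_id,
        ← lr_inter, lb, lb, smul_add, Finsupp.smul_single, smul_eq_mul, H.t_mul]
      have := lr_lr (B := B) b g h
      rw [eq_neg_of_add_eq_zero_left this]; abel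
  cases a with
  | nil => simp [lb]
  | cons g a =>
    rw [lb, map_add, LC_single, key]; simp

theorem wb_wb (H : BTRel s t) (p : ℕ) (w : Wd G) : LC (wb t p) (wb t p w) = 0 := by
  induction w with
  | nil => simp [wb]
  | cons a w ih =>
    have e1 : LC (fun x => wb t p (a :: x)) (wb t p w) =
        LC (fun x => mp (fun x => a :: x) (wb t p x) +
          (- sg (wdeg w)) • mp (fun y => y :: x) (lb t (p + w.length) a)) (wb t p w) := by
      refine LC_congr (wb_supp t p w) fun x hx => ?_
      rw [wb, hx.1, ← hx.2, sg_succ, neg_neg]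
    have e2 : (fun y => wb t p (y :: w)) = fun y => mp (fun x => y :: x) (wb t p w) +
        sg (wdeg w) • mp (fun x => x :: w) (lb t (p + w.length) y) := by
      funext y; rw [wb]
    rw [wb, map_add, map_zsmul, LC_mp, LC_mp, e1, e2, LC_add, LC_add, ← map_LC, ih, map_zero,
      LC_zsmul, LC_zsmul, ← map_LC, lb_lb H, map_zero]
    simp only [mp_eq_LC]
    rw [LC_swap]
    · simp
    · intro b
      refine wb_inter w fun g i hi => (Rm_comm_apply ?_ b).symm
      exact lb_inter (fun g' => H.tt_comm _ _ _ _ (by omega)) a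

/-! Coassociativity. -/

theorem cop_coassoc (H : BTRel s t) (p : ℕ) (w : Wd G) :
    LC (fun x : Wd G × Wd G => mp (fun y : Wd G × Wd G => (x.1, y.1, y.2))
      (cop s (p + x.1.length) x.2)) (cop s p w) =
    LC (fun x : Wd G × Wd G => mp (fun y : Wd G × Wd G => (y.1, y.2, x.2))
      (cop s p x.1)) (cop s p w) := by
  induction w with
  | nil => simp [cop]
  | cons a w ih =>
    let L3 : Wd G × Wd G × Wd G → (Wd G × Wd G × Wd G →₀ B) := fun x =>
      sg (ldeg a * (wdeg x.2.1 + wdeg x.2.2)) • Finsupp.single (a :: x.1, x.2.1, x.2.2)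
        (cc s (p + x.1.length) (x.2.1.length + x.2.2.length)) +
      (sg (ldeg a * wdeg x.2.2) • Finsupp.single (x.1, a :: x.2.1, x.2.2)
        (cc s (p + x.1.length + x.2.1.length) x.2.2.length) + bb (x.1, x.2.1, a :: x.2.2))
    have h1 : LC (fun x : Wd G × Wd G => mp (fun y : Wd G × Wd G => (x.1, y.1, y.2))
        (cop s (p + x.1.length) x.2)) (cop s p (a :: w)) =
        LC L3 (LC (fun x : Wd G × Wd G => mp (fun y : Wd G × Wd G => (x.1, y.1, y.2))
      (cop s (p + x.1.length) x.2)) (cop s p w)) := by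
      rw [cop, LC_LC, LC_LC]
      refine LC_congr (cop_supp s p w) fun x hx => ?_
      rw [copL, map_add, map_zsmul, LC_single, LC_single, one_smul, ← map_smul]
      have e : cc s (p + x.1.length) x.2.length • cop s (p + (a :: x.1).length) x.2 =
          Rm (cc s (p + x.1.length) x.2.length) (cop s (p + x.1.length) x.2) := by
        refine cop_inter _ fun i hi => ?_
        rw [show p + (a :: x.1).length + i = (p + x.1.length + i) + 1 by simp; omega]
        exact cc_s H.toBRel (by omega) (by omega)
      dsimp only
      rw [e, cop, LC_mp, map_LC, mp_eq_LC, LC_Rm, ← LC_zsmul, ← LC_add]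
      refine LC_congr (cop_supp s _ x.2) fun y hy => ?_
      simp only [L3, copL, map_add, map_zsmul, mp_single, Finsupp.smul_single, smul_eq_mul,
        mul_one, hy.1, hy.2]
    have h2 : LC (fun x : Wd G × Wd G => mp (fun y : Wd G × Wd G => (y.1, y.2, x.2))
      (cop s p x.1)) (cop s p (a :: w)) =
        LC L3 (LC (fun x : Wd G × Wd G => mp (fun y : Wd G × Wd G => (y.1, y.2, x.2))
      (cop s p x.1)) (cop s p w)) := by
      rw [cop, LC_LC, LC_LC]
      refine LC_congr (cop_supp s p w) fun x hx => ?_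
      rw [copL, map_add, map_zsmul, LC_single, LC_single, one_smul, ← map_smul]
      have e : cc s (p + x.1.length) x.2.length • cop s p x.1 =
          Rm (cc s (p + x.1.length) x.2.length) (cop s p x.1) := by
        refine cop_inter _ fun i hi => ?_
        refine (cc_intertwine s fun j hj => H.comm _ _ (by unfold Far; omega)).symm
      dsimp only
      rw [cop, ← map_smul (LC (copL s p a)), e, LC_mp, LC_Rm, map_LC, mp_eq_LC, ← LC_zsmul, ← LC_add]
      refine LC_congr (cop_supp s _ x.1) fun y hy => ?_
      have e4 : cc s (p + x.1.length) x.2.length * cc s (p + y.1.length) y.2.length =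
          cc s (p + y.1.length) (y.2.length + x.2.length) := by
        rw [cc_add, ← hy.1]; congr 2; omega
      simp only [L3, copL, map_add, map_zsmul, mp_single, Finsupp.smul_single, smul_eq_mul,
        mul_one, smul_add, map_smul, mul_smul_comm, e4, smul_smul, ← sg_add]
      rw [show p + x.1.length = p + y.1.length + y.2.length by have := hy.1; omega]
      rw [show ldeg a * wdeg x.2 + ldeg a * wdeg y.2 = ldeg a * (wdeg y.2 + wdeg x.2) by ring]
      abel
    rw [h1, h2, ih]

/-- Coderivation term. -/
def Jc (t : G → ℕ → B) (p : ℕ) (x : Wd G × Wd G) : Wd G × Wd G →₀ B :=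
  mp (fun u => (u, x.2)) (wb t p x.1) +
    sg (wdeg x.1) • mp (fun v => (x.1, v)) (wb t (p + x.1.length) x.2)

theorem cop_wb (H : BTRel s t) (p : ℕ) (w : Wd G) :
    LC (cop s p) (wb t p w) = LC (Jc t p) (cop s p w) := by
  induction w with
  | nil => simp [wb, cop, Jc]
  | cons a w ih =>
    have e1 : (fun x => cop s p (a :: x)) = fun x => LC (copL s p a) (cop s p x) := by
      funext x; rw [cop]
    have e2 : (fun y => cop s p (y :: w)) = fun y => LC (fun x => copL s p y x) (cop s p w) := by
      funext x; rw [cop]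
    rw [wb, map_add, map_zsmul, LC_mp, LC_mp, e1, e2, ← map_LC, ih]
    rw [← LC_swap, cop, LC_LC, LC_LC, ← LC_zsmul, ← LC_add]
    · refine LC_congr (cop_supp s p w) fun x hx => ?_
      obtain ⟨u, v⟩ := x
      obtain ⟨hl, hd⟩ := hx
      dsimp only at hl hd
      set z := cc s (p + u.length) v.length with hz
      have f1 : LC (copL s p a) (mp (fun u => (u, v)) (wb t p u)) =
          sg (ldeg a * wdeg v) • z • mp (fun u => (a :: u, v)) (wb t p u) +
            mp (fun u => (u, a :: v)) (wb t p u) := by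
        have : z • wb t p u = Rm z (wb t p u) :=
          wb_inter u fun g i hi => cc_t_far H g (by omega)
        rw [← map_smul, this, LC_mp, mp_eq_LC, mp_eq_LC, LC_Rm, ← LC_zsmul, ← LC_add]
        refine LC_congr (wb_supp t p u) fun x hx => ?_
        rw [copL]; simp only [hx.1, ← hz, Finsupp.smul_single, smul_eq_mul, mul_one]
      have f2 : LC (copL s p a) (mp (fun v => (u, v)) (wb t (p + u.length) v)) =
          (sg (ldeg a) * sg (ldeg a * wdeg v)) • z •
            mp (fun v => (a :: u, v)) (wb t (p + u.length + 1) v) +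
            mp (fun v => (u, a :: v)) (wb t (p + u.length) v) := by
        have : z • wb t (p + u.length + 1) v = Rm z (wb t (p + u.length) v) :=
          wb_inter v fun g i hi => by
            rw [show p + u.length + 1 + i = (p + u.length + i) + 1 by omega]
            exact cc_t' H g (by omega) (by omega)
        rw [← map_smul, this, LC_mp, mp_eq_LC, mp_eq_LC, LC_Rm, ← LC_zsmul, ← LC_add]
        refine LC_congr (wb_supp t _ v) fun x hx => ?_
        rw [copL]; simp only [hx.1, ← hz, Finsupp.smul_single, smul_eq_mul, mul_one, ← hx.2]
        rw [mul_add, mul_one, sg_add, mul_left_comm, sg_sq, mul_one]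
      have f3 : LC (fun y => copL s p y (u, v)) (lb t (p + w.length) a) =
          (sg (wdeg v) * sg (ldeg a * wdeg v)) • z •
            mp (fun y => (y :: u, v)) (lb t (p + u.length) a) +
            mp (fun y => (u, y :: v)) (lb t (p + w.length) a) := by
        have : z • lb t (p + u.length) a = Rm z (lb t (p + w.length) a) :=
          lb_inter (fun g => by
            rw [hz, cc_t H, show p + u.length + v.length = p + w.length by omega]) a
        rw [← map_smul, this, mp_eq_LC, mp_eq_LC, LC_Rm, ← LC_zsmul, ← LC_add]
        refine LC_congr (lb_supp t _ a) fun x hx => ?_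
        change x.length + 1 = a.length at hx
        rw [copL]; simp only [← hz, Finsupp.smul_single, smul_eq_mul, mul_one]
        have : ldeg a * wdeg v = ldeg x * wdeg v + wdeg v := by
          simp only [ldeg, ← hx]; ring
        rw [this, sg_add, mul_left_comm, sg_sq, mul_one]
      rw [f3, Jc, map_add, map_zsmul]
      dsimp only
      rw [f1, f2, copL, map_add, map_zsmul, LC_single, LC_single, one_smul, Jc, Jc]
      dsimp only
      rw [wb, wb]
      simp only [map_add, map_zsmul, smul_add, smul_comm z (_ : ℤ), smul_smul, wdeg_cons,
        sg_add, ← hd, mp_eq_LC, LC_LC, LC_single, one_smul, ← hz, List.length_cons, ← add_assoc, ← hl]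
      rw [show sg (wdeg u) * sg (wdeg v) * (sg (wdeg v) * sg (ldeg a * wdeg v)) =
        sg (ldeg a * wdeg v) * sg (wdeg u) by
          rw [mul_assoc, ← mul_assoc (sg (wdeg v)), sg_sq, one_mul, mul_comm],
        show sg (wdeg u) * (sg (ldeg a) * sg (ldeg a * wdeg v)) =
        sg (ldeg a * wdeg v) * (sg (ldeg a) * sg (wdeg u)) by ring]
      abel
    · intro b
      refine cop_inter w fun i hi => (Rm_comm_apply ?_ b).symm
      exact lb_inter (fun g' => H.st_comm _ _ _ (by omega) (by omega)) a

end BR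
end

noncomputable section

namespace BR

variable {G : Type} [Group G] {B : Type} [Ring B] {s : ℕ → B} {t : G → ℕ → B}

theorem mp_mp {α β γ : Type} (f : β → γ) (g : α → β) (X : α →₀ B) :
    mp f (mp g X) = mp (fun x => f (g x)) X := by
  rw [mp_eq_LC, LC_mp, mp_eq_LC]

/-- Double cut term. -/
def T3 (W : Cf G) (x : Wd G × Wd G × Wd G) : Wd G × Cf G →₀ B :=
  if x.2.1 = [] ∨ x.2.2 = [] then 0 else sg (wdeg x.2.1) • bb (x.1, x.2.1 :: x.2.2 :: W)

theorem mp_zero_of {α β : Type} (f : α → (β →₀ B)) (X : α →₀ B) (h : ∀ a, f a = 0) :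
    LC f X = 0 := by
  rw [show f = fun _ => 0 from funext h, LC_zero]

theorem dE_cut (H : BTRel s t) (p n : ℕ) (W : Cf G) (u v : Wd G)
    (hl : u.length + v.length = n) :
    LC (B := B) (dE s t p) (cutT W (u, v)) =
      - LC (B := B) (cutT (B := B) W) (Jc t p (u, v))
      - LC (B := B) (T3 (B := B) W) (mp (fun y : Wd G × Wd G => (y.1, y.2, v)) (cop s p u))
      + LC (B := B) (T3 (B := B) W) (mp (fun y : Wd G × Wd G => (u, y.1, y.2)) (cop s (p + u.length) v))
      - sg (wdeg v) • LC (fun Y => if v = [] then 0 else bb (u, v :: Y)) (dC s t (p + n) W) := by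
  by_cases hv : v = []
  · subst hv
    simp only [cutT, T3, Jc, wb, cop, if_true, map_zero, map_add, smul_zero, add_zero, LC_mp,
      LC_zero, or_true, mp_single, LC_single, sub_zero, true_or, neg_zero]
  · have e1 : LC (B := B) (cutT (B := B) W) (Jc t p (u, v)) =
        - (sg (wdeg u) • mp (fun x => (x, v :: W)) (wb t p u)) +
          mp (fun x => (u, x :: W)) (wb t (p + u.length) v) := by
      rw [Jc, map_add, map_zsmul, LC_mp, LC_mp]
      congr 1
      · rw [mp_eq_LC, ← LC_zsmul, ← LC_neg]
        refine LC_congr (wb_supp t p u) fun x hx => ?_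
        rw [cutT, if_neg hv, ← hx.2, sg_succ, neg_smul, neg_neg]
      · rw [mp_eq_LC, ← LC_zsmul]
        refine LC_congr (wb_supp t _ v) fun x hx => ?_
        have : x ≠ [] := by
          rintro rfl
          have := hx.1
          simp at this
          exact hv (List.eq_nil_of_length_eq_zero this.symm)
        rw [cutT, if_neg this, smul_smul, sg_sq, one_smul]
    have e2 : LC (B := B) (T3 (B := B) W) (mp (fun y : Wd G × Wd G => (y.1, y.2, v)) (cop s p u)) =
        sg (wdeg u) • LC (B := B) (cutT (B := B) (v :: W)) (cop s p u) := by
      rw [LC_mp, ← LC_zsmul]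
      refine LC_congr (cop_supp s p u) fun x hx => ?_
      simp only [T3, cutT, hv, or_false]
      split_ifs
      · simp
      · rw [smul_smul, ← hx.2, sg_add, mul_right_comm, sg_sq, one_mul]
    have e3 : dC s t (p + u.length) (v :: W) =
        - mp (fun x => x :: W) (wb t (p + u.length) v)
        + LC (fun y : Wd G × Wd G => if y.1 = [] ∨ y.2 = [] then 0 else
          sg (wdeg y.1) • bb (y.1 :: y.2 :: W)) (cop s (p + u.length) v)
        - sg (wdeg v) • mp (fun Y => v :: Y) (dC s t (p + n) W) := by
      rw [dC, dEb, map_add, map_sub, map_zsmul, qm, LC_mp, LC_mp, LC_LC]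
      have g1 : LC (fun a : Wd G => if (a, W).1 = [] then 0 else bb ((a, W).1 :: (a, W).2))
          (wb t (p + u.length) v) = mp (fun x => x :: W) (wb t (p + u.length) v) := by
        rw [mp_eq_LC]
        refine LC_congr (wb_supp t _ v) fun x hx => ?_
        have : x ≠ [] := by
          rintro rfl
          have := hx.1
          simp at this
          exact hv (List.eq_nil_of_length_eq_zero this.symm)
        simp [this]
      have g2 : (fun a : Cf G => if (v, a).1 = [] then (0 : Cf G →₀ B) else bb ((v, a).1 :: (v, a).2))
          = fun a => bb (v :: a) := by funext a; simp [hv]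
      rw [g1, g2, ← mp_eq_LC, add_assoc, hl]
      have g3 : (fun a : Wd G × Wd G => LC (B := B) (fun x : Wd G × Cf G => if x.1 = [] then
          (0 : Cf G →₀ B) else bb (x.1 :: x.2)) (cutT W a)) =
          (fun y : Wd G × Wd G => if y.1 = [] ∨ y.2 = [] then 0 else
            sg (wdeg y.1) • bb (y.1 :: y.2 :: W)) := by
        funext y
        rw [cutT]
        by_cases h1 : y.2 = []
        · simp [h1]
        · by_cases h2 : y.1 = []
          · simp only [h1, h2, if_false, map_zsmul, LC_single]; simp
          · simp only [h1, h2, if_false, map_zsmul, LC_single]; simp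
      rw [g3]; abel
    have e4 : LC (B := B) (T3 (B := B) W) (mp (fun y : Wd G × Wd G => (u, y.1, y.2)) (cop s (p + u.length) v)) =
        mp (fun Y => (u, Y)) (LC (fun y : Wd G × Wd G => if y.1 = [] ∨ y.2 = [] then 0 else
          sg (wdeg y.1) • bb (y.1 :: y.2 :: W)) (cop s (p + u.length) v)) := by
      rw [LC_mp, map_LC]
      congr 1
      refine congrArg _ ?_
      funext y
      simp only [T3]
      split_ifs
      · simp
      · simp
    have e5 : (fun Y => if v = [] then (0 : Wd G × Cf G →₀ B) else bb (u, v :: Y)) =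
        fun Y => bb (u, v :: Y) := by simp [hv]
    rw [e1, e2, e4, e5, cutT, if_neg hv, map_zsmul, LC_single, one_smul, dE, dEb]
    dsimp only
    rw [e3]
    simp only [map_add, map_sub, map_neg, map_zsmul, smul_add, smul_sub, smul_neg, mp_mp,
      smul_smul, ← mul_assoc, sg_sq, one_mul, one_smul, ← mp_eq_LC]
    abel

theorem dE_dE_aux (H : BTRel s t) (p : ℕ) (w : Wd G) (W : Cf G)
    (ih : LC (dC s t (p + w.length)) (dC s t (p + w.length) W) = 0) :
    LC (dE s t p) (dE s t p (w, W)) = 0 := by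
  have hA : LC (fun x => dE s t p (x, W)) (wb t p w) =
      - LC (B := B) (cutT (B := B) W) (LC (Jc t p) (cop s p w)) - sg (wdeg w) • LC (fun x => mp (fun Y => (x, Y))
        (dC s t (p + w.length) W)) (wb t p w) := by
    have : LC (fun x => dE s t p (x, W)) (wb t p w) = LC (fun x =>
        mp (fun x => (x, W)) (wb t p x) - LC (B := B) (cutT (B := B) W) (cop s p x) + (- sg (wdeg w)) •
        mp (fun y => (x, y)) (dC s t (p + w.length) W)) (wb t p w) := by
      refine LC_congr (wb_supp t p w) fun x hx => ?_
      rw [dE, dEb]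
      dsimp only
      rw [hx.1, ← hx.2, sg_succ, neg_neg]
    rw [this, LC_add, LC_sub, ← map_LC, wb_wb H, ← map_LC, cop_wb H, map_zero, LC_zsmul]
    rw [neg_smul]; abel
  have hB : LC (fun x => LC (B := B) (dE s t p) (cutT W x)) (cop s p w) =
      - LC (B := B) (cutT (B := B) W) (LC (Jc t p) (cop s p w)) -
      LC (fun x : Wd G × Wd G => sg (wdeg x.2) • LC (fun Y => if x.2 = [] then 0 else
        bb (x.1, x.2 :: Y)) (dC s t (p + w.length) W)) (cop s p w) := by
    have : LC (fun x => LC (B := B) (dE s t p) (cutT W x)) (cop s p w) =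
      LC (fun x : Wd G × Wd G => - LC (B := B) (cutT (B := B) W) (Jc t p x)
        - LC (B := B) (T3 (B := B) W) (mp (fun y : Wd G × Wd G => (y.1, y.2, x.2)) (cop s p x.1))
      + LC (B := B) (T3 (B := B) W) (mp (fun y : Wd G × Wd G => (x.1, y.1, y.2)) (cop s (p + x.1.length) x.2))
      - sg (wdeg x.2) • LC (fun Y => if x.2 = [] then 0 else bb (x.1, x.2 :: Y))
        (dC s t (p + w.length) W)) (cop s p w) :=
      LC_congr (cop_supp s p w) fun x hx => dE_cut H p _ W x.1 x.2 hx.1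
    rw [this, LC_sub, LC_add, LC_sub, LC_neg, ← map_LC, ← map_LC, ← map_LC, cop_coassoc H]
    abel
  have hC : LC (fun Y => dE s t p (w, Y)) (dC s t (p + w.length) W) =
      LC (fun Y => mp (fun x => (x, Y)) (wb t p w)) (dC s t (p + w.length) W)
      - LC (fun Y => LC (B := B) (cutT (B := B) Y) (cop s p w)) (dC s t (p + w.length) W) := by
    have : (fun Y => dE s t p (w, Y)) = fun Y => mp (fun x => (x, Y)) (wb t p w)
        - LC (B := B) (cutT (B := B) Y) (cop s p w) + sg (wdeg w) • mp (fun y => (w, y))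
          (dC s t (p + w.length) Y) := rfl
    rw [this, LC_add, LC_sub, LC_zsmul, ← map_LC, ih, map_zero, smul_zero, add_zero]
  have c1 : LC (fun x => mp (fun Y => (x, Y)) (dC s t (p + w.length) W)) (wb t p w) =
      LC (fun Y => mp (fun x => (x, Y)) (wb t p w)) (dC s t (p + w.length) W) := by
    simp only [mp_eq_LC]
    rw [LC_swap]
    intro b
    refine wb_inter w fun g i hi => (Rm_comm_apply ?_ b).symm
    exact dC_inter W ⟨fun j _ => (H.st_comm _ _ _ (by omega) (by omega)).symm,
      fun g' j _ => H.tt_comm _ _ _ _ (by omega)⟩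
  have c2 : LC (fun x : Wd G × Wd G => sg (wdeg x.2) • LC (fun Y => if x.2 = [] then 0 else
        bb (x.1, x.2 :: Y)) (dC s t (p + w.length) W)) (cop s p w) =
      sg (wdeg w) • LC (fun Y => LC (B := B) (cutT (B := B) Y) (cop s p w)) (dC s t (p + w.length) W) := by
    have : ∀ b, dC s t (p + w.length) W b • cop s p w =
        Rm (dC s t (p + w.length) W b) (cop s p w) := by
      intro b
      refine cop_inter w fun i hi => (Rm_comm_apply ?_ b).symm
      exact dC_inter W ⟨fun j _ => H.comm _ _ (by unfold Far; omega),
        fun g' j _ => H.st_comm _ _ _ (by omega) (by omega)⟩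
    rw [← LC_swap this, ← LC_zsmul]
    refine LC_congr (cop_supp s p w) fun x hx => ?_
    rw [← LC_zsmul, ← LC_zsmul]
    congr 1
    refine congrArg _ ?_
    funext Y
    rw [cutT]
    split_ifs
    · simp
    · rw [smul_smul, ← hx.2, sg_add, mul_right_comm, sg_sq, one_mul]
  rw [dE, dEb, map_add, map_sub, map_zsmul, LC_mp, LC_mp, LC_LC]
  dsimp only
  rw [hA, hB, hC, c1, c2, smul_sub]
  abel

theorem dC_qm (p : ℕ) (X : Wd G × Cf G →₀ B) :
    LC (dC s t p) (qm X) = - qm (LC (dE s t p) X) := by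
  rw [qm, LC_LC, ← qm, map_LC, ← LC_neg]
  congr 1
  refine congrArg _ ?_
  funext x
  obtain ⟨x, Y⟩ := x
  by_cases h : x = []
  · subst h
    simp only [dE, dEb, cop, wb, qm]
    rw [map_add, map_zsmul, LC_mp, LC_single, one_smul]
    simp [cutT, LC_zero]
  · simp only [h, if_false, LC_single, one_smul, dC_cons]

theorem dC_dC (H : BTRel s t) (W : Cf G) : ∀ p, LC (dC s t p) (dC s t p W) = 0 := by
  induction W with
  | nil => intro p; simp [dC]
  | cons w W ih =>
    intro p
    rw [dC_cons, map_neg, dC_qm, dE_dE_aux H p w W (ih _)]; simp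

theorem dE_dE (H : BTRel s t) (p : ℕ) (x : Wd G × Cf G) : LC (dE s t p) (dE s t p x) = 0 :=
  dE_dE_aux H p x.1 x.2 (dC_dC H _ _)

end BR
end

noncomputable section

namespace BR

variable {G : Type} [Group G] {B : Type} [Ring B] {s : ℕ → B} {t : G → ℕ → B}

/-! Supports of the differentials. -/

def Valid (W : Cf G) : Prop := ∀ w ∈ W, w ≠ []

def cdeg : Cf G → ℕ
  | [] => 0
  | w :: W => (wdeg w - 1) + cdeg W
@[simp] theorem cdeg_nil : cdeg ([] : Cf G) = 0 := rfl
@[simp] theorem cdeg_cons (w : Wd G) (W : Cf G) : cdeg (w :: W) = (wdeg w - 1) + cdeg W := rfl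

theorem Valid.nil : Valid ([] : Cf G) := by intro w hw; simp at hw
theorem valid_cons {w : Wd G} {W : Cf G} : Valid (w :: W) ↔ w ≠ [] ∧ Valid W := by
  simp [Valid]

theorem wdeg_pos {w : Wd G} (h : w ≠ []) : 1 ≤ wdeg w := by
  cases w with
  | nil => exact absurd rfl h
  | cons a w => simp only [wdeg_cons, ldeg]; omega

/-- Configurations of weight `n` and degree `q`. -/
def CS (G : Type) [Group G] (n q : ℕ) : Set (Cf G) := {W | Valid W ∧ wt W = n ∧ cdeg W = q}
/-- Marked configurations of weight `n` and degree `q`. -/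
def ES (G : Type) [Group G] (n q : ℕ) : Set (Wd G × Cf G) :=
  {x | Valid x.2 ∧ x.1.length + wt x.2 = n ∧ wdeg x.1 + cdeg x.2 = q}

theorem qm_supp {n q : ℕ} {X : Wd G × Cf G →₀ B}
    (hX : X ∈ Finsupp.supported B B (ES G n (q + 1))) :
    qm X ∈ Finsupp.supported B B (CS G n q) := by
  refine LC_mem hX _ fun x hx => ?_
  split_ifs with h
  · exact Submodule.zero_mem _
  · refine Finsupp.single_mem_supported B _ ?_
    obtain ⟨h1, h2, h3⟩ := hx
    have := wdeg_pos h
    exact ⟨valid_cons.2 ⟨h, h1⟩, by simpa using h2, by simp; omega⟩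

theorem dEb_supp (p : ℕ) (w : Wd G) (W : Cf G) (hW : Valid W) (X : Cf G →₀ B)
    (hX : X ∈ Finsupp.supported B B {Y | Valid Y ∧ wt Y = wt W ∧ cdeg Y + 1 = cdeg W}) :
    dEb s t p w W X ∈ Finsupp.supported B B {y : Wd G × Cf G | Valid y.2 ∧
      y.1.length + wt y.2 = w.length + wt W ∧ wdeg y.1 + cdeg y.2 + 1 = wdeg w + cdeg W} := by
  rw [dEb]
  refine Submodule.add_mem _ (Submodule.sub_mem _ ?_ ?_) (Submodule.smul_of_tower_mem _ _ ?_)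
  · refine mp_mem (wb_supp t p w) fun x hx => ?_
    obtain ⟨h1, h2⟩ := hx
    exact ⟨hW, by simp only; omega, by simp only; omega⟩
  · refine LC_mem (cop_supp s p w) _ fun x hx => ?_
    rw [cutT]
    split_ifs with h
    · exact Submodule.zero_mem _
    · refine Submodule.smul_of_tower_mem _ _ (Finsupp.single_mem_supported B _ ?_)
      obtain ⟨h1, h2⟩ := hx
      have := wdeg_pos h
      exact ⟨valid_cons.2 ⟨h, hW⟩, by simp only [wt_cons]; omega, by simp only [cdeg_cons]; omega⟩
  · refine mp_mem hX fun x hx => ?_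
    obtain ⟨h1, h2, h3⟩ := hx
    exact ⟨h1, by simp only; omega, by simp only; omega⟩

theorem dC_supp' (W : Cf G) (hW : Valid W) : ∀ p, dC s t p W ∈
    Finsupp.supported B B {Y | Valid Y ∧ wt Y = wt W ∧ cdeg Y + 1 = cdeg W} := by
  induction W with
  | nil => intro p; rw [dC]; exact Submodule.zero_mem _
  | cons w W ih =>
    intro p
    obtain ⟨h1, h2⟩ := valid_cons.1 hW
    have := dEb_supp (s := s) (t := t) p w W h2 _ (ih h2 (p + w.length))
    rw [dC]
    refine Submodule.neg_mem _ (LC_mem this _ fun x hx => ?_)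
    obtain ⟨h3, h4, h5⟩ := hx
    split_ifs with h
    · exact Submodule.zero_mem _
    · refine Finsupp.single_mem_supported B _ ?_
      have := wdeg_pos h
      have := wdeg_pos h1
      exact ⟨valid_cons.2 ⟨h, h3⟩, by simpa using h4, by simp; omega⟩

theorem dC_supp {W : Cf G} {n q : ℕ} (hW : W ∈ CS G n (q + 1)) (p : ℕ) :
    dC s t p W ∈ Finsupp.supported B B (CS G n q) := by
  obtain ⟨h1, h2, h3⟩ := hW
  refine Finsupp.supported_mono ?_ (dC_supp' W h1 p)
  rintro Y ⟨h4, h5, h6⟩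
  exact ⟨h4, by omega, by omega⟩

theorem dE_supp {x : Wd G × Cf G} {n q : ℕ} (hx : x ∈ ES G n (q + 1)) (p : ℕ) :
    dE s t p x ∈ Finsupp.supported B B (ES G n q) := by
  obtain ⟨h1, h2, h3⟩ := hx
  refine Finsupp.supported_mono ?_ (dEb_supp p x.1 x.2 h1 _ (dC_supp' x.2 h1 _))
  rintro Y ⟨h4, h5, h6⟩
  exact ⟨h4, by omega, by omega⟩

theorem dC_zero_deg {W : Cf G} {n : ℕ} (hW : W ∈ CS G n 0) (p : ℕ) : dC s t p W = 0 := by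
  obtain ⟨h1, h2, h3⟩ := hW
  have := dC_supp' (s := s) (t := t) W h1 p
  have e : {Y : Cf G | Valid Y ∧ wt Y = wt W ∧ cdeg Y + 1 = cdeg W} = ∅ := by
    ext Y; simp [h3]
  rw [e, Finsupp.supported_empty] at this
  simpa using this

theorem LC_supp {α β : Type} {S : Set α} {T : Set β} {f : α → (β →₀ B)} {X : α →₀ B}
    (hX : X ∈ Finsupp.supported B B S) (hf : ∀ a ∈ S, f a ∈ Finsupp.supported B B T) :
    LC f X ∈ Finsupp.supported B B T := LC_mem hX _ hf

/-! Naturality -/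
section nat
variable {B' : Type} [Ring B'] (φ : B →+* B') {s' : ℕ → B'} {t' : G → ℕ → B'}

/-- Change of coefficients. -/
def nm {α : Type} : (α →₀ B) →+ (α →₀ B') :=
  Finsupp.mapRange.addMonoidHom (φ : B →+ B')

theorem nm_single {α : Type} (a : α) (b : B) :
    nm φ (Finsupp.single a b) = Finsupp.single a (φ b) := by simp [nm]

theorem nm_apply {α : Type} (X : α →₀ B) (a : α) : nm φ X a = φ (X a) := by simp [nm]

theorem nm_smul {α : Type} (b : B) (X : α →₀ B) : nm φ (b • X) = φ b • nm φ X := by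
  ext a; simp [nm_apply]

theorem nm_LC {α β : Type} (f : α → (β →₀ B)) (X : α →₀ B) :
    nm φ (LC f X) = LC (fun a => nm φ (f a)) (nm φ X) := by
  induction X using Finsupp.induction_linear with
  | zero => simp
  | add f g hf hg => rw [map_add, map_add, hf, hg, map_add, map_add]
  | single a b => rw [LC_single, nm_single, LC_single, nm_smul]

theorem nm_mp {α β : Type} (f : α → β) (X : α →₀ B) :
    nm φ (mp f X) = mp f (nm φ X) := by
  rw [mp_eq_LC, nm_LC, mp_eq_LC]
  simp [nm_single]

theorem nm_supp {α : Type} {S : Set α} {X : α →₀ B} (h : X ∈ Finsupp.supported B B S) :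
    nm φ X ∈ Finsupp.supported B' B' S := by
  refine (Finsupp.mem_supported _ _).2 fun a ha => h ?_
  simp only [Finset.mem_coe, Finsupp.mem_support_iff, nm_apply] at ha ⊢
  intro h0; rw [h0] at ha; simp at ha

theorem map_cc {p p' q : ℕ} (h : ∀ i, i < q → φ (s (p + i)) = s' (p' + i)) :
    φ (cc s p q) = cc s' p' q := by
  induction q with
  | zero => simp
  | succ q ih => rw [cc_succ, cc_succ, map_mul, h q (by omega), ih fun i hi => h i (by omega)]

theorem nm_cop {p p' : ℕ} (w : Wd G) (h : ∀ i, i + 1 < w.length → φ (s (p + i)) = s' (p' + i)) :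
    nm φ (cop s p w) = cop s' p' w := by
  induction w with
  | nil => rw [cop, cop, nm_single]; simp
  | cons a w ih =>
    rw [cop, cop, nm_LC, ih fun i hi => h i (by simp; omega)]
    refine LC_congr (cop_supp s' p' w) fun x hx => ?_
    rw [copL, copL, map_add, map_zsmul, nm_single, nm_single, map_one, map_cc]
    intro i hi
    have := hx.1
    rw [add_assoc, add_assoc]
    exact h _ (by simp; omega)

theorem nm_lr (a : List G) : nm φ (lr a) = lr a := by
  induction a with
  | nil => simp [lr]
  | cons g a ih =>
    cases a with
    | nil => simp [lr, nm_single]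
    | cons h a => rw [lr, lr, map_sub, map_neg, nm_single, nm_mp, ih, map_one]

theorem nm_lb {j j' : ℕ} (a : List G) (h : ∀ g, φ (t g j) = t' g j') :
    nm φ (lb t j a) = lb t' j' a := by
  cases a with
  | nil => simp [lb]
  | cons g a => rw [lb, lb, map_add, nm_single, nm_lr, h]

theorem nm_wb {p p' : ℕ} (w : Wd G) (h : ∀ g i, i < w.length → φ (t g (p + i)) = t' g (p' + i)) :
    nm φ (wb t p w) = wb t' p' w := by
  induction w with
  | nil => simp [wb]
  | cons a w ih =>
    rw [wb, wb, map_add, map_zsmul, nm_mp, nm_mp, ih fun g i hi => h g i (by simp; omega),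
      nm_lb φ a fun g => h g _ (by simp)]

theorem nm_qm (X : Wd G × Cf G →₀ B) : nm φ (qm X) = qm (nm φ X) := by
  rw [qm, nm_LC, qm]
  congr 1
  refine congrArg _ ?_
  funext x
  split_ifs
  · simp
  · simp [nm_single]

theorem nm_dEb {p p' : ℕ} (w : Wd G) (W : Cf G) (X : Cf G →₀ B)
    (hs : ∀ i, i + 1 < w.length → φ (s (p + i)) = s' (p' + i))
    (ht : ∀ g i, i < w.length → φ (t g (p + i)) = t' g (p' + i)) :
    nm φ (dEb s t p w W X) = dEb s' t' p' w W (nm φ X) := by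
  rw [dEb, dEb, map_add, map_sub, map_zsmul, nm_mp, nm_mp, nm_wb φ w ht, nm_LC, nm_cop φ w hs]
  congr 3
  refine congrArg _ ?_
  funext x
  rw [cutT, cutT]
  split_ifs
  · simp
  · simp [nm_single]

theorem nm_dC (W : Cf G) : ∀ {p p' : ℕ},
    (∀ i, i + 1 < wt W → φ (s (p + i)) = s' (p' + i)) →
    (∀ g i, i < wt W → φ (t g (p + i)) = t' g (p' + i)) →
    nm φ (dC s t p W) = dC s' t' p' W := by
  induction W with
  | nil => intro p p' _ _; simp [dC]
  | cons w W ih =>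
    intro p p' hs ht
    rw [dC, dC, map_neg, nm_qm, nm_dEb φ w W _ (fun i hi => hs i (by simp; omega))
      (fun g i hi => ht g i (by simp; omega)), ih]
    · intro i hi
      rw [add_assoc, add_assoc]; exact hs _ (by simp; omega)
    · intro g i hi
      rw [add_assoc, add_assoc]; exact ht _ _ (by simp; omega)

end nat

/-- Adding a trivial strand commutes with the differential. -/
theorem dC_stab (p : ℕ) (W : Cf G) :
    dC s t p ([[]] :: W) = mp (fun Y => [[]] :: Y) (dC s t (p + 1) W) := by
  rw [dC, dEb]
  simp only [wb, cop, lb, map_zero, smul_zero, add_zero, LC_single, one_smul, copL, map_add,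
    map_zsmul, cutT, List.length_nil, List.length_cons, zero_add]
  simp [qm, ldeg, LC_mp]
  exact (mp_eq_LC (fun Y => [[]] :: Y) _).symm

end BR
end

noncomputable section

namespace BR

/-! Homological stability of the reduced complex. -/

section stab
variable {G : Type} [Group G] {k : Type} [CommRing k]

open scoped Classical

/-- Even initial run of trivial letters. -/
def ev : Wd G → Prop
  | [] => True
  | a :: w => a = [] → ¬ ev w

def lev (w : Wd G) : ℕ := if ev w then wdeg w else wdeg w - 1

theorem lev_ev {w : Wd G} (h : ev w) : lev w = wdeg w := by simp [lev, h]
theorem ev_sigma {w : Wd G} : ev ([] :: w) ↔ ¬ ev w := by simp [ev]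
theorem lev_sigma {w : Wd G} (h : ev w) : lev ([] :: w) = wdeg w := by
  have : ¬ ev ([] :: w) := by simpa [ev] using h
  simp [lev, this, ldeg]
theorem lev_le (w : Wd G) : lev w ≤ wdeg w := by
  unfold lev; split_ifs <;> omega
theorem not_ev {w : Wd G} (h : ¬ ev w) : ∃ w', w = [] :: w' ∧ ev w' := by
  cases w with
  | nil => simp [ev] at h
  | cons a w =>
    simp only [ev] at h
    push Not at h
    exact ⟨w, by rw [h.1], h.2⟩

theorem wdeg_ge (w : Wd G) : w.length ≤ wdeg w := by
  induction w with
  | nil => simp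
  | cons a w ih => simp [ldeg]; omega

theorem ev_bound {w : Wd G} (h : ev w) (hw : w ≠ []) : 2 + w.length ≤ 2 * wdeg w := by
  match w with
  | [] => exact absurd rfl hw
  | [a] =>
    have : a ≠ [] := by
      rintro rfl; simp [ev] at h
    cases a with
    | nil => exact absurd rfl this
    | cons g a => simp [ldeg]; omega
  | a :: b :: w =>
    have := wdeg_ge (a :: b :: w)
    simp only [List.length_cons] at *
    omega

theorem ev_bound' {w : Wd G} (h : ev w) (hw : w ≠ []) (h2 : 2 * wdeg w ≤ 2 + w.length) :
    w = [[], []] := by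
  match w with
  | [] => exact absurd rfl hw
  | [a] =>
    have : a ≠ [] := by
      rintro rfl; simp [ev] at h
    cases a with
    | nil => exact absurd rfl this
    | cons g a => simp [ldeg] at h2; omega
  | a :: b :: w =>
    have := wdeg_ge w
    simp only [List.length_cons, wdeg_cons, ldeg] at *
    have h3 : w.length = 0 := by omega
    have h4 : a.length = 0 := by omega
    have h5 : b.length = 0 := by omega
    rw [List.length_eq_zero_iff] at h3 h4 h5
    rw [h3, h4, h5]

variable (G k) in
abbrev o1 : ℕ → k := fun _ => 1
variable (G k) in
abbrev o2 : G → ℕ → k := fun _ _ => 1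

theorem o_rel : BTRel (o1 k) (o2 G k) := by
  constructor <;> first | (constructor <;> simp [o1, tri]) | simp [o1, o2]

/-- reduced differentials -/
def dc (W : Cf G) : Cf G →₀ k := dC (o1 k) (o2 G k) 0 W
def de (x : Wd G × Cf G) : Wd G × Cf G →₀ k := dE (o1 k) (o2 G k) 0 x

theorem dc_off (p : ℕ) (W : Cf G) : dC (o1 k) (o2 G k) p W = dc W := by
  have := nm_dC (RingHom.id k) (s := o1 k) (t := o2 G k) (s' := o1 k) (t' := o2 G k) W
    (p := p) (p' := 0) (by simp) (by simp)
  rw [dc, ← this]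
  ext x; simp [nm_apply]

theorem de_eq (w : Wd G) (W : Cf G) : (de (w, W) : _ →₀ k) =
    mp (fun x => (x, W)) (wb (o2 G k) 0 w) - LC (cutT (B := k) W) (cop (o1 k) 0 w)
      + sg (wdeg w) • mp (fun y => (w, y)) (dc W) := by
  rw [de, dE, dEb, dc_off]

theorem cc_o1 (p q : ℕ) : cc (o1 k) p q = 1 := by
  induction q with
  | zero => simp
  | succ q ih => rw [cc_succ, ih]; simp

theorem lb_o {a : List G} (j : ℕ) : lb (o2 G k) j a ∈ Finsupp.supported k k
    {x : List G | x ≠ [] ∧ a ≠ []} := by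
  match a with
  | [] => exact Submodule.zero_mem _
  | [g] => simp [lb, lr]
  | g :: h :: a =>
    refine Finsupp.supported_mono ?_ (lb_supp (o2 G k) j (g :: h :: a))
    intro x hx
    simp only [Set.mem_setOf_eq, List.length_cons] at *
    refine ⟨?_, by simp⟩
    rintro rfl
    simp at hx

theorem wb_o (p : ℕ) (w : Wd G) : wb (o2 G k) p w ∈ Finsupp.supported k k
    {x : Wd G | ev x ↔ ev w} := by
  induction w with
  | nil => exact Submodule.zero_mem _
  | cons a w ih =>
    rw [wb]
    refine Submodule.add_mem _ (mp_mem ih fun x hx => ?_)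
      (Submodule.smul_of_tower_mem _ _ (mp_mem (lb_o _) fun x hx => ?_))
    · simp only [Set.mem_setOf_eq, ev] at *; rw [hx]
    · simp only [Set.mem_setOf_eq, ev] at *; simp [hx.1, hx.2]

/-- the coproduct, right end. -/
theorem cop_right (w : Wd G) : cop (o1 k) 0 w - bb (w, []) ∈ Finsupp.supported k k
    {x : Wd G × Wd G | x.2 ≠ [] ∧ wdeg x.1 + wdeg x.2 = wdeg w} := by
  induction w with
  | nil => simp [cop]
  | cons a w ih =>
    have : cop (o1 k) 0 (a :: w) - bb (a :: w, []) =
        LC (copL (o1 k) 0 a) (cop (o1 k) 0 w - bb (w, [])) + bb (w, [a]) := by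
      rw [map_sub, LC_single, copL, cop]
      simp; abel
    rw [this]
    refine Submodule.add_mem _ (LC_mem ih _ fun x hx => ?_) (Finsupp.single_mem_supported k _ ?_)
    · obtain ⟨h1, h2⟩ := hx
      refine Submodule.add_mem _ (Submodule.smul_of_tower_mem _ _ ?_) ?_
      · refine Finsupp.single_mem_supported k _ ⟨h1, by simp only [wdeg_cons]; omega⟩
      · refine Finsupp.single_mem_supported k _ ⟨by simp, by simp only [wdeg_cons]; omega⟩
    · exact ⟨by simp, by simp; omega⟩

theorem cop_left (w : Wd G) : cop (o1 k) 0 w - bb ([], w) ∈ Finsupp.supported k k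
    {x : Wd G × Wd G | x.1 ≠ []} := by
  induction w with
  | nil => simp [cop]
  | cons a w ih =>
    have : cop (o1 k) 0 (a :: w) - bb ([], a :: w) =
        LC (copL (o1 k) 0 a) (cop (o1 k) 0 w - bb ([], w)) +
          sg (ldeg a * wdeg w) • Finsupp.single ([a], w) (cc (o1 k) 0 w.length) := by
      rw [map_sub, LC_single, copL, cop, one_smul]
      simp only [List.length_nil, add_zero]; abel
    rw [this]
    refine Submodule.add_mem _ (LC_mem ih _ fun x hx => ?_)
      (Submodule.smul_of_tower_mem _ _ (Finsupp.single_mem_supported k _ (by simp)))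
    refine Submodule.add_mem _ (Submodule.smul_of_tower_mem _ _ ?_) ?_
    · exact Finsupp.single_mem_supported k _ (by simp)
    · exact Finsupp.single_mem_supported k _ hx

/-- removal of a trivial letter. -/
def dsg : (Wd G × Wd G →₀ k) →ₗ[k] (Wd G →₀ k) := LC fun x => if x.2 = [[]] then bb x.1 else 0

theorem dsg_cons (a : List G) (w : Wd G) : dsg (cop (o1 k) 0 (a :: w)) =
    sg (ldeg a) • mp (fun u => a :: u) (dsg (cop (o1 k) 0 w)) + if a = [] then bb w else 0 := by
  have key : ∀ X : Wd G × Wd G →₀ k, dsg (LC (copL (o1 k) 0 a) X) =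
      sg (ldeg a) • mp (fun u => a :: u) (dsg X)
        + LC (fun x : Wd G × Wd G => if a = [] ∧ x.2 = [] then bb x.1 else 0) X := by
    intro X
    induction X using Finsupp.induction_linear with
    | zero => simp
    | add f g hf hg => simp only [map_add, hf, hg, smul_add]; abel
    | single x b =>
      simp only [LC_single, map_smul, copL, map_add, map_zsmul, dsg, cc_o1]
      rw [smul_comm (sg (ldeg a)) b, ← smul_add]
      congr 2
      · by_cases h : x.2 = [[]]
        · simp [h, ldeg]
        · simp [h]
      · by_cases h : a = [] <;> by_cases h' : x.2 = [] <;> simp [h, h']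
  rw [cop, key]
  congr 1
  have h2 := cop_right (k := k) w
  have : LC (fun x : Wd G × Wd G => if a = [] ∧ x.2 = [] then (bb x.1 : Wd G →₀ k) else 0)
      (cop (o1 k) 0 w - bb (w, [])) = 0 := by
    rw [LC_congr h2 (g := fun _ => 0), LC_zero]
    intro x hx
    simp [hx.1]
  rw [map_sub, sub_eq_zero] at this
  rw [this]
  simp

theorem dsg_ev (w : Wd G) : (ev w → dsg (cop (o1 k) 0 w) ∈ Finsupp.supported k k {x : Wd G | ev x}) ∧
    (¬ ev w → dsg (cop (o1 k) 0 w) - bb w.tail ∈ Finsupp.supported k k {x : Wd G | ¬ ev x}) := by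
  induction w with
  | nil => simp [ev, cop, dsg]
  | cons a w ih =>
    rw [dsg_cons]
    by_cases ha : a = []
    · subst ha
      rw [ev_sigma]
      constructor
      · intro h
        obtain ⟨w', rfl, h'⟩ := not_ev h
        have := ih.2 h
        have e : sg (ldeg ([] : List G)) • mp (fun u => [] :: u) (dsg (cop (o1 k) 0 ([] :: w'))) +
            (if ([] : List G) = [] then bb ([] :: w') else 0) =
            - mp (fun u => [] :: u) (dsg (cop (o1 k) 0 ([] :: w')) - bb w') := by
          rw [map_sub, mp_single]; simp [ldeg]; abel
        rw [e]
        refine Submodule.neg_mem _ (mp_mem this fun x hx => ?_)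
        exact ev_sigma.2 hx
      · intro h
        rw [not_not] at h
        simp only [if_true, List.tail_cons, add_sub_cancel_right]
        refine Submodule.smul_of_tower_mem _ _ (mp_mem (ih.1 h) fun x hx => ?_)
        simpa [ev_sigma] using hx
    · simp only [ha, if_false, add_zero]
      have hev : ∀ x, ev (a :: x) := fun x => by simp [ev, ha]
      refine ⟨fun _ => ?_, fun h => absurd (hev _) h⟩
      refine Submodule.smul_of_tower_mem _ _ ?_
      have hu : dsg (cop (o1 k) 0 w) ∈ Finsupp.supported k k Set.univ := by simp
      exact mp_mem hu fun x _ => hev x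

/-- inclusion of configurations at a base word -/
abbrev iw (w : Wd G) : (Cf G →₀ k) →ₗ[k] (Wd G × Cf G →₀ k) := mp (fun y => (w, y))

abbrev LT (G k : Type) [Group G] [CommRing k] (m : ℕ) : Submodule k (Wd G × Cf G →₀ k) :=
  Finsupp.supported k k {y : Wd G × Cf G | lev y.1 < m}

theorem cut_split (W : Cf G) (w : Wd G) : LC (cutT (B := k) W) (cop (o1 k) 0 w) =
    LC (cutT (B := k) W) (cop (o1 k) 0 w - bb (w, [])) := by
  rw [map_sub, LC_single, cutT]; simp

theorem de_ev {w : Wd G} (h : ev w) (W : Cf G) :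
    (de (w, W) : _ →₀ k) - sg (wdeg w) • iw w (dc W) ∈ LT G k (wdeg w) := by
  rw [de_eq, add_sub_cancel_right, cut_split]
  refine Submodule.sub_mem _ (mp_mem (wb_supp _ _ _) fun x hx => ?_) (LC_mem (cop_right w) _ fun x hx => ?_)
  · have := lev_le x
    obtain ⟨_, h2⟩ := hx
    simp only [Set.mem_setOf_eq]; omega
  · obtain ⟨h1, h2⟩ := hx
    rw [cutT, if_neg h1]
    refine Submodule.smul_of_tower_mem _ _ (Finsupp.single_mem_supported k _ ?_)
    have := lev_le x.1
    have := wdeg_pos h1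
    simp only [Set.mem_setOf_eq]; omega

theorem wdeg_one {w : Wd G} (h : wdeg w = 1) : w = [[]] := by
  match w with
  | [] => simp at h
  | [a] =>
    simp [ldeg] at h; rw [h]
  | a :: b :: w =>
    simp [ldeg] at h; omega

theorem de_odd {w : Wd G} (h : ev w) (W : Cf G) :
    (de ([] :: w, W) : _ →₀ k) + sg (wdeg w) • (iw w (bb ([[]] :: W)) + iw ([] :: w) (dc W))
      ∈ LT G k (wdeg w) := by
  have e1 : wb (o2 G k) 0 ([] :: w) = mp (fun x => [] :: x) (wb (o2 G k) 0 w) := by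
    simp [wb, lb]
  set Q := cop (o1 k) 0 w - bb (w, []) with hQ
  have e2 : LC (cutT (B := k) W) (cop (o1 k) 0 ([] :: w)) = sg (wdeg w) • iw w (bb ([[]] :: W))
      + LC (cutT (B := k) W) (LC (copL (o1 k) 0 []) Q) := by
    have : cop (o1 k) 0 w = bb (w, []) + Q := by rw [hQ]; abel
    rw [cop, this, map_add, map_add, LC_single, copL]
    simp [cutT]
  have e3 : LC (cutT (B := k) W) (LC (copL (o1 k) 0 []) Q) =
      LC (fun x : Wd G × Wd G => sg (wdeg x.1) • bb (x.1, ([] :: x.2) :: W)) Q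
      - LC (fun x : Wd G × Wd G => if x.2 = [[]] then 0 else
          sg (wdeg x.2 + wdeg x.1) • bb ([] :: x.1, x.2 :: W)) Q
      - LC (fun x : Wd G × Wd G => if x.2 = [[]] then
          sg (wdeg x.2 + wdeg x.1) • bb ([] :: x.1, x.2 :: W) else 0) Q := by
    rw [LC_LC, ← LC_sub, ← LC_sub]
    refine LC_congr (cop_right w) fun x hx => ?_
    simp only [copL, map_add, map_zsmul, cc_o1, LC_single, cutT, hx.1, one_smul, if_false,
      List.cons_ne_nil, wdeg_cons, ldeg, List.length_nil, zero_add, one_mul, smul_smul, ← sg_add]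
    split_ifs <;>
    · rw [show wdeg x.2 + (1 + wdeg x.1) = wdeg x.2 + wdeg x.1 + 1 by ring, sg_succ]
      simp only [neg_smul, sub_zero, zero_sub]; abel
  have e4 : LC (fun x : Wd G × Wd G => if x.2 = [[]] then
          sg (wdeg x.2 + wdeg x.1) • bb ([] :: x.1, x.2 :: W) else 0) Q =
      sg (wdeg w) • mp (fun u => ([] :: u, [[]] :: W)) (dsg (cop (o1 k) 0 w)) := by
    have h1 : dsg (cop (o1 k) 0 w) = dsg Q := by
      rw [hQ, map_sub]; simp [dsg]
    rw [h1, dsg, map_LC, ← LC_zsmul]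
    refine LC_congr (cop_right w) fun x hx => ?_
    split_ifs with h2
    · rw [mp_single, h2]
      have := hx.2
      rw [h2] at this
      rw [← this, add_comm]
    · simp
  rw [de_eq, e1, e2, e3, e4, mp_mp]
  rw [show wdeg ([] :: w) = wdeg w + 1 by simp [ldeg]; ring, sg_succ]
  have : ∀ a b c d e f : Wd G × Cf G →₀ k, a - (sg (wdeg w) • b + (c - d - e)) + (- sg (wdeg w)) • f
      + sg (wdeg w) • (b + f) = a - c + d + e := by
    intros; rw [smul_add, neg_smul]; abel
  rw [this]
  refine Submodule.add_mem _ (Submodule.add_mem _ (Submodule.sub_mem _ ?_ ?_) ?_) ?_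
  · have h3 : wb (o2 G k) 0 w ∈ Finsupp.supported k k ({x : Wd G | ev x ↔ ev w} ∩
        {x | x.length = w.length ∧ wdeg x + 1 = wdeg w}) := by
      rw [Finsupp.supported_inter]; exact ⟨wb_o _ _, wb_supp _ _ _⟩
    refine mp_mem h3 fun x hx => ?_
    obtain ⟨h4, _, h5⟩ := hx
    simp only [Set.mem_setOf_eq]
    rw [lev_sigma (h4.2 h)]; omega
  · refine LC_mem (cop_right w) _ fun x hx => ?_
    obtain ⟨h1, h2⟩ := hx
    refine Submodule.smul_of_tower_mem _ _ (Finsupp.single_mem_supported k _ ?_)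
    have := lev_le x.1
    have := wdeg_pos h1
    simp only [Set.mem_setOf_eq]; omega
  · refine LC_mem (cop_right w) _ fun x hx => ?_
    obtain ⟨h1, h2⟩ := hx
    split_ifs with h3
    · exact Submodule.zero_mem _
    · refine Submodule.smul_of_tower_mem _ _ (Finsupp.single_mem_supported k _ ?_)
      have h4 := lev_le ([] :: x.1)
      have := wdeg_pos h1
      have : wdeg x.2 ≠ 1 := fun h => h3 (wdeg_one h)
      simp only [wdeg_cons, ldeg, List.length_nil] at h4
      simp only [Set.mem_setOf_eq]; omega
  · refine Submodule.smul_of_tower_mem _ _ ?_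
    have h6 : dsg (cop (o1 k) 0 w) ∈ Finsupp.supported k k {x : Wd G | wdeg x + 1 = wdeg w} := by
      refine LC_mem (cop_supp _ _ _) _ fun x hx => ?_
      split_ifs with h7
      · refine Finsupp.single_mem_supported k _ ?_
        have := hx.2
        rw [h7] at this
        simpa [ldeg] using this
      · exact Submodule.zero_mem _
    have h3 : dsg (cop (o1 k) 0 w) ∈ Finsupp.supported k k ({x : Wd G | ev x} ∩
        {x : Wd G | wdeg x + 1 = wdeg w}) := by
      rw [Finsupp.supported_inter]; exact ⟨(dsg_ev w).1 h, h6⟩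
    refine mp_mem h3 fun x hx => ?_
    obtain ⟨h4, h5⟩ := hx
    simp only [Set.mem_setOf_eq] at *
    rw [lev_sigma h4]; omega

end stab
end BR
end

noncomputable section

namespace BR

section stab2
variable {G : Type} [Group G] {k : Type} [CommRing k]
open scoped Classical

abbrev deL : (Wd G × Cf G →₀ k) →ₗ[k] (Wd G × Cf G →₀ k) := LC (de (k := k))
abbrev dcL : (Cf G →₀ k) →ₗ[k] (Cf G →₀ k) := LC (dc (k := k))

/-! Acyclicity of the marked complex. -/

theorem de_base {w : Wd G} (hw : w ≠ []) (W : Cf G) :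
    (de (w, W) : _ →₀ k) + bb ([], w :: W) ∈ Finsupp.supported k k {x : Wd G × Cf G | x.1 ≠ []} := by
  have : LC (cutT (B := k) W) (cop (o1 k) 0 w) =
      LC (cutT (B := k) W) (cop (o1 k) 0 w - bb ([], w)) + bb ([], w :: W) := by
    rw [map_sub, LC_single, cutT]; simp [hw]
  rw [de_eq, this]
  have e : ∀ a b c d : Wd G × Cf G →₀ k, a - (b + c) + d + c = a - b + d := by intros; abel
  rw [e]
  refine Submodule.add_mem _ (Submodule.sub_mem _ (mp_mem (wb_supp _ _ _) fun x hx => ?_)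
    (LC_mem (cop_left w) _ fun x hx => ?_)) (Submodule.smul_of_tower_mem _ _ ?_)
  · rintro rfl
    exact hw (List.length_eq_zero_iff.1 hx.1.symm)
  · rw [cutT]; split_ifs with h
    · exact Submodule.zero_mem _
    · exact Submodule.smul_of_tower_mem _ _ (Finsupp.single_mem_supported k _ hx)
  · have hu : (dc W : Cf G →₀ k) ∈ Finsupp.supported k k Set.univ := by simp
    exact mp_mem hu fun x _ => hw

def hEb : Wd G × Cf G → (Wd G × Cf G →₀ k)
  | ([], v :: W) => - bb (v, W)
  | _ => 0

abbrev hEL : (Wd G × Cf G →₀ k) →ₗ[k] (Wd G × Cf G →₀ k) := LC (hEb (k := k))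

theorem hEb_ne {x : Wd G × Cf G} (h : x.1 ≠ []) : (hEb x : _ →₀ k) = 0 := by
  obtain ⟨w, W⟩ := x
  cases w with
  | nil => exact absurd rfl h
  | cons a w => rfl

theorem hE_zero {Y : Wd G × Cf G →₀ k} (h : Y ∈ Finsupp.supported k k {x : Wd G × Cf G | x.1 ≠ []}) :
    hEL Y = 0 := by
  rw [LC_congr h (g := fun _ => 0), LC_zero]
  intro x hx; exact hEb_ne hx

def rs : (Wd G × Cf G →₀ k) →ₗ[k] (Wd G × Cf G →₀ k) := LC fun x => if x.1 = [] then 0 else bb x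

theorem hE_qm (Y : Wd G × Cf G →₀ k) : hEL (iw [] (qm Y)) = - rs Y := by
  rw [qm, map_LC, map_LC, rs, ← LC_neg]
  congr 2
  funext x
  split_ifs
  · simp
  · simp [hEb]

theorem de_nil (W : Cf G) : (de ([], W) : _ →₀ k) = iw [] (dc W) := by
  rw [de_eq]; simp [wb, cop, cutT]

theorem hE_contr {n q : ℕ} (hn : 1 ≤ n) {x : Wd G × Cf G} (hx : x ∈ ES G n q) :
    deL (hEb x : _ →₀ k) + hEL (de x : _ →₀ k) = bb x := by
  obtain ⟨w, W⟩ := x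
  obtain ⟨h1, h2, h3⟩ := hx
  by_cases hw : w = []
  · subst hw
    cases W with
    | nil => simp at h2; omega
    | cons v W =>
      have hv := (valid_cons.1 h1).1
      have hb := de_base (k := k) hv W
      rw [de_nil]
      have e1 : (dc (v :: W) : Cf G →₀ k) = - qm (de (v, W)) := by
        rw [dc, dC_cons]; rfl
      rw [e1, map_neg, map_neg, hE_qm, neg_neg, hEb, map_neg, LC_single, one_smul]
      have e2 : rs (de (v, W) + bb ([], v :: W)) = (de (v, W) + bb ([], v :: W) : _ →₀ k) := by
        conv_rhs => rw [← LC_id (de (v, W) + bb ([], v :: W) : _ →₀ k)]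
        rw [rs]
        refine LC_congr hb fun x hx => ?_
        rw [if_neg hx]
      have e3 : rs (bb ([], v :: W) : Wd G × Cf G →₀ k) = 0 := by simp [rs]
      rw [map_add, e3, add_zero] at e2
      rw [e2]; abel
  · have hb := de_base (k := k) hw W
    have := hE_zero hb
    rw [map_add, LC_single, one_smul, hEb] at this
    rw [hEb_ne (show (w, W).1 ≠ [] from hw), map_zero, zero_add]
    rw [add_neg_eq_zero] at this
    exact this

theorem hE_supp {n q : ℕ} {x : Wd G × Cf G} (hx : x ∈ ES G n q) :
    (hEb x : _ →₀ k) ∈ Finsupp.supported k k (ES G n (q + 1)) := by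
  obtain ⟨w, W⟩ := x
  obtain ⟨h1, h2, h3⟩ := hx
  match w, W with
  | [], [] => exact Submodule.zero_mem _
  | _ :: _, _ => exact Submodule.zero_mem _
  | [], v :: W =>
    refine Submodule.neg_mem _ (Finsupp.single_mem_supported k _ ?_)
    have := valid_cons.1 h1
    have := wdeg_pos this.1
    simp only [List.length_nil, wt_cons, wdeg_nil, cdeg_cons] at h2 h3
    exact ⟨(valid_cons.1 h1).2, by simp only; omega, by simp only; omega⟩

theorem E_acyclic {n q : ℕ} (hn : 1 ≤ n) {z : Wd G × Cf G →₀ k}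
    (hz : z ∈ Finsupp.supported k k (ES G n q)) (h0 : deL z = 0) :
    ∃ y ∈ Finsupp.supported k k (ES G n (q + 1)), deL y = z := by
  refine ⟨hEL z, LC_supp hz fun x hx => hE_supp hx, ?_⟩
  have : LC (fun x => deL (hEb x : _ →₀ k) + hEL (de x : _ →₀ k)) z = z := by
    conv_rhs => rw [← LC_id z]
    exact LC_congr hz fun x hx => hE_contr hn hx
  rw [LC_add, ← LC_LC, ← LC_LC, h0, map_zero, add_zero] at this
  exact this

/-! Components. -/

def pr (w : Wd G) : (Wd G × Cf G →₀ k) →ₗ[k] (Cf G →₀ k) :=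
  LC fun x => if x.1 = w then bb x.2 else 0

theorem pr_iw (w w' : Wd G) (A : Cf G →₀ k) : pr w (iw w' A) = if w' = w then A else 0 := by
  rw [pr, iw, LC_mp]
  split_ifs with h
  · exact LC_id A
  · exact LC_zero A

theorem pr_apply (w : Wd G) (y : Wd G × Cf G →₀ k) (X : Cf G) : pr w y X = y (w, X) := by
  induction y using Finsupp.induction_linear with
  | zero => simp
  | add f g hf hg => simp [hf, hg]
  | single x b =>
    obtain ⟨u, Y⟩ := x
    rw [pr, LC_single]
    by_cases h : u = w
    · subst h
      by_cases h' : Y = X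
      · subst h'; simp
      · simp [Finsupp.single_apply, h']
    · simp [Finsupp.single_apply, h]

theorem pr_zero {w : Wd G} {m : ℕ} {Y : Wd G × Cf G →₀ k} (hY : Y ∈ LT G k m) (h : m ≤ lev w) :
    pr w Y = 0 := by
  rw [pr, LC_congr hY (g := fun _ => 0), LC_zero]
  intro x hx
  rw [if_neg]
  rintro rfl
  exact absurd hx (by simpa using h)

theorem pr_supp {w : Wd G} {n q : ℕ} {Y : Wd G × Cf G →₀ k}
    (hY : Y ∈ Finsupp.supported k k (ES G n q)) : pr w Y ∈ Finsupp.supported k k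
      {X | Valid X ∧ w.length + wt X = n ∧ wdeg w + cdeg X = q} := by
  refine LC_mem hY _ fun x hx => ?_
  split_ifs with h
  · subst h
    exact Finsupp.single_mem_supported k _ hx
  · exact Submodule.zero_mem _

abbrev sig : (Cf G →₀ k) →ₗ[k] (Cf G →₀ k) := mp (fun Y => [[]] :: Y)

theorem pr_de {m : ℕ} {y : Wd G × Cf G →₀ k} (hy : y ∈ LT G k (m + 1)) {w : Wd G} (hw : ev w)
    (hm : wdeg w = m) : pr w (deL y) = sg m • (dcL (pr w y) - sig (pr ([] :: w) y)) ∧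
      pr ([] :: w) (deL y) = - sg m • dcL (pr ([] :: w) y) := by
  have hl : lev w = m := by rw [lev_ev hw, hm]
  have hl' : lev ([] :: w) = m := by rw [lev_sigma hw, hm]
  have hne : ∀ x : Wd G, ev x → x ≠ [] :: w := by
    rintro x hx rfl
    exact (ev_sigma.1 hx) hw
  have main : ∀ x : Wd G × Cf G, lev x.1 < m + 1 →
      pr w (de x : _ →₀ k) = sg m • (dcL (pr w (bb x)) - sig (pr ([] :: w) (bb x))) ∧
      pr ([] :: w) (de x : _ →₀ k) = - sg m • dcL (pr ([] :: w) (bb x)) := by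
    rintro ⟨x, X⟩ hx
    have bbx : ∀ (x : Wd G) (X : Cf G), (bb (x, X) : _ →₀ k) = iw x (bb X) := by
      intro x X; simp
    by_cases hxe : ev x
    · simp only [lev_ev hxe] at hx
      have h1 := de_ev (k := k) hxe X
      have h2 := pr_zero h1 (w := w) (by omega)
      have h3 := pr_zero h1 (w := [] :: w) (by omega)
      rw [map_sub, sub_eq_zero, map_zsmul, pr_iw] at h2 h3
      rw [h2, h3, bbx, pr_iw, pr_iw, if_neg (hne x hxe)]
      by_cases hxw : x = w
      · subst hxw; simp [hm]
      · simp [hxw, hne x hxe]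
    · obtain ⟨x, rfl, hx'⟩ := not_ev hxe
      simp only [lev_sigma hx'] at hx
      have h1 := de_odd (k := k) hx' X
      have h2 := pr_zero h1 (w := w) (by omega)
      have h3 := pr_zero h1 (w := [] :: w) (by omega)
      have h4 : [] :: x ≠ w := fun h => hxe (h ▸ hw)
      rw [map_add, map_zsmul, map_add, pr_iw, pr_iw, ← eq_neg_iff_add_eq_zero] at h2 h3
      rw [h2, h3, bbx, pr_iw, pr_iw, if_neg h4, if_neg (hne x hx')]
      by_cases hxw : x = w
      · subst hxw; simp [hm]
      · have : ([] : List G) :: x ≠ [] :: w := by simpa using hxw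
        simp [hxw, h4, hne x hx']
  constructor
  · have e : sg m • (dcL (pr w y) - sig (pr ([] :: w) y)) =
        LC (fun x => sg m • (dcL (pr w (bb x : _ →₀ k)) - sig (pr ([] :: w) (bb x : _ →₀ k)))) y := by
      rw [LC_zsmul, LC_sub, ← map_LC, ← map_LC, ← map_LC, ← map_LC, LC_id]
    rw [e, map_LC]
    exact LC_congr hy fun x hx => (main x hx).1
  · have e : - sg m • (dcL (pr ([] :: w) y)) =
        LC (fun x => - sg m • (dcL (pr ([] :: w) (bb x : _ →₀ k)))) y := by
      rw [LC_zsmul, ← map_LC, ← map_LC, LC_id]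
    rw [e, map_LC]
    exact LC_congr hy fun x hx => (main x hx).2

theorem LT_mono {m m' : ℕ} (h : m ≤ m') : LT G k m ≤ LT G k m' :=
  Finsupp.supported_mono fun x hx => lt_of_lt_of_le hx h

theorem iw_LT {w : Wd G} {m : ℕ} (h : lev w < m) (A : Cf G →₀ k) : iw w A ∈ LT G k m := by
  have hu : A ∈ Finsupp.supported k k Set.univ := by simp
  exact mp_mem hu fun x _ => h

theorem de_LT {m : ℕ} {y : Wd G × Cf G →₀ k} (hy : y ∈ LT G k (m + 1)) :
    deL y ∈ LT G k (m + 1) := by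
  refine LC_mem hy _ fun x hx => ?_
  obtain ⟨x, X⟩ := x
  simp only [Set.mem_setOf_eq] at hx
  by_cases hxe : ev x
  · have h1 := de_ev (k := k) hxe X
    have h2 := Submodule.add_mem _ (LT_mono (m' := m + 1) (by rw [← lev_ev hxe]; omega) h1)
      (Submodule.smul_of_tower_mem (LT G k (m + 1)) (sg (wdeg x)) (iw_LT hx (dc X)))
    simpa using h2
  · obtain ⟨x, rfl, hx'⟩ := not_ev hxe
    have hx2 := hx
    rw [lev_sigma hx'] at hx2
    have h1 := de_odd (k := k) hx' X
    have h2 := Submodule.sub_mem _ (LT_mono (m' := m + 1) (by omega) h1)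
      (Submodule.smul_of_tower_mem (LT G k (m + 1)) (sg (wdeg x)) (Submodule.add_mem _
        (iw_LT (w := x) (by rw [lev_ev hx']; omega) (bb ([[]] :: X))) (iw_LT hx (dc X))))
    simpa using h2


/-! The main induction. -/

def tau (p : ℕ) : Cf G := List.replicate p [[], []]

variable (G k) in
def Rc (n p : ℕ) : Submodule k (Cf G →₀ k) :=
  Submodule.span k {x | x = bb (tau p) ∧ 2 * p = n}
variable (G k) in
def Re (n p : ℕ) : Submodule k (Wd G × Cf G →₀ k) :=
  Submodule.span k {x | x = bb ([], tau p) ∧ 2 * p = n}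

variable (G k) in
abbrev BS (n p : ℕ) : Submodule k (Cf G →₀ k) :=
  Finsupp.supported k k {X | Valid X ∧ wt X + 1 = n ∧ cdeg X + 1 = p}

variable (G k) in
def Tst (n p : ℕ) : Prop := ∀ A ∈ Finsupp.supported k k (CS G n p), ∀ B ∈ BS G k n p,
  dcL A = sig B → dcL B = 0 → ∃ A' ∈ Finsupp.supported k k (CS G n (p + 1)), ∃ B' ∈ BS G k n (p + 1),
    A - (dcL A' - sig B') ∈ Rc G k n p ∧ B = - dcL B'

theorem de_ss (W : Cf G) : (de ([[], []], W) : _ →₀ k) = - bb ([], [[], []] :: W)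
    + iw [[], []] (dc W) := by
  rw [de_eq]
  simp [wb, lb, cop, copL, cutT, ldeg, cc_o1, sg]

theorem dc_tau (p : ℕ) : (dc (tau p) : Cf G →₀ k) = 0 := by
  induction p with
  | zero => simp [tau, dc, dC]
  | succ p ih =>
    have e1 : (dc ([[], []] :: tau p) : Cf G →₀ k) = - qm (de ([[], []], tau p)) := by
      rw [dc, dC_cons]; rfl
    rw [tau, List.replicate_succ]
    change dc ([[], []] :: tau p) = 0
    rw [e1, de_ss, ih]
    simp [qm]

theorem sg_smul_sg {M : Type} [AddCommGroup M] (m : ℕ) (x : M) : sg m • sg m • x = x := by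
  rw [smul_smul, sg_sq, one_smul]

theorem deL_supp {n q : ℕ} {y : Wd G × Cf G →₀ k} (hy : y ∈ Finsupp.supported k k (ES G n (q + 1))) :
    deL y ∈ Finsupp.supported k k (ES G n q) := LC_supp hy fun x hx => dE_supp hx 0

theorem iw_supp {w : Wd G} {A : Cf G →₀ k} {n q : ℕ}
    (hA : A ∈ Finsupp.supported k k {X | Valid X ∧ w.length + wt X = n ∧ wdeg w + cdeg X = q}) :
    iw w A ∈ Finsupp.supported k k (ES G n q) := mp_mem hA fun x hx => hx

theorem deL_deL (y : Wd G × Cf G →₀ k) : deL (deL y) = 0 := by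
  rw [deL, LC_LC, LC_congr (S := Set.univ) (by simp) (g := fun _ => 0), LC_zero]
  intro x _
  exact dE_dE o_rel 0 x

theorem per_word {n p m : ℕ} (h2 : 2 * p ≤ n) (hm : 1 ≤ m)
    (IH : ∀ n' < n, ∀ p', 2 * p' ≤ n' → Tst G k n' p')
    {y : Wd G × Cf G →₀ k} (hy : y ∈ Finsupp.supported k k (ES G n (p + 1)))
    (hl : y ∈ LT G k (m + 1)) (hd : deL y ∈ LT G k 1) {w : Wd G} (hw : ev w) (hwm : wdeg w = m) :
    ∃ r ∈ Finsupp.supported k k (ES G n (p + 1)), r ∈ LT G k (m + 1) ∧ pr w r = pr w y ∧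
      pr ([] :: w) r = pr ([] :: w) y ∧
      (∀ w', lev w' = m → w' ≠ w → w' ≠ [] :: w → pr w' r = 0) ∧ deL r ∈ Re G k n p := by
  have hwn : w ≠ [] := by rintro rfl; simp at hwm; omega
  have hb := ev_bound hw hwn
  have hlen : 1 ≤ w.length := List.length_pos_iff.2 hwn
  have sA := pr_supp hy (w := w)
  have sB := pr_supp hy (w := [] :: w)
  by_cases hc : w.length ≤ n ∧ m ≤ p + 1
  swap
  · refine ⟨0, Submodule.zero_mem _, Submodule.zero_mem _, ?_, ?_, by simp, by simp⟩
    · have : {X : Cf G | Valid X ∧ w.length + wt X = n ∧ wdeg w + cdeg X = p + 1} = ∅ := by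
        ext X; simp only [Set.mem_setOf_eq, Set.mem_empty_iff_false, iff_false]
        rintro ⟨_, h1, h2⟩; omega
      rw [this, Finsupp.supported_empty] at sA
      rw [(Submodule.mem_bot k).1 sA, map_zero]
    · have : {X : Cf G | Valid X ∧ ([] :: w).length + wt X = n ∧ wdeg ([] :: w) + cdeg X = p + 1}
          = ∅ := by
        ext X; simp only [Set.mem_setOf_eq, Set.mem_empty_iff_false, iff_false]
        rintro ⟨_, h1, h2⟩
        simp only [List.length_cons, wdeg_cons, ldeg] at h1 h2
        omega
      rw [this, Finsupp.supported_empty] at sB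
      rw [(Submodule.mem_bot k).1 sB, map_zero]
  obtain ⟨hc1, hc2⟩ := hc
  have hlw : lev w = m := by rw [lev_ev hw, hwm]
  have hlw' : lev ([] :: w) = m := by rw [lev_sigma hw, hwm]
  obtain ⟨d1, d2⟩ := pr_de hl hw hwm
  rw [pr_zero hd (by omega)] at d1 d2
  have c1 : dcL (pr w y) = sig (pr ([] :: w) y) := by
    have := congrArg (fun z => sg m • z) d1
    simp only [smul_zero, sg_smul_sg] at this
    exact (sub_eq_zero.1 this.symm)
  have c2 : dcL (pr ([] :: w) y) = 0 := by
    have := congrArg (fun z => sg m • z) d2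
    simp only [smul_zero, neg_smul, smul_neg, sg_smul_sg] at this
    exact (neg_eq_zero.1 this.symm)
  obtain ⟨A', hA', B', hB', e1, e2⟩ := IH (n - w.length) (by omega) (p + 1 - m) (by omega)
    (pr w y) (Finsupp.supported_mono (by
      rintro X ⟨a, b, c⟩; exact ⟨a, by omega, by omega⟩) sA) (pr ([] :: w) y)
    (Finsupp.supported_mono (by
      rintro X ⟨a, b, c⟩
      simp only [List.length_cons, wdeg_cons, ldeg, List.length_nil] at b c
      exact ⟨a, by omega, by omega⟩) sB) c1 c2
  set ρ := pr w y - (dcL A' - sig B') with hρ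
  set u := iw w A' + iw ([] :: w) B' with hu
  have hul : u ∈ LT G k (m + 1) := Submodule.add_mem _ (iw_LT (by omega) _) (iw_LT (by omega) _)
  have hus : u ∈ Finsupp.supported k k (ES G n (p + 1 + 1)) := by
    refine Submodule.add_mem _ (iw_supp (Finsupp.supported_mono ?_ hA'))
      (iw_supp (Finsupp.supported_mono ?_ hB'))
    · rintro X ⟨a, b, c⟩; exact ⟨a, by omega, by omega⟩
    · rintro X ⟨a, b, c⟩
      refine ⟨a, by simp only [List.length_cons]; omega, ?_⟩
      simp only [wdeg_cons, ldeg, List.length_nil]; omega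
  have hne : w ≠ [] :: w := by simp
  have hne' : [] :: w ≠ w := by simp
  obtain ⟨u1, u2⟩ := pr_de hul hw hwm
  have pu1 : pr w u = A' := by rw [hu, map_add, pr_iw, pr_iw]; simp
  have pu2 : pr ([] :: w) u = B' := by rw [hu, map_add, pr_iw, pr_iw]; simp
  rw [pu1, pu2] at u1
  rw [pu2] at u2
  have hρs : ρ ∈ Finsupp.supported k k
      {X | Valid X ∧ w.length + wt X = n ∧ wdeg w + cdeg X = p + 1} := by
    have : pr w (sg m • deL u) = dcL A' - sig B' := by rw [map_zsmul, u1, sg_smul_sg]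
    rw [hρ, ← this]
    exact Submodule.sub_mem _ sA (pr_supp (Submodule.smul_of_tower_mem _ _ (deL_supp hus)))
  refine ⟨iw w ρ + sg m • deL u, Submodule.add_mem _ (iw_supp hρs)
    (Submodule.smul_of_tower_mem _ _ (deL_supp hus)), Submodule.add_mem _ (iw_LT (by omega) _)
    (Submodule.smul_of_tower_mem _ _ (de_LT hul)), ?_, ?_, ?_, ?_⟩
  · rw [map_add, map_zsmul, u1, sg_smul_sg, pr_iw, if_pos rfl, hρ]; abel
  · rw [map_add, map_zsmul, u2, pr_iw, if_neg hne, e2, neg_smul, smul_neg, sg_smul_sg, zero_add]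
  · intro w' hw' n1 n2
    rw [map_add, map_zsmul, pr_iw, if_neg n1.symm, zero_add]
    by_cases hev : ev w'
    · obtain ⟨v1, _⟩ := pr_de hul hev (by rw [← lev_ev hev, hw'])
      rw [v1, hu, map_add, map_add (pr ([] :: w')), pr_iw, pr_iw, pr_iw, pr_iw, if_neg n1.symm,
        if_neg n2.symm, if_neg (fun h : w = [] :: w' => ev_sigma.1 (h ▸ hw : ev ([] :: w')) hev), if_neg (by simpa using n1.symm)]
      simp
    · obtain ⟨w'', rfl, hev'⟩ := not_ev hev
      rw [lev_sigma hev'] at hw'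
      obtain ⟨_, v1⟩ := pr_de hul hev' hw'
      rw [v1, hu, map_add, pr_iw, pr_iw, if_neg n1.symm, if_neg n2.symm]
      simp
  · rw [map_add, map_zsmul, deL_deL, smul_zero, add_zero]
    have : Rc G k (n - w.length) (p + 1 - m) ≤ (Re G k n p).comap (deL ∘ₗ iw w) := by
      refine Submodule.span_le.2 ?_
      rintro _ ⟨rfl, hh⟩
      have hww : w = [[], []] := ev_bound' hw hwn (by omega)
      subst hww
      have : m = 2 := by rw [← hwm]; simp [ldeg]
      subst this
      simp only [Submodule.comap_coe, Set.mem_preimage, LinearMap.comp_apply, SetLike.mem_coe,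
        mp_single, LC_single, one_smul]
      rw [de_ss, dc_tau, map_zero, add_zero]
      refine Submodule.neg_mem _ (Submodule.subset_span ⟨?_, ?_⟩)
      · rw [show p = (p + 1 - 2) + 1 by omega]; rfl
      · simp at hh; omega
    exact this e1

theorem reduce_level {n p m : ℕ} (h2 : 2 * p ≤ n) (hm : 1 ≤ m)
    (IH : ∀ n' < n, ∀ p', 2 * p' ≤ n' → Tst G k n' p')
    {y : Wd G × Cf G →₀ k} (hy : y ∈ Finsupp.supported k k (ES G n (p + 1)))
    (hl : y ∈ LT G k (m + 1)) (hd : deL y ∈ LT G k 1) :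
    ∃ y' ∈ Finsupp.supported k k (ES G n (p + 1)), y' ∈ LT G k m ∧ deL y - deL y' ∈ Re G k n p := by
  have := fun (w : Wd G) (hw : ev w ∧ wdeg w = m) => per_word h2 hm IH hy hl hd hw.1 hw.2
  choose! r hr using this
  set T : Finset (Wd G) := (y.support.image fun x => if ev x.1 then x.1 else x.1.tail).filter
    (fun w => ev w ∧ wdeg w = m) with hT
  have hTm : ∀ w ∈ T, ev w ∧ wdeg w = m := fun w hw => (Finset.mem_filter.1 hw).2
  have hs1 : (∑ w ∈ T, r w) ∈ Finsupp.supported k k (ES G n (p + 1)) :=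
    Submodule.sum_mem _ fun w hw => (hr w (hTm w hw)).1
  have hs2 : (∑ w ∈ T, r w) ∈ LT G k (m + 1) :=
    Submodule.sum_mem _ fun w hw => (hr w (hTm w hw)).2.1
  refine ⟨y - ∑ w ∈ T, r w, Submodule.sub_mem _ hy hs1, ?_, ?_⟩
  · have hz : ∀ x : Wd G, lev x = m → pr x (y - ∑ w ∈ T, r w) = 0 := by
      intro x hx
      rw [map_sub, map_sum, sub_eq_zero]
      -- the base word
      obtain ⟨w, hw, hwm, hxw, hbase⟩ : ∃ w, ev w ∧ wdeg w = m ∧ (x = w ∨ x = [] :: w) ∧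
          (if ev x then x else x.tail) = w := by
        by_cases hxe : ev x
        · exact ⟨x, hxe, by rw [← lev_ev hxe, hx], Or.inl rfl, by simp [hxe]⟩
        · obtain ⟨x', rfl, hx'⟩ := not_ev hxe
          exact ⟨x', hx', by rw [← lev_sigma hx', hx], Or.inr rfl, by simp [hxe]⟩
      have hother : ∀ w' ∈ T, w' ≠ w → pr x (r w') = 0 := by
        intro w' hw' hne
        refine (hr w' (hTm w' hw')).2.2.2.2.1 x hx ?_ ?_
        · rintro rfl
          rcases hxw with h | h
          · exact hne h
          · exact ev_sigma.1 (h ▸ (hTm _ hw').1 : ev ([] :: w)) hw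
        · rintro rfl
          rcases hxw with h | h
          · exact ev_sigma.1 (h ▸ hw : ev ([] :: w')) (hTm _ hw').1
          · exact hne (by simpa using h)
      have hmain : pr x (r w) = pr x y := by
        rcases hxw with rfl | rfl
        · exact (hr _ ⟨hw, hwm⟩).2.2.1
        · exact (hr _ ⟨hw, hwm⟩).2.2.2.1
      by_cases hwT : w ∈ T
      · rw [Finset.sum_eq_single_of_mem w hwT hother, hmain]
      · rw [Finset.sum_eq_zero fun w' hw' => hother w' hw' (fun h => hwT (h ▸ hw'))]
        ext X
        rw [pr_apply]
        by_contra hne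
        refine hwT (Finset.mem_filter.2 ⟨Finset.mem_image.2 ⟨(x, X), ?_, hbase⟩, hw, hwm⟩)
        exact Finsupp.mem_support_iff.2 hne
    have hl' := Submodule.sub_mem _ hl hs2
    rw [Finsupp.mem_supported] at hl' ⊢
    intro x hx
    have h1 := hl' hx
    simp only [Set.mem_setOf_eq] at h1 ⊢
    by_contra h3
    have h4 := hz x.1 (by omega)
    have h5 := congrArg (fun f => f x.2) h4
    simp only [pr_apply] at h5
    exact Finsupp.mem_support_iff.1 hx h5
  · rw [map_sub, sub_sub_cancel, map_sum]
    exact Submodule.sum_mem _ fun w hw => (hr w (hTm w hw)).2.2.2.2.2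

theorem Re_LT (n p : ℕ) : Re G k n p ≤ LT G k 1 := by
  refine Submodule.span_le.2 ?_
  rintro _ ⟨rfl, _⟩
  exact Finsupp.single_mem_supported k _ (by simp [lev, ev])

theorem reduce_all {n p : ℕ} (h2 : 2 * p ≤ n)
    (IH : ∀ n' < n, ∀ p', 2 * p' ≤ n' → Tst G k n' p') (m : ℕ) :
    ∀ {y : Wd G × Cf G →₀ k}, y ∈ Finsupp.supported k k (ES G n (p + 1)) →
    y ∈ LT G k (m + 1) → deL y ∈ LT G k 1 →
    ∃ y' ∈ Finsupp.supported k k (ES G n (p + 1)), y' ∈ LT G k 1 ∧ deL y - deL y' ∈ Re G k n p := by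
  induction m with
  | zero => intro y hy hl hd; exact ⟨y, hy, hl, by simp⟩
  | succ m ih =>
    intro y hy hl hd
    obtain ⟨y1, h1, h3, h4⟩ := reduce_level h2 (by omega) IH hy hl hd
    have hd1 : deL y1 ∈ LT G k 1 := by
      have := Submodule.sub_mem _ hd (Re_LT n p h4)
      simpa using this
    obtain ⟨y2, h5, h6, h7⟩ := ih h1 h3 hd1
    exact ⟨y2, h5, h6, by simpa using Submodule.add_mem _ h4 h7⟩

theorem Tst_all (n : ℕ) : ∀ p, 2 * p ≤ n → Tst G k n p := by
  induction n using Nat.strong_induction_on with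
  | _ n IH =>
  intro p h2 A hA B hB hAB hdB
  rcases Nat.eq_zero_or_pos n with rfl | hn
  · have hp : p = 0 := by omega
    subst hp
    have : {X : Cf G | Valid X ∧ wt X + 1 = 0 ∧ cdeg X + 1 = 0} = ∅ := by
      ext X; simp
    rw [BS, this, Finsupp.supported_empty] at hB
    have hB0 := (Submodule.mem_bot k).1 hB
    refine ⟨0, Submodule.zero_mem _, 0, Submodule.zero_mem _, ?_, by simp [hB0]⟩
    simp only [map_zero, sub_zero]
    rw [← LC_id A]
    refine LC_mem hA _ fun X hX => Submodule.subset_span ⟨?_, rfl⟩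
    obtain ⟨h3, h4, _⟩ := hX
    cases X with
    | nil => rfl
    | cons w W =>
      exfalso
      have := List.length_pos_iff.2 (valid_cons.1 h3).1
      simp at h4; simp [h4.1] at this
  · set z := iw [] A + iw [[]] B with hz
    have hzs : z ∈ Finsupp.supported k k (ES G n p) := by
      refine Submodule.add_mem _ (iw_supp (Finsupp.supported_mono ?_ hA))
        (iw_supp (Finsupp.supported_mono ?_ hB))
      · rintro X ⟨a, b, c⟩; exact ⟨a, by simpa using b, by simpa using c⟩
      · rintro X ⟨a, b, c⟩
        refine ⟨a, by simp; omega, ?_⟩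
        simp [ldeg]; omega
    have hzl : z ∈ LT G k 1 := Submodule.add_mem _ (iw_LT (by simp [lev, ev]) _)
      (iw_LT (by simp [lev, ev, ldeg]) _)
    have evn : ev ([] : Wd G) := by simp [ev]
    have wz1 : pr [] z = A := by rw [hz, map_add, pr_iw, pr_iw]; simp
    have wz2 : pr [[]] z = B := by rw [hz, map_add, pr_iw, pr_iw]; simp
    have split : ∀ y ∈ LT G k 1, y = iw [] (pr [] y) + iw [[]] (pr [[]] y) := by
      intro y hy
      conv_lhs => rw [← LC_id y]
      have : iw [] (pr [] y) + iw [[]] (pr [[]] y) = LC (fun x => iw [] (pr [] (bb x : _ →₀ k)) +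
          iw [[]] (pr [[]] (bb x : _ →₀ k))) y := by
        rw [LC_add, ← map_LC, ← map_LC, ← map_LC, ← map_LC, LC_id]
      rw [this]
      refine LC_congr hy fun x hx => ?_
      obtain ⟨x, X⟩ := x
      have bbx : ∀ (x : Wd G), (bb (x, X) : _ →₀ k) = iw x (bb X) := by
        intro x; simp
      simp only [Set.mem_setOf_eq] at hx
      have : x = [] ∨ x = [[]] := by
        by_cases he : ev x
        · left
          rw [lev_ev he] at hx
          by_contra hne
          have := wdeg_pos hne
          omega
        · right
          obtain ⟨x', rfl, hx'⟩ := not_ev he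
          rw [lev_sigma hx'] at hx
          by_contra hne
          have : x' ≠ [] := fun h => hne (by rw [h])
          have := wdeg_pos this
          omega
      rw [bbx]
      rcases this with rfl | rfl <;> rw [pr_iw, pr_iw] <;> simp
    have hzd : deL z = 0 := by
      obtain ⟨v1, v2⟩ := pr_de (m := 0) hzl evn rfl
      rw [wz1, wz2, hAB, sub_self, smul_zero] at v1
      rw [wz2, hdB, smul_zero] at v2
      rw [split _ (de_LT hzl), v1, v2]; simp
    obtain ⟨y, hy, hyz⟩ := E_acyclic hn hzs hzd
    have hyl : y ∈ LT G k (p + 1 + 1) := by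
      refine Finsupp.supported_mono ?_ hy
      rintro ⟨x, X⟩ ⟨_, _, c⟩
      have := lev_le x
      simp only [Set.mem_setOf_eq] at c ⊢; omega
    obtain ⟨y', h3, h4, h5⟩ := reduce_all h2 IH (p + 1) hy hyl (by rw [hyz]; exact hzl)
    rw [hyz] at h5
    obtain ⟨v1, v2⟩ := pr_de (m := 0) h4 evn rfl
    refine ⟨pr [] y', Finsupp.supported_mono ?_ (pr_supp h3), pr [[]] y',
      Finsupp.supported_mono ?_ (pr_supp h3), ?_, ?_⟩
    · rintro X ⟨a, b, c⟩; exact ⟨a, by simpa using b, by simpa using c⟩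
    · rintro X ⟨a, b, c⟩
      simp [ldeg] at b c
      exact ⟨a, by omega, by omega⟩
    · have : Re G k n p ≤ (Rc G k n p).comap (pr []) := by
        refine Submodule.span_le.2 ?_
        rintro _ ⟨rfl, hh⟩
        simp only [Submodule.comap_coe, Set.mem_preimage, SetLike.mem_coe]
        refine Submodule.subset_span ⟨?_, hh⟩
        simp [pr]
      have := this h5
      simp only [Submodule.mem_comap, map_sub, v1, wz1, sg_zero, one_smul] at this
      exact this
    · have : Re G k n p ≤ (⊥ : Submodule k (Cf G →₀ k)).comap (pr [[]]) := by
        refine Submodule.span_le.2 ?_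
        rintro _ ⟨rfl, hh⟩
        simp [pr]
      have := this h5
      simp only [Submodule.mem_comap, map_sub, v2, wz2, sg_zero, Submodule.mem_bot, neg_smul,
        one_smul, sub_eq_zero] at this
      exact this

/-- Surjectivity of stabilization. -/
theorem stab_surj {n q : ℕ} (h : 2 * q < n + 1) {A : Cf G →₀ k}
    (hA : A ∈ Finsupp.supported k k (CS G (n + 1) q)) (hd : dcL A = 0) :
    ∃ B ∈ Finsupp.supported k k (CS G n q), ∃ A' ∈ Finsupp.supported k k (CS G (n + 1) (q + 1)),
      dcL B = 0 ∧ A = sig B + dcL A' := by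
  obtain ⟨A', hA', B', hB', h1, h2⟩ := Tst_all (n + 1) q (by omega) A hA 0 (Submodule.zero_mem _)
    (by simpa using hd) (by simp)
  refine ⟨-B', Submodule.neg_mem _ (Finsupp.supported_mono ?_ hB'), A', hA', ?_, ?_⟩
  · rintro X ⟨a, b, c⟩; exact ⟨a, by omega, by omega⟩
  · rw [map_neg, ← h2]
  · have : Rc G k (n + 1) q = ⊥ := by
      rw [Rc, eq_bot_iff, Submodule.span_le]
      rintro _ ⟨_, hh⟩; omega
    rw [this, Submodule.mem_bot, sub_eq_zero] at h1
    rw [h1, map_neg]; abel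

/-- Injectivity of stabilization. -/
theorem stab_inj {n q : ℕ} (h : 2 * q + 2 ≤ n + 1) {B A : Cf G →₀ k}
    (hB : B ∈ Finsupp.supported k k (CS G n q)) (hd : dcL B = 0)
    (hA : A ∈ Finsupp.supported k k (CS G (n + 1) (q + 1))) (hAB : dcL A = sig B) :
    ∃ B' ∈ Finsupp.supported k k (CS G n (q + 1)), dcL B' = B := by
  obtain ⟨A', hA', B', hB', h1, h2⟩ := Tst_all (n + 1) (q + 1) (by omega) A hA B
    (Finsupp.supported_mono (by rintro X ⟨a, b, c⟩; exact ⟨a, by omega, by omega⟩) hB) hAB hd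
  refine ⟨-B', Submodule.neg_mem _ (Finsupp.supported_mono ?_ hB'), ?_⟩
  · rintro X ⟨a, b, c⟩; exact ⟨a, by omega, by omega⟩
  · rw [map_neg, h2]

end stab2
end BR
end

noncomputable section

namespace BR

/-! Free modules over monoid algebras, with supports in the monoid. -/
section sp
variable {k M α β V : Type} [CommRing k] [Monoid M] [AddCommGroup V] [Module k V]

/-- monoid element in the algebra -/
abbrev oo (k : Type) [CommRing k] {M : Type} (γ : M) : MonoidAlgebra k M := MonoidAlgebra.single γ 1

/-- generator -/
abbrev gn (k : Type) [CommRing k] {M : Type} (γ : M) (a : α) : α →₀ MonoidAlgebra k M :=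
  Finsupp.single a (oo k γ)

def SP (T : Set (M × α)) : Submodule k (α →₀ MonoidAlgebra k M) where
  carrier := {X | ∀ a γ, (γ, a) ∉ T → (X a).coeff γ = 0}
  add_mem' := by
    intro X Y hX hY a γ h
    have h1 := hX a γ h
    have h2 := hY a γ h
    simp [h1, h2]
  zero_mem' := by intro a γ h; simp
  smul_mem' := by
    intro c X hX a γ h
    have h1 := hX a γ h
    simp [h1]

theorem mem_SP {T : Set (M × α)} {X : α →₀ MonoidAlgebra k M} :
    X ∈ SP T ↔ ∀ a γ, (γ, a) ∉ T → (X a).coeff γ = 0 := Iff.rfl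

theorem sp_gen {T : Set (M × α)} {γ : M} {a : α} (h : (γ, a) ∈ T) : gn k γ a ∈ SP (k := k) T := by
  classical
  intro b γ' h'
  by_cases hb : a = b
  · subst hb
    rw [Finsupp.single_eq_same, MonoidAlgebra.coeff_single_apply, if_neg]
    rintro rfl; exact h' h
  · rw [Finsupp.single_eq_of_ne (Ne.symm hb)]; simp

theorem gen_mem {T : Set (M × α)} {X : α →₀ MonoidAlgebra k M} (hX : X ∈ SP T)
    (P : Submodule k (α →₀ MonoidAlgebra k M)) (h : ∀ γ a, (γ, a) ∈ T → gn k γ a ∈ P) : X ∈ P := by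
  rw [← Finsupp.sum_single X]
  refine Submodule.sum_mem _ fun a _ => ?_
  have e : Finsupp.single a (X a) = ∑ γ ∈ (X a).coeff.support, ((X a).coeff γ) • gn k γ a := by
    conv_lhs => rw [← MonoidAlgebra.sum_coeff_single (X a)]
    rw [Finsupp.sum, ← Finsupp.singleAddHom_apply, map_sum]
    refine Finset.sum_congr rfl fun γ _ => ?_
    simp [gn, oo, MonoidAlgebra.smul_single]
  rw [e]
  refine Submodule.sum_mem _ fun γ hγ => P.smul_mem _ (h γ a ?_)
  by_contra hn
  exact (Finsupp.mem_support_iff.1 hγ) (hX a γ hn)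

theorem gen_map {T : Set (M × α)} {X : α →₀ MonoidAlgebra k M} (hX : X ∈ SP T)
    (F : (α →₀ MonoidAlgebra k M) →ₗ[k] V) (P : Submodule k V)
    (h : ∀ γ a, (γ, a) ∈ T → F (gn k γ a) ∈ P) : F X ∈ P :=
  gen_mem hX (P.comap F) h

theorem gen_eq {T : Set (M × α)} {X : α →₀ MonoidAlgebra k M} (hX : X ∈ SP T)
    (F F' : (α →₀ MonoidAlgebra k M) →ₗ[k] V)
    (h : ∀ γ a, (γ, a) ∈ T → F (gn k γ a) = F' (gn k γ a)) : F X = F' X :=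
  gen_mem hX (LinearMap.eqLocus F F') h

theorem SP_mono {T T' : Set (M × α)} (h : T ⊆ T') : SP (k := k) T ≤ SP T' :=
  fun _ hX a γ hn => hX a γ fun h' => hn (h h')

theorem SP_inter {T T' : Set (M × α)} {X : α →₀ MonoidAlgebra k M} (h : X ∈ SP T) (h' : X ∈ SP T') :
    X ∈ SP (T ∩ T') := by
  intro a γ hn
  by_cases h1 : (γ, a) ∈ T
  · exact h' a γ fun h2 => hn ⟨h1, h2⟩
  · exact h a γ h1

theorem SP_univ (X : α →₀ MonoidAlgebra k M) : X ∈ SP (k := k) (Set.univ : Set (M × α)) :=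
  fun a γ h => absurd trivial h

theorem SP_supported {S : Set α} {X : α →₀ MonoidAlgebra k M} :
    X ∈ Finsupp.supported _ (MonoidAlgebra k M) S ↔ X ∈ SP (k := k) {x : M × α | x.2 ∈ S} := by
  rw [Finsupp.mem_supported']
  constructor
  · intro h a γ hn
    rw [h a hn]; simp
  · intro h a ha
    ext γ
    exact h a γ ha

/-- `k`-linear map defined on generators -/
def kl (F : M → α → V) : (α →₀ MonoidAlgebra k M) →ₗ[k] V :=
  Finsupp.lsum k fun a => (Finsupp.linearCombination k fun γ => F γ a) ∘ₗ
    (MonoidAlgebra.coeffLinearEquiv k).toLinearMap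

theorem kl_gen (F : M → α → V) (γ : M) (a : α) : kl (k := k) F (gn k γ a) = F γ a := by
  simp only [kl, gn, Finsupp.lsum_single, LinearMap.comp_apply]
  change Finsupp.linearCombination k (fun γ => F γ a) ((oo k γ).coeff) = _
  rw [oo, MonoidAlgebra.coeff_single]; simp

/-- linear combination as a `k`-linear map -/
abbrev LK (f : α → (β →₀ MonoidAlgebra k M)) : (α →₀ MonoidAlgebra k M) →ₗ[k] (β →₀ MonoidAlgebra k M) :=
  (LC f).restrictScalars k

theorem LC_gen (f : α → (β →₀ MonoidAlgebra k M)) (γ : M) (a : α) :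
    LC f (gn k γ a) = oo k γ • f a := LC_single _ _ _

theorem smul_gen (γ γ' : M) (a : α) : oo k γ • gn k γ' a = gn k (γ * γ') a := by
  rw [gn, Finsupp.smul_single, smul_eq_mul, MonoidAlgebra.single_mul_single, mul_one]

theorem mp_gen (f : α → β) (γ : M) (a : α) : mp f (gn k γ a) = gn k γ (f a) := mp_single _ _ _

theorem sp_LC {T : Set (M × α)} {T' : Set (M × β)} {X : α →₀ MonoidAlgebra k M} (hX : X ∈ SP T)
    {f : α → (β →₀ MonoidAlgebra k M)} (h : ∀ γ a, (γ, a) ∈ T → oo k γ • f a ∈ SP (k := k) T') :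
    LC f X ∈ SP (k := k) T' := by
  refine gen_map hX (LK f) _ fun γ a ha => ?_
  change LC f _ ∈ _
  rw [LC_gen]; exact h γ a ha

theorem sp_mp {T : Set (M × α)} {T' : Set (M × β)} {X : α →₀ MonoidAlgebra k M} (hX : X ∈ SP T)
    {f : α → β} (h : ∀ γ a, (γ, a) ∈ T → (γ, f a) ∈ T') :
    mp f X ∈ SP (k := k) T' := by
  rw [mp_eq_LC]
  refine sp_LC hX fun γ a ha => ?_
  have := smul_gen (k := k) γ 1 (f a)
  rw [mul_one] at this
  change oo k γ • gn k 1 (f a) ∈ _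
  rw [this]
  exact sp_gen (h γ a ha)

theorem sp_smul {T T' : Set (M × α)} {X : α →₀ MonoidAlgebra k M} (hX : X ∈ SP T) (γ : M)
    (h : ∀ γ' a, (γ', a) ∈ T → (γ * γ', a) ∈ T') :
    oo k γ • X ∈ SP (k := k) T' := by
  let F : (α →₀ MonoidAlgebra k M) →ₗ[k] (α →₀ MonoidAlgebra k M) :=
    { toFun := fun X => oo k γ • X
      map_add' := smul_add _
      map_smul' := fun c X => by
        ext a γ'
        simp [mul_smul_comm] }
  refine gen_map hX F _ fun γ' a ha => ?_
  change oo k γ • gn k γ' a ∈ _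
  rw [smul_gen]; exact sp_gen (h γ' a ha)

theorem sp_zsmul {T : Set (M × α)} {X : α →₀ MonoidAlgebra k M} (hX : X ∈ SP (k := k) T) (c : ℤ) :
    c • X ∈ SP (k := k) T := Submodule.smul_of_tower_mem _ _ hX

end sp

end BR
end

noncomputable section

namespace BR
section lead
variable {k G : Type} [CommRing k] [Group G]

/-- generators in the monoid algebra -/
abbrev ms (k G : Type) [CommRing k] [Group G] : ℕ → MonoidAlgebra k (LB G) := fun i => oo k (ls i)
abbrev mt (k G : Type) [CommRing k] [Group G] : G → ℕ → MonoidAlgebra k (LB G) :=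
  fun g i => oo k (lt g i)

def fw : Wd G → ℕ
  | [] => 0
  | a :: w => a.length + w.length + fw w
def fW : Cf G → ℕ
  | [] => 0
  | w :: W => fw w + fW W
def nl : Wd G → ℕ
  | [] => 0
  | a :: w => a.length + nl w
def NL : Cf G → ℕ
  | [] => 0
  | w :: W => nl w + NL W
def De (p : ℕ) : Cf G → LB G
  | [] => 1
  | w :: W => De (p + w.length) W * dl ls p w.length

theorem fw_append (u v : Wd G) : fw (u ++ v) = fw u + fw v + u.length * v.length := by
  induction u with
  | nil => simp [fw]
  | cons a u ih => simp only [List.cons_append, fw, ih, List.length_append, List.length_cons]; ring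

theorem llen_cc (p q : ℕ) : llen (cc ls p q : LB G) = q := by
  induction q with
  | zero => simp
  | succ q ih => rw [cc_succ, llen_mul, llen_ls, ih, add_comm]

theorem llen_bcr (p a b : ℕ) : llen (bcr ls p a b : LB G) = a * b := by
  induction a with
  | zero => simp [bcr]
  | succ a ih => rw [bcr, llen_mul, llen_cc, ih]; ring

theorem llen_dl_fw (w : Wd G) : ∀ p, llen (dl ls p w.length : LB G) + nl w = fw w := by
  induction w with
  | nil => intro p; simp [dl_zero, fw, nl]
  | cons a w ih =>
    intro p
    have := ih (p + 1)
    rw [List.length_cons, dl_succ, llen_mul, llen_cc, nl, fw]; omega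

theorem llen_De (W : Cf G) : ∀ p, llen (De p W) + NL W = fW W := by
  induction W with
  | nil => intro p; simp [De, fW, NL]
  | cons w W ih =>
    intro p
    have := ih (p + w.length)
    have := llen_dl_fw w p
    rw [De, llen_mul, NL, fW]; omega

theorem oo_cc (p q : ℕ) : cc (ms k G) p q = oo k (cc ls p q) := by
  induction q with
  | zero => rfl
  | succ q ih => rw [cc_succ, cc_succ, ih, MonoidAlgebra.single_mul_single, one_mul]

theorem lr_sp (a : List G) : (lr a : List G →₀ MonoidAlgebra k (LB G)) ∈
    SP (k := k) {x | llen x.1 = 0 ∧ x.2.length + 1 = a.length} := by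
  induction a with
  | nil => exact Submodule.zero_mem _
  | cons g a ih =>
    cases a with
    | nil => exact Submodule.neg_mem _ (sp_gen (by simp))
    | cons h a =>
      rw [lr]
      refine Submodule.sub_mem _ (Submodule.neg_mem _ (sp_gen (by simp))) ?_
      exact sp_mp ih fun γ x hx => by simpa using hx

theorem lb_sp (j : ℕ) (a : List G) : lb (mt k G) j a ∈
    SP (k := k) {x | llen x.1 = 0 ∧ x.2.length + 1 = a.length} := by
  cases a with
  | nil => exact Submodule.zero_mem _
  | cons g a =>
    rw [lb]
    exact Submodule.add_mem _ (sp_gen (by simp)) (lr_sp _)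

theorem wb_sp (p : ℕ) (w : Wd G) : wb (mt k G) p w ∈
    SP (k := k) {x | llen x.1 + fw x.2 < fw w ∧ x.2.length = w.length} := by
  induction w with
  | nil => exact Submodule.zero_mem _
  | cons a w ih =>
    rw [wb]
    refine Submodule.add_mem _ (sp_mp ih fun γ x hx => ?_) (sp_zsmul (sp_mp (lb_sp _ a) fun γ x hx => ?_) _)
    · simp only [Set.mem_setOf_eq, fw, List.length_cons] at hx ⊢; omega
    · simp only [Set.mem_setOf_eq, fw, List.length_cons] at hx ⊢
      exact ⟨by omega, trivial⟩

/-- leading part of the coproduct, without the empty left factor -/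
def cl1 (k : Type) [CommRing k] : Wd G → (Wd G × Wd G →₀ k)
  | [] => 0
  | a :: w => LC (fun x => sg (ldeg a * wdeg x.2) • bb (a :: x.1, x.2)) (bb ([], w) + cl1 k w)

theorem cl1_supp (w : Wd G) : cl1 k w ∈ Finsupp.supported k k {x | x.1 ≠ [] ∧ x.1 ++ x.2 = w} := by
  induction w with
  | nil => exact Submodule.zero_mem _
  | cons a w ih =>
    rw [cl1, map_add, LC_single, one_smul]
    refine Submodule.add_mem _ (Submodule.smul_of_tower_mem _ _ (Finsupp.single_mem_supported _ _ (by simp))) ?_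
    refine LC_mem ih _ fun x hx => Submodule.smul_of_tower_mem _ _ (Finsupp.single_mem_supported _ _ ?_)
    simpa using hx.2

def leadT (k : Type) [CommRing k] (p : ℕ) (x : Wd G × Wd G) : Wd G × Wd G →₀ MonoidAlgebra k (LB G) :=
  gn k (bcr ls p x.1.length x.2.length) x

def lowC (w : Wd G) : Set (LB G × (Wd G × Wd G)) :=
  {x | llen x.1 + fw x.2.1 + fw x.2.2 < fw w ∧ x.2.1.length + x.2.2.length = w.length}

theorem copL_gen (p : ℕ) (a : List G) (x : Wd G × Wd G) (γ : LB G) :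
    oo k γ • copL (ms k G) p a x = sg (ldeg a * wdeg x.2) • gn k (γ * cc ls (p + x.1.length) x.2.length) (a :: x.1, x.2)
      + gn k γ (x.1, a :: x.2) := by
  rw [copL, smul_add, oo_cc, smul_comm, smul_gen]
  congr 1
  exact (smul_gen γ 1 _).trans (by rw [mul_one])

theorem cop_lead (p : ℕ) (w : Wd G) :
    cop (ms k G) p w - (gn k (1 : LB G) ([], w) + LC (B := k) (leadT k p) (cl1 k w)) ∈ SP (k := k) (lowC w) := by
  induction w with
  | nil =>
    rw [cop, cl1, map_zero, add_zero]
    exact (sub_self (bb (([], []) : Wd G × Wd G) : _ →₀ MonoidAlgebra k (LB G))).symm ▸ Submodule.zero_mem _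
  | cons a w ih =>
    have e1 : LC (copL (ms k G) p a) (gn k (1 : LB G) ([], w)) =
        sg (ldeg a * wdeg w) • leadT k p ([a], w) + gn k (1 : LB G) ([], a :: w) := by
      rw [LC_gen, copL_gen]
      simp [leadT, bcr]
    have e2 : LC (B := k) (leadT k p) (cl1 k (a :: w)) = sg (ldeg a * wdeg w) • leadT k p ([a], w) +
        LC (B := k) (fun x => sg (ldeg a * wdeg x.2) • leadT k p (a :: x.1, x.2)) (cl1 k w) := by
      rw [cl1, map_add, LC_single, one_smul, map_add, map_zsmul, LC_single, one_smul, LC_LC]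
      congr 2
      refine congrArg _ (funext fun x => ?_)
      rw [map_zsmul, LC_single, one_smul]
    have e3 : LC (copL (ms k G) p a) (LC (B := k) (leadT k p) (cl1 k w)) =
        LC (B := k) (fun x => sg (ldeg a * wdeg x.2) • leadT k p (a :: x.1, x.2)) (cl1 k w) +
        LC (B := k) (fun x => gn k (bcr ls p x.1.length x.2.length) (x.1, a :: x.2)) (cl1 k w) := by
      have := map_LC (B := k) (LK (copL (ms k G) p a)) (leadT k p) (cl1 k w)
      rw [← LC_add]
      refine this.trans ?_
      refine LinearMap.congr_fun (congrArg _ (funext fun x => ?_)) _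
      change LC (copL (ms k G) p a) (leadT k p x) = _
      rw [leadT, LC_gen, copL_gen]
      rfl
    set L := LC (B := k) (leadT k p) (cl1 k w) with hL
    have e4 : cop (ms k G) p (a :: w) - (gn k (1 : LB G) ([], a :: w) + LC (B := k) (leadT k p) (cl1 k (a :: w))) =
        LC (copL (ms k G) p a) (cop (ms k G) p w - (gn k (1 : LB G) ([], w) + L)) +
        LC (B := k) (fun x => gn k (bcr ls p x.1.length x.2.length) (x.1, a :: x.2)) (cl1 k w) := by
      rw [map_sub, map_add, e1, e2, e3, cop]; abel
    rw [e4]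
    refine Submodule.add_mem _ (sp_LC ih fun γ x hx => ?_) ?_
    · rw [copL_gen]
      simp only [lowC, Set.mem_setOf_eq] at hx
      refine Submodule.add_mem _ (sp_zsmul (sp_gen ?_) _) (sp_gen ?_)
      · simp only [lowC, Set.mem_setOf_eq, fw, List.length_cons, llen_mul, llen_cc]; omega
      · simp only [lowC, Set.mem_setOf_eq, fw, List.length_cons]; omega
    · refine LC_mem (cl1_supp w) _ fun x hx => sp_gen ?_
      obtain ⟨h1, h2⟩ := hx
      have h3 := List.length_pos_iff.2 h1
      simp only [lowC, Set.mem_setOf_eq, llen_bcr, fw, ← h2, fw_append, List.length_cons, List.length_append]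
      constructor
      · omega
      · omega

def cutW (k : Type) [CommRing k] (W : Cf G) (x : Wd G × Wd G) : Cf G →₀ k :=
  if x.2 = [] then 0 else sg (wdeg x.1) • bb (x.1 :: x.2 :: W)

/-- the leading differential -/
def dcut (k : Type) [CommRing k] : Cf G → (Cf G →₀ k)
  | [] => 0
  | w :: W => LC (cutW k W) (cl1 k w) - sg (wdeg w) • mp (fun x => w :: x) (dcut k W)

theorem De_far {k' : ℕ} (W : Cf G) : ∀ p, k' + 1 < p → Peel ls k' (De p W) := by
  induction W with
  | nil => intro p h; exact Peel.one _
  | cons w W ih =>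
    intro p h
    exact (ih (p + w.length) (by omega)).mul (Peel.dl lb_garside fun i hi => Or.inr (by omega))

theorem De_cancel (W : Cf G) : ∀ p {x y : LB G}, x * De p W = y * De p W → x = y := by
  induction W with
  | nil => intro p x y h; simpa [De] using h
  | cons w W ih =>
    intro p x y h
    rw [De, ← mul_assoc, ← mul_assoc] at h
    exact ih _ (dl_cancel lb_garside h)

theorem De_s_comm {i : ℕ} (W : Cf G) : ∀ p, i + 1 < p → (ls i * De p W : LB G) = De p W * ls i := by
  induction W with
  | nil => intro p h; simp [De]
  | cons w W ih =>
    intro p h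
    have h1 : (ls i * dl ls p w.length : LB G) = dl ls p w.length * ls i := by
      refine dl_intertwine _ fun j hj => ?_
      exact lb_rel.comm _ _ (Or.inl (by omega))
    rw [De, ← mul_assoc, ih _ (by omega), mul_assoc, h1, mul_assoc]

open Classical in
/-- the generator on `W` of total element `y` -/
def ee (k : Type) [CommRing k] (p : ℕ) (y : LB G) (W : Cf G) : Cf G →₀ MonoidAlgebra k (LB G) :=
  if h : ∃ γ, γ * De p W = y then gn k h.choose W else 0

theorem ee_eq {p : ℕ} {y γ : LB G} {W : Cf G} (h : γ * De p W = y) : ee k p y W = gn k γ W := by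
  have h' : ∃ γ, γ * De p W = y := ⟨γ, h⟩
  rw [ee, dif_pos h', De_cancel W p (h'.choose_spec.trans h.symm)]

theorem ee_smul {p : ℕ} {y : LB G} (γ : LB G) {W : Cf G} (h : ∃ γ, γ * De p W = y) :
    oo k γ • ee k p y W = ee k p (γ * y) W := by
  obtain ⟨γ', h⟩ := h
  rw [ee_eq h, smul_gen, ee_eq (γ := γ * γ')]
  rw [mul_assoc, h]

theorem ee_cons (p : ℕ) (y : LB G) (w : Wd G) (W : Cf G) :
    ee k p (y * dl ls p w.length) (w :: W) = mp (fun x => w :: x) (ee k (p + w.length) y W) := by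
  by_cases h : ∃ γ, γ * De (p + w.length) W = y
  · obtain ⟨γ, h⟩ := h
    rw [ee_eq h, mp_gen, ee_eq]
    rw [De, ← mul_assoc, h]
  · have h' : ¬ ∃ γ, γ * De p (w :: W) = y * dl ls p w.length := by
      rintro ⟨γ, h'⟩
      rw [De, ← mul_assoc] at h'
      exact h ⟨γ, dl_cancel lb_garside h'⟩
    rw [ee, ee, dif_neg h, dif_neg h', map_zero]

theorem cc_De_comm {a b : ℕ} (W : Cf G) (p : ℕ) (h : a + b < p) : (cc ls a b * De p W : LB G) = De p W * cc ls a b := by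
  symm
  refine cc_intertwine _ fun i hi => ?_
  exact (De_s_comm W p (by omega)).symm

theorem bcr_De_comm {q a b : ℕ} (W : Cf G) (p : ℕ) (h : q + a + b ≤ p) :
    (bcr ls q a b * De p W : LB G) = De p W * bcr ls q a b := by
  induction a with
  | zero => simp [bcr]
  | succ a ih =>
    rw [bcr, mul_assoc, cc_De_comm _ _ (by omega), ← mul_assoc, ih (by omega), mul_assoc]

theorem dl_dl_comm (p a b : ℕ) : (dl ls (p + a) b * dl ls p a : LB G) = dl ls p a * dl ls (p + a) b := by
  refine dl_intertwine _ fun i hi => ?_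
  symm
  refine dl_intertwine _ fun j hj => ?_
  refine lb_rel.comm _ _ ?_
  exact (Or.inl (by omega))

theorem De_cut (p : ℕ) (u v : Wd G) (W : Cf G) :
    bcr ls p u.length v.length * De p (u :: v :: W) = De p ((u ++ v) :: W) := by
  rw [De, De, De, List.length_append, ← bcr_dl lb_rel.toBRel, mul_assoc, dl_dl_comm, ← mul_assoc,
    ← add_assoc, bcr_De_comm _ _ le_rfl, mul_assoc, mul_assoc]

/-- Supports of the leading differential. -/
def dvd (p : ℕ) (y : LB G) : Set (Cf G) := {W | Valid W ∧ ∃ γ, γ * De p W = y}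

theorem dcut_supp (W : Cf G) : ∀ p, Valid W → dcut k W ∈ Finsupp.supported k k (dvd p (De p W)) := by
  induction W with
  | nil => intro p _; exact Submodule.zero_mem _
  | cons w W ih =>
    intro p hV
    obtain ⟨h1, h2⟩ := valid_cons.1 hV
    rw [dcut]
    refine Submodule.sub_mem _ (LC_mem (cl1_supp w) _ fun x hx => ?_) (Submodule.smul_of_tower_mem _ _ ?_)
    · rw [cutW]
      split_ifs with hv
      · exact Submodule.zero_mem _
      · refine Submodule.smul_of_tower_mem _ _ (Finsupp.single_mem_supported _ _ ?_)
        refine ⟨valid_cons.2 ⟨hx.1, valid_cons.2 ⟨hv, h2⟩⟩, bcr ls p x.1.length x.2.length, ?_⟩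
        rw [De_cut, hx.2]
    · refine mp_mem (ih (p + w.length) h2) ?_
      rintro W' ⟨h3, γ, h4⟩
      refine ⟨valid_cons.2 ⟨h1, h3⟩, γ, ?_⟩
      rw [De, ← mul_assoc, h4]; rfl

def lowW (W : Cf G) : Set (LB G × Cf G) := {x | llen x.1 + fW x.2 < fW W}

theorem qm_gen (γ : LB G) (x : Wd G × Cf G) :
    qm (gn k γ x) = if x.1 = [] then 0 else gn k γ (x.1 :: x.2) := by
  rw [qm, LC_gen]
  split_ifs with h
  · rw [smul_zero]
  · exact (smul_gen γ 1 _).trans (by rw [mul_one])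

theorem sp_qm {T : Set (LB G × (Wd G × Cf G))} {T' : Set (LB G × Cf G)} {X : Wd G × Cf G →₀ MonoidAlgebra k (LB G)}
    (hX : X ∈ SP (k := k) T) (h : ∀ γ x, (γ, x) ∈ T → (γ, x.1 :: x.2) ∈ T') : qm X ∈ SP (k := k) T' := by
  refine gen_map hX (qm.restrictScalars k) _ fun γ x hx => ?_
  change qm _ ∈ _
  rw [qm_gen]
  split_ifs
  · exact Submodule.zero_mem _
  · exact sp_gen (h γ x hx)

theorem cutT_gen (γ : LB G) (W : Cf G) (x : Wd G × Wd G) : LC (cutT W) (gn k γ x) =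
    if x.2 = [] then 0 else sg (wdeg x.1) • gn k γ (x.1, x.2 :: W) := by
  rw [LC_gen, cutT]
  split_ifs with h
  · rw [smul_zero]
  · rw [smul_comm]; congr 1
    exact (smul_gen γ 1 _).trans (by rw [mul_one])

set_option maxHeartbeats 1000000 in
theorem dC_lead (W : Cf G) : ∀ p, Valid W →
    dC (ms k G) (mt k G) p W - LC (B := k) (ee k p (De p W)) (dcut k W) ∈ SP (k := k) (lowW W) := by
  induction W with
  | nil => intro p _; rw [dC, dcut, map_zero, sub_zero]; exact Submodule.zero_mem _
  | cons w W ih =>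
    intro p hV
    obtain ⟨h1, h2⟩ := valid_cons.1 hV
    have IH := ih (p + w.length) h2
    set D := dC (ms k G) (mt k G) (p + w.length) W with hD
    set L := LC (B := k) (leadT k p) (cl1 k w) with hL
    have e1 : LC (B := k) (ee k p (De p (w :: W))) (dcut k (w :: W)) =
        qm (LC (cutT W) L) - sg (wdeg w) • mp (fun x => w :: x)
          (LC (B := k) (ee k (p + w.length) (De (p + w.length) W)) (dcut k W)) := by
      rw [dcut, map_sub, map_zsmul]
      congr 1
      · rw [LC_LC, hL]
        have := map_LC (B := k) ((qm.restrictScalars k) ∘ₗ (LK (cutT W))) (leadT k p) (cl1 k w)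
        refine Eq.trans ?_ this.symm
        refine LC_congr (cl1_supp w) fun x hx => ?_
        change _ = qm (LC (cutT W) (leadT k p x))
        rw [cutW, leadT, cutT_gen]
        split_ifs with hv
        · simp
        · rw [map_zsmul, map_zsmul, qm_gen, if_neg hx.1, LC_single, one_smul, ee_eq]
          rw [De_cut, hx.2]
      · congr 1
        rw [LC_mp]
        have := map_LC (B := k) ((mp (B := MonoidAlgebra k (LB G)) (fun x : Cf G => w :: x)).restrictScalars k)
          (ee k (p + w.length) (De (p + w.length) W)) (dcut k W)
        refine Eq.trans ?_ this.symm
        refine LinearMap.congr_fun (congrArg _ (funext fun x => ?_)) _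
        rw [De, ee_cons]; rfl
    have e2 : qm (mp (fun y => (w, y)) D) = mp (fun x => w :: x) D := by
      rw [qm, LC_mp, mp_eq_LC]
      simp [h1]
    have e3 : qm (LC (cutT W) (gn k (1 : LB G) (([], w) : Wd G × Wd G))) = (0 : Cf G →₀ MonoidAlgebra k (LB G)) := by
      rw [cutT_gen, if_neg h1, map_zsmul, qm_gen]; simp
    have e4 : dC (ms k G) (mt k G) p (w :: W) - LC (B := k) (ee k p (De p (w :: W))) (dcut k (w :: W)) =
        - qm (mp (fun x => (x, W)) (wb (mt k G) p w)) +
        qm (LC (cutT W) (cop (ms k G) p w - (gn k (1 : LB G) ([], w) + L)))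
        - sg (wdeg w) • mp (fun x => w :: x)
          (D - LC (B := k) (ee k (p + w.length) (De (p + w.length) W)) (dcut k W)) := by
      have e5 : qm (LC (cutT (B := MonoidAlgebra k (LB G)) W) (cop (ms k G) p w - (gn k (1 : LB G) ([], w) + L))) =
          qm (LC (cutT (B := MonoidAlgebra k (LB G)) W) (cop (ms k G) p w)) - qm (LC (cutT (B := MonoidAlgebra k (LB G)) W) L) := by
        rw [map_sub, map_add, map_sub, map_add, e3, zero_add]
      rw [e5, map_sub (mp (B := MonoidAlgebra k (LB G)) (fun x : Cf G => w :: x)), smul_sub, e1, dC, dEb, ← hD, map_add, map_sub, map_zsmul, e2]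
      abel
    rw [e4]
    refine Submodule.sub_mem _ (Submodule.add_mem _ (Submodule.neg_mem _ ?_) ?_) (sp_zsmul ?_ _)
    · refine sp_qm (sp_mp (wb_sp p w) (T' := {x | llen x.1 + fw x.2.1 < fw w ∧ x.2.2 = W}) ?_) ?_
      · intro γ a ha; exact ⟨ha.1, rfl⟩
      · rintro γ ⟨u, V⟩ ⟨ha, rfl⟩
        simp only [lowW, Set.mem_setOf_eq, fW] at ha ⊢; omega
    · refine sp_qm (sp_LC (cop_lead p w) (T' := {x | llen x.1 + fw x.2.1 + fW x.2.2 < fw w + fW W}) ?_) ?_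
      · intro γ x hx
        have := cutT_gen (k := k) γ W x
        rw [LC_gen] at this
        rw [this]
        split_ifs
        · exact Submodule.zero_mem _
        · refine sp_zsmul (sp_gen ?_) _
          simp only [lowC, Set.mem_setOf_eq, fW] at hx ⊢; omega
      · intro γ x hx
        simp only [lowW, Set.mem_setOf_eq, fW] at hx ⊢; omega
    · refine sp_mp IH fun γ x hx => ?_
      simp only [lowW, Set.mem_setOf_eq, fW] at hx ⊢; omega

end lead
end BR
end

noncomputable section

namespace BR
section contr
variable {k G : Type} [CommRing k] [Group G]

theorem sg_cases (n : ℕ) : sg n = 1 ∨ sg n = -1 := by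
  rcases Nat.even_or_odd n with h | h
  · exact Or.inl h.neg_one_pow
  · exact Or.inr h.neg_one_pow

theorem wdeg_append (u v : Wd G) : wdeg (u ++ v) = wdeg u + wdeg v := by
  induction u with
  | nil => simp
  | cons a u ih => simp [ih, add_assoc]

/-- contracting homotopy for the leading differential -/
def hW (k : Type) [CommRing k] : ℕ → Cf G → (Cf G →₀ k)
  | 0, [b] :: v :: R => sg (ldeg b + ldeg b * wdeg v) • bb ((b :: v) :: R)
  | i + 1, [a] :: W => (- sg (ldeg a)) • mp (fun x => [a] :: x) (hW k i W)
  | _, _ => 0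

def SS : ℕ → Cf G → Prop
  | 0, W => 2 ≤ wt W ∧ Valid W
  | i + 1, [_] :: W => SS i W
  | _ + 1, _ => False

theorem dcut_single (a : List G) (W : Cf G) :
    dcut k ([a] :: W) = (- sg (ldeg a)) • mp (fun x => [a] :: x) (dcut k W) := by
  rw [dcut, cl1, cl1, add_zero, LC_single, one_smul, map_zsmul, LC_single, one_smul, cutW]
  simp

theorem hW_zero_cons (b b' : List G) (u : Wd G) (R : Cf G) : hW k 0 ((b :: b' :: u) :: R) = 0 := by
  simp [hW]

theorem hW_contr0 (W : Cf G) (h : 2 ≤ wt W ∧ Valid W) :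
    LC (hW k 0) (dcut k W) + LC (dcut k) (hW k 0 W) = bb W := by
  obtain ⟨hw, hV⟩ := h
  match W, hw, hV with
  | [], hw, _ => simp at hw
  | [] :: W, _, hV => exact absurd rfl (valid_cons.1 hV).1
  | [[_]], hw, _ => simp at hw
  | (b :: b' :: u) :: R, _, _ =>
    rw [hW_zero_cons, map_zero, add_zero, dcut, map_sub, map_zsmul, LC_mp]
    have e1 : LC (fun a => hW k 0 ((b :: b' :: u) :: a)) (dcut k R) = 0 := by
      simp only [hW_zero_cons]; exact LC_zero _
    rw [e1, smul_zero, sub_zero, cl1, map_add, LC_single, one_smul, LC_LC, map_add, LC_LC]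
    have e2 : LC (fun a => LC (fun x => LC (hW k 0) (cutW k R x)) (sg (ldeg b * wdeg a.2) • (bb (b :: a.1, a.2) : _ →₀ k)))
        (cl1 k (b' :: u)) = 0 := by
      refine Eq.trans (LC_congr (cl1_supp _) (g := fun _ => 0) fun x hx => ?_) (LC_zero _)
      rw [map_zsmul, LC_single, one_smul, cutW]
      obtain ⟨x1, x2⟩ := x
      cases x1 with
      | nil => exact absurd rfl hx.1
      | cons c x1 =>
        split_ifs
        · simp
        · rw [map_zsmul, LC_single, hW_zero_cons]; simp
    rw [e2, add_zero, map_zsmul, LC_single, one_smul, cutW, if_neg (by simp), map_zsmul, LC_single,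
      one_smul, hW, smul_smul, smul_smul]
    simp only [wdeg_cons, wdeg_nil, add_zero, sg_add]
    rcases sg_cases (ldeg b) with h1 | h1 <;> rcases sg_cases (ldeg b * wdeg (b' :: u)) with h2 | h2 <;>
      simp only [wdeg_cons] at h2 ⊢ <;> simp [h1, h2]
  | [b] :: v :: R, _, hV =>
    have hv := (valid_cons.1 (valid_cons.1 hV).2).1
    have e1 : ∀ v : Wd G, ∀ R : Cf G, hW k 0 ([b] :: v :: R) = sg (ldeg b + ldeg b * wdeg v) • bb ((b :: v) :: R) :=
      fun v R => by rw [hW]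
    rw [dcut_single, map_zsmul, LC_mp, e1, map_zsmul, LC_single, one_smul, dcut, map_sub, map_zsmul, LC_mp, LC_LC]
    have e2 : LC (fun R => hW k 0 ([b] :: v :: R)) (dcut k R) =
        sg (ldeg b + ldeg b * wdeg v) • mp (fun x => (b :: v) :: x) (dcut k R) := by
      simp only [e1]
      rw [LC_zsmul, mp_eq_LC]
    have e3 : dcut k ((b :: v) :: R) = (sg (ldeg b * wdeg v) * sg (ldeg b)) • bb ([b] :: v :: R) +
        LC (fun x => if x.2 = [] then 0 else (sg (ldeg b * wdeg x.2) * sg (ldeg b + wdeg x.1)) •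
          bb ((b :: x.1) :: x.2 :: R)) (cl1 k v)
        - sg (ldeg b + wdeg v) • mp (fun x => (b :: v) :: x) (dcut k R) := by
      rw [dcut, cl1, map_add, LC_single, one_smul, map_add, map_zsmul, LC_single, one_smul, LC_LC, cutW,
        if_neg hv, smul_smul, wdeg_cons, wdeg_cons, wdeg_nil, add_zero]
      congr 3
      refine congrArg _ (funext fun x => ?_)
      rw [map_zsmul, LC_single, one_smul, cutW]
      split_ifs
      · simp
      · rw [smul_smul]; rfl
    have e4 : LC (fun x => LC (fun Y => hW k 0 ([b] :: Y)) (cutW k R x)) (cl1 k v) =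
        (sg (ldeg b) * sg (ldeg b + ldeg b * wdeg v)) •
          LC (fun x => if x.2 = [] then 0 else (sg (ldeg b * wdeg x.2) * sg (ldeg b + wdeg x.1)) •
          bb ((b :: x.1) :: x.2 :: R)) (cl1 k v) := by
      rw [← LC_zsmul]
      refine LC_congr (cl1_supp v) fun x hx => ?_
      rw [cutW]
      split_ifs
      · simp
      · rw [map_zsmul, LC_single, one_smul, e1, smul_smul, smul_smul, ← hx.2, wdeg_append, mul_add]
        simp only [sg_add]
        congr 1
        have h1 := sg_sq (ldeg b)
        have h2 := sg_sq (ldeg b * wdeg x.2)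
        generalize sg (ldeg b) = A at *
        generalize sg (ldeg b * wdeg x.2) = C at *
        linear_combination (-(sg (wdeg x.1) * A * sg (ldeg b * wdeg x.1))) * (A * A * h2 + h1)
    rw [e2, e3, e4]
    simp only [smul_sub, smul_add, smul_smul]
    rcases sg_cases (ldeg b) with h1 | h1 <;> rcases sg_cases (ldeg b * wdeg v) with h2 | h2 <;>
      rcases sg_cases (wdeg v) with h3 | h3 <;> simp [h1, h2, h3, sg_add]

theorem hW_contr (i : ℕ) : ∀ W : Cf G, SS i W →
    LC (hW k i) (dcut k W) + LC (dcut k) (hW k i W) = bb W := by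
  induction i with
  | zero => exact hW_contr0
  | succ i ih =>
    intro W h
    match W, h with
    | [a] :: W, h =>
      have e := ih W h
      have e1 : ∀ W : Cf G, hW k (i + 1) ([a] :: W) = (- sg (ldeg a)) • mp (fun x => [a] :: x) (hW k i W) :=
        fun W => by rw [hW]
      rw [dcut_single, e1, map_zsmul, map_zsmul, LC_mp, LC_mp]
      simp only [e1, dcut_single]
      rw [LC_zsmul, LC_zsmul, smul_smul, smul_smul, neg_mul_neg, sg_sq, one_smul, one_smul, ← map_LC, ← map_LC,
        ← map_add, e, mp_single]

theorem De_dl_comm {a b : ℕ} (W : Cf G) (p : ℕ) (h : a + b ≤ p) :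
    (dl ls a b * De p W : LB G) = De p W * dl ls a b := by
  symm
  refine dl_intertwine _ fun i hi => ?_
  exact (De_s_comm W p (by omega)).symm

theorem SS_of (i : ℕ) : ∀ (W : Cf G) (p : ℕ) (y : LB G), Valid W → i + 1 < wt W → (∃ γ, γ * De p W = y) →
    (∀ j < i, ¬ ∃ z, y = z * ls (p + j)) → SS i W := by
  induction i with
  | zero => intro W p y hV hw _ _; exact ⟨by omega, hV⟩
  | succ i ih =>
    intro W p y hV hw hy hj
    match W, hV, hw, hy with
    | [], _, hw, _ => simp at hw
    | [] :: W, hV, _, _ => exact absurd rfl (valid_cons.1 hV).1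
    | [a] :: W, hV, hw, ⟨γ, hy⟩ =>
      refine ih W (p + 1) y (valid_cons.1 hV).2 ?_ ⟨γ, ?_⟩ fun j hj' => ?_
      · simp at hw; omega
      · rw [← hy, De]; simp
      · have := hj (j + 1) (by omega)
        rwa [show p + (j + 1) = p + 1 + j by omega] at this
    | (a :: b :: u) :: W, hV, hw, ⟨γ, hy⟩ =>
      obtain ⟨z, hz⟩ := dl_div (lb_rel (G := G)).toBRel p u.length
      refine absurd ⟨γ * De (p + (a :: b :: u).length) W * z, ?_⟩ (hj 0 (by omega))
      rw [← hy, De, List.length_cons, List.length_cons, hz]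
      simp only [mul_assoc, add_zero]

theorem hW_supp (i : ℕ) : ∀ (W : Cf G) (p : ℕ) (y : LB G), Valid W → (∃ γ, γ * De p W = y) →
    (∃ z, y = z * ls (p + i)) → hW k i W ∈ Finsupp.supported k k
      {W' | W' ∈ dvd p y ∧ wt W' = wt W ∧ cdeg W' = cdeg W + 1 ∧ NL W' = NL W} := by
  induction i with
  | zero =>
    intro W p y hV hy hz
    match W, hV, hy with
    | [], _, _ => rw [hW] <;> simp
    | [] :: W, hV, _ => exact absurd rfl (valid_cons.1 hV).1
    | [[_]], _, _ => rw [hW] <;> simp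
    | (b :: b' :: u) :: R, _, _ => rw [hW_zero_cons]; exact Submodule.zero_mem _
    | [b] :: v :: R, hV, ⟨γ, hy⟩ =>
      have h1 := (valid_cons.1 hV).2
      have hv := (valid_cons.1 h1).1
      have hR := (valid_cons.1 h1).2
      rw [hW]
      refine Submodule.smul_of_tower_mem _ _ (Finsupp.single_mem_supported _ _ ⟨?_, ?_, ?_, ?_⟩)
      · obtain ⟨z, hz⟩ := hz
        rw [De, De, List.length_singleton, dl_one, mul_one, ← De_dl_comm _ _ le_rfl, ← mul_assoc] at hy
        have h2 := hy.trans hz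
        rw [add_zero] at h2
        obtain ⟨Z, hZ, -⟩ := De_far R _ (by have := List.length_pos_iff.2 hv; omega) _ _ h2
        obtain ⟨Z', hZ'⟩ := merge lb_rel.toBRel lb_garside p v.length (List.length_pos_iff.2 hv) _ _ hZ
        refine ⟨valid_cons.2 ⟨by simp, hR⟩, Z', ?_⟩
        rw [De, List.length_cons, ← hy, hZ', ← De_dl_comm _ _ le_rfl, dl_succ, show p + 1 + v.length = p + (v.length + 1) by omega]
        simp only [mul_assoc]
      · simp; omega
      · have := wdeg_pos hv
        simp [ldeg]; omega
      · simp [NL, nl]; omega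
  | succ i ih =>
    intro W p y hV hy hz
    match W, hV, hy with
    | [], _, _ => rw [hW] <;> simp
    | [] :: W, hV, _ => exact absurd rfl (valid_cons.1 hV).1
    | (b :: b' :: u) :: R, _, _ => rw [hW] <;> simp
    | [a] :: W, hV, ⟨γ, hy⟩ =>
      rw [hW]
      obtain ⟨z, hz⟩ := hz
      refine Submodule.smul_of_tower_mem _ _ (mp_mem (ih W (p + 1) y (valid_cons.1 hV).2 ⟨γ, ?_⟩ ⟨z, ?_⟩) ?_)
      · rw [← hy, De]; simp
      · rw [hz]; congr 2; omega
      · rintro W' ⟨⟨h1, γ', h2⟩, h3, h4, h5⟩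
        refine ⟨⟨valid_cons.2 ⟨by simp, h1⟩, γ', ?_⟩, ?_, ?_, ?_⟩
        · rw [← h2, De]; simp
        · simp [h3]
        · simp [h4]; omega
        · simp [NL, h5]

end contr
end BR
end

noncomputable section

namespace BR
section stage1
variable {k G : Type} [CommRing k] [Group G]

theorem Nn_of_dl {n p q : ℕ} {a : LB G} (h : a * dl ls p q ∈ Nn G n) : a ∈ Nn G n := by
  have : (dl ls p q : LB G) = lbx (dl bs p q) := by
    have hc : ∀ p q, (cc ls p q : LB G) = lbx (cc bs p q) := by
      intro p q
      induction q with
      | zero => simp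
      | succ q ih => rw [cc_succ, cc_succ, map_mul, ih]; rfl
    induction q generalizing p a with
    | zero => simp [dl_zero]
    | succ q ih => 
      rw [dl_succ, dl_succ, map_mul, hc]
      rw [dl_succ, ← mul_assoc] at h
      rw [ih h]
  rw [this] at h
  exact mem_of_mul_lbx h

theorem Nn_of_De {n : ℕ} (W : Cf G) : ∀ {p : ℕ} {a : LB G}, a * De p W ∈ Nn G n → a ∈ Nn G n := by
  induction W with
  | nil => intro p a h; simpa [De] using h
  | cons w W ih =>
    intro p a h
    rw [De, ← mul_assoc] at h
    exact ih (Nn_of_dl h)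

theorem De_mem {n : ℕ} (W : Cf G) : ∀ p : ℕ, p + wt W ≤ n → De p W ∈ Nn G n := by
  induction W with
  | nil => intro p h; exact one_mem _
  | cons w W ih =>
    intro p h
    rw [wt_cons] at h
    refine mul_mem (ih _ (by omega)) (dl_mem _ fun i hi => ?_)
    rw [ls_mem]; omega

/-- allowed generators -/
def TT (G : Type) [Group G] (n q : ℕ) : Set (LB G × Cf G) := {x | x.1 ∈ Nn G n ∧ x.2 ∈ CS G n q}

/-- generators of the monoid algebra of `Nn`. -/
def ns (k G : Type) [CommRing k] [Group G] (n : ℕ) (i : ℕ) : MonoidAlgebra k (Nn G n) :=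
  if h : i + 1 < n then oo k ⟨ls i, ls_mem.2 h⟩ else 0
def nt (k G : Type) [CommRing k] [Group G] (n : ℕ) (g : G) (i : ℕ) : MonoidAlgebra k (Nn G n) :=
  if h : i < n then oo k ⟨lt g i, lt_mem g h⟩ else 1

def nin (k G : Type) [CommRing k] [Group G] (n : ℕ) : MonoidAlgebra k (Nn G n) →+* MonoidAlgebra k (LB G) :=
  MonoidAlgebra.mapDomainRingHom k (Nn G n).subtype

theorem nin_oo (n : ℕ) (γ : Nn G n) (c : k) :
    nin k G n (MonoidAlgebra.single γ c) = MonoidAlgebra.single (γ : LB G) c := by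
  simp [nin]

theorem nin_dC {n p : ℕ} (W : Cf G) (h : p + wt W ≤ n) :
    nm (nin k G n) (dC (ns k G n) (nt k G n) p W) = dC (ms k G) (mt k G) p W := by
  refine nm_dC _ W (fun i hi => ?_) (fun g i hi => ?_)
  · rw [ns, dif_pos (by omega), nin_oo]
  · rw [nt, dif_pos (by omega), nin_oo]

theorem nin_sp {n : ℕ} {α : Type} (X : α →₀ MonoidAlgebra k (Nn G n)) :
    nm (nin k G n) X ∈ SP (k := k) {x | x.1 ∈ Nn G n} := by
  induction X using Finsupp.induction_linear with
  | zero => rw [map_zero]; exact Submodule.zero_mem _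
  | add f g hf hg => rw [map_add]; exact Submodule.add_mem _ hf hg
  | single a b =>
    rw [nm_single]
    induction b using MonoidAlgebra.induction_linear with
    | zero => rw [map_zero, Finsupp.single_zero]; exact Submodule.zero_mem _
    | add f g hf hg => rw [map_add, Finsupp.single_add]; exact Submodule.add_mem _ hf hg
    | single γ c =>
      rw [nin_oo]
      have : Finsupp.single a (MonoidAlgebra.single (γ : LB G) c) = c • gn k (γ : LB G) a := by
        simp [gn, oo, MonoidAlgebra.smul_single]
      rw [this]
      exact Submodule.smul_mem _ _ (sp_gen γ.2)

theorem dC_Nn {n p : ℕ} (W : Cf G) (h : p + wt W ≤ n) :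
    dC (ms k G) (mt k G) p W ∈ SP (k := k) {x | x.1 ∈ Nn G n} := by
  rw [← nin_dC W h]; exact nin_sp _

/-- the differential as a `k`-linear map -/
abbrev dd (k G : Type) [CommRing k] [Group G] :
    (Cf G →₀ MonoidAlgebra k (LB G)) →ₗ[k] (Cf G →₀ MonoidAlgebra k (LB G)) :=
  LK (dC (ms k G) (mt k G) 0)

theorem dd_gen (γ : LB G) (W : Cf G) : dd k G (gn k γ W) = oo k γ • dC (ms k G) (mt k G) 0 W := LC_gen _ _ _

theorem ms_rel : BTRel (ms k G) (mt k G) := by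
  have f : ∀ a b : LB G, oo k a * oo k b = oo k (a * b) := fun a b => by
    rw [MonoidAlgebra.single_mul_single, one_mul]
  have H := lb_rel (G := G)
  refine ⟨⟨?_, ?_⟩, ?_, ?_, ?_, ?_, ?_, ?_⟩ <;> intros <;> simp only [f, ms, mt]
  · rw [H.comm _ _ (by assumption)]
  · rw [H.braid _ _ (by assumption)]
  · rw [← H.t_mul]
  · rw [H.t_one]; rfl
  · rw [H.tt_comm _ _ _ _ (by assumption)]
  · rw [H.st_comm _ _ _ (by assumption) (by assumption)]
  · rw [H.slide]
  · rw [H.slide']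

theorem dd_dd (X : Cf G →₀ MonoidAlgebra k (LB G)) : dd k G (dd k G X) = 0 := by
  change LC _ (LC _ X) = 0
  rw [LC_LC]
  have H : ∀ W, LC (dC (ms k G) (mt k G) 0) (dC (ms k G) (mt k G) 0 W) = 0 := fun W =>
    dC_dC (B := MonoidAlgebra k (LB G)) (by exact ms_rel) W 0
  simp only [H]
  exact LC_zero _

theorem dd_TT {n q : ℕ} {X : Cf G →₀ MonoidAlgebra k (LB G)} (hX : X ∈ SP (k := k) (TT G n (q + 1))) :
    dd k G X ∈ SP (k := k) (TT G n q) := by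
  refine gen_map hX _ _ fun γ W ⟨h1, h2⟩ => ?_
  rw [dd_gen]
  have e1 := dC_Nn (k := k) (p := 0) (n := n) W (by have := h2.2.1; simp only at this; omega)
  have e2 := SP_supported (k := k).1 (dC_supp (s := ms k G) (t := mt k G) h2 0)
  exact sp_smul (SP_inter e1 e2) γ fun γ' a h => ⟨mul_mem h1 h.1, h.2⟩

open Classical in
def hh (k G : Type) [CommRing k] [Group G] :
    (Cf G →₀ MonoidAlgebra k (LB G)) →ₗ[k] (Cf G →₀ MonoidAlgebra k (LB G)) :=
  kl fun γ W => if h : ∃ i, ∃ z, γ * De 0 W = z * ls i then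
    LC (B := k) (ee k 0 (γ * De 0 W)) (hW k (Nat.find h) W) else 0

/-- the minimal right divisor -/
def md (y : LB G) (i : ℕ) : Prop := (∃ z, y = z * ls i) ∧ ∀ j < i, ¬ ∃ z, y = z * ls j

theorem md_ex {y : LB G} (h : llen y ≠ 0) : ∃ i, md y i := by
  classical
  have h' : ∃ i, ∃ z, y = z * ls i := by
    obtain ⟨i, z, h⟩ := lb_len_pos y h
    exact ⟨i, z, h⟩
  exact ⟨Nat.find h', Nat.find_spec h', fun j hj => Nat.find_min h' hj⟩

theorem hh_gen {γ y : LB G} {W : Cf G} {i : ℕ} (hy : γ * De 0 W = y) (hi : md y i) :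
    hh k G (gn k γ W) = LC (B := k) (ee k 0 y) (hW k i W) := by
  classical
  subst hy
  have h' : ∃ i, ∃ z, γ * De 0 W = z * ls i := ⟨i, hi.1⟩
  rw [hh, kl_gen, dif_pos h']
  have : Nat.find h' = i := by
    rw [Nat.find_eq_iff]; exact hi
  rw [this]

theorem hh_zero {γ : LB G} {W : Cf G} (h : llen (γ * De 0 W) = 0) : hh k G (gn k γ W) = 0 := by
  rw [hh, kl_gen, dif_neg]
  rintro ⟨i, z, h'⟩
  rw [h'] at h
  simp at h

/-- `level` -/
def lvl (x : LB G × Cf G) : ℕ := llen x.1 + fW x.2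

theorem lvl_eq {γ y : LB G} {W : Cf G} (hy : γ * De 0 W = y) : lvl (γ, W) = llen y + NL W := by
  have := llen_De W 0
  rw [← hy, llen_mul, lvl]; simp only; omega

theorem ee_mem {y : LB G} {W : Cf G} {T : Set (LB G × Cf G)} (h : ∀ γ, γ * De 0 W = y → (γ, W) ∈ T) :
    ee k 0 y W ∈ SP (k := k) T := by
  by_cases h' : ∃ γ, γ * De 0 W = y
  · obtain ⟨γ, hγ⟩ := h'
    rw [ee_eq hγ]; exact sp_gen (h γ hγ)
  · rw [ee, dif_neg h']; exact Submodule.zero_mem _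

/-- homotopy preserves things -/
theorem hh_gen_mem {n q N : ℕ} {γ : LB G} {W : Cf G} (h : (γ, W) ∈ TT G n q) (hl : lvl (γ, W) < N) :
    hh k G (gn k γ W) ∈ SP (k := k) (TT G n (q + 1) ∩ {x | lvl x < N}) := by
  by_cases h0 : llen (γ * De 0 W) = 0
  · rw [hh_zero h0]; exact Submodule.zero_mem _
  obtain ⟨i, hi⟩ := md_ex h0
  rw [hh_gen rfl hi]
  obtain ⟨h1, h2, h3, h4⟩ := h
  refine LC_mem (hW_supp i W 0 _ h2 ⟨γ, rfl⟩ (by rw [zero_add]; exact hi.1)) _ ?_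
  rintro W' ⟨h5, h6, h7, h8⟩
  refine ee_mem fun γ' hγ' => ⟨⟨?_, h5.1, ?_, ?_⟩, ?_⟩
  · have : γ * De 0 W ∈ Nn G n := mul_mem h1 (De_mem W 0 (by simp only at h3; omega))
    rw [← hγ'] at this
    exact Nn_of_De _ this
  · exact h6.trans h3
  · rw [h7, h4]
  · rw [Set.mem_setOf_eq, lvl_eq hγ']
    rw [lvl_eq rfl] at hl
    rw [h8]; exact hl

theorem hh_mem {n q N : ℕ} {X : Cf G →₀ MonoidAlgebra k (LB G)}
    (hX : X ∈ SP (k := k) (TT G n q ∩ {x | lvl x < N})) :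
    hh k G X ∈ SP (k := k) (TT G n (q + 1) ∩ {x | lvl x < N}) :=
  gen_map hX _ _ fun _ _ h => hh_gen_mem h.1 h.2

theorem hh_TT {n q : ℕ} {X : Cf G →₀ MonoidAlgebra k (LB G)}
    (hX : X ∈ SP (k := k) (TT G n q)) : hh k G X ∈ SP (k := k) (TT G n (q + 1)) :=
  gen_map hX _ _ fun γ W h => SP_mono Set.inter_subset_left (hh_gen_mem (N := lvl (γ, W) + 1) h (Nat.lt_succ_self _))

theorem oo_smul_LC {γ y : LB G} {x : Cf G →₀ k} (hx : x ∈ Finsupp.supported k k (dvd 0 y)) :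
    oo k γ • LC (B := k) (ee k 0 y) x = LC (B := k) (ee k 0 (γ * y)) x := by
  let F : (Cf G →₀ MonoidAlgebra k (LB G)) →ₗ[k] (Cf G →₀ MonoidAlgebra k (LB G)) :=
    { toFun := fun X => oo k γ • X
      map_add' := smul_add _
      map_smul' := fun c X => by
        ext a γ'
        simp [mul_smul_comm] }
  have := map_LC (B := k) F (ee k 0 y) x
  refine this.trans (LC_congr hx fun W hW => ?_)
  exact ee_smul γ hW.2

theorem dd_ee_low {y : LB G} {W : Cf G} (hV : W ∈ dvd 0 y) :
    dd k G (ee k 0 y W) - LC (B := k) (ee k 0 y) (dcut k W) ∈ SP (k := k) {x | lvl x < llen y + NL W} := by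
  obtain ⟨hV, γ, hγ⟩ := hV
  rw [ee_eq hγ, dd_gen, ← hγ, ← oo_smul_LC (dcut_supp W 0 hV), ← smul_sub]
  refine sp_smul (dC_lead W 0 hV) γ fun γ' W' h => ?_
  have := llen_De W 0
  simp only [lowW, Set.mem_setOf_eq, lvl, llen_mul] at h ⊢
  omega

theorem SS_ex {n i : ℕ} {y : LB G} (hy : y ∈ Nn G n) (hi : md y i) {W : Cf G} (hW : W ∈ dvd 0 y) (hw : wt W = n) :
    SS i W := by
  have h1 : i + 1 < n := by
    obtain ⟨z, hz⟩ := hi.1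
    rw [hz] at hy
    exact (mem_of_mul_ls hy).2
  refine SS_of i W 0 y hW.1 (by omega) hW.2 fun j hj => ?_
  rw [zero_add]; exact hi.2 j hj

theorem dcut_eq {n q i : ℕ} {γ y : LB G} {W : Cf G} (h : (γ, W) ∈ TT G n (q + 1)) (hy : γ * De 0 W = y) (hi : md y i) :
    hh k G (LC (B := k) (ee k 0 y) (dcut k W)) = LC (B := k) (ee k 0 y) (LC (hW k i) (dcut k W)) := by
  rw [map_LC, LC_LC]
  refine LC_congr (dcut_supp W 0 h.2.1) fun W' h' => ?_
  obtain ⟨γ', h'⟩ := h'.2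
  have e : γ * γ' * De 0 W' = y := by rw [mul_assoc, h', hy]
  rw [ee_eq e, hh_gen e hi]

theorem dC_zero_TT {n : ℕ} {γ : LB G} {W : Cf G} (h : (γ, W) ∈ TT G n 0) : dd k G (gn k γ W) = 0 := by
  rw [dd_gen, dC_zero_deg h.2 0, smul_zero]

theorem dcut_zero {n : ℕ} (W : Cf G) : W ∈ CS G n 0 → dcut k W = 0 := by
  induction W generalizing n with
  | nil => intro _; rfl
  | cons w W ih =>
    rintro ⟨h1, h2, h3⟩
    obtain ⟨h4, h5⟩ := valid_cons.1 h1
    rw [cdeg_cons] at h3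
    match w, h4 with
    | [a], _ =>
      rw [dcut_single, ih (n := wt W) ⟨h5, rfl, by omega⟩, map_zero, smul_zero]
    | a :: b :: u, _ =>
      simp [ldeg] at h3

theorem dcut_deg (W : Cf G) : Valid W →
    dcut k W ∈ Finsupp.supported k k {W' | Valid W' ∧ wt W' = wt W ∧ cdeg W' + 1 = cdeg W} := by
  induction W with
  | nil => intro _; exact Submodule.zero_mem _
  | cons w W ih =>
    intro hV
    obtain ⟨h1, h2⟩ := valid_cons.1 hV
    rw [dcut]
    refine Submodule.sub_mem _ (LC_mem (cl1_supp w) _ fun x hx => ?_) (Submodule.smul_of_tower_mem _ _ ?_)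
    · rw [cutW]
      split_ifs with hv
      · exact Submodule.zero_mem _
      · refine Submodule.smul_of_tower_mem _ _ (Finsupp.single_mem_supported _ _ ?_)
        refine ⟨valid_cons.2 ⟨hx.1, valid_cons.2 ⟨hv, h2⟩⟩, ?_, ?_⟩
        · rw [← hx.2]; simp only [wt_cons, List.length_append]; omega
        · have := wdeg_pos hx.1
          have := wdeg_pos hv
          rw [← hx.2]; simp only [cdeg_cons, wdeg_append]; omega
    · refine mp_mem (ih h2) ?_
      rintro W' ⟨h3, h4, h5⟩
      exact ⟨valid_cons.2 ⟨h1, h3⟩, by simp only [wt_cons]; omega, by simp only [cdeg_cons]; omega⟩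

theorem step_gen {n q N : ℕ} {γ : LB G} {W : Cf G} (h : (γ, W) ∈ TT G n q) (hl : lvl (γ, W) < N + 1)
    (h0 : llen (γ * De 0 W) ≠ 0) :
    gn k γ W - dd k G (hh k G (gn k γ W)) - hh k G (dd k G (gn k γ W)) ∈ SP (k := k) {x | lvl x < N} := by
  obtain ⟨i, hi⟩ := md_ex h0
  have hyN : γ * De 0 W ∈ Nn G n := mul_mem h.1 (De_mem W 0 (by have := h.2.2.1; simp only at this; omega))
  have hsupp := hW_supp (k := k) i W 0 _ h.2.1 ⟨γ, rfl⟩ (by rw [zero_add]; exact hi.1)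
  have hlev := lvl_eq (rfl : γ * De 0 W = _)
  generalize hy : γ * De 0 W = y at *
  have hgn : ee k 0 y W = gn k γ W := ee_eq hy
  have hWd : W ∈ dvd 0 y := ⟨h.2.1, γ, hy⟩
  have hSS := SS_ex hyN hi hWd h.2.2.1
  have e1 : gn k γ W = LC (B := k) (ee k 0 y) (LC (hW k i) (dcut k W)) + LC (B := k) (ee k 0 y) (LC (dcut k) (hW k i W)) := by
    rw [← map_add, hW_contr i W hSS, LC_single, one_smul, hgn]
  have e2 : dd k G (hh k G (gn k γ W)) - LC (B := k) (ee k 0 y) (LC (dcut k) (hW k i W)) ∈ SP (k := k) {x | lvl x < N} := by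
    rw [hh_gen hy hi, map_LC, LC_LC, ← LC_sub]
    refine LC_mem hsupp _ ?_
    rintro W' ⟨h1, h2, h3, h4⟩
    refine SP_mono ?_ (dd_ee_low h1)
    intro x hx
    simp only [Set.mem_setOf_eq] at hx ⊢
    omega
  have e3 : hh k G (dd k G (gn k γ W)) - LC (B := k) (ee k 0 y) (LC (hW k i) (dcut k W)) ∈ SP (k := k) {x | lvl x < N} := by
    cases q with
    | zero =>
      rw [dC_zero_TT h, dcut_zero W h.2]; simp
    | succ q =>
      rw [← dcut_eq h hy hi, ← map_sub]
      refine SP_mono Set.inter_subset_right (hh_mem (n := n) (q := q) (SP_inter ?_ ?_))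
      · refine Submodule.sub_mem _ (dd_TT (sp_gen h)) ?_
        have e4 := dcut_supp (k := k) W 0 h.2.1
        have e5 : dcut k W ∈ Finsupp.supported k k (CS G n q) := by
          refine Finsupp.supported_mono (fun x hx => ?_) (dcut_deg (k := k) W h.2.1)
          obtain ⟨f1, f2, f3⟩ := hx
          exact ⟨f1, f2.trans h.2.2.1, by have := h.2.2.2; simp only at this; omega⟩
        refine LC_mem e5 _ fun W' h' => ee_mem fun γ' hγ' => ⟨?_, h'⟩
        rw [← hγ'] at hyN
        exact Nn_of_De _ hyN
      · have := dd_ee_low (k := k) hWd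
        rw [hgn] at this
        refine SP_mono ?_ this
        intro x hx
        simp only [Set.mem_setOf_eq] at hx ⊢
        omega
  have : gn k γ W - dd k G (hh k G (gn k γ W)) - hh k G (dd k G (gn k γ W)) =
    -(dd k G (hh k G (gn k γ W)) - LC (B := k) (ee k 0 y) (LC (dcut k) (hW k i W))) -
    (hh k G (dd k G (gn k γ W)) - LC (B := k) (ee k 0 y) (LC (hW k i) (dcut k W))) := by
    generalize dd k G (hh k G (gn k γ W)) = D
    generalize hh k G (dd k G (gn k γ W)) = D'
    rw [e1]; abel
  rw [this]
  exact Submodule.sub_mem _ (Submodule.neg_mem _ e2) e3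

/-- all words are single letters -/
def sing : Wd G → Cf G
  | [] => []
  | a :: v => [a] :: sing v

theorem dC_sing_cons (p : ℕ) (a : List G) (W : Cf G) : dC (ms k G) (mt k G) p ([a] :: W) =
    - mp (fun x => [x] :: W) (lb (mt k G) p a) - sg (ldeg a) • mp (fun x => [a] :: x) (dC (ms k G) (mt k G) (p + 1) W) := by
  have e1 : LC (cutT (B := MonoidAlgebra k (LB G)) W) (cop (ms k G) p [a]) = gn k (1 : LB G) ([], [a] :: W) := by
    have : cop (ms k G) p [a] = oo k (1 : LB G) • copL (ms k G) p a ([], []) := LC_gen _ _ _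
    rw [this, copL_gen, map_add, map_zsmul, cutT_gen, cutT_gen]
    simp
  rw [dC, dEb, map_add, map_sub, e1, map_zsmul, qm_gen, wb, wb, map_zero, zero_add]
  have e2 : ∀ (x : Cf G →₀ MonoidAlgebra k (LB G)), qm (mp (fun y => ([a], y)) x) = mp (fun x => [a] :: x) x := by
    intro x
    refine gen_eq (SP_univ x) (((qm ∘ₗ mp (fun y => ([a], y))).restrictScalars k)) ((mp (fun x => [a] :: x)).restrictScalars k) ?_
    intro γ b _
    change qm (mp _ _) = mp _ _
    rw [mp_gen, mp_gen, qm_gen]; simp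
  have e3 : ∀ (x : List G →₀ MonoidAlgebra k (LB G)), qm (mp (fun x => (x, W)) (mp (fun x => [x]) x)) = mp (fun x => [x] :: W) x := by
    intro x
    refine gen_eq (SP_univ x) (((qm ∘ₗ mp (fun x => (x, W)) ∘ₗ mp (fun x => [x])).restrictScalars k)) ((mp (fun x => [x] :: W)).restrictScalars k) ?_
    intro γ b _
    change qm (mp _ (mp _ _)) = mp _ _
    rw [mp_gen, mp_gen, mp_gen, qm_gen]; simp
  rw [e2]
  simp only [wdeg_nil, sg_zero, one_smul, List.length_nil, add_zero, wdeg_cons, if_true, sub_zero, List.length_cons, zero_add]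
  rw [e3]
  abel

/-- level zero generators -/
def QQ (G : Type) [Group G] : Set (LB G × Cf G) := {x | llen x.1 = 0 ∧ ∃ v, x.2 = sing v}

theorem dC_QQ (v : Wd G) : ∀ p, dC (ms k G) (mt k G) p (sing v) ∈ SP (k := k) (QQ G) := by
  induction v with
  | nil => intro p; exact Submodule.zero_mem _
  | cons a v ih =>
    intro p
    rw [sing, dC_sing_cons]
    refine Submodule.sub_mem _ (Submodule.neg_mem _ (sp_mp (lb_sp _ _) fun γ x hx => ?_)) (sp_zsmul (sp_mp (ih _) ?_) _)
    · exact ⟨hx.1, x :: v, rfl⟩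
    · rintro γ x ⟨h1, v', h2⟩
      exact ⟨h1, a :: v', by rw [sing, ← h2]⟩

theorem De_sing (v : Wd G) : ∀ p, De p (sing v) = 1 := by
  induction v with
  | nil => intro p; rfl
  | cons a v ih => intro p; rw [sing, De, ih]; simp [dl_one]

theorem sing_of_De (W : Cf G) : ∀ p, Valid W → llen (De p W) = 0 → ∃ v, W = sing v := by
  induction W with
  | nil => intro p _ _; exact ⟨[], rfl⟩
  | cons w W ih =>
    intro p hV h
    obtain ⟨h1, h2⟩ := valid_cons.1 hV
    rw [De, llen_mul] at h
    obtain ⟨v, rfl⟩ := ih (p + w.length) h2 (by omega)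
    match w, h1 with
    | [a], _ => exact ⟨a :: v, rfl⟩
    | a :: b :: u, _ =>
      rw [List.length_cons, dl_succ, llen_mul, llen_cc] at h
      simp at h

theorem dd_QQ {X : Cf G →₀ MonoidAlgebra k (LB G)} (hX : X ∈ SP (k := k) (QQ G)) :
    dd k G X ∈ SP (k := k) (QQ G) := by
  refine gen_map hX _ _ ?_
  rintro γ W ⟨h1, v, h2⟩
  simp only at h1 h2
  rw [dd_gen, h2]
  refine sp_smul (dC_QQ v 0) γ ?_
  rintro γ' W' ⟨h3, h4⟩
  exact ⟨by simp only [llen_mul] at h3 ⊢; omega, h4⟩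

theorem hh_QQ {X : Cf G →₀ MonoidAlgebra k (LB G)} (hX : X ∈ SP (k := k) (QQ G)) : hh k G X = 0 := by
  refine gen_eq hX _ 0 ?_
  rintro γ W ⟨h1, v, h2⟩
  simp only at h1 h2
  rw [h2, hh_zero]
  · rfl
  · rw [De_sing, mul_one, h1]

theorem stage1_aux {n q : ℕ} (N : ℕ) : ∀ {X : Cf G →₀ MonoidAlgebra k (LB G)},
    X ∈ SP (k := k) (TT G n q ∩ ({x | lvl x < N} ∪ QQ G)) → dd k G X = 0 →
    ∃ Y ∈ SP (k := k) (TT G n (q + 1)), X - dd k G Y ∈ SP (k := k) (TT G n q ∩ QQ G) := by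
  induction N with
  | zero =>
    intro X hX _
    refine ⟨0, Submodule.zero_mem _, ?_⟩
    rw [map_zero, sub_zero]
    refine SP_mono ?_ hX
    rintro x ⟨h1, h2 | h2⟩
    · exact absurd h2 (Nat.not_lt_zero _)
    · exact ⟨h1, h2⟩
  | succ N ih =>
    intro X hX hd
    have hXT := SP_mono (k := k) Set.inter_subset_left hX
    have h1 : X - dd k G (hh k G X) ∈ SP (k := k) (TT G n q ∩ ({x | lvl x < N} ∪ QQ G)) := by
      refine SP_inter (Submodule.sub_mem _ hXT (dd_TT (hh_TT hXT))) ?_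
      have : X - dd k G (hh k G X) = (LinearMap.id - dd k G ∘ₗ hh k G - hh k G ∘ₗ dd k G :
          (Cf G →₀ MonoidAlgebra k (LB G)) →ₗ[k] (Cf G →₀ MonoidAlgebra k (LB G))) X := by
        change _ = X - dd k G (hh k G X) - hh k G (dd k G X)
        rw [hd, map_zero, sub_zero]
      rw [this]
      refine gen_map hX _ _ ?_
      rintro γ W ⟨h1, h2⟩
      change gn k γ W - dd k G (hh k G (gn k γ W)) - hh k G (dd k G (gn k γ W)) ∈ _
      by_cases h3 : (γ, W) ∈ QQ G
      · rw [hh_QQ (sp_gen h3), hh_QQ (dd_QQ (sp_gen h3)), map_zero, sub_zero, sub_zero]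
        exact sp_gen (Or.inr h3)
      · refine SP_mono Set.subset_union_left (step_gen h1 (h2.resolve_right h3) fun h4 => h3 ?_)
        rw [llen_mul] at h4
        exact ⟨by simp only; omega, sing_of_De W 0 h1.2.1 (by omega)⟩
    obtain ⟨Y, hY, hY'⟩ := ih h1 (by rw [map_sub, hd, dd_dd, sub_zero])
    refine ⟨hh k G X + Y, Submodule.add_mem _ (hh_TT hXT) hY, ?_⟩
    rwa [map_add, ← sub_sub]

theorem lvl_bdd (T : Set (LB G × Cf G)) {X : Cf G →₀ MonoidAlgebra k (LB G)} (hX : X ∈ SP (k := k) T) :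
    ∃ N, X ∈ SP (k := k) (T ∩ {x | lvl x < N}) := by
  let P : Submodule k (Cf G →₀ MonoidAlgebra k (LB G)) :=
    { carrier := {X | ∃ N, X ∈ SP (k := k) (T ∩ {x | lvl x < N})}
      zero_mem' := ⟨0, Submodule.zero_mem _⟩
      add_mem' := by
        rintro X Y ⟨N, hX⟩ ⟨M, hY⟩
        refine ⟨max N M, Submodule.add_mem _ (SP_mono ?_ hX) (SP_mono ?_ hY)⟩
        · rintro x ⟨h1, h2⟩; exact ⟨h1, (lt_max_of_lt_left h2 : lvl x < max N M)⟩
        · rintro x ⟨h1, h2⟩; exact ⟨h1, (lt_max_of_lt_right h2 : lvl x < max N M)⟩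
      smul_mem' := by
        rintro c X ⟨N, hX⟩
        exact ⟨N, Submodule.smul_mem _ _ hX⟩ }
  exact gen_mem hX P fun γ W h => ⟨lvl (γ, W) + 1, sp_gen ⟨h, Nat.lt_succ_self _⟩⟩

theorem stage1 {n q : ℕ} {X : Cf G →₀ MonoidAlgebra k (LB G)}
    (hX : X ∈ SP (k := k) (TT G n q)) (hd : dd k G X = 0) :
    ∃ Y ∈ SP (k := k) (TT G n (q + 1)), X - dd k G Y ∈ SP (k := k) (TT G n q ∩ QQ G) := by
  obtain ⟨N, h⟩ := lvl_bdd _ hX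
  exact stage1_aux N (SP_mono (Set.inter_subset_inter_right _ Set.subset_union_left) h) hd

end stage1
end BR
end

noncomputable section

namespace BR
section stage2
variable {k G : Type} [CommRing k] [Group G]

/-- multiplication by a monoid element, as a `k`-linear map -/
def SM {α : Type} (γ : LB G) : (α →₀ MonoidAlgebra k (LB G)) →ₗ[k] (α →₀ MonoidAlgebra k (LB G)) where
  toFun := fun X => oo k γ • X
  map_add' := smul_add _
  map_smul' := fun c X => by
    ext a γ'
    simp [mul_smul_comm]

theorem SM_apply {α : Type} (γ : LB G) (X : α →₀ MonoidAlgebra k (LB G)) : SM γ X = oo k γ • X := rfl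
theorem SM_gen {α : Type} (γ γ' : LB G) (a : α) : SM γ (gn k γ' a) = gn k (γ * γ') a := smul_gen _ _ _
theorem SM_mp {α β : Type} (γ : LB G) (f : α → β) (X : α →₀ MonoidAlgebra k (LB G)) :
    SM γ (mp f X) = mp f (SM γ X) := by rw [SM_apply, SM_apply, map_smul]

/-- reset a coordinate -/
def up (g : ℕ → G) (p : ℕ) : ℕ → G := Function.update g p 1

open Classical in
/-- The contraction on single-letter configurations. -/
def Hc (k : Type) [CommRing k] : ℕ → (ℕ → G) → Wd G → (Cf G →₀ MonoidAlgebra k (LB G))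
  | _, _, [] => 0
  | p, g, a :: v => - gn k (lbg (up g p)) ([g p :: a] :: sing v) +
      if a = [] then mp (fun x => [[]] :: x) (Hc k (p + 1) (up g p) v) else 0

open Classical in
/-- The augmentation part. -/
def Ac (k : Type) [CommRing k] : ℕ → (ℕ → G) → Wd G → (Cf G →₀ MonoidAlgebra k (LB G))
  | _, g, [] => gn k (lbg g) []
  | p, g, a :: v => if a = [] then mp (fun x => [[]] :: x) (Ac k (p + 1) (up g p) v) else 0

theorem sing_flatten (v : Wd G) : (sing v).flatten = v := by
  induction v with
  | nil => rfl
  | cons a v ih => simp [sing, ih]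

def HK (k G : Type) [CommRing k] [Group G] (p : ℕ) :
    (Cf G →₀ MonoidAlgebra k (LB G)) →ₗ[k] (Cf G →₀ MonoidAlgebra k (LB G)) :=
  kl fun γ W => Hc k p γ.g W.flatten

theorem HK_gen (p : ℕ) (g : ℕ → G) (v : Wd G) : HK k G p (gn k (lbg g) (sing v)) = Hc k p g v := by
  rw [HK, kl_gen, sing_flatten, lbg_g]

/-- configurations from position `p` on -/
def RR (G : Type) [Group G] (p : ℕ) : Set (LB G × Cf G) :=
  {x | ∃ g v, x = (lbg g, sing v) ∧ ∀ j < p, g j = 1}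

theorem lr_one (a : List G) : (lr a : List G →₀ MonoidAlgebra k (LB G)) ∈
    SP (k := k) {x | x.1 = 1 ∧ x.2.length + 1 = a.length} := by
  induction a with
  | nil => exact Submodule.zero_mem _
  | cons g a ih =>
    cases a with
    | nil => exact Submodule.neg_mem _ (sp_gen (by simp))
    | cons h a =>
      rw [lr]
      refine Submodule.sub_mem _ (Submodule.neg_mem _ (sp_gen (by simp))) ?_
      exact sp_mp ih fun γ x hx => by simpa using hx

theorem dC_RR (v : Wd G) : ∀ p, dC (ms k G) (mt k G) p (sing v) ∈ SP (k := k) (RR G p) := by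
  induction v with
  | nil => intro p; exact Submodule.zero_mem _
  | cons a v ih =>
    intro p
    rw [sing, dC_sing_cons]
    refine Submodule.sub_mem _ (Submodule.neg_mem _ ?_) (sp_zsmul (sp_mp (ih _) ?_) _)
    · cases a with
      | nil => rw [lb, map_zero]; exact Submodule.zero_mem _
      | cons x a =>
        rw [lb, map_add]
        refine Submodule.add_mem _ ?_ (sp_mp (lr_one _) ?_)
        · refine Eq.subst (motive := fun z => z ∈ SP (k := k) (RR G p)) (mp_gen (fun x : List G => [x] :: sing v) (lt x p) a).symm ?_
          exact sp_gen ⟨Pi.mulSingle p x, a :: v, rfl, fun j hj => Pi.mulSingle_eq_of_ne (by omega) _⟩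
        · rintro γ y ⟨h1, h2⟩
          simp only at h1
          exact ⟨1, y :: v, by rw [h1, map_one]; rfl, fun _ _ => rfl⟩
    · rintro γ x ⟨g, v', h1, h2⟩
      simp only [Prod.mk.injEq] at h1
      exact ⟨g, a :: v', by rw [h1.1, h1.2]; rfl, fun j hj => h2 j (by omega)⟩

theorem up_mul {g h : ℕ → G} {p : ℕ} (hp : h p = 1) : up (g * h) p = up g p * h := by
  funext j
  by_cases hj : j = p
  · subst hj; simp [up, hp]
  · simp [up, hj]

theorem up_mul' (g : ℕ → G) (p : ℕ) (x : G) : up (g * Pi.mulSingle p x) p = up g p := by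
  funext j
  by_cases hj : j = p
  · subst hj; simp [up]
  · simp [up, hj]

theorem up_lt (g : ℕ → G) (p : ℕ) : lbg (up g p) * lt (g p) p = lbg g := by
  rw [lt, ← map_mul]
  congr 1
  funext j
  by_cases hj : j = p
  · subst hj; simp [up]
  · simp [up, hj]

theorem HK_cons (p : ℕ) (g : ℕ → G) (a : List G) {Y : Cf G →₀ MonoidAlgebra k (LB G)}
    (hY : Y ∈ SP (k := k) (RR G (p + 1))) :
    HK k G p (SM (lbg g) (mp (fun x => [a] :: x) Y)) = - mp (fun x => [g p :: a] :: x) (SM (lbg (up g p)) Y) +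
      if a = [] then mp (fun x => [[]] :: x) (HK k G (p + 1) (SM (lbg (up g p)) Y)) else 0 := by
  let c : k := if a = [] then 1 else 0
  have e := gen_eq hY (HK k G p ∘ₗ SM (lbg g) ∘ₗ (mp (fun x => [a] :: x)).restrictScalars k)
    (- ((mp (fun x => [g p :: a] :: x)).restrictScalars k ∘ₗ SM (lbg (up g p))) +
      c • ((mp (fun x => [[]] :: x)).restrictScalars k ∘ₗ HK k G (p + 1) ∘ₗ SM (lbg (up g p)))) ?_
  · refine Eq.trans e ?_
    change - mp (fun x => [g p :: a] :: x) (SM (lbg (up g p)) Y) +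
      c • mp (fun x => [[]] :: x) (HK k G (p + 1) (SM (lbg (up g p)) Y)) = _
    by_cases h : a = []
    · rw [if_pos h]; simp only [c, if_pos h, one_smul]
    · rw [if_neg h]; simp only [c, if_neg h, zero_smul]
  · rintro γ W ⟨h, v, h1, h2⟩
    simp only [Prod.mk.injEq] at h1
    obtain ⟨rfl, rfl⟩ := h1
    change HK k G p (SM (lbg g) (mp (fun x => [a] :: x) _)) = - mp (fun x => [g p :: a] :: x) (SM (lbg (up g p)) _) +
      c • mp (fun x => [[]] :: x) (HK k G (p + 1) (SM (lbg (up g p)) _))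
    rw [mp_gen, SM_gen, SM_gen, ← map_mul, ← map_mul]
    have := HK_gen (k := k) p (g * h) (a :: v)
    rw [sing] at this
    rw [this, mp_gen, HK_gen, Hc, up_mul (h2 p (by omega)), Pi.mul_apply, h2 p (by omega), mul_one]
    by_cases h : a = []
    · rw [if_pos h]; simp only [c, if_pos h, one_smul]
    · rw [if_neg h]; simp only [c, if_neg h, zero_smul]

theorem HK_one (p : ℕ) (g : ℕ → G) (v : Wd G) {Z : List G →₀ MonoidAlgebra k (LB G)}
    (hZ : Z ∈ SP (k := k) {x | x.1 = 1 ∧ x.2 ≠ []}) :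
    HK k G p (SM (lbg g) (mp (fun x => [x] :: sing v) Z)) =
      - mp (fun x => [g p :: x] :: sing v) (SM (lbg (up g p)) Z) := by
  refine gen_eq hZ (HK k G p ∘ₗ SM (lbg g) ∘ₗ (mp (fun x => [x] :: sing v)).restrictScalars k)
    (- ((mp (fun x => [g p :: x] :: sing v)).restrictScalars k ∘ₗ SM (lbg (up g p)))) ?_
  rintro γ x ⟨h1, h2⟩
  simp only at h1 h2
  subst h1
  change HK k G p (SM (lbg g) (mp (fun x => [x] :: sing v) _)) = - mp (fun x => [g p :: x] :: sing v) (SM (lbg (up g p)) _)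
  rw [mp_gen, SM_gen, SM_gen, mp_gen, mul_one, mul_one]
  have := HK_gen (k := k) p g (x :: v)
  rw [sing] at this
  rw [this, Hc, if_neg h2, add_zero]

theorem gnsing (γ : LB G) (a : List G) (v : Wd G) : gn k γ ([a] :: sing v) = gn k γ (sing (a :: v)) := rfl

open Classical in
theorem HK_lb (p : ℕ) (g : ℕ → G) (v : Wd G) (a : List G) :
    HK k G p (SM (lbg g) (mp (fun x => [x] :: sing v) (lb (mt k G) p a))) =
      mp (fun x => [x] :: sing v) (SM (lbg (up g p)) (lb (mt k G) p (g p :: a))) - gn k (lbg g) (sing (a :: v))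
      + if a = [] then gn k (lbg (up g p)) (sing ([] :: v)) else 0 := by
  have hs : ∀ x a, (Finsupp.single a (mt k G x p) : List G →₀ MonoidAlgebra k (LB G)) = gn k (lt x p) a := fun _ _ => rfl
  have hb : (bb ([] : List G) : List G →₀ MonoidAlgebra k (LB G)) = gn k 1 [] := rfl
  cases a with
  | nil =>
    rw [if_pos rfl, lb, lb, lr, map_zero, map_zero, map_zero, hs, map_add, map_neg, hb, SM_gen, SM_gen, up_lt, mul_one,
      map_add, map_neg, mp_gen, mp_gen]
    simp only [gnsing]; abel
  | cons x a =>
    rw [if_neg (by simp), add_zero, lb, lb, hs, hs, map_add, map_add, map_add, map_add, map_add, mp_gen, SM_gen, SM_gen, up_lt,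
      mp_gen, lt, ← map_mul, gnsing, HK_gen, Hc, up_mul']
    have hbb : (bb ((g p * x) :: a) : List G →₀ MonoidAlgebra k (LB G)) = gn k 1 ((g p * x) :: a) := rfl
    rw [lr, hbb, map_sub, map_neg, map_sub, map_neg, SM_gen, mul_one, mp_gen, SM_mp (lbg (up g p)), mp_mp]
    have hgp : (g * Pi.mulSingle p x : ℕ → G) p = g p * x := by simp
    rw [hgp]
    cases a with
    | nil =>
      rw [if_pos rfl, lr, hb, map_neg, map_neg, map_neg, map_neg, map_neg, SM_gen, mp_gen, SM_gen, mp_gen, mul_one, mul_one,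
        gnsing (lbg g) [], HK_gen, Hc, if_pos rfl]
      simp only [gnsing]; abel
    | cons y a =>
      rw [if_neg (by simp), HK_one]
      · simp only [gnsing]; abel
      · refine SP_mono ?_ (lr_one _)
        rintro x ⟨h1, h2⟩
        refine ⟨h1, fun h => ?_⟩
        rw [h] at h2; simp at h2

/-- differential from position `p` -/
abbrev dp (k G : Type) [CommRing k] [Group G] (p : ℕ) :
    (Cf G →₀ MonoidAlgebra k (LB G)) →ₗ[k] (Cf G →₀ MonoidAlgebra k (LB G)) :=
  LK (dC (ms k G) (mt k G) p)

theorem dp_gen (p : ℕ) (γ : LB G) (W : Cf G) : dp k G p (gn k γ W) = SM γ (dC (ms k G) (mt k G) p W) := LC_gen _ _ _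

theorem dp_empty (p : ℕ) (X : Cf G →₀ MonoidAlgebra k (LB G)) :
    dp k G p (mp (fun x => [[]] :: x) X) = mp (fun x => [[]] :: x) (dp k G (p + 1) X) := by
  refine gen_eq (SP_univ X) (dp k G p ∘ₗ (mp (fun x => [[]] :: x)).restrictScalars k)
    ((mp (fun x => [[]] :: x)).restrictScalars k ∘ₗ dp k G (p + 1)) ?_
  intro γ W _
  change dp k G p (mp (fun x => [[]] :: x) _) = mp (fun x => [[]] :: x) (dp k G (p + 1) _)
  rw [mp_gen, dp_gen, dp_gen, dC_sing_cons, ← SM_mp, lb, map_zero, neg_zero, zero_sub]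
  congr 1
  have : ldeg ([] : List G) = 1 := rfl
  rw [this, sg_one, neg_smul, one_smul, neg_neg]

open Classical in
theorem contr2 (v : Wd G) : ∀ (p : ℕ) (g : ℕ → G),
    dp k G p (Hc k p g v) + HK k G p (dp k G p (gn k (lbg g) (sing v))) = gn k (lbg g) (sing v) - Ac k p g v := by
  induction v with
  | nil =>
    intro p g
    rw [Hc, map_zero, dp_gen, sing, dC, map_zero, map_zero, Ac]; simp
  | cons a v ih =>
    intro p g
    have hY := dC_RR (k := k) v (p + 1)
    have ihh := ih (p + 1) (up g p)
    rw [dp_gen] at ihh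
    rw [Hc, map_add, map_neg, dp_gen, dp_gen, sing, dC_sing_cons, dC_sing_cons]
    set Y := dC (ms k G) (mt k G) (p + 1) (sing v) with hYd
    have e1 : ldeg (g p :: a) = ldeg a + 1 := rfl
    rw [e1, sg_succ]
    rw [map_sub (SM (lbg g)), map_neg (SM (lbg g)), map_zsmul, map_sub (HK k G p), map_neg (HK k G p), map_zsmul, HK_lb, HK_cons p g a hY,
      map_sub (SM _), map_neg (SM _), map_zsmul, SM_mp, SM_mp, Ac]
    by_cases h : a = []
    · subst h
      have e2 : ldeg ([] : List G) = 1 := rfl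
      rw [if_pos rfl, if_pos rfl, if_pos rfl, if_pos rfl, e2, sg_one, dp_empty]
      have e3 := congrArg (mp (fun x : Cf G => [[]] :: x)) ihh
      rw [map_add, map_sub, mp_gen] at e3
      rw [eq_sub_iff_add_eq] at e3
      rw [sing, ← sub_eq_zero]
      have e4 := sub_eq_zero.2 e3
      rw [← e4]
      module
    · rw [if_neg h, if_neg h, if_neg h, if_neg h, map_zero]
      rw [sing]; module

open Classical in
theorem Hc_sp (v : Wd G) : ∀ (p : ℕ) (g : ℕ → G), Hc k p g v ∈ SP (k := k)
    {x | ∃ g' v', x = (lbg g', sing v') ∧ (∀ j, g j = 1 → g' j = 1) ∧ v'.length = v.length ∧ nl v' = nl v + 1} := by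
  induction v with
  | nil => intro p g; exact Submodule.zero_mem _
  | cons a v ih =>
    intro p g
    have hup : ∀ j, g j = 1 → up g p j = 1 := by
      intro j hj
      by_cases h : j = p
      · simp [up, h]
      · simpa [up, h] using hj
    rw [Hc]
    refine Submodule.add_mem _ (Submodule.neg_mem _ (sp_gen ⟨up g p, (g p :: a) :: v, rfl, hup, rfl, ?_⟩)) ?_
    · simp only [nl, List.length_cons]; omega
    · split_ifs with h
      · refine sp_mp (ih _ _) ?_
        rintro γ x ⟨g', v', h1, h2, h3, h4⟩
        simp only [Prod.mk.injEq] at h1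
        refine ⟨g', [] :: v', by rw [h1.1, h1.2]; rfl, fun j hj => h2 j (hup j hj), by simp [h3], ?_⟩
        subst h
        simp only [nl]; omega
      · exact Submodule.zero_mem _

open Classical in
theorem Ac_sp (v : Wd G) : ∀ (p : ℕ) (g : ℕ → G), Ac k p g v ∈ SP (k := k)
    {x | ∃ g', x = (lbg g', List.replicate v.length [[]]) ∧ (∀ j, g j = 1 → g' j = 1) ∧
      (∀ j, p ≤ j → j < p + v.length → g' j = 1) ∧ nl v = 0} := by
  induction v with
  | nil => 
    intro p g
    exact sp_gen ⟨g, rfl, fun _ h => h, fun j h1 h2 => by simp at h2; omega, rfl⟩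
  | cons a v ih =>
    intro p g
    have hup : ∀ j, g j = 1 → up g p j = 1 := by
      intro j hj
      by_cases h : j = p
      · simp [up, h]
      · simpa [up, h] using hj
    rw [Ac]
    split_ifs with h
    · refine sp_mp (ih _ _) ?_
      rintro γ x ⟨g', h1, h2, h3, h4⟩
      simp only [Prod.mk.injEq] at h1
      refine ⟨g', by rw [h1.1, h1.2]; rfl, fun j hj => h2 j (hup j hj), fun j hj hj' => ?_, ?_⟩
      · by_cases e : j = p
        · exact h2 j (by simp [up, e])
        · exact h3 j (by omega) (by simp at hj'; omega)
      · subst h; simp only [nl, List.length_nil]; omega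
    · exact Submodule.zero_mem _

theorem sing_CS {n q : ℕ} (v : Wd G) : sing v ∈ CS G n q ↔ v.length = n ∧ nl v = q := by
  have h1 : Valid (sing v) ∧ wt (sing v) = v.length ∧ cdeg (sing v) = nl v := by
    induction v with
    | nil => exact ⟨Valid.nil, rfl, rfl⟩
    | cons a v ih =>
      refine ⟨valid_cons.2 ⟨by simp, ih.1⟩, ?_, ?_⟩
      · rw [sing, wt_cons, ih.2.1]; simp; omega
      · rw [sing, cdeg_cons, ih.2.2, nl]; simp [ldeg]
  constructor
  · rintro ⟨h2, h3, h4⟩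
    exact ⟨h1.2.1 ▸ h3, h1.2.2 ▸ h4⟩
  · rintro ⟨h3, h4⟩
    exact ⟨h1.1, h1.2.1.trans h3, h1.2.2.trans h4⟩

theorem exact_SP {n q : ℕ} {X : Cf G →₀ MonoidAlgebra k (LB G)}
    (hX : X ∈ SP (k := k) (TT G n q)) (hd : dd k G X = 0) :
    ∃ Y ∈ SP (k := k) (TT G n (q + 1)),
      X - dd k G Y ∈ SP (k := k) {x | x = (1, List.replicate n [[]]) ∧ q = 0} := by
  obtain ⟨Y, hY, h⟩ := stage1 hX hd
  set Z := X - dd k G Y with hZ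
  have hdZ : dd k G Z = 0 := by rw [hZ, map_sub, dd_dd, hd, sub_zero]
  have key : ∀ γ W, (γ, W) ∈ TT G n q ∩ QQ G → ∃ g v, γ = lbg g ∧ W = sing v ∧ v.length = n ∧ nl v = q ∧ ∀ j, n ≤ j → g j = 1 := by
    rintro γ W ⟨⟨h1, h2⟩, h3, v, h4⟩
    simp only at h1 h2 h3 h4
    subst h4
    obtain ⟨h5, h6⟩ := (sing_CS v).1 h2
    exact ⟨γ.g, v, lb_len_zero γ h3, rfl, h5, h6, (mem_Nn.1 h1).2⟩
  refine ⟨Y + HK k G 0 Z, Submodule.add_mem _ hY (gen_map h _ _ ?_), ?_⟩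
  · intro γ W hh
    obtain ⟨g, v, rfl, rfl, h1, h2, h3⟩ := key _ _ hh
    rw [HK_gen]
    refine SP_mono ?_ (Hc_sp v 0 g)
    rintro x ⟨g', v', rfl, h4, h5, h6⟩
    refine ⟨?_, (sing_CS v').2 ⟨h5.trans h1, by omega⟩⟩
    exact mem_Nn.2 ⟨by simp, fun j hj => h4 j (h3 j hj)⟩
  · have : X - dd k G (Y + HK k G 0 Z) = (LinearMap.id - dd k G ∘ₗ HK k G 0 - HK k G 0 ∘ₗ dd k G :
          (Cf G →₀ MonoidAlgebra k (LB G)) →ₗ[k] (Cf G →₀ MonoidAlgebra k (LB G))) Z := by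
        change _ = Z - dd k G (HK k G 0 Z) - HK k G 0 (dd k G Z)
        rw [hdZ, map_zero, sub_zero, map_add, ← sub_sub]
    rw [this]
    refine gen_map h _ _ fun γ W hh => ?_
    obtain ⟨g, v, rfl, rfl, h1, h2, h3⟩ := key _ _ hh
    change gn k (lbg g) (sing v) - dp k G 0 (HK k G 0 (gn k (lbg g) (sing v))) - HK k G 0 (dp k G 0 (gn k (lbg g) (sing v))) ∈ _
    have e := contr2 (k := k) v 0 g
    rw [HK_gen, sub_sub, e, sub_sub_cancel]
    refine SP_mono ?_ (Ac_sp v 0 g)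
    rintro x ⟨g', rfl, h4, h5, h6⟩
    refine ⟨?_, by omega⟩
    have : g' = 1 := by
      funext j
      by_cases hj : n ≤ j
      · exact h4 j (h3 j hj)
      · exact h5 j (by omega) (by omega)
    rw [this, map_one, h1]

end stage2
end BR
end

noncomputable section
open scoped TensorProduct

namespace BR

section bar
variable {k : Type} [CommRing k] {A : Type} [Ring A] [Algebra k A]

variable (k A) in
/-- the bar modules -/
abbrev Bq (q : ℕ) : Type := (barC k A q : Type)

instance bqMod (q : ℕ) : Module A (Bq k A (q+1)) :=
  inferInstanceAs (Module A (A ⊗[k] (barC k A q : Type)))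

instance bqTower (q : ℕ) : IsScalarTower k A (Bq k A (q+1)) :=
  inferInstanceAs (IsScalarTower k A (A ⊗[k] (barC k A q : Type)))

/-- unit insertion -/
def un {q : ℕ} : Bq k A q →ₗ[k] Bq k A (q+1) := TensorProduct.mk k A (barC k A q : Type) 1

/-- typed pure tensor -/
def tm {q : ℕ} (a : A) (x : Bq k A q) : Bq k A (q+1) :=
  (TensorProduct.tmul k a (x : (barC k A q : Type)) : A ⊗[k] (barC k A q : Type))

theorem tm_eq {q : ℕ} (a : A) (x : Bq k A q) : tm a x = a • un x := by
  change a ⊗ₜ[k] x = a • (1 : A) ⊗ₜ[k] x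
  rw [TensorProduct.smul_tmul', smul_eq_mul, mul_one]

theorem bq_ind {q : ℕ} {p : Bq k A (q+1) → Prop} (h0 : p 0)
    (h1 : ∀ (a : A) (x : Bq k A q), p (a • un x)) (h2 : ∀ x y, p x → p y → p (x+y))
    (x : Bq k A (q+1)) : p x :=
  TensorProduct.induction_on (motive := p) x h0
    (fun a x => by have := h1 a x; rw [← tm_eq] at this; exact this) h2

/-- extension of a `k`-linear map to an `A`-linear one. -/
def exA {q : ℕ} {P : Type} [AddCommGroup P] [Module k P] [Module A P]
    [IsScalarTower k A P] (f : Bq k A q →ₗ[k] P) : Bq k A (q+1) →ₗ[A] P :=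
  (TensorProduct.AlgebraTensorModule.lift
    (LinearMap.toSpanSingleton A ((barC k A q : Type) →ₗ[k] P) f) :
      A ⊗[k] (barC k A q : Type) →ₗ[A] P)

theorem exA_un {q : ℕ} {P : Type} [AddCommGroup P] [Module k P] [Module A P]
    [IsScalarTower k A P] (f : Bq k A q →ₗ[k] P) (x : Bq k A q) : exA f (un x) = f x := by
  change (1 : A) • f x = f x
  rw [one_smul]

variable (ε : A →ₐ[k] k)

/-- typed `barB` -/
def bB (q : ℕ) : Bq k A (q+1) →ₗ[k] Bq k A q := barB k A ε q

/-- bar resolution differential -/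
def Dm (q : ℕ) : Bq k A (q+1) →ₗ[k] Bq k A q := - bB ε q

/-- reduction -/
def red (q : ℕ) : Bq k A (q+1) →ₗ[k] Bq k A q :=
  TensorProduct.lift ((LinearMap.lsmul k (barC k A q : Type)).comp ε.toLinearMap)

/-- bar differential -/
def bd (q : ℕ) : Bq k A (q+1) →ₗ[k] Bq k A q := bard k A ε q

theorem red_smul {q : ℕ} (a : A) (x : Bq k A (q+1)) : red ε q (a • x) = ε a • red ε q x := by
  have h : ∀ b (y : Bq k A q), red ε q (b • un y) = ε b • y := fun b y => by
    rw [← tm_eq]; exact (TensorProduct.lift.tmul _ _)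
  induction x using bq_ind with
  | h0 => simp
  | h2 x y hx hy => rw [smul_add, map_add, hx, hy, map_add, smul_add]
  | h1 b y => rw [h, smul_smul, h, map_mul, mul_smul]

theorem red_un {q : ℕ} (y : Bq k A q) : red ε q (un y) = y := by
  have : red ε q (un y) = ε 1 • y := TensorProduct.lift.tmul _ _
  rw [this, map_one, one_smul]

theorem bd_eq {q : ℕ} (x : Bq k A (q+1)) : bd ε q x = red ε q x - Dm ε q x := by
  have : bd ε q x = red ε q x + bB ε q x := rfl
  rw [this, Dm, LinearMap.neg_apply, sub_neg_eq_add]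

theorem act_eq (q : ℕ) (a : A) (x : A ⊗[k] (barC k A q : Type)) :
    barActT k A ε q a x = a • x := by
  induction x using TensorProduct.induction_on with
  | zero => simp
  | add x y hx hy => rw [smul_add, map_add, hx, hy]
  | tmul b y => rw [barActT_tmul]; rfl

theorem Dm_zero (a : A) (c : Bq k A 0) : Dm ε 0 (a • un c) = ε a • c := by
  have h : bB ε 0 (tm a c) = -(ε a • c) := barB_zero_apply k A ε a c
  rw [← tm_eq, Dm, LinearMap.neg_apply, h, neg_neg]

theorem Dm_succ (q : ℕ) (a : A) (x : Bq k A (q+1)) :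
    Dm ε (q+1) (a • un x) = a • x - a • un (Dm ε q x) := by
  let ac : Bq k A (q+1) → Bq k A (q+1) := fun y => barActT k A ε q a y
  have h0 : ac x = a • x := act_eq ε q a x
  have h : bB ε (q+1) (tm a x) = - ac x - tm a (bB ε q x) := barB_succ_apply k A ε q a x
  rw [h0, tm_eq, tm_eq] at h
  rw [Dm, LinearMap.neg_apply, h, Dm, LinearMap.neg_apply, map_neg, smul_neg]
  abel

theorem Dm_un (q : ℕ) (x : Bq k A (q+1)) : Dm ε (q+1) (un x) = x - un (Dm ε q x) := by
  have := Dm_succ ε q 1 x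
  simpa using this

theorem Dm_un0 (x : Bq k A 0) : Dm ε 0 (un x) = x := by
  have := Dm_zero ε 1 x
  simpa using this

theorem Dm_smul {q : ℕ} (a : A) (x : Bq k A (q+2)) : Dm ε (q+1) (a • x) = a • Dm ε (q+1) x := by
  induction x using bq_ind with
  | h0 => simp
  | h2 x y hx hy => rw [smul_add, map_add, hx, hy, map_add, smul_add]
  | h1 b y => rw [smul_smul, Dm_succ, Dm_succ, smul_sub, smul_smul, smul_smul]

theorem Dm_smul0 (a : A) (x : Bq k A 1) : Dm ε 0 (a • x) = ε a • Dm ε 0 x := by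
  induction x using bq_ind with
  | h0 => simp
  | h2 x y hx hy => rw [smul_add, map_add, hx, hy, map_add, smul_add]
  | h1 b y => rw [smul_smul, Dm_zero, Dm_zero, map_mul, mul_smul]

theorem DD (q : ℕ) : ∀ x : Bq k A (q+2), Dm ε q (Dm ε (q+1) x) = 0 := by
  induction q with
  | zero =>
    intro x
    induction x using bq_ind with
    | h0 => simp
    | h2 x y hx hy => rw [map_add, map_add, hx, hy, add_zero]
    | h1 b y => rw [Dm_smul, Dm_un, Dm_smul0, map_sub, Dm_un0, sub_self, smul_zero]
  | succ q ih =>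
    intro x
    induction x using bq_ind with
    | h0 => simp
    | h2 x y hx hy => rw [map_add, map_add, hx, hy, add_zero]
    | h1 b y =>
      rw [Dm_smul, Dm_un, Dm_smul, map_sub, Dm_un, ih, map_zero, sub_zero, sub_self, smul_zero]

theorem red_D (q : ℕ) (x : Bq k A (q+2)) :
    red ε q (Dm ε (q+1) x) = bd ε q (red ε (q+1) x) := by
  induction x using bq_ind with
  | h0 => simp
  | h2 x y hx hy => rw [map_add, map_add, hx, hy, map_add, map_add]
  | h1 b y =>
    rw [Dm_smul, Dm_un, red_smul, map_sub, red_un, red_smul, red_un, map_smul, bd_eq]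

/-- cycle condition -/
def IsCyc : ∀ q, Bq k A q → Prop
  | 0, _ => True
  | q+1, x => bd ε q x = 0

theorem mem_cycles {q : ℕ} (x : Bq k A q) : x ∈ barCycles k A ε q ↔ IsCyc ε q x := by
  cases q with
  | zero => exact ⟨fun _ => trivial, fun _ => Submodule.mem_top⟩
  | succ q => exact Iff.rfl

section tor
variable {A₂ : Type} [Ring A₂] [Algebra k A₂] (ε₂ : A₂ →ₐ[k] k) (φ : A →ₐ[k] A₂)
  (hφ : ε₂.comp φ = ε)

/-- typed bar map -/
def bm (q : ℕ) : Bq k A q →ₗ[k] Bq k A₂ q := barMap k φ q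

theorem bm_zero (x : Bq k A 0) : bm φ 0 x = (show Bq k A₂ 0 from (show k from x)) := rfl

theorem bm_un {q : ℕ} (a : A) (x : Bq k A q) : bm φ (q+1) (a • un x) = φ a • un (bm φ q x) := by
  rw [← tm_eq, ← tm_eq]; rfl

theorem bm_un1 {q : ℕ} (x : Bq k A q) : bm φ (q+1) (un x) = un (bm φ q x) := by
  have := bm_un φ 1 x
  simpa using this

theorem bm_smul {q : ℕ} (a : A) (x : Bq k A (q+1)) : bm φ (q+1) (a • x) = φ a • bm φ (q+1) x := by
  induction x using bq_ind with
  | h0 => simp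
  | h2 x y hx hy => rw [smul_add, map_add, hx, hy, map_add, smul_add]
  | h1 b y => rw [smul_smul, bm_un, bm_un, map_mul, mul_smul]

include hφ in
theorem bm_bd {q : ℕ} (x : Bq k A (q+1)) : bd ε₂ q (bm φ (q+1) x) = bm φ q (bd ε q x) :=
  LinearMap.congr_fun (barMap_comm k ε ε₂ φ hφ q) x

include hφ in
theorem bm_red {q : ℕ} (x : Bq k A (q+1)) : red ε₂ q (bm φ (q+1) x) = bm φ q (red ε q x) := by
  induction x using bq_ind with
  | h0 => simp
  | h2 x y hx hy => rw [map_add, map_add, hx, hy, map_add, map_add]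
  | h1 b y => 
    rw [bm_un, red_smul, red_un, red_smul, red_un, map_smul, ← hφ]; rfl

theorem tor_bij (q : ℕ)
    (hs : ∀ x, IsCyc ε₂ q x → ∃ y, IsCyc ε q y ∧ ∃ z, x = bm φ q y + bd ε₂ q z)
    (hi : ∀ x, IsCyc ε q x → (∃ z, bd ε₂ q z = bm φ q x) → ∃ z, bd ε q z = x) :
    Function.Bijective (torMap k ε ε₂ φ hφ q) := by
  constructor
  · rw [injective_iff_map_eq_zero]
    intro X hX
    obtain ⟨⟨x, hx⟩, rfl⟩ := Submodule.Quotient.mk_surjective _ X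
    have h1 : (Submodule.Quotient.mk (⟨bm φ q x, barMap_cycles k ε ε₂ φ hφ q x hx⟩ :
      barCycles k A₂ ε₂ q) : barTor k A₂ ε₂ q) = 0 := hX
    have h2 := (Submodule.Quotient.mk_eq_zero _).1 h1
    obtain ⟨z, hz⟩ := h2
    obtain ⟨w, hw⟩ := hi x ((mem_cycles ε x).1 hx) ⟨z, hz⟩
    exact (Submodule.Quotient.mk_eq_zero _).2 ⟨w, hw⟩
  · intro X
    obtain ⟨⟨x, hx⟩, rfl⟩ := Submodule.Quotient.mk_surjective _ X
    obtain ⟨y, hy, z, hz⟩ := hs x ((mem_cycles ε₂ x).1 hx)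
    refine ⟨Submodule.Quotient.mk ⟨y, (mem_cycles ε y).2 hy⟩, ?_⟩
    change (Submodule.Quotient.mk (⟨bm φ q y, _⟩ :
      barCycles k A₂ ε₂ q) : barTor k A₂ ε₂ q) = Submodule.Quotient.mk ⟨x, hx⟩
    refine (Submodule.Quotient.eq _).2 ⟨-z, ?_⟩
    change bd ε₂ q (-z) = bm φ q y - x
    rw [hz, map_neg]; abel

end tor
end bar
end BR
end

noncomputable section
open scoped TensorProduct

namespace BR

section cmp
variable {k : Type} [CommRing k] {A : Type} [Ring A] [Algebra k A]

/-- resolution data -/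
structure RD (ε : A →ₐ[k] k) (ι : Type) where
  S : ℕ → Set ι
  e0 : ι
  d : ι → (ι →₀ A)
  S0 : S 0 = {e0}
  d0 : d e0 = 0
  dS : ∀ q w, w ∈ S (q+1) → d w ∈ Finsupp.supported A A (S q)
  dd : ∀ q w, w ∈ S (q+1) → LC d (d w) = 0
  aug : ∀ w ∈ S 1, ε (d w e0) = 0
  ex0 : ∀ X ∈ Finsupp.supported A A (S 0), ε (X e0) = 0 →
    ∃ Y ∈ Finsupp.supported A A (S 1), LC d Y = X
  ex : ∀ q, ∀ X ∈ Finsupp.supported A A (S (q+1)), LC d X = 0 →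
    ∃ Y ∈ Finsupp.supported A A (S (q+2)), LC d Y = X

variable {ε : A →ₐ[k] k} {ι : Type} (R : RD ε ι)

/-- the differential -/
abbrev RD.δ : (ι →₀ A) →ₗ[A] (ι →₀ A) := LC R.d

/-- supports -/
abbrev RD.P (q : ℕ) : Submodule A (ι →₀ A) := Finsupp.supported A A (R.S q)

theorem RD.δP {q : ℕ} {X : ι →₀ A} (hX : X ∈ R.P (q+1)) : R.δ X ∈ R.P q :=
  LC_supp hX fun w hw => R.dS q w hw

theorem RD.δδ {q : ℕ} {X : ι →₀ A} (hX : X ∈ R.P (q+1)) : R.δ (R.δ X) = 0 := by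
  rw [LC_LC, LC_congr hX (g := fun _ => 0) fun w hw => R.dd q w hw, LC_zero]

theorem klin {M N : Type} [AddCommGroup M] [Module k M] [Module A M] [IsScalarTower k A M]
    [AddCommGroup N] [Module k N] [Module A N] [IsScalarTower k A N] (f : M →ₗ[A] N) (c : k) (x : M) :
    f (c • x) = c • f x := by
  rw [← algebraMap_smul A c x, map_smul, algebraMap_smul]

/-- restriction of scalars to `k` -/
def rk {M N : Type} [AddCommGroup M] [Module k M] [Module A M] [IsScalarTower k A M]
    [AddCommGroup N] [Module k N] [Module A N] [IsScalarTower k A N] (f : M →ₗ[A] N) : M →ₗ[k] N where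
  toFun := f
  map_add' := map_add f
  map_smul' := klin f

theorem rk_apply {M N : Type} [AddCommGroup M] [Module k M] [Module A M] [IsScalarTower k A M]
    [AddCommGroup N] [Module k N] [Module A N] [IsScalarTower k A N] (f : M →ₗ[A] N) (x : M) :
    rk (k := k) f x = f x := rfl

theorem RD.lift [Module.Free k A] (q : ℕ) (g : (ι →₀ A) →ₗ[k] (ι →₀ A))
    (hg : ∀ X ∈ R.P q, ∃ Y ∈ R.P (q+1), R.δ Y = g X) :
    ∃ h : (ι →₀ A) →ₗ[k] (ι →₀ A), ∀ X ∈ R.P q, h X ∈ R.P (q+1) ∧ R.δ (h X) = g X := by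
  classical
  let pr : (ι →₀ A) →ₗ[A] (ι →₀ A) := LC fun w => if w ∈ R.S q then Finsupp.single w 1 else 0
  have hpr : ∀ X, pr X ∈ R.P q := by
    intro X
    refine LC_mem (S := Set.univ) (by simp [Finsupp.supported_univ]) _ fun w _ => ?_
    split_ifs with h
    · exact Finsupp.single_mem_supported A _ h
    · exact zero_mem _
  have hpr2 : ∀ X ∈ R.P q, pr X = X := by
    intro X hX
    refine (LC_congr hX fun w hw => ?_).trans (LC_id X)
    rw [if_pos hw]
  let b := Module.Free.chooseBasis k (ι →₀ A)
  choose y hy1 hy2 using fun X => hg (pr X) (hpr X)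
  let h : (ι →₀ A) →ₗ[k] (ι →₀ A) := b.constr k fun i => y (b i)
  have e1 : ∀ X, h X ∈ R.P (q+1) := by
    intro X
    have : LinearMap.range h ≤ (R.P (q+1)).restrictScalars k := by
      rw [Module.Basis.constr_range, Submodule.span_le]
      rintro _ ⟨i, rfl⟩
      exact hy1 _
    exact this ⟨X, rfl⟩
  have e2 : (rk (k := k) R.δ).comp h = g.comp (rk (k := k) pr) := by
    refine b.ext fun i => ?_
    simp only [LinearMap.comp_apply, rk_apply]
    rw [Module.Basis.constr_basis]
    exact hy2 _
  refine ⟨h, fun X hX => ⟨e1 X, ?_⟩⟩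
  have := LinearMap.congr_fun e2 X
  simp only [LinearMap.comp_apply, rk_apply] at this
  rw [hpr2 X hX] at this
  exact this

variable (k A) in
/-- degree zero identification -/
def toB : k ≃ₗ[k] Bq k A 0 := (LinearEquiv.refl k k : k ≃ₗ[k] k)

/-- the augmentation section -/
def RD.h0 : Bq k A 0 →ₗ[k] (ι →₀ A) :=
  (LinearMap.toSpanSingleton k _ (Finsupp.single R.e0 1)).comp (toB k A).symm.toLinearMap

/-- the augmentation -/
def RD.η : (ι →₀ A) →ₗ[k] Bq k A 0 :=
  (toB k A).toLinearMap.comp (ε.toLinearMap.comp (Finsupp.lapply R.e0))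

theorem RD.η_apply (X : ι →₀ A) : R.η X = toB k A (ε (X R.e0)) := rfl

theorem RD.e0_mem : R.e0 ∈ R.S 0 := by rw [R.S0]; rfl

theorem RD.h0_apply (c : Bq k A 0) : R.h0 c = (toB k A).symm c • Finsupp.single R.e0 (1 : A) := rfl

theorem RD.h0P (c : Bq k A 0) : R.h0 c ∈ R.P 0 := by
  rw [RD.h0_apply, ← algebraMap_smul A]
  exact Submodule.smul_mem _ _ (Finsupp.single_mem_supported A _ R.e0_mem)

theorem RD.η_h0 (c : Bq k A 0) : R.η (R.h0 c) = c := by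
  rw [RD.h0_apply, map_smul, RD.η_apply, Finsupp.single_eq_same, map_one, ← map_smul, smul_eq_mul,
    mul_one, LinearEquiv.apply_symm_apply]

theorem RD.η_smul (a : A) (X : ι →₀ A) : R.η (a • X) = ε a • R.η X := by
  rw [RD.η_apply, Finsupp.smul_apply, smul_eq_mul, map_mul, RD.η_apply, ← map_smul, smul_eq_mul]

/-- reduction of coefficients -/
abbrev RD.rd (_R : RD ε ι) : (ι →₀ A) →+ (ι →₀ k) := nm (ε : A →+* k)

/-- reduced differential -/
abbrev RD.db : (ι →₀ k) →ₗ[k] (ι →₀ k) := LC fun w => R.rd (R.d w)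

theorem RD.rd_smul (a : A) (X : ι →₀ A) : R.rd (a • X) = ε a • R.rd X := nm_smul _ a X

theorem RD.rd_smulk (c : k) (X : ι →₀ A) : R.rd (c • X) = c • R.rd X := by
  rw [← algebraMap_smul A c X, R.rd_smul, AlgHom.commutes]; rfl

theorem RD.rd_δ (X : ι →₀ A) : R.rd (R.δ X) = R.db (R.rd X) := nm_LC _ _ _

theorem RD.rd_mem {T : Set ι} {X : ι →₀ A} (h : X ∈ Finsupp.supported A A T) :
    R.rd X ∈ Finsupp.supported k k T := nm_supp _ h

theorem RD.rd_single (w : ι) (a : A) : R.rd (Finsupp.single w a) = Finsupp.single w (ε a) :=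
  nm_single _ _ _

theorem RD.ηδ {X : ι →₀ A} (hX : X ∈ R.P 1) : R.η (R.δ X) = 0 := by
  have h1 : ε (R.δ X R.e0) = R.rd (R.δ X) R.e0 := (nm_apply (ε : A →+* k) (R.δ X) R.e0).symm
  rw [R.η_apply, h1, R.rd_δ, LinearEquiv.map_eq_zero_iff]
  refine (LC_mem (R.rd_mem hX) (LinearMap.ker (Finsupp.lapply (R := k) R.e0 : (ι →₀ k) →ₗ[k] k))
    fun w hw => ?_ :)
  exact (nm_apply (ε : A →+* k) (R.d w) R.e0).trans (R.aug w hw)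

theorem RD.hex [Module.Free k A] : ∃ h : ℕ → (ι →₀ A) →ₗ[k] (ι →₀ A),
    (∀ q, ∀ X ∈ R.P q, h q X ∈ R.P (q+1)) ∧
    (∀ X ∈ R.P 0, R.δ (h 0 X) = X - R.h0 (R.η X)) ∧
    (∀ q, ∀ X ∈ R.P (q+1), R.δ (h (q+1) X) = X - h q (R.δ X)) := by
  obtain ⟨f, hf⟩ := R.lift 0 (LinearMap.id - R.h0.comp R.η) fun X hX => R.ex0 _
    (sub_mem hX (R.h0P _)) (by
      have : R.η (X - R.h0 (R.η X)) = 0 := by rw [map_sub, R.η_h0, sub_self]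
      exact (LinearEquiv.map_eq_zero_iff (toB k A)).1 this)
  let C : ℕ → ((ι →₀ A) →ₗ[k] (ι →₀ A)) → Prop := fun q h =>
    (∀ X ∈ R.P q, h X ∈ R.P (q+1)) ∧ ∀ X ∈ R.P (q+1), R.δ (h (R.δ X)) = R.δ X
  have C0 : C 0 f := by
    refine ⟨fun X hX => (hf X hX).1, fun X hX => ?_⟩
    rw [(hf _ (R.δP hX)).2]
    change R.δ X - R.h0 (R.η (R.δ X)) = _
    rw [R.ηδ hX, map_zero, sub_zero]
  have step : ∀ q, ∀ h, C q h → ∃ h', C (q+1) h' ∧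
      ∀ X ∈ R.P (q+1), R.δ (h' X) = X - h (R.δ X) := by
    intro q h hC
    obtain ⟨f', hf'⟩ := R.lift (q+1) (LinearMap.id - h.comp (rk R.δ)) fun X hX => R.ex q _
      (sub_mem hX (hC.1 _ (R.δP hX))) (by
        have : R.δ (X - h (R.δ X)) = 0 := by rw [map_sub, hC.2 X hX, sub_self]
        exact this)
    refine ⟨f', ⟨fun X hX => (hf' X hX).1, fun X hX => ?_⟩, fun X hX => (hf' X hX).2⟩
    rw [(hf' _ (R.δP hX)).2]
    change R.δ X - h (R.δ (R.δ X)) = _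
    rw [R.δδ hX, map_zero, sub_zero]
  choose F hF1 hF2 using step
  let H : ∀ q, {h // C q h} := fun q => Nat.rec ⟨f, C0⟩ (fun q h => ⟨F q h.1 h.2, hF1 q h.1 h.2⟩) q
  exact ⟨fun q => (H q).1, fun q => (H q).2.1, fun X hX => (hf X hX).2,
    fun q => hF2 q (H q).1 (H q).2⟩

section maps
variable (h : ℕ → (ι →₀ A) →ₗ[k] (ι →₀ A))

/-- comparison map from the bar resolution -/
def RD.b : ∀ q, Bq k A q →ₗ[k] (ι →₀ A)
  | 0 => R.h0
  | q+1 => ((h q).comp (rk (exA (RD.b q)))).comp ((Dm ε (q+1)).comp un)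

/-- its `A`-linear extension -/
abbrev RD.β (q : ℕ) : Bq k A (q+1) →ₗ[A] (ι →₀ A) := exA (R.b h q)

theorem RD.b_zero (c : Bq k A 0) : R.b h 0 c = R.h0 c := rfl

theorem RD.b_succ (q : ℕ) (x : Bq k A (q+1)) :
    R.b h (q+1) x = h q (R.β h q (Dm ε (q+1) (un x))) := rfl

variable (h1 : ∀ q, ∀ X ∈ R.P q, h q X ∈ R.P (q+1))
  (h2 : ∀ X ∈ R.P 0, R.δ (h 0 X) = X - R.h0 (R.η X))
  (h3 : ∀ q, ∀ X ∈ R.P (q+1), R.δ (h (q+1) X) = X - h q (R.δ X))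

include h1 in
theorem RD.b_mem (q : ℕ) : ∀ x, R.b h q x ∈ R.P q := by
  cases q with
  | zero => exact fun c => R.h0P c
  | succ q =>
    induction q with
    | zero =>
      intro x
      rw [RD.b_succ]
      refine h1 _ _ ?_
      generalize Dm ε (0+1) (un x) = y
      induction y using bq_ind with
      | h0 => simp
      | h2 x y hx hy => rw [map_add]; exact add_mem hx hy
      | h1 a y => rw [map_smul, exA_un]; exact Submodule.smul_mem _ _ (R.h0P y)
    | succ q ih =>
      intro x
      rw [RD.b_succ]
      refine h1 _ _ ?_
      generalize Dm ε (q+1+1) (un x) = y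
      induction y using bq_ind with
      | h0 => simp
      | h2 x y hx hy => rw [map_add]; exact add_mem hx hy
      | h1 a y => rw [map_smul, exA_un]; exact Submodule.smul_mem _ _ (ih y)

include h1 in
theorem RD.β_mem (q : ℕ) (y : Bq k A (q+1)) : R.β h q y ∈ R.P q := by
  induction y using bq_ind with
  | h0 => simp
  | h2 x y hx hy => rw [map_add]; exact add_mem hx hy
  | h1 a y => rw [map_smul, exA_un]; exact Submodule.smul_mem _ _ (R.b_mem h h1 q y)

theorem RD.ηβ (y : Bq k A 1) : R.η (R.β h 0 y) = Dm ε 0 y := by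
  induction y using bq_ind with
  | h0 => simp
  | h2 x y hx hy => rw [map_add, map_add, hx, hy, map_add]
  | h1 a y =>
    rw [map_smul, exA_un, RD.b_zero, RD.η_smul, R.η_h0, Dm_zero]

include h1 h2 h3 in
theorem RD.δβ (q : ℕ) : ∀ y : Bq k A (q+2), R.δ (R.β h (q+1) y) = R.β h q (Dm ε (q+1) y) := by
  induction q with
  | zero =>
    intro y
    induction y using bq_ind with
    | h0 => simp
    | h2 x y hx hy => simp only [map_add, hx, hy]
    | h1 a y =>
      rw [map_smul, map_smul, exA_un, RD.b_succ, h2 _ (R.β_mem h h1 _ _), R.ηβ, Dm_smul, DD,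
        map_smul, map_zero, sub_zero]
  | succ q ih =>
    intro y
    induction y using bq_ind with
    | h0 => simp
    | h2 x y hx hy => simp only [map_add, hx, hy]
    | h1 a y =>
      rw [map_smul, map_smul, exA_un, RD.b_succ, h3 _ _ (R.β_mem h h1 _ _), ih, Dm_smul, DD,
        map_smul, map_zero, map_zero, sub_zero]

/-- comparison map to the bar resolution -/
def RD.aw (R : RD ε ι) : ∀ q, ι → Bq k A (q+1)
  | 0, _ => un (toB k A 1)
  | q+1, w => un (LC (RD.aw R q) (R.d w))

/-- linear extension -/
abbrev RD.α (q : ℕ) : (ι →₀ A) →ₗ[A] Bq k A (q+1) := LC (R.aw q)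

theorem RD.aw_succ (q : ℕ) (w : ι) : R.aw (q+1) w = un (R.α q (R.d w)) := rfl

theorem RD.supp0 {X : ι →₀ A} (hX : X ∈ R.P 0) : X = Finsupp.single R.e0 (X R.e0) := by
  rw [RD.P, R.S0] at hX
  exact Finsupp.eq_single_iff.2 ⟨fun x hx => by simpa using (Finsupp.mem_supported A _).1 hX hx, rfl⟩

theorem RD.Dα0 {X : ι →₀ A} (hX : X ∈ R.P 0) : Dm ε 0 (R.α 0 X) = R.η X := by
  rw [R.supp0 hX, LC_single, RD.aw, Dm_zero, RD.η_apply, Finsupp.single_eq_same, ← map_smul,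
    smul_eq_mul, mul_one]

theorem Dm_LC {q : ℕ} (f : ι → Bq k A (q+2)) (X : ι →₀ A) :
    Dm ε (q+1) (LC f X) = LC (fun w => Dm ε (q+1) (f w)) X := by
  induction X using Finsupp.induction_linear with
  | zero => simp
  | single w a => rw [LC_single, LC_single, Dm_smul]
  | add f g hf hg => simp only [map_add, hf, hg]

theorem RD.Dα (q : ℕ) : ∀ X ∈ R.P (q+1), Dm ε (q+1) (R.α (q+1) X) = R.α q (R.δ X) := by
  induction q with
  | zero =>
    intro X hX
    rw [Dm_LC, LC_LC]
    refine LC_congr hX fun w hw => ?_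
    have e := R.ηδ (X := Finsupp.single w 1) (Finsupp.single_mem_supported A _ hw)
    rw [LC_single, one_smul] at e
    rw [RD.aw_succ, Dm_un, R.Dα0 (R.dS _ w hw), e, map_zero, sub_zero]
  | succ q ih =>
    intro X hX
    rw [Dm_LC, LC_LC]
    refine LC_congr hX fun w hw => ?_
    rw [RD.aw_succ, Dm_un, ih _ (R.dS _ w hw), R.dd _ w hw, map_zero, map_zero, sub_zero]

end maps
end cmp
end BR
end

noncomputable section
open scoped TensorProduct

namespace BR

section cmp2
variable {k : Type} [CommRing k] {A : Type} [Ring A] [Algebra k A]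
variable {ε : A →ₐ[k] k} {ι : Type} (R : RD ε ι)
variable (h : ℕ → (ι →₀ A) →ₗ[k] (ι →₀ A))

/-- the error term -/
def RD.θ (q : ℕ) : Bq k A (q+1) →ₗ[A] Bq k A (q+1) := (R.α q).comp (R.β h q) - LinearMap.id

theorem RD.θ_apply (q : ℕ) (x : Bq k A (q+1)) : R.θ h q x = R.α q (R.β h q x) - x := rfl

/-- homotopy -/
def RD.kk : ∀ q, Bq k A q →ₗ[k] Bq k A (q+2)
  | 0 => un.comp ((rk (R.θ h 0)).comp un)
  | q+1 => un.comp ((rk (R.θ h (q+1)) - (rk (exA (RD.kk q))).comp (Dm ε (q+1))).comp un)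

/-- homotopy, extended -/
abbrev RD.K (q : ℕ) : Bq k A (q+1) →ₗ[A] Bq k A (q+2) := exA (R.kk h q)

theorem RD.kk_zero (x : Bq k A 0) : R.kk h 0 x = un (R.θ h 0 (un x)) := rfl

theorem RD.kk_succ (q : ℕ) (x : Bq k A (q+1)) : R.kk h (q+1) x =
    un (R.θ h (q+1) (un x) - R.K h q (Dm ε (q+1) (un x))) := rfl

variable (h1 : ∀ q, ∀ X ∈ R.P q, h q X ∈ R.P (q+1))
  (h2 : ∀ X ∈ R.P 0, R.δ (h 0 X) = X - R.h0 (R.η X))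
  (h3 : ∀ q, ∀ X ∈ R.P (q+1), R.δ (h (q+1) X) = X - h q (R.δ X))

include h1 in
theorem RD.Dθ0 (x : Bq k A 1) : Dm ε 0 (R.θ h 0 x) = 0 := by
  rw [RD.θ_apply, map_sub, R.Dα0 (R.β_mem h h1 _ _), R.ηβ, sub_self]

include h1 h2 h3 in
theorem RD.Dθ (q : ℕ) (x : Bq k A (q+2)) :
    Dm ε (q+1) (R.θ h (q+1) x) = R.θ h q (Dm ε (q+1) x) := by
  rw [RD.θ_apply, map_sub, R.Dα q _ (R.β_mem h h1 _ _), R.δβ h h1 h2 h3, RD.θ_apply]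

include h1 h2 h3 in
theorem RD.DK0 (x : Bq k A 1) : Dm ε 1 (R.K h 0 x) = R.θ h 0 x := by
  induction x using bq_ind with
  | h0 => simp
  | h2 x y hx hy => simp only [map_add, hx, hy]
  | h1 a y => rw [map_smul, exA_un, Dm_smul, RD.kk_zero, Dm_un, R.Dθ0 h h1, map_zero, sub_zero,
      map_smul]

include h1 h2 h3 in
theorem RD.DK (q : ℕ) : ∀ x : Bq k A (q+2), Dm ε (q+2) (R.K h (q+1) x)
    = R.θ h (q+1) x - R.K h q (Dm ε (q+1) x) := by
  induction q with
  | zero =>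
    intro x
    induction x using bq_ind with
    | h0 => simp
    | h2 x y hx hy => simp only [map_add, hx, hy]; abel
    | h1 a y => 
      rw [map_smul, exA_un, Dm_smul, RD.kk_succ, Dm_un, map_sub, R.Dθ h h1 h2 h3,
        R.DK0 h h1 h2 h3, sub_self, map_zero, sub_zero, map_smul, Dm_smul, map_smul, smul_sub]
  | succ q ih =>
    intro x
    induction x using bq_ind with
    | h0 => simp
    | h2 x y hx hy => simp only [map_add, hx, hy]; abel
    | h1 a y => 
      rw [map_smul, exA_un, Dm_smul, RD.kk_succ, Dm_un, map_sub, R.Dθ h h1 h2 h3,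
        ih, DD, map_zero, sub_zero, sub_self, map_zero, sub_zero, map_smul, Dm_smul, map_smul,
        smul_sub]

/-- reduced comparison -/
def RD.ab (R : RD ε ι) (q : ℕ) : (ι →₀ k) →ₗ[k] Bq k A q := LC fun w => red ε q (R.aw q w)

theorem RD.red_α (q : ℕ) (X : ι →₀ A) : red ε q (R.α q X) = R.ab q (R.rd X) := by
  induction X using Finsupp.induction_linear with
  | zero => simp
  | single w a => rw [LC_single, red_smul, R.rd_single, RD.ab, LC_single]
  | add f g hf hg => simp only [map_add, hf, hg]

/-- reduced comparison -/
def RD.bt (q : ℕ) (x : Bq k A q) : ι →₀ k := R.rd (R.b h q x)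

theorem RD.rd_β (q : ℕ) (x : Bq k A (q+1)) : R.rd (R.β h q x) = R.bt h q (red ε q x) := by
  induction x using bq_ind with
  | h0 => simp [RD.bt]
  | h2 x y hx hy => rw [map_add, map_add, hx, hy, RD.bt, RD.bt, RD.bt, map_add, map_add, map_add]
  | h1 a y => rw [map_smul, exA_un, R.rd_smul, red_smul, red_un, RD.bt, map_smul, R.rd_smulk]

include h1 in
theorem RD.bt_mem (q : ℕ) (x : Bq k A q) : R.bt h q x ∈ Finsupp.supported k k (R.S q) :=
  R.rd_mem (R.b_mem h h1 q x)

include h1 h2 h3 in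
theorem RD.bt_chain (q : ℕ) (x : Bq k A (q+1)) :
    R.db (R.bt h (q+1) x) = R.bt h q (bd ε q x) := by
  have e : R.b h (q+1) x = R.β h (q+1) (un x) := (exA_un _ _).symm
  rw [RD.bt, ← R.rd_δ, e, R.δβ h h1 h2 h3, R.rd_β, red_D, red_un]

theorem RD.ab_chain (q : ℕ) (c : ι →₀ k) (hc : c ∈ Finsupp.supported k k (R.S (q+1))) :
    bd ε q (R.ab (q+1) c) = R.ab q (R.db c) := by
  rw [RD.ab, map_LC, RD.ab, LC_LC]
  refine LC_congr hc fun w hw => ?_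
  have := R.Dα q (Finsupp.single w 1) (Finsupp.single_mem_supported A _ hw)
  rw [LC_single, LC_single, one_smul, one_smul] at this
  rw [← red_D, this, R.red_α]; rfl

include h1 h2 h3 in
/-- cycles are homologous to their image -/
theorem RD.ab_bt (q : ℕ) (x : Bq k A q) (hx : IsCyc ε q x) :
    ∃ z, R.ab q (R.bt h q x) - x = bd ε q z := by
  have key : R.ab q (R.bt h q x) - x = red ε q (R.θ h q (un x)) := by
    rw [RD.θ_apply, map_sub, R.red_α, R.rd_β, red_un]
  refine ⟨red ε (q+1) (R.K h q (un x)), ?_⟩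
  rw [key, ← red_D]
  cases q with
  | zero => rw [R.DK0 h h1 h2 h3]
  | succ q =>
    have hK : ∀ y : Bq k A (q+1), red ε (q+1) (R.K h q y) = red ε (q+1) (R.K h q (un (red ε q y))) := by
      intro y
      induction y using bq_ind with
      | h0 => simp
      | h2 x y hx hy => simp only [map_add, hx, hy]
      | h1 a y => rw [map_smul, red_smul, red_smul, red_un, map_smul, klin, map_smul]
    have hx' : bd ε q x = 0 := hx
    rw [R.DK h h1 h2 h3, map_sub, hK (Dm _ _ _), red_D, red_un, hx', map_zero, map_zero, map_zero, sub_zero]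

/-- the other error term -/
def RD.τ (q : ℕ) : (ι →₀ A) →ₗ[A] (ι →₀ A) := (R.β h q).comp (R.α q) - LinearMap.id

theorem RD.τ_apply (q : ℕ) (X : ι →₀ A) : R.τ h q X = R.β h q (R.α q X) - X := rfl

/-- the other homotopy -/
def RD.l : ∀ _ : ℕ, ι → (ι →₀ A)
  | 0, w => h 0 (R.τ h 0 (bb w))
  | q+1, w => h (q+1) (R.τ h (q+1) (bb w) - LC (RD.l q) (R.d w))

/-- extended -/
abbrev RD.L (q : ℕ) : (ι →₀ A) →ₗ[A] (ι →₀ A) := LC (R.l h q)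

theorem RD.l_zero (w : ι) : R.l h 0 w = h 0 (R.τ h 0 (bb w)) := rfl
theorem RD.l_succ (q : ℕ) (w : ι) :
    R.l h (q+1) w = h (q+1) (R.τ h (q+1) (bb w) - R.L h q (R.d w)) := rfl

include h1 in
theorem RD.τ_mem (q : ℕ) {X : ι →₀ A} (hX : X ∈ R.P q) : R.τ h q X ∈ R.P q :=
  sub_mem (R.β_mem h h1 _ _) hX

include h1 in
theorem RD.l_mem (q : ℕ) : ∀ w ∈ R.S q, R.l h q w ∈ R.P (q+1) := by
  induction q with
  | zero => exact fun w hw => h1 _ _ (R.τ_mem h h1 _ (Finsupp.single_mem_supported A _ hw))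
  | succ q ih =>
    exact fun w hw => h1 _ _ (sub_mem (R.τ_mem h h1 _ (Finsupp.single_mem_supported A _ hw))
      (LC_supp (R.dS _ w hw) ih))

include h1 h2 h3 in
theorem RD.δL0 (X : ι →₀ A) (hX : X ∈ R.P 0) : R.δ (R.L h 0 X) = R.τ h 0 X := by
  have e : R.τ h 0 X = LC (fun w => R.τ h 0 (bb w)) X := by rw [← map_LC, LC_id]
  rw [LC_LC, e]
  refine LC_congr hX fun w hw => ?_
  have hw' := R.τ_mem h h1 0 (Finsupp.single_mem_supported A (1:A) hw)
  have e2 : R.η (R.τ h 0 (bb w)) = 0 := by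
    rw [R.τ_apply, map_sub, R.ηβ, R.Dα0 (Finsupp.single_mem_supported A (1:A) hw), sub_self]
  rw [R.l_zero, h2 _ hw', e2, map_zero, sub_zero]

include h1 h2 h3 in
theorem RD.δτ (q : ℕ) (X : ι →₀ A) (hX : X ∈ R.P (q+1)) :
    R.δ (R.τ h (q+1) X) = R.τ h q (R.δ X) := by
  rw [R.τ_apply, map_sub, R.δβ h h1 h2 h3, R.Dα _ _ hX, R.τ_apply]

include h1 h2 h3 in
theorem RD.δL (q : ℕ) : ∀ X ∈ R.P (q+1), R.δ (R.L h (q+1) X) = R.τ h (q+1) X - R.L h q (R.δ X) := by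
  have main : ∀ q, (∀ w ∈ R.S (q+1), R.δ (R.τ h (q+1) (bb w) - R.L h q (R.d w)) = 0) →
      ∀ X ∈ R.P (q+1), R.δ (R.L h (q+1) X) = R.τ h (q+1) X - R.L h q (R.δ X) := by
    intro q hq X hX
    have e : R.τ h (q+1) X - R.L h q (R.δ X)
        = LC (fun w => R.τ h (q+1) (bb w) - R.L h q (R.d w)) X := by
      rw [LC_sub, ← map_LC, LC_id, ← map_LC]
    rw [LC_LC, e]
    refine LC_congr hX fun w hw => ?_
    rw [R.l_succ, h3, hq w hw, map_zero, sub_zero]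
    exact sub_mem (R.τ_mem h h1 _ (Finsupp.single_mem_supported A _ hw))
      (LC_supp (R.dS _ w hw) (R.l_mem h h1 q))
  have hb : ∀ w, R.δ (bb w) = R.d w := fun w => by rw [LC_single, one_smul]
  induction q with
  | zero =>
    refine main 0 fun w hw => ?_
    rw [map_sub, R.δτ h h1 h2 h3 _ _ (Finsupp.single_mem_supported A _ hw), hb,
      R.δL0 h h1 h2 h3 _ (R.dS _ w hw), sub_self]
  | succ q ih =>
    refine main (q+1) fun w hw => ?_
    rw [map_sub, R.δτ h h1 h2 h3 _ _ (Finsupp.single_mem_supported A _ hw), hb,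
      ih _ (R.dS _ w hw), R.dd _ w hw, map_zero, sub_zero, sub_self]

include h1 h2 h3 in
theorem RD.bt_ab (q : ℕ) (c : ι →₀ k) (hc : c ∈ Finsupp.supported k k (R.S q)) (hd : R.db c = 0) :
    ∃ z ∈ Finsupp.supported k k (R.S (q+1)), R.bt h q (R.ab q c) - c = R.db z := by
  let lb : (ι →₀ k) →ₗ[k] (ι →₀ k) := LC fun w => R.rd (R.l h q w)
  have hτ : R.bt h q (R.ab q c) - c = LC (fun w => R.rd (R.τ h q (bb w))) c := by
    have e1 : ∀ w, R.rd (R.τ h q (bb w)) = R.bt h q (red ε q (R.aw q w)) - bb w := by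
      intro w
      rw [R.τ_apply, map_sub, R.rd_β, LC_single, one_smul, R.rd_single, map_one]
    simp only [e1]
    rw [LC_sub, LC_id]
    congr 1
    let btl : Bq k A q →ₗ[k] (ι →₀ k) :=
      { toFun := R.bt h q
        map_add' := fun x y => by rw [RD.bt, RD.bt, RD.bt, map_add, map_add]
        map_smul' := fun x y => by rw [RD.bt, RD.bt, map_smul, R.rd_smulk]; rfl }
    exact map_LC btl _ c
  refine ⟨lb c, LC_supp hc fun w hw => R.rd_mem (R.l_mem h h1 q w hw), ?_⟩
  rw [hτ, LC_LC]
  cases q with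
  | zero =>
    refine LC_congr hc fun w hw => ?_
    rw [← R.rd_δ, ← R.δL0 h h1 h2 h3 _ (Finsupp.single_mem_supported A _ hw), LC_single, one_smul]
  | succ q =>
    have e2 : LC (fun w => R.rd (R.L h q (R.d w))) c = 0 := by
      have : ∀ X : ι →₀ A, R.rd (R.L h q X) = LC (fun w => R.rd (R.l h q w)) (R.rd X) :=
        fun X => nm_LC _ _ _
      simp only [this]
      rw [← map_LC, hd, map_zero]
    rw [← sub_zero (LC (fun w => R.rd (R.τ h (q+1) (bb w))) c), ← e2, ← LC_sub]
    refine LC_congr hc fun w hw => ?_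
    have := R.δL h h1 h2 h3 q _ (Finsupp.single_mem_supported A (1:A) hw)
    rw [LC_single, LC_single, one_smul, one_smul] at this
    rw [← map_sub, ← this, R.rd_δ]

end cmp2

section two
variable {k : Type} [CommRing k] {A : Type} [Ring A] [Algebra k A] [Module.Free k A]
  {A₂ : Type} [Ring A₂] [Algebra k A₂] [Module.Free k A₂]
  {ε : A →ₐ[k] k} {ε₂ : A₂ →ₐ[k] k} {ι : Type} (R : RD ε ι) (R₂ : RD ε₂ ι)
  (φ : A →ₐ[k] A₂) (hφ : ε₂.comp φ = ε) (σ : ι → ι)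

theorem bm_LC {q : ℕ} (f : ι → Bq k A (q+1)) (X : ι →₀ A) :
    bm φ (q+1) (LC f X) = LC (fun w => bm φ (q+1) (f w)) (nm (φ : A →+* A₂) X) := by
  induction X using Finsupp.induction_linear with
  | zero => simp
  | single w a => rw [LC_single, nm_single, LC_single, bm_smul]; rfl
  | add f g hf hg => simp only [map_add, hf, hg]

theorem aw_nat (hd : ∀ q, ∀ w ∈ R.S q, R₂.d (σ w) = mp σ (nm (φ : A →+* A₂) (R.d w))) (q : ℕ) :
    ∀ w ∈ R.S q, R₂.aw q (σ w) = bm φ (q+1) (R.aw q w) := by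
  induction q with
  | zero => intro w _; rw [RD.aw, RD.aw, bm_un1]; rfl
  | succ q ih =>
    intro w hw
    rw [RD.aw_succ, RD.aw_succ, bm_un1, hd _ w hw, RD.α, LC_mp, bm_LC]
    congr 1
    exact LC_congr (nm_supp _ (R.dS _ w hw)) ih

include hφ in
theorem ab_nat (hd : ∀ q, ∀ w ∈ R.S q, R₂.d (σ w) = mp σ (nm (φ : A →+* A₂) (R.d w))) (q : ℕ)
    (c : ι →₀ k) (hc : c ∈ Finsupp.supported k k (R.S q)) :
    R₂.ab q (mp σ c) = bm φ q (R.ab q c) := by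
  rw [RD.ab, LC_mp, RD.ab, map_LC]
  refine LC_congr hc fun w hw => ?_
  rw [aw_nat R R₂ φ σ hd q w hw, bm_red ε ε₂ φ hφ]

theorem compare (hσ : ∀ q, ∀ w ∈ R.S q, σ w ∈ R₂.S q)
    (hd : ∀ q, ∀ w ∈ R.S q, R₂.d (σ w) = mp σ (nm (φ : A →+* A₂) (R.d w))) (q : ℕ)
    (hs : ∀ c ∈ Finsupp.supported k k (R₂.S q), R₂.db c = 0 →
      ∃ B ∈ Finsupp.supported k k (R.S q), ∃ c' ∈ Finsupp.supported k k (R₂.S (q+1)),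
        R.db B = 0 ∧ c = mp σ B + R₂.db c')
    (hi : ∀ B ∈ Finsupp.supported k k (R.S q), R.db B = 0 →
      ∀ c ∈ Finsupp.supported k k (R₂.S (q+1)), R₂.db c = mp σ B →
        ∃ B' ∈ Finsupp.supported k k (R.S (q+1)), R.db B' = B) :
    Function.Bijective (torMap k ε ε₂ φ hφ q) := by
  obtain ⟨h, h1, h2, h3⟩ := R.hex
  obtain ⟨g, g1, g2, g3⟩ := R₂.hex
  have db0 : ∀ {A : Type} [Ring A] [Algebra k A] {ε : A →ₐ[k] k} (R : RD ε ι) (c : ι →₀ k),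
      c ∈ Finsupp.supported k k (R.S 0) → R.db c = 0 := by
    intro A _ _ ε R c hc
    rw [LC_congr hc (g := fun _ => 0) (fun w hw => ?_), LC_zero]
    rw [R.S0] at hw
    rw [hw, R.d0, map_zero]
  have btz : ∀ {A : Type} [Ring A] [Algebra k A] {ε : A →ₐ[k] k} (R : RD ε ι) h,
      (∀ q, ∀ X ∈ R.P q, h q X ∈ R.P (q+1)) →
      (∀ X ∈ R.P 0, R.δ (h 0 X) = X - R.h0 (R.η X)) →
      (∀ q, ∀ X ∈ R.P (q+1), R.δ (h (q+1) X) = X - h q (R.δ X)) →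
      ∀ q x, IsCyc ε q x → R.db (R.bt h q x) = 0 := by
    intro A _ _ ε R h h1 h2 h3 q x hx
    cases q with
    | zero => exact db0 R _ (R.bt_mem h h1 _ _)
    | succ q =>
      have hx' : bd ε q x = 0 := hx
      rw [R.bt_chain h h1 h2 h3, hx', RD.bt, map_zero, map_zero]
  have abz : ∀ q c, c ∈ Finsupp.supported k k (R.S q) → R.db c = 0 → IsCyc ε q (R.ab q c) := by
    intro q c hc hc0
    cases q with
    | zero => trivial
    | succ q => exact (R.ab_chain q c hc).trans (by rw [hc0, map_zero])
  have bts : ∀ {A : Type} [Ring A] [Algebra k A] {ε : A →ₐ[k] k} (R : RD ε ι) h q x y,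
      R.bt h q (x - y) = R.bt h q x - R.bt h q y := by
    intro A _ _ ε R h q x y
    rw [RD.bt, RD.bt, RD.bt, map_sub, map_sub]
  refine tor_bij ε ε₂ φ hφ q (fun x hx => ?_) fun x hx hz => ?_
  · obtain ⟨B, hB, c', hc', hB0, e⟩ := hs (R₂.bt g q x) (R₂.bt_mem g g1 q x) (btz R₂ g g1 g2 g3 q x hx)
    obtain ⟨z, hz⟩ := R₂.ab_bt g g1 g2 g3 q x hx
    refine ⟨R.ab q B, abz q B hB hB0, R₂.ab (q+1) c' - z, ?_⟩
    rw [map_sub, R₂.ab_chain q c' hc', ← ab_nat R R₂ φ hφ σ hd q B hB, ← hz, e, map_add]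
    abel
  · obtain ⟨z, hz⟩ := hz
    have hc := R.bt_mem h h1 q x
    have hc0 := btz R h h1 h2 h3 q x hx
    obtain ⟨y, hy⟩ := R.ab_bt h h1 h2 h3 q x hx
    have hσc : mp σ (R.bt h q x) ∈ Finsupp.supported k k (R₂.S q) := mp_mem hc (hσ q)
    have hnat : ∀ B : ι →₀ k, B ∈ Finsupp.supported k k (R.S q) → R₂.db (mp σ B) = mp σ (R.db B) := by
      intro B hB
      rw [LC_mp, map_LC]
      refine LC_congr hB fun w hw => ?_
      have e : ∀ a, ε₂ (φ a) = ε a := fun a => by rw [← hφ]; rfl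
      rw [hd q w hw]
      have : R₂.rd (nm (φ : A →+* A₂) (R.d w)) = R.rd (R.d w) := by
        ext i
        rw [nm_apply, nm_apply, nm_apply]; exact e _
      rw [← this]
      exact nm_mp _ _ _
    have hσc0 : R₂.db (mp σ (R.bt h q x)) = 0 := by rw [hnat _ hc, hc0, map_zero]
    obtain ⟨u, hu, hu'⟩ := R₂.bt_ab g g1 g2 g3 q _ hσc hσc0
    rw [ab_nat R R₂ φ hφ σ hd q _ hc] at hu'
    have e3 : R.ab q (R.bt h q x) = x + bd ε q y := by rw [← hy]; abel
    have e4 : bm φ q (R.ab q (R.bt h q x)) = bd ε₂ q (z + bm φ (q+1) y) := by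
      rw [e3, map_add, map_add, hz, bm_bd ε ε₂ φ hφ]
    rw [e4, ← R₂.bt_chain g g1 g2 g3] at hu'
    obtain ⟨B', hB', e5⟩ := hi _ hc hc0 (R₂.bt g (q+1) (z + bm φ (q+1) y) - u)
      (sub_mem (R₂.bt_mem g g1 _ _) hu) (by rw [map_sub, ← hu']; abel)
    refine ⟨R.ab (q+1) B' - y, ?_⟩
    rw [map_sub, R.ab_chain q B' hB', e5, e3]; abel

end two
end BR
end

noncomputable section
open scoped TensorProduct

namespace BR

section htp
variable {k : Type} [CommRing k] {A : Type} [Ring A] [Algebra k A]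
  {A₂ : Type} [Ring A₂] [Algebra k A₂] {ε : A →ₐ[k] k} {ε₂ : A₂ →ₐ[k] k}

theorem bm_Dm (φ : A →ₐ[k] A₂) (hφ : ε₂.comp φ = ε) {q : ℕ} (x : Bq k A (q+1)) :
    Dm ε₂ q (bm φ (q+1) x) = bm φ q (Dm ε q x) := by
  have h1 := bm_bd ε ε₂ φ hφ x
  rw [bd_eq, bd_eq, map_sub, bm_red ε ε₂ φ hφ] at h1
  exact sub_right_injective h1

theorem tor_mk {q : ℕ} (X : barTor k A ε q) : ∃ x, ∃ hx : x ∈ barCycles k A ε q,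
    X = Submodule.Quotient.mk ⟨x, hx⟩ := by
  obtain ⟨⟨x, hx⟩, rfl⟩ := Submodule.Quotient.mk_surjective _ X
  exact ⟨x, hx, rfl⟩

theorem torMap_mk (φ : A →ₐ[k] A₂) (hφ : ε₂.comp φ = ε) {q : ℕ} (x : Bq k A q)
    (hx : x ∈ barCycles k A ε q) :
    torMap k ε ε₂ φ hφ q (Submodule.Quotient.mk ⟨x, hx⟩) =
    (Submodule.Quotient.mk (⟨bm φ q x, barMap_cycles k ε ε₂ φ hφ q x hx⟩ :
      barCycles k A₂ ε₂ q) : barTor k A₂ ε₂ q) := rfl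

theorem tor_eq {q : ℕ} {x y : Bq k A q} (hx : x ∈ barCycles k A ε q) (hy : y ∈ barCycles k A ε q)
    (z : Bq k A (q+1)) (h : x - y = bd ε q z) :
    (Submodule.Quotient.mk (⟨x, hx⟩ : barCycles k A ε q) : barTor k A ε q)
      = Submodule.Quotient.mk ⟨y, hy⟩ :=
  (Submodule.Quotient.eq _).2 ⟨z, h.symm⟩

variable (φ₁ φ₂ : A →ₐ[k] A₂) (f : A₂)

/-- typed tensor map -/
def vmap {q r : ℕ} (φ : A →ₐ[k] A₂) (g : Bq k A q →ₗ[k] Bq k A₂ r) :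
    Bq k A (q+1) →ₗ[k] Bq k A₂ (r+1) :=
  TensorProduct.map φ.toLinearMap (g : (barC k A q : Type) →ₗ[k] (barC k A₂ r : Type))

theorem vmap_un {q r : ℕ} (φ : A →ₐ[k] A₂) (g : Bq k A q →ₗ[k] Bq k A₂ r) (a : A) (x : Bq k A q) :
    vmap φ g (a • un x) = φ a • un (g x) := by
  rw [← tm_eq, ← tm_eq]; rfl

theorem vmap_smul {q r : ℕ} (φ : A →ₐ[k] A₂) (g : Bq k A q →ₗ[k] Bq k A₂ r) (a : A)
    (x : Bq k A (q+1)) : vmap φ g (a • x) = φ a • vmap φ g x := by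
  induction x using bq_ind with
  | h0 => simp
  | h2 x y hx hy => rw [smul_add, map_add, hx, hy, map_add, smul_add]
  | h1 b y => rw [smul_smul, vmap_un, vmap_un, map_mul, mul_smul]

/-- multiplication by `f` -/
def fm {q : ℕ} : Bq k A₂ q →ₗ[k] Bq k A₂ (q+1) where
  toFun x := f • un x
  map_add' x y := by rw [map_add, smul_add]
  map_smul' c x := by rw [map_smul, RingHom.id_apply, smul_comm]

theorem fm_apply {q : ℕ} (x : Bq k A₂ q) : fm f x = f • un x := rfl

/-- chain homotopy -/
def HH : ∀ q, Bq k A q →ₗ[k] Bq k A₂ (q+1)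
  | 0 => (fm f).comp (bm φ₁ 0)
  | q+1 => (fm f).comp (bm φ₁ (q+1)) - vmap φ₂ (HH q)

theorem HH_zero (x : Bq k A 0) : HH φ₁ φ₂ f 0 x = f • un (bm φ₁ 0 x) := rfl
theorem HH_succ {q : ℕ} (x : Bq k A (q+1)) : HH φ₁ φ₂ f (q+1) x =
    f • un (bm φ₁ (q+1) x) - vmap φ₂ (HH φ₁ φ₂ f q) x := rfl

variable (h1 : ε₂.comp φ₁ = ε) (h2 : ε₂.comp φ₂ = ε) (hf : ε₂ f = 1)
  (hc : ∀ a, f * φ₁ a = φ₂ a * f)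

include hf h2 in
theorem red_HH {q : ℕ} (y : Bq k A (q+1)) :
    red ε₂ (q+1) (HH φ₁ φ₂ f (q+1) y) = bm φ₁ (q+1) y - HH φ₁ φ₂ f q (red ε q y) := by
  induction y using bq_ind with
  | h0 => simp
  | h2 x y hx hy => simp only [map_add, hx, hy]; abel
  | h1 a x =>
    have e : ε₂ (φ₂ a) = ε a := by rw [← h2]; rfl
    rw [HH_succ, map_sub, red_smul, red_un, hf, one_smul, vmap_un, red_smul, red_un, red_smul,
      red_un, map_smul (HH φ₁ φ₂ f q), e]

include hf h1 h2 hc in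
theorem D_HH : ∀ (q : ℕ) (y : Bq k A (q+1)),
    Dm ε₂ (q+1) (HH φ₁ φ₂ f (q+1) y) = bm φ₂ (q+1) y - HH φ₁ φ₂ f q (Dm ε q y) := by
  intro q
  induction q with
  | zero =>
    intro y
    induction y using bq_ind with
    | h0 => simp
    | h2 x y hx hy => simp only [map_add, hx, hy]; abel
    | h1 a c =>
      have e0 : bm φ₁ 0 c = bm φ₂ 0 c := rfl
      rw [HH_succ, map_sub, Dm_smul, Dm_un, vmap_un, Dm_smul, Dm_un, bm_Dm φ₁ h1, HH_zero, HH_zero,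
        Dm_smul0 ε₂ f, Dm_un0, hf, one_smul, bm_un, bm_un, smul_sub, smul_smul, hc, smul_sub, smul_smul,
        e0]
      abel
  | succ q ih =>
    intro y
    induction y using bq_ind with
    | h0 => simp
    | h2 x y hx hy => simp only [map_add, hx, hy]; abel
    | h1 a x =>
      rw [HH_succ, map_sub, Dm_smul, Dm_un, vmap_un, Dm_smul, Dm_un, ih, bm_Dm φ₁ h1, HH_succ _ _ _ x,
        HH_succ _ _ _ (Dm _ _ _), Dm_smul, Dm_un, vmap_smul, map_sub (vmap _ _), bm_un, bm_un]
      have e : vmap φ₂ (HH φ₁ φ₂ f q) (un (Dm ε q x)) = un (HH φ₁ φ₂ f q (Dm ε q x)) := by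
        have := vmap_un φ₂ (HH φ₁ φ₂ f q) 1 (Dm ε q x)
        simpa using this
      rw [e, map_sub un]
      generalize bm φ₁ (q + 1) (a • x - a • un (Dm ε q x)) = y0
      simp only [smul_sub, smul_smul, hc]
      abel

include hf h1 h2 hc in
theorem torMap_htp (q : ℕ) : torMap k ε ε₂ φ₁ h1 q = torMap k ε ε₂ φ₂ h2 q := by
  refine LinearMap.ext fun X => ?_
  obtain ⟨x, hx, rfl⟩ := tor_mk X
  rw [torMap_mk, torMap_mk]
  refine tor_eq _ _ (HH φ₁ φ₂ f q x) ?_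
  cases q with
  | zero =>
    have e0 : bm φ₁ 0 x = bm φ₂ 0 x := rfl
    rw [HH_zero, bd_eq, Dm_smul0, Dm_un0, red_smul, red_un, hf, e0, sub_self, sub_self]
  | succ q =>
    have hx' : bd ε q x = 0 := (mem_cycles ε x).1 hx
    have e : red ε q x = Dm ε q x := by rw [bd_eq] at hx'; exact sub_eq_zero.1 hx'
    rw [bd_eq, red_HH φ₁ φ₂ f h2 hf, D_HH φ₁ φ₂ f h1 h2 hf hc, e]; abel

variable {A₃ : Type} [Ring A₃] [Algebra k A₃] {ε₃ : A₃ →ₐ[k] k}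

theorem bm_comp (φ : A →ₐ[k] A₂) (ψ : A₂ →ₐ[k] A₃) (q : ℕ) (x : Bq k A q) :
    bm (ψ.comp φ) q x = bm ψ q (bm φ q x) := by
  induction q with
  | zero => rfl
  | succ q ih =>
    induction x using bq_ind with
    | h0 => simp
    | h2 x y hx hy => simp only [map_add, hx, hy]
    | h1 a c => rw [bm_un, bm_un, bm_un, ih]; rfl

theorem bm_id (q : ℕ) (x : Bq k A q) : bm (AlgHom.id k A) q x = x := by
  induction q with
  | zero => rfl
  | succ q ih =>
    induction x using bq_ind with
    | h0 => simp
    | h2 x y hx hy => simp only [map_add, hx, hy]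
    | h1 a c => rw [bm_un, ih]; rfl

theorem torMap_comp (φ : A →ₐ[k] A₂) (ψ : A₂ →ₐ[k] A₃) (hφ : ε₂.comp φ = ε) (hψ : ε₃.comp ψ = ε₂)
    (hχ : ε₃.comp (ψ.comp φ) = ε) (q : ℕ) (X : barTor k A ε q) :
    torMap k ε ε₃ (ψ.comp φ) hχ q X = torMap k ε₂ ε₃ ψ hψ q (torMap k ε ε₂ φ hφ q X) := by
  obtain ⟨x, hx, rfl⟩ := tor_mk X
  rw [torMap_mk, torMap_mk]
  refine Eq.trans ?_ (torMap_mk ψ hψ (bm φ q x) (barMap_cycles k ε ε₂ φ hφ q x hx)).symm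
  exact tor_eq _ _ 0 (by rw [map_zero, bm_comp, sub_self])

theorem torMap_id (h : ε.comp (AlgHom.id k A) = ε) (q : ℕ) (X : barTor k A ε q) :
    torMap k ε ε (AlgHom.id k A) h q X = X := by
  obtain ⟨x, hx, rfl⟩ := tor_mk X
  rw [torMap_mk]
  exact tor_eq _ _ 0 (by rw [map_zero, bm_id, sub_self])

/-- quotient by a split idempotent does not change Tor -/
theorem torMap_split (π : A →ₐ[k] A₂) (Ψ : A₂ →ₐ[k] A) (hπ : ε₂.comp π = ε) (hΨ : ε.comp Ψ = ε₂)
    (hs : ∀ a, π (Ψ a) = a) (e : A) (he : ε e = 1) (hc : ∀ a, e * Ψ (π a) = a * e) (q : ℕ) :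
    Function.Bijective (torMap k ε ε₂ π hπ q) := by
  have c1 : ε₂.comp (π.comp Ψ) = ε₂ := by rw [← AlgHom.comp_assoc, hπ, hΨ]
  have c2 : ε.comp (Ψ.comp π) = ε := by rw [← AlgHom.comp_assoc, hΨ, hπ]
  have hid : π.comp Ψ = AlgHom.id k A₂ := AlgHom.ext hs
  refine Function.bijective_iff_has_inverse.2 ⟨torMap k ε₂ ε Ψ hΨ q, fun X => ?_, fun X => ?_⟩
  · rw [← torMap_comp π Ψ hπ hΨ c2, torMap_htp (Ψ.comp π) (AlgHom.id k A) e c2 rfl he hc]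
    exact torMap_id _ q X
  · rw [← torMap_comp Ψ π hΨ hπ c1]
    have : ∀ (φ : A₂ →ₐ[k] A₂) (hφ : ε₂.comp φ = ε₂), φ = AlgHom.id k A₂ →
        torMap k ε₂ ε₂ φ hφ q X = X := by
      rintro φ hφ rfl
      exact torMap_id _ q X
    exact this _ _ hid

end htp
end BR
end

noncomputable section

namespace BR
section locn
variable {k G : Type} [CommRing k] [Group G]

theorem CS_zero {n : ℕ} : CS G n 0 = {List.replicate n [[]]} := by
  ext W
  constructor
  · rintro ⟨h1, h2, h3⟩
    induction W generalizing n with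
    | nil => 
      have : n = 0 := by simpa [wt] using h2.symm
      subst this; rfl
    | cons w W ih =>
      obtain ⟨hw, hW⟩ := valid_cons.1 h1
      rw [cdeg_cons] at h3
      rw [wt_cons] at h2
      match w, hw with
      | a :: w, _ =>
        rw [wdeg_cons, ldeg] at h3
        have ha : a = [] := List.length_eq_zero_iff.1 (by omega)
        have hw : w = [] := by
          cases w with
          | nil => rfl
          | cons b w => rw [wdeg_cons, ldeg] at h3; omega
        subst ha hw
        have := ih (n := wt W) hW rfl (by omega)
        rw [← h2]
        simp only [List.length_singleton]
        rw [Set.mem_singleton_iff] at this ⊢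
        rw [add_comm, List.replicate_succ, ← this]
  · rintro rfl
    induction n with
    | zero => exact ⟨by intro w hw; simp at hw, rfl, rfl⟩
    | succ n ih =>
      obtain ⟨h1, h2, h3⟩ := ih
      refine ⟨?_, ?_, ?_⟩
      · rw [List.replicate_succ]; exact valid_cons.2 ⟨by simp, h1⟩
      · rw [List.replicate_succ, wt_cons, h2, List.length_singleton, add_comm]
      · rw [List.replicate_succ, cdeg_cons, h3]; simp [ldeg]

theorem dc_one {W : Cf G} {n : ℕ} (hW : W ∈ CS G n 1) : (dc W : Cf G →₀ k) = 0 := by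
  induction W generalizing n with
  | nil => rfl
  | cons w W ih =>
    obtain ⟨h1, h2, h3⟩ := hW
    obtain ⟨hw, hW⟩ := valid_cons.1 h1
    rw [cdeg_cons] at h3
    match w, hw with
    | a :: w, _ =>
    rw [wdeg_cons] at h3
    have key : a.length + wdeg w = 0 ∨ (cdeg W = 0 ∧ a.length + wdeg w = 1) := by
      unfold ldeg at h3; omega
    rcases key with h | ⟨h0, h⟩
    · have ha : a = [] := List.length_eq_zero_iff.1 (by omega)
      have hw : w = [] := by
        cases w with
        | nil => rfl
        | cons b w => rw [wdeg_cons, ldeg] at h; omega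
      subst ha hw
      rw [dc, dC_stab, dc_off, ih (n := wt W) ⟨hW, rfl, by simpa [ldeg] using h3⟩, map_zero]
    · have hd : ∀ p, dC (o1 k) (o2 G k) p W = 0 := fun p => dC_zero_deg (n := wt W) ⟨hW, rfl, h0⟩ p
      rw [dc, dC, hd]
      match a, w with
      | [g], [] =>
        simp [dEb, wb, cop, copL, lb, lr, LC_single, cutT, mp_single, ldeg, qm, cc_zero, sg, bb]
      | [], [[]] =>
        simp [dEb, wb, cop, copL, lb, lr, LC_single, cutT, mp_single, ldeg, qm, cc_zero, sg, bb, cc_one]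
      | [g], b :: w => simp [ldeg] at h
      | [], (c :: b) :: w => simp [ldeg] at h; omega
      | [], [] => simp at h
      | [], [] :: b :: w => simp [ldeg] at h
      | g :: g' :: a, _ => simp at h; omega

theorem nin_inj (n : ℕ) : Function.Injective (nin k G n) :=
  MonoidAlgebra.mapDomain_injective Subtype.val_injective

theorem nm_inj {B B' α : Type} [Ring B] [Ring B'] {φ : B →+* B'} (h : Function.Injective φ) :
    Function.Injective (nm (α := α) φ) := by
  intro X Y hXY
  ext1 a
  apply h
  rw [← nm_apply, ← nm_apply, hXY]

theorem nm_supp' {B B' α : Type} [Ring B] [Ring B'] {φ : B →+* B'} (h : Function.Injective φ)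
    {S : Set α} {X : α →₀ B} (hX : nm φ X ∈ Finsupp.supported B' B' S) :
    X ∈ Finsupp.supported B B S := by
  rw [Finsupp.mem_supported'] at hX ⊢
  intro a ha
  have := hX a ha
  rw [nm_apply] at this
  exact h (by rw [this, map_zero])

theorem nin_lift {α : Type} {n : ℕ} {X : α →₀ MonoidAlgebra k (LB G)}
    (hX : X ∈ SP (k := k) {x | x.1 ∈ Nn G n}) : ∃ X', nm (nin k G n) X' = X := by
  let P : Submodule k (α →₀ MonoidAlgebra k (LB G)) :=
    { carrier := {X | ∃ X', nm (nin k G n) X' = X}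
      add_mem' := by
        rintro _ _ ⟨a, rfl⟩ ⟨b, rfl⟩
        exact ⟨a + b, map_add _ _ _⟩
      zero_mem' := ⟨0, map_zero _⟩
      smul_mem' := by
        rintro c _ ⟨a, rfl⟩
        refine ⟨algebraMap k (MonoidAlgebra k (Nn G n)) c • a, ?_⟩
        rw [nm_smul]
        ext1 x
        have : nin k G n (algebraMap k (MonoidAlgebra k (Nn G n)) c) = algebraMap k _ c := by
          simp [MonoidAlgebra.algebraMap_def, nin]
        rw [this]
        simp [Algebra.smul_def] }
  refine gen_mem hX P fun γ a h => ⟨gn k (⟨γ, h⟩ : Nn G n) a, ?_⟩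
  rw [gn, nm_single, gn, oo, nin_oo]

theorem nin_LC {n : ℕ} {X : Cf G →₀ MonoidAlgebra k (Nn G n)} {q : ℕ}
    (hX : X ∈ Finsupp.supported _ (MonoidAlgebra k (Nn G n)) (CS G n q)) :
    nm (nin k G n) (LC (dC (ns k G n) (nt k G n) 0) X) = dd k G (nm (nin k G n) X) := by
  rw [nm_LC]
  refine LC_congr (nm_supp _ hX) fun W hW => ?_
  exact nin_dC W (by rw [hW.2.1]; omega)

theorem ddN {n q : ℕ} {W : Cf G} (hW : W ∈ CS G n (q + 1)) :
    LC (dC (ns k G n) (nt k G n) 0) (dC (ns k G n) (nt k G n) 0 W) = 0 := by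
  apply nm_inj (nin_inj n)
  rw [nin_LC (dC_supp hW 0), nin_dC W (by rw [hW.2.1]; omega), map_zero]
  exact dC_dC (B := MonoidAlgebra k (LB G)) (by exact ms_rel) W 0

set_option maxHeartbeats 400000 in
theorem exact_N {n q : ℕ} {X : Cf G →₀ MonoidAlgebra k (Nn G n)}
    (hX : X ∈ Finsupp.supported _ (MonoidAlgebra k (Nn G n)) (CS G n q))
    (hd : LC (B := MonoidAlgebra k (Nn G n)) (dC (ns k G n) (nt k G n) 0) X = 0) :
    ∃ Y ∈ Finsupp.supported _ (MonoidAlgebra k (Nn G n)) (CS G n (q + 1)), ∃ c : k,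
      X = LC (B := MonoidAlgebra k (Nn G n)) (dC (ns k G n) (nt k G n) 0) Y +
        (Finsupp.single (List.replicate n [[]] : Cf G) (MonoidAlgebra.single (1 : Nn G n) c) : Cf G →₀ MonoidAlgebra k (Nn G n)) ∧ (q ≠ 0 → c = 0) := by
  have h0 : nm (nin k G n) X ∈ Finsupp.supported _ (MonoidAlgebra k (LB G)) (CS G n q) :=
    nm_supp (nin k G n) hX
  have h1 : nm (nin k G n) X ∈ SP (k := k) (TT G n q) :=
    SP_inter (nin_sp X) ((SP_supported (k := k)).1 h0)
  obtain ⟨Y, hY, h⟩ := exact_SP h1 (by rw [← nin_LC hX, hd, map_zero])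
  obtain ⟨Y', rfl⟩ := nin_lift (SP_mono (fun x hx => hx.1) hY)
  have hY' : Y' ∈ Finsupp.supported _ (MonoidAlgebra k (Nn G n)) (CS G n (q + 1)) :=
by
    have h2 : nm (nin k G n) Y' ∈ Finsupp.supported _ (MonoidAlgebra k (LB G)) (CS G n (q + 1)) :=
      (SP_supported (k := k)).2 (SP_mono (fun x hx => hx.2) hY)
    exact nm_supp' (φ := nin k G n) (nin_inj n) h2
  rw [← nin_LC hY', ← map_sub] at h
  set Z := X - LC (B := MonoidAlgebra k (Nn G n)) (dC (ns k G n) (nt k G n) 0) Y' with hZ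
  rw [mem_SP] at h
  refine ⟨Y', hY', (nm (nin k G n) Z (List.replicate n [[]])).coeff 1, ?_, ?_⟩
  · rw [← sub_eq_iff_eq_add', ← hZ]
    apply nm_inj (nin_inj n)
    rw [nm_single, nin_oo]
    ext a γ
    classical
    by_cases ha : a = List.replicate n [[]]
    · subst ha
      rw [Finsupp.single_eq_same]
      by_cases hg : γ = 1
      · subst hg; simp
      · rw [h _ _ (by simp [hg])]
        rw [MonoidAlgebra.coeff_single_apply, if_neg]
        rintro h; exact hg h.symm
    · rw [h _ _ (by simp [ha]), Finsupp.single_eq_of_ne ha]; simp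
  · intro hq
    exact h _ _ (by simp [hq])

end locn
end BR
end

noncomputable section

namespace BR
section absloc
variable {k G : Type} [CommRing k] [Group G] {A : Type} [Ring A] [Algebra k A] {n : ℕ}
  (φ : MonoidAlgebra k (Nn G n) →+* A) (ε : A →ₐ[k] k)

/-- the transported differential -/
def dA (W : Cf G) : Cf G →₀ A := dC (fun i => φ (ns k G n i)) (fun g i => φ (nt k G n g i)) 0 W

theorem nm_dA (W : Cf G) : nm φ (dC (ns k G n) (nt k G n) 0 W) = dA φ W :=
  nm_dC φ W (fun _ _ => rfl) (fun _ _ _ => rfl)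

theorem LC_dA (X : Cf G →₀ MonoidAlgebra k (Nn G n)) :
    LC (dA φ) (nm φ X) = nm φ (LC (B := MonoidAlgebra k (Nn G n)) (dC (ns k G n) (nt k G n) 0) X) := by
  rw [nm_LC]
  simp only [nm_dA]

theorem dA_red (hε : ∀ γ c, ε (φ (MonoidAlgebra.single γ c)) = c) {q : ℕ} {W : Cf G} (hW : W ∈ CS G n q) :
    nm (ε : A →+* k) (dA φ W) = dc W := by
  have hw := hW.2.1
  refine nm_dC _ W (fun i hi => ?_) (fun g i hi => ?_)
  · simp only [zero_add]
    rw [ns, dif_pos (by omega)]; exact hε _ _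
  · simp only [zero_add]
    rw [nt, dif_pos (by omega)]; exact hε _ _

theorem denom (ζ : MonoidAlgebra k (Nn G n)) (hl : ∀ a : A, ∃ m : ℕ, ∃ b, φ ζ ^ m * a = φ b)
    {α : Type} (X : α →₀ A) : ∃ (m : ℕ) (X' : α →₀ MonoidAlgebra k (Nn G n)), φ ζ ^ m • X = nm φ X' := by
  induction X using Finsupp.induction_linear with
  | zero => exact ⟨0, 0, by simp⟩
  | add f g hf hg =>
    obtain ⟨m, X, hX⟩ := hf
    obtain ⟨l, Y, hY⟩ := hg
    refine ⟨l + m, ζ ^ l • X + ζ ^ m • Y, ?_⟩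
    rw [map_add, nm_smul, nm_smul, ← hX, ← hY, map_pow, map_pow, smul_smul, smul_smul, smul_add,
      ← pow_add, ← pow_add, add_comm m l]
  | single a b =>
    obtain ⟨m, c, h⟩ := hl b
    exact ⟨m, Finsupp.single a c, by rw [nm_single, ← h, Finsupp.smul_single, smul_eq_mul]⟩

theorem exact_A (hφ : Function.Injective φ) (ζ : MonoidAlgebra k (Nn G n)) (hz : IsUnit (φ ζ))
    (hl : ∀ a : A, ∃ m : ℕ, ∃ b, φ ζ ^ m * a = φ b) {q : ℕ} {X : Cf G →₀ A}
    (hX : X ∈ Finsupp.supported A A (CS G n q)) (hd : LC (dA φ) X = 0) :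
    ∃ Y ∈ Finsupp.supported A A (CS G n (q + 1)), ∃ (w : A) (c : k), IsUnit w ∧
      X = LC (dA φ) Y +
        Finsupp.single (List.replicate n [[]] : Cf G) (w * φ (MonoidAlgebra.single 1 c)) ∧
      (q ≠ 0 → c = 0) := by
  obtain ⟨m, X', hX'⟩ := denom φ ζ hl X
  have h1 : X' ∈ Finsupp.supported (MonoidAlgebra k (Nn G n)) (MonoidAlgebra k (Nn G n)) (CS G n q) := by
    apply nm_supp' (φ := φ) hφ
    rw [← hX']
    exact Submodule.smul_mem _ _ hX
  have h2 : LC (B := MonoidAlgebra k (Nn G n)) (dC (ns k G n) (nt k G n) 0) X' = 0 := by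
    apply nm_inj (φ := φ) hφ
    rw [← LC_dA, ← hX', map_smul, hd, smul_zero, map_zero]
  obtain ⟨Y, hY, c, h, hc⟩ := exact_N h1 h2
  obtain ⟨u, hu⟩ := hz.pow m
  refine ⟨(↑u⁻¹ : A) • nm φ Y, Submodule.smul_mem _ _ (nm_supp φ hY), ↑u⁻¹, c, Units.isUnit _, ?_, hc⟩
  have h3 : X = (↑u⁻¹ : A) • nm φ X' := by
    rw [← hX', ← hu, smul_smul, Units.inv_mul, one_smul]
  rw [h3, h, map_add, ← LC_dA, nm_single, smul_add, map_smul, Finsupp.smul_single, smul_eq_mul]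

theorem aug_dA (hε : ∀ γ c, ε (φ (MonoidAlgebra.single γ c)) = c) {Y : Cf G →₀ A}
    (hY : Y ∈ Finsupp.supported A A (CS G n 1)) (W : Cf G) : ε (LC (dA φ) Y W) = 0 := by
  have : nm (ε : A →+* k) (LC (dA φ) Y) = 0 := by
    rw [nm_LC, LC_congr (nm_supp _ hY) (g := fun _ => 0) (fun W hW => ?_), LC_zero]
    rw [dA_red φ ε hε hW, dc_one hW]
  have h := DFunLike.congr_fun this W
  rw [nm_apply] at h
  exact h

/-- the resolution -/
def RA (hε : ∀ γ c, ε (φ (MonoidAlgebra.single γ c)) = c)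
    (hφ : Function.Injective φ) (ζ : MonoidAlgebra k (Nn G n)) (hz : IsUnit (φ ζ))
    (hl : ∀ a : A, ∃ m : ℕ, ∃ b, φ ζ ^ m * a = φ b) : RD ε (Cf G) where
  S q := CS G n q
  e0 := List.replicate n [[]]
  d := dA φ
  S0 := CS_zero
  d0 := dC_zero_deg (n := n) (by rw [CS_zero]; rfl) 0
  dS q w hw := dC_supp hw 0
  dd q w hw := by
    rw [← nm_dA, LC_dA, ddN hw, map_zero]
  aug w hw := by
    have := aug_dA φ ε hε (Finsupp.single_mem_supported A (1 : A) hw) (List.replicate n [[]])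
    rwa [LC_single, one_smul] at this
  ex0 X hX h := by
    obtain ⟨Y, hY, w, c, hw, h1, -⟩ := exact_A φ hφ ζ hz hl hX (by
      rw [LC_congr hX (g := fun _ => 0) (fun w hw => ?_), LC_zero]
      exact dC_zero_deg hw 0)
    refine ⟨Y, hY, ?_⟩
    rw [h1, Finsupp.add_apply, map_add, aug_dA φ ε hε hY, zero_add, Finsupp.single_eq_same,
      map_mul, hε, (hw.map ε).mul_right_eq_zero] at h
    rw [h1, h]
    simp
  ex q X hX h := by
    obtain ⟨Y, hY, w, c, hw, h1, hc⟩ := exact_A φ hφ ζ hz hl hX h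
    refine ⟨Y, hY, ?_⟩
    rw [h1, hc (by omega)]
    simp

end absloc
end BR
end

noncomputable section

namespace BR
section abscmp
variable {k G : Type} [CommRing k] [Group G] {A : Type} [Ring A] [Algebra k A] {n : ℕ}
  (φ : MonoidAlgebra k (Nn G n) →+* A) (ε : A →ₐ[k] k)

theorem RA_db (hε : ∀ γ c, ε (φ (MonoidAlgebra.single γ c)) = c)
    (hφ : Function.Injective φ) (ζ : MonoidAlgebra k (Nn G n)) (hz : IsUnit (φ ζ))
    (hl : ∀ a : A, ∃ m : ℕ, ∃ b, φ ζ ^ m * a = φ b) {q : ℕ} {X : Cf G →₀ k}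
    (hX : X ∈ Finsupp.supported k k (CS G n q)) :
    (RA φ ε hε hφ ζ hz hl).db X = dcL X :=
  LC_congr hX fun _ hw => dA_red φ ε hε hw

theorem stab_abs [Module.Free k A] (hε : ∀ γ c, ε (φ (MonoidAlgebra.single γ c)) = c)
    (hφ : Function.Injective φ) (ζ : MonoidAlgebra k (Nn G n)) (hz : IsUnit (φ ζ))
    (hl : ∀ a : A, ∃ m : ℕ, ∃ b, φ ζ ^ m * a = φ b)
    {A₂ : Type} [Ring A₂] [Algebra k A₂] [Module.Free k A₂]
    (φ₂ : MonoidAlgebra k (Nn G (n + 1)) →+* A₂) (ε₂ : A₂ →ₐ[k] k)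
    (hε₂ : ∀ γ c, ε₂ (φ₂ (MonoidAlgebra.single γ c)) = c)
    (hφ₂ : Function.Injective φ₂) (ζ₂ : MonoidAlgebra k (Nn G (n + 1))) (hz₂ : IsUnit (φ₂ ζ₂))
    (hl₂ : ∀ a : A₂, ∃ m : ℕ, ∃ b, φ₂ ζ₂ ^ m * a = φ₂ b)
    (Θ : A →ₐ[k] A₂) (hΘ : ε₂.comp Θ = ε)
    (hs : ∀ i, i + 1 < n → Θ (φ (ns k G n i)) = φ₂ (ns k G (n + 1) (i + 1)))
    (ht : ∀ g i, i < n → Θ (φ (nt k G n g i)) = φ₂ (nt k G (n + 1) g (i + 1)))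
    (q : ℕ) (h : 2 * q + 2 ≤ n + 1) : Function.Bijective (torMap k ε ε₂ Θ hΘ q) := by
  refine compare (RA φ ε hε hφ ζ hz hl) (RA φ₂ ε₂ hε₂ hφ₂ ζ₂ hz₂ hl₂) Θ hΘ
    (fun W => [[]] :: W) ?_ ?_ q ?_ ?_
  · rintro q w ⟨h1, h2, h3⟩
    refine ⟨valid_cons.2 ⟨by simp, h1⟩, ?_, ?_⟩
    · rw [wt_cons, h2, List.length_singleton, add_comm]
    · rw [cdeg_cons, h3]; simp [ldeg]
  · rintro q w ⟨h1, h2, h3⟩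
    change dA φ₂ _ = mp _ (nm _ (dA φ w))
    rw [dA, dC_stab, dA]
    congr 1
    refine (nm_dC _ w (fun i hi => ?_) fun g i hi => ?_).symm
    · simp only [zero_add]
      rw [add_comm 1 i]
      exact hs i (by omega)
    · simp only [zero_add]
      rw [add_comm 1 i]
      exact ht g i (by omega)
  · intro c hc hd
    rw [RA_db φ₂ ε₂ hε₂ hφ₂ ζ₂ hz₂ hl₂ hc] at hd
    obtain ⟨B, hB, A', hA', h1, h2⟩ := stab_surj (by omega) hc hd
    refine ⟨B, hB, A', hA', ?_, ?_⟩
    · rw [RA_db φ ε hε hφ ζ hz hl hB]; exact h1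
    · rw [RA_db φ₂ ε₂ hε₂ hφ₂ ζ₂ hz₂ hl₂ hA']; exact h2
  · intro B hB hd c hc hcB
    rw [RA_db φ ε hε hφ ζ hz hl hB] at hd
    rw [RA_db φ₂ ε₂ hε₂ hφ₂ ζ₂ hz₂ hl₂ hc] at hcB
    obtain ⟨B', hB', h1⟩ := stab_inj h hB hd hc hcB
    refine ⟨B', hB', ?_⟩
    rw [RA_db φ ε hε hφ ζ hz hl hB']; exact h1

end abscmp
end BR
end

noncomputable section

namespace BR
section lblift
variable {G : Type} [Group G] {R : Type} [Ring R] {s : ℕ → R} {t : G → ℕ → R} (n : ℕ)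

/-- the `t`-part of the lift -/
def tH (H : BTRel s t) (j : ℕ) : G →* R where
  toFun g := t g j
  map_one' := H.t_one j
  map_mul' g h := (H.t_mul g h j).symm

theorem tH_comm (H : BTRel s t) : Pairwise fun i j : Fin n => ∀ x y : G,
    Commute (tH H (i : ℕ) x) (tH H (j : ℕ) y) := by
  intro i j hij x y
  exact H.tt_comm x y i j (fun h => hij (Fin.ext h))

/-- the `t`-part of the lift -/
def tL (H : BTRel s t) : (ℕ → G) →* R :=
  (MonoidHom.noncommPiCoprod (fun j : Fin n => tH H (j : ℕ)) (tH_comm n H)).comp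
  { toFun := fun (f : ℕ → G) (j : Fin n) => f j
    map_one' := rfl
    map_mul' := fun _ _ => rfl }

theorem tL_congr (H : BTRel s t) {f f' : ℕ → G} (h : ∀ j, j < n → f j = f' j) :
    tL n H f = tL n H f' := by
  unfold tL
  simp only [MonoidHom.comp_apply, MonoidHom.coe_mk, OneHom.coe_mk]
  congr 1
  funext j
  exact h j j.2

theorem tL_single (H : BTRel s t) (h1 : ∀ g j, n ≤ j → t g j = 1) (g : G) (j : ℕ) :
    tL n H (Pi.mulSingle j g) = t g j := by
  by_cases hj : j < n
  · unfold tL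
    have : (fun i : Fin n => (Pi.mulSingle j g : ℕ → G) i) = Pi.mulSingle (⟨j, hj⟩ : Fin n) g := by
      funext i
      by_cases h : i = ⟨j, hj⟩
      · subst h; simp
      · rw [Pi.mulSingle_eq_of_ne h, Pi.mulSingle_eq_of_ne]
        intro h'; exact h (Fin.ext h')
    simp only [MonoidHom.comp_apply, MonoidHom.coe_mk, OneHom.coe_mk]
    rw [this, MonoidHom.noncommPiCoprod_mulSingle]
    rfl
  · rw [h1 g j (by omega), tL_congr n H (f' := 1), map_one]
    intro i hi
    rw [Pi.mulSingle_eq_of_ne (by omega)]; rfl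

theorem s_tL (H : BTRel s t) (h1 : ∀ g j, n ≤ j → t g j = 1) (h0 : ∀ i, n ≤ i + 1 → s i = 0)
    (i : ℕ) (f : ℕ → G) : s i * tL n H f = tL n H (fun j => f (Equiv.swap i (i + 1) j)) * s i := by
  by_cases hi : n ≤ i + 1
  · rw [h0 i hi, zero_mul, mul_zero]
  classical
  set f' : ℕ → G := fun j => if j < n then f j else 1 with hf'
  have e1 : tL n H f = tL n H f' := tL_congr n H fun j hj => by simp [hf', hj]
  have e2 : tL n H (fun j => f (Equiv.swap i (i + 1) j)) =
      tL n H (fun j => f' (Equiv.swap i (i + 1) j)) := tL_congr n H fun j hj => by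
    have : Equiv.swap i (i + 1) j < n := by
      rw [Equiv.swap_apply_def]; split_ifs <;> omega
    simp [hf', this]
  rw [e1, e2]
  have := lbg_induction (fun a : LB G => a.x = 1 ∧ s i * tL n H a.g =
    tL n H (fun j => a.g (Equiv.swap i (i + 1) j)) * s i) n ?_ ?_ f' (fun j hj => by
      simp [hf', not_lt.2 hj])
  · exact this.2
  · refine ⟨rfl, ?_⟩
    have : (1 : LB G).g = 1 := rfl
    rw [this]
    have : (fun j => (1 : ℕ → G) (Equiv.swap i (i + 1) j)) = 1 := rfl
    rw [this, map_one, mul_one, one_mul]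
  · rintro a g j hj ⟨hx, ha⟩
    refine ⟨by simp [hx], ?_⟩
    have e : (a * lt g j).g = a.g * Pi.mulSingle j g := by
      funext l; rw [LB.mul_g, hx, map_one]; rfl
    rw [e, map_mul, ← mul_assoc, ha]
    have e' : (fun l => (a.g * Pi.mulSingle j g : ℕ → G) (Equiv.swap i (i + 1) l)) =
      (fun l => a.g (Equiv.swap i (i + 1) l)) * Pi.mulSingle (Equiv.swap i (i + 1) j) g := by
      rw [← mulSingle_swap]; rfl
    rw [e', map_mul, mul_assoc, mul_assoc]
    congr 1
    rw [tL_single n H h1, tL_single n H h1]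
    by_cases h2 : j = i
    · subst h2; rw [Equiv.swap_apply_left, H.slide]
    by_cases h3 : j = i + 1
    · subst h3; rw [Equiv.swap_apply_right, H.slide']
    rw [Equiv.swap_apply_of_ne_of_ne h2 h3, H.st_comm g i j h2 h3]

/-- the lift to the labelled braid monoid -/
def lbL (H : BTRel s t) (h1 : ∀ g j, n ≤ j → t g j = 1) (h0 : ∀ i, n ≤ i + 1 → s i = 0) : LB G →* R where
  toFun a := tL n H a.g * bmLift s H.toBRel a.x
  map_one' := by
    have : (1 : LB G).g = 1 := rfl
    rw [this]; simp
  map_mul' a b := by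
    have key : ∀ (x : BM) (f : ℕ → G), bmLift s H.toBRel x * tL n H f =
        tL n H (fun j => f ((swp x).symm j)) * bmLift s H.toBRel x := by
      intro x
      induction x using bm_induction with
      | h1 => intro f; rw [map_one, map_one, one_mul, mul_one]; rfl
      | hs x i ih =>
        intro f
        rw [map_mul, bmLift_bs, mul_assoc, s_tL n H h1 h0, ← mul_assoc, ih, mul_assoc, map_mul, swp_bs]
        rfl
    have e : (a * b).g = a.g * fun j => b.g ((swp a.x).symm j) := rfl
    have k1 := key a.x b.g
    rw [e, map_mul, LB.mul_x, map_mul, mul_assoc, mul_assoc,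
      ← mul_assoc (bmLift s H.toBRel a.x) (tL n H b.g), k1, mul_assoc]

theorem lbL_ls (H : BTRel s t) (h1 : ∀ g j, n ≤ j → t g j = 1) (h0 : ∀ i, n ≤ i + 1 → s i = 0) (i : ℕ) :
    lbL n H h1 h0 (ls i) = s i := by
  have : (ls i : LB G).g = 1 := rfl
  change tL n H _ * bmLift _ _ _ = _
  rw [this, map_one, one_mul, ls_x, bmLift_bs]

theorem lbL_lt (H : BTRel s t) (h1 : ∀ g j, n ≤ j → t g j = 1) (h0 : ∀ i, n ≤ i + 1 → s i = 0)
    (g : G) (i : ℕ) : lbL n H h1 h0 (lt g i) = t g i := by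
  change tL n H _ * bmLift _ _ _ = _
  rw [lt_x, map_one, mul_one, lt_g, tL_single n H h1]

end lblift

section gam
variable {k G : Type} [CommRing k] [Group G] (n : ℕ)

/-- the full twist -/
def zz (G : Type) [Group G] (n : ℕ) : Nn G n := ⟨ztw G n, ztw_mem n⟩

theorem zz_comm (a b : Nn G n) (hb : b ∈ Submonoid.powers (zz G n)) : b * a = a * b := by
  obtain ⟨m, rfl⟩ := hb
  have : Commute (zz G n) a := Subtype.ext (ztw_central n (a : LB G) a.2)
  exact (this.pow_left m).eq

theorem zz_cancel (a b : Nn G n) (c : Nn G n) (hc : c ∈ Submonoid.powers (zz G n)) (h : a * c = b * c) :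
    a = b := by
  obtain ⟨m, rfl⟩ := hc
  dsimp only at h
  induction m with
  | zero => simpa using h
  | succ m ih =>
    rw [pow_succ, ← mul_assoc, ← mul_assoc] at h
    exact ih (Subtype.ext (ztw_cancel n _ _ (congrArg Subtype.val h)))

instance oreN : OreLocalization.OreSet (Submonoid.powers (zz G n)) where
  ore_right_cancel r₁ r₂ s h := ⟨1, by rw [zz_cancel n r₁ r₂ s s.2 h]⟩
  oreNum r _ := r
  oreDenom _ s := s
  ore_eq r s := zz_comm n r s s.2

/-- the localization -/
def Gam (G : Type) [Group G] (n : ℕ) : Type := OreLocalization (Submonoid.powers (zz G n)) (Nn G n)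

instance : Monoid (Gam G n) := inferInstanceAs (Monoid (OreLocalization (Submonoid.powers (zz G n)) (Nn G n)))

def jn (G : Type) [Group G] (n : ℕ) : Nn G n →* Gam G n :=
  OreLocalization.numeratorHom (R := Nn G n) (S := Submonoid.powers (zz G n))

theorem jn_inj : Function.Injective (jn G n) := by
  intro a b h
  obtain ⟨u, v, h1, h2⟩ := OreLocalization.oreDiv_eq_iff.1 h
  simp only [Submonoid.coe_one, mul_one] at h2
  have h1' : (u : Nn G n) * b = v * a := h1
  rw [← h2, zz_comm n b u u.2, zz_comm n a u u.2] at h1'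
  exact (zz_cancel n _ _ _ u.2 h1').symm

theorem jn_z : IsUnit (jn G n (zz G n)) :=
  OreLocalization.numerator_isUnit (⟨zz G n, Submonoid.mem_powers _⟩ : Submonoid.powers (zz G n))

theorem jn_frac (γ : Gam G n) : ∃ (m : ℕ) (x : Nn G n), jn G n (zz G n) ^ m * γ = jn G n x := by
  induction γ using OreLocalization.ind with
  | c r s =>
    obtain ⟨m, hm⟩ := s.2
    refine ⟨m, r, ?_⟩
    rw [← map_pow]
    have : zz G n ^ m = (s : Nn G n) := hm
    rw [this]
    exact OreLocalization.mul_cancel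

theorem gam_lift {R : Type} [Monoid R] (f : Nn G n →* R) (hf : IsUnit (f (zz G n))) :
    ∃ F : Gam G n →* R, ∀ x, F (jn G n x) = f x := by
  have h : ∀ x : Submonoid.powers (zz G n), IsUnit ((f.comp (Submonoid.powers (zz G n)).subtype) x) := by
    rintro ⟨x, m, rfl⟩
    simpa using hf.pow m
  exact ⟨OreLocalization.universalMulHom f (IsUnit.liftRight _ h) (fun s => rfl), fun x =>
    OreLocalization.universalMulHom_commutes _ _ _⟩

theorem gam_ext {R : Type} [Monoid R] {f f' : Gam G n →* R} (h : ∀ x, f (jn G n x) = f' (jn G n x)) :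
    f = f' := by
  ext γ
  obtain ⟨m, x, hx⟩ := jn_frac n γ
  have h1 := congrArg f hx
  have h2 := congrArg f' hx
  rw [map_mul, map_pow] at h1 h2
  rw [← h, ← h] at h2
  rw [← h2] at h1
  exact (((jn_z n).map f).pow m).mul_left_cancel h1

theorem dl_unit : IsUnit (jn G n ⟨dl ls 0 n, dl_mem _ fun i hi => by rw [ls_mem]; omega⟩) := by
  have hz := jn_z (G := G) n
  have e : zz G n = ⟨dl ls 0 n, dl_mem _ fun i hi => by rw [ls_mem]; omega⟩ *
    ⟨dl ls 0 n, dl_mem _ fun i hi => by rw [ls_mem]; omega⟩ := rfl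
  rw [e, map_mul] at hz
  exact (Commute.isUnit_mul_iff (Commute.refl _)).1 hz |>.1

theorem dl_div_r (i : ℕ) : ∀ p q, i + 2 ≤ q → ∃ y : LB G, dl ls p q = y * ls (p + i) := by
  induction i with
  | zero =>
    intro p q h
    obtain ⟨q, rfl⟩ : ∃ r, q = r + 2 := ⟨q - 2, by omega⟩
    exact dl_div lb_rel.toBRel p q
  | succ i ih =>
    intro p q h
    obtain ⟨q, rfl⟩ : ∃ r, q = r + 1 := ⟨q - 1, by omega⟩
    obtain ⟨y, hy⟩ := ih (p + 1) q (by omega)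
    refine ⟨cc ls p q * y, ?_⟩
    rw [dl_succ, hy, mul_assoc]
    congr 3; omega

theorem ls_left (i : ℕ) (h : i + 1 < n) : ∃ y : Nn G n, IsUnit (jn G n (y * ⟨ls i, ls_mem.2 h⟩)) := by
  obtain ⟨y, hy⟩ := dl_div_r (G := G) i 0 n (by omega)
  rw [zero_add] at hy
  have hm : (dl ls 0 n : LB G) ∈ Nn G n := dl_mem _ fun i hi => by rw [ls_mem]; omega
  have hm' := hm
  rw [hy] at hm'
  refine ⟨⟨y, (mem_of_mul_ls hm').1⟩, ?_⟩
  have := dl_unit (G := G) n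
  convert this using 2
  exact Subtype.ext hy.symm

theorem lt_unit (g : G) (i : ℕ) (h : i < n) : IsUnit (jn G n ⟨lt g i, lt_mem g h⟩) := by
  refine IsUnit.map (jn G n) ⟨⟨⟨lt g i, lt_mem g h⟩, ⟨lt g⁻¹ i, lt_mem _ h⟩, ?_, ?_⟩, rfl⟩
  · refine Subtype.ext ?_
    change lt g i * lt g⁻¹ i = 1
    rw [lb_rel.t_mul, mul_inv_cancel, lb_rel.t_one]
  · refine Subtype.ext ?_
    change lt g⁻¹ i * lt g i = 1
    rw [lb_rel.t_mul, inv_mul_cancel, lb_rel.t_one]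

theorem jn_left (x : Nn G n) : ∃ r, r * jn G n x = 1 := by
  obtain ⟨x, hx⟩ := x
  suffices ∀ hx : x ∈ Nn G n, ∃ r, r * jn G n ⟨x, hx⟩ = 1 from this hx
  refine Nn_induction n (fun x => ∀ hx : x ∈ Nn G n, ∃ r, r * jn G n ⟨x, hx⟩ = 1) ?_ ?_ ?_ x hx
  · intro h; exact ⟨1, by rw [one_mul]; exact map_one _⟩
  · intro a g j hj ih h
    have ha : a ∈ Nn G n := by
      have := mul_mem h (lt_mem g⁻¹ hj)
      rwa [mul_assoc, lb_rel.t_mul, mul_inv_cancel, lb_rel.t_one, mul_one] at this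
    obtain ⟨r, hr⟩ := ih ha
    obtain ⟨u, hu⟩ := lt_unit n g j hj
    refine ⟨↑u⁻¹ * r, ?_⟩
    have e : (⟨a * lt g j, h⟩ : Nn G n) = ⟨a, ha⟩ * ⟨lt g j, lt_mem g hj⟩ := rfl
    rw [e, map_mul, ← hu, mul_assoc, ← mul_assoc r, hr, one_mul, Units.inv_mul]
  · intro a i hi ih h
    obtain ⟨ha, -⟩ := mem_of_mul_ls h
    obtain ⟨r, hr⟩ := ih ha
    obtain ⟨y, u, hu⟩ := ls_left (G := G) n i hi
    refine ⟨↑u⁻¹ * jn G n y * r, ?_⟩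
    have e : (⟨a * ls i, h⟩ : Nn G n) = ⟨a, ha⟩ * ⟨ls i, ls_mem.2 hi⟩ := rfl
    rw [e, map_mul, mul_assoc, ← mul_assoc r, hr, one_mul, mul_assoc, ← map_mul, ← hu, Units.inv_mul]

theorem ls_unit (i : ℕ) (h : i + 1 < n) : IsUnit (jn G n ⟨ls i, ls_mem.2 h⟩) := by
  obtain ⟨y, u, hu⟩ := ls_left (G := G) n i h
  obtain ⟨r, hr⟩ := jn_left n y
  rw [map_mul] at hu
  have hy : IsUnit (jn G n y) := by
    refine ⟨⟨jn G n y, r, ?_, hr⟩, rfl⟩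
    have h1 : jn G n y * (jn G n ⟨ls i, ls_mem.2 h⟩ * ↑u⁻¹) = 1 := by
      rw [← mul_assoc, ← hu, Units.mul_inv]
    rw [left_inv_eq_right_inv hr h1, h1]
  obtain ⟨v, hv⟩ := hy
  rw [← hv] at hu
  refine ⟨v⁻¹ * u, ?_⟩
  rw [Units.val_mul, hu, ← mul_assoc, Units.inv_mul, one_mul]

end gam
end BR
end

noncomputable section

namespace BR
section mk
variable {G : Type} [Group G] {R : Type} [Ring R] {s : ℕ → R} {t : G → ℕ → R} (n : ℕ)

/-- relations only need to be checked in range -/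
theorem btmk (h1 : ∀ g j, n ≤ j → t g j = 1) (h0 : ∀ i, n ≤ i + 1 → s i = 0)
    (comm : ∀ i j, i + 1 < n → j + 1 < n → Far i j → s i * s j = s j * s i)
    (braid : ∀ i j, i + 1 < n → j + 1 < n → Adj i j → s i * s j * s i = s j * s i * s j)
    (t_mul : ∀ g h j, j < n → t g j * t h j = t (g * h) j)
    (t_one : ∀ j, j < n → t 1 j = 1)
    (tt_comm : ∀ g h j l, j < n → l < n → j ≠ l → t g j * t h l = t h l * t g j)
    (st_comm : ∀ g i l, i + 1 < n → l < n → l ≠ i → l ≠ i + 1 → s i * t g l = t g l * s i)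
    (slide : ∀ g i, i + 1 < n → s i * t g i = t g (i + 1) * s i)
    (slide' : ∀ g i, i + 1 < n → s i * t g (i + 1) = t g i * s i) : BTRel s t where
  comm i j h := by
    by_cases hi : i + 1 < n
    · by_cases hj : j + 1 < n
      · exact comm i j hi hj h
      · rw [h0 j (by omega), mul_zero, zero_mul]
    · rw [h0 i (by omega), mul_zero, zero_mul]
  braid i j h := by
    by_cases hi : i + 1 < n
    · by_cases hj : j + 1 < n
      · exact braid i j hi hj h
      · rw [h0 j (by omega)]; simp
    · rw [h0 i (by omega)]; simp
  t_mul g h j := by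
    by_cases hj : j < n
    · exact t_mul g h j hj
    · rw [h1 _ j (by omega), h1 _ j (by omega), h1 _ j (by omega), mul_one]
  t_one j := by
    by_cases hj : j < n
    · exact t_one j hj
    · rw [h1 _ j (by omega)]
  tt_comm g h j l e := by
    by_cases hj : j < n
    · by_cases hl : l < n
      · exact tt_comm g h j l hj hl e
      · rw [h1 _ l (by omega), mul_one, one_mul]
    · rw [h1 _ j (by omega), mul_one, one_mul]
  st_comm g i l a b := by
    by_cases hi : i + 1 < n
    · by_cases hl : l < n
      · exact st_comm g i l hi hl a b
      · rw [h1 _ l (by omega), mul_one, one_mul]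
    · rw [h0 i (by omega), mul_zero, zero_mul]
  slide g i := by
    by_cases hi : i + 1 < n
    · exact slide g i hi
    · rw [h0 i (by omega), mul_zero, zero_mul]
  slide' g i := by
    by_cases hi : i + 1 < n
    · exact slide' g i hi
    · rw [h0 i (by omega), mul_zero, zero_mul]

end mk

section AAs
variable (k G : Type) [CommRing k] [Group G] (n : ℕ)

/-- the group algebra -/
abbrev AA : Type := MonoidAlgebra k (Gam G n)

/-- the localization map -/
def ph : MonoidAlgebra k (Nn G n) →+* AA k G n := MonoidAlgebra.mapDomainRingHom k (jn G n)

theorem ph_single (γ : Nn G n) (c : k) :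
    ph k G n (MonoidAlgebra.single γ c) = MonoidAlgebra.single (jn G n γ) c := by
  unfold ph
  simp

theorem ph_inj : Function.Injective (ph k G n) :=
  MonoidAlgebra.mapDomain_injective (jn_inj n)

/-- augmentation -/
def aA : AA k G n →ₐ[k] k := MonoidAlgebra.lift k k (Gam G n) 1

theorem aA_single (γ : Gam G n) (c : k) : aA k G n (MonoidAlgebra.single γ c) = c := by
  unfold aA
  rw [MonoidAlgebra.lift_single]; simp

theorem aA_ph (γ : Nn G n) (c : k) : aA k G n (ph k G n (MonoidAlgebra.single γ c)) = c := by
  rw [ph_single, aA_single]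

theorem oo_unit {γ : Gam G n} (h : IsUnit γ) : IsUnit (MonoidAlgebra.single γ (1 : k)) :=
  h.map (MonoidAlgebra.of k (Gam G n))

theorem ph_z : IsUnit (ph k G n (oo k (zz G n))) := by
  unfold oo
  rw [ph_single]
  exact oo_unit k G n (jn_z n)

theorem ph_frac (a : AA k G n) : ∃ m : ℕ, ∃ b, ph k G n (oo k (zz G n)) ^ m * a = ph k G n b := by
  induction a using MonoidAlgebra.induction_linear with
  | zero => exact ⟨0, 0, by simp⟩
  | add x y hx hy =>
    obtain ⟨m, b, hb⟩ := hx
    obtain ⟨m', b', hb'⟩ := hy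
    refine ⟨m + m', oo k (zz G n) ^ m' * b + oo k (zz G n) ^ m * b', ?_⟩
    rw [map_add, map_mul, map_mul, map_pow, map_pow, mul_add, ← hb, ← hb', ← mul_assoc, ← mul_assoc,
      ← pow_add, ← pow_add, add_comm m' m]
  | single γ c =>
    obtain ⟨m, x, hx⟩ := jn_frac n γ
    refine ⟨m, MonoidAlgebra.single x c, ?_⟩
    unfold oo
    rw [ph_single, ph_single, MonoidAlgebra.single_pow, one_pow, MonoidAlgebra.single_mul_single, one_mul, ← hx]

/-- generators of the group algebra -/
def as (i : ℕ) : AA k G n := ph k G n (ns k G n i)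
def at' (g : G) (i : ℕ) : AA k G n := ph k G n (nt k G n g i)

theorem as_of (i : ℕ) (h : i + 1 < n) : as k G n i = MonoidAlgebra.single (jn G n ⟨ls i, ls_mem.2 h⟩) 1 := by
  unfold as ns oo
  rw [dif_pos h, ph_single]
theorem at_of (g : G) (i : ℕ) (h : i < n) : at' k G n g i = MonoidAlgebra.single (jn G n ⟨lt g i, lt_mem g h⟩) 1 := by
  unfold at' nt oo
  rw [dif_pos h, ph_single]
theorem as_z (i : ℕ) (h : n ≤ i + 1) : as k G n i = 0 := by
  unfold as ns
  rw [dif_neg (by omega), map_zero]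
theorem at_z (g : G) (i : ℕ) (h : n ≤ i) : at' k G n g i = 1 := by
  unfold at' nt
  rw [dif_neg (by omega), map_one]

theorem as_unit (i : ℕ) (h : i + 1 < n) : IsUnit (as k G n i) := by
  rw [as_of k G n i h]; exact oo_unit k G n (ls_unit n i h)

theorem aa_rel : BTRel (as k G n) (at' k G n) := by
  refine btmk n (at_z k G n) (as_z k G n) ?_ ?_ ?_ ?_ ?_ ?_ ?_ ?_
  · intro i j hi hj h
    rw [as_of k G n i hi, as_of k G n j hj]
    simp only [MonoidAlgebra.single_mul_single, ← map_mul]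
    congr 2; exact Subtype.ext (lb_rel.comm i j h)
  · intro i j hi hj h
    rw [as_of k G n i hi, as_of k G n j hj]
    simp only [MonoidAlgebra.single_mul_single, ← map_mul]
    congr 2; exact Subtype.ext (lb_rel.braid i j h)
  · intro g h j hj
    rw [at_of k G n _ j hj, at_of k G n _ j hj, at_of k G n _ j hj]
    simp only [MonoidAlgebra.single_mul_single, ← map_mul, mul_one]
    congr 2; exact Subtype.ext (lb_rel.t_mul g h j)
  · intro j hj
    rw [at_of k G n _ j hj, MonoidAlgebra.one_def]
    congr 1; rw [← map_one (jn G n)]; congr 1; exact Subtype.ext (lb_rel.t_one j)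
  · intro g h j l hj hl e
    rw [at_of k G n _ j hj, at_of k G n _ l hl]
    simp only [MonoidAlgebra.single_mul_single, ← map_mul]
    congr 2; exact Subtype.ext (lb_rel.tt_comm g h j l e)
  · intro g i l hi hl a b
    rw [as_of k G n i hi, at_of k G n _ l hl]
    simp only [MonoidAlgebra.single_mul_single, ← map_mul]
    congr 2; exact Subtype.ext (lb_rel.st_comm g i l a b)
  · intro g i hi
    rw [as_of k G n i hi, at_of k G n _ i (by omega), at_of k G n _ (i + 1) hi]
    simp only [MonoidAlgebra.single_mul_single, ← map_mul]
    congr 2; exact Subtype.ext (lb_rel.slide g i)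
  · intro g i hi
    rw [as_of k G n i hi, at_of k G n _ i (by omega), at_of k G n _ (i + 1) hi]
    simp only [MonoidAlgebra.single_mul_single, ← map_mul]
    congr 2; exact Subtype.ext (lb_rel.slide' g i)

variable {R : Type} [Ring R] [Algebra k R]

theorem aa_lift {s : ℕ → R} {t : G → ℕ → R} (H : BTRel s t)
    (h1 : ∀ g j, n ≤ j → t g j = 1) (h0 : ∀ i, n ≤ i + 1 → s i = 0)
    (hu : ∀ i, i + 1 < n → IsUnit (s i)) :
    ∃ Ψ : AA k G n →ₐ[k] R, (∀ i, Ψ (as k G n i) = s i) ∧ ∀ g j, Ψ (at' k G n g j) = t g j := by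
  have hz : IsUnit (((lbL n H h1 h0).comp (Nn G n).subtype) (zz G n)) := by
    have : dl (ls : ℕ → LB G) 0 n ∈ (IsUnit.submonoid R).comap (lbL n H h1 h0) := by
      apply dl_mem
      intro i hi
      change IsUnit _
      rw [lbL_ls]
      exact hu _ (by omega)
    have := mul_mem this this
    exact this
  obtain ⟨F, hF⟩ := gam_lift n _ hz
  refine ⟨MonoidAlgebra.lift k R (Gam G n) F, fun i => ?_, fun g j => ?_⟩
  · by_cases h : i + 1 < n
    · rw [as_of k G n i h, MonoidAlgebra.lift_single, one_smul, hF]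
      exact lbL_ls n H h1 h0 i
    · rw [as_z k G n i (by omega), h0 i (by omega), map_zero]
  · by_cases h : j < n
    · rw [at_of k G n g j h, MonoidAlgebra.lift_single, one_smul, hF]
      exact lbL_lt n H h1 h0 g j
    · rw [at_z k G n g j (by omega), h1 g j (by omega), map_one]

theorem aa_ext {Φ Ψ : AA k G n →ₐ[k] R} (hs : ∀ i, i + 1 < n → Φ (as k G n i) = Ψ (as k G n i))
    (ht : ∀ g j, j < n → Φ (at' k G n g j) = Ψ (at' k G n g j)) : Φ = Ψ := by
  have : (Φ : AA k G n →* R).comp (MonoidAlgebra.of k (Gam G n)) =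
      (Ψ : AA k G n →* R).comp (MonoidAlgebra.of k (Gam G n)) := by
    apply gam_ext n
    rintro ⟨x, hx⟩
    have key : ∀ h : x ∈ Nn G n, Φ (MonoidAlgebra.single (jn G n ⟨x, h⟩) 1) =
        Ψ (MonoidAlgebra.single (jn G n ⟨x, h⟩) 1) := by
      refine Nn_induction n (fun x => ∀ h : x ∈ Nn G n, Φ (MonoidAlgebra.single (jn G n ⟨x, h⟩) 1) =
        Ψ (MonoidAlgebra.single (jn G n ⟨x, h⟩) 1)) ?_ ?_ ?_ x hx
      · intro h
        have : (⟨1, h⟩ : Nn G n) = 1 := rfl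
        rw [this, map_one, ← MonoidAlgebra.one_def, map_one, map_one]
      · intro a g j hj ih h
        have ha : a ∈ Nn G n := by
          have := mul_mem h (lt_mem (g⁻¹) hj)
          rwa [mul_assoc, lb_rel.t_mul, mul_inv_cancel, lb_rel.t_one, mul_one] at this
        have e : (⟨a * lt g j, h⟩ : Nn G n) = ⟨a, ha⟩ * ⟨lt g j, lt_mem g hj⟩ := rfl
        have e2 := ht g j hj
        rw [at_of k G n g j hj] at e2
        rw [e, map_mul, ← one_mul (1 : k), ← MonoidAlgebra.single_mul_single, map_mul, map_mul, ih ha, e2]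
      · intro a i hi ih h
        have ha : a ∈ Nn G n := (mem_of_mul_ls h).1
        have e : (⟨a * ls i, h⟩ : Nn G n) = ⟨a, ha⟩ * ⟨ls i, ls_mem.2 hi⟩ := rfl
        have e2 := hs i hi
        rw [as_of k G n i hi] at e2
        rw [e, map_mul, ← one_mul (1 : k), ← MonoidAlgebra.single_mul_single, map_mul, map_mul, ih ha, e2]
    exact key hx
  refine MonoidAlgebra.algHom_ext (fun x => DFunLike.congr_fun this x) ?_
  ext

end AAs
end BR
end

noncomputable section

namespace BR
section idem
variable {k R : Type} [CommRing k] [Ring R] [Algebra k R]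

/-- a complement of commuting quasi-idempotents -/
theorem exists_compl (χ : R →ₐ[k] k) (p : ℕ → R) (ε δ : k) (hδ : δ * ε = 1)
    (hsq : ∀ j, p j * p j = ε • p j) (hc : ∀ j l, p j * p l = p l * p j) (hχ : ∀ j, χ (p j) = 0) (m : ℕ) :
    ∃ f : R, χ f = 1 ∧ (∀ j, j < m → p j * f = 0) ∧ (∀ j, p j * f = f * p j) ∧
      (∀ y, (∀ j, p j * y = 0) → f * y = y) ∧ (∀ y, (∀ j, y * p j = 0) → y * f = y) := by
  induction m with
  | zero => exact ⟨1, by simp, by simp, by simp, by simp, by simp⟩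
  | succ m ih =>
    obtain ⟨f, h1, h2, h3, h4, h5⟩ := ih
    refine ⟨f * (1 - δ • p m), ?_, ?_, ?_, ?_, ?_⟩
    · simp [h1, hχ]
    · intro j hj
      rcases Nat.lt_succ_iff_lt_or_eq.1 hj with h | rfl
      · rw [← mul_assoc, h2 j h, zero_mul]
      · rw [← mul_assoc, h3, mul_assoc, mul_sub, mul_smul_comm, hsq, smul_smul, hδ, one_smul, mul_one,
          sub_self, mul_zero]
    · intro j
      rw [← mul_assoc, h3, mul_assoc, mul_assoc, mul_sub, sub_mul, mul_smul_comm, smul_mul_assoc, hc,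
        mul_one, one_mul]
    · intro y hy
      rw [mul_assoc, sub_mul, smul_mul_assoc, hy m, smul_zero, sub_zero, one_mul, h4 y hy]
    · intro y hy
      rw [← mul_assoc, h5 y hy, mul_sub, mul_smul_comm, hy m, smul_zero, sub_zero, mul_one]

theorem compl_comm {p : ℕ → R} {f u : R} (h2 : ∀ j, p j * f = 0) (h3 : ∀ j, f * p j = 0)
    (h4 : ∀ y, (∀ j, p j * y = 0) → f * y = y) (h5 : ∀ y, (∀ j, y * p j = 0) → y * f = y)
    (hu : ∀ j, ∃ l v, u * p j = p l * v) (hu' : ∀ j, ∃ l v, p j * u = v * p l) : f * u = u * f := by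
  rw [← h5 (f * u), mul_assoc, h4 (u * f)]
  · intro j
    obtain ⟨l, v, h⟩ := hu' j
    rw [← mul_assoc, h, mul_assoc, h2, mul_zero]
  · intro j
    obtain ⟨l, v, h⟩ := hu j
    rw [mul_assoc, h, ← mul_assoc, h3, zero_mul]
end idem

section gbr
variable (k G : Type) [CommRing k] [Group G] (n : ℕ) (ε : k)

/-- generators of the diagram algebra -/
def gg (x : GBRGen n G) : GBRAlg k G n ε := RingQuot.mkAlgHom k (GBRRel k G n ε) (FreeAlgebra.ι k x)

/-- flipped braid generators -/
def sG (i : ℕ) : GBRAlg k G n ε :=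
  if h : i + 1 < n then gg k G n ε (.b ⟨n - 2 - i, by omega⟩) else 0
def tG (g : G) (j : ℕ) : GBRAlg k G n ε :=
  if h : j < n then gg k G n ε (.t g ⟨n - 1 - j, by omega⟩) else 1
def pG (j : ℕ) : GBRAlg k G n ε :=
  if h : j < n then gg k G n ε (.p ⟨j, h⟩) else 0

variable {k G n ε}

theorem rel {x y : FreeAlgebra k (GBRGen n G)} (h : GBRRel k G n ε x y) :
    RingQuot.mkAlgHom k (GBRRel k G n ε) x = RingQuot.mkAlgHom k (GBRRel k G n ε) y :=
  RingQuot.mkAlgHom_rel k h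

theorem sG_of (i : ℕ) (h : i + 1 < n) : sG k G n ε i = gg k G n ε (.b ⟨n - 2 - i, by omega⟩) := dif_pos h
theorem tG_of (g : G) (i : ℕ) (h : i < n) : tG k G n ε g i = gg k G n ε (.t g ⟨n - 1 - i, by omega⟩) := dif_pos h
theorem pG_of (i : ℕ) (h : i < n) : pG k G n ε i = gg k G n ε (.p ⟨i, h⟩) := dif_pos h
theorem pG_z (i : ℕ) (h : n ≤ i) : pG k G n ε i = 0 := dif_neg (by omega)
theorem sG_z (i : ℕ) (h : n ≤ i + 1) : sG k G n ε i = 0 := dif_neg (by omega)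
theorem tG_z (g : G) (i : ℕ) (h : n ≤ i) : tG k G n ε g i = 1 := dif_neg (by omega)

theorem gbr_rel : BTRel (sG k G n ε) (tG k G n ε) := by
  refine btmk n tG_z sG_z ?_ ?_ ?_ ?_ ?_ ?_ ?_ ?_
  · intro i j hi hj h
    rw [sG_of i hi, sG_of j hj]
    unfold gg
    simp only [← map_mul]
    rcases h with h | h
    · exact (rel (GBRRel.bb_comm _ _ (by simp only; omega))).symm
    · exact rel (GBRRel.bb_comm _ _ (by simp only; omega))
  · intro i j hi hj h
    rw [sG_of i hi, sG_of j hj]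
    unfold gg
    simp only [← map_mul]
    rcases h with h | h
    · exact rel (GBRRel.b_braid _ _ (by simp only; omega))
    · exact (rel (GBRRel.b_braid _ _ (by simp only; omega))).symm
  · intro g h j hj
    rw [tG_of _ j hj, tG_of _ j hj, tG_of _ j hj]
    unfold gg
    simp only [← map_mul]
    exact rel (GBRRel.t_mul _ _ _)
  · intro j hj
    rw [tG_of _ j hj]
    unfold gg
    rw [← map_one (RingQuot.mkAlgHom k (GBRRel k G n ε))]
    exact rel (GBRRel.t_one _)
  · intro g h j l hj hl e
    rw [tG_of _ j hj, tG_of _ l hl]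
    unfold gg
    simp only [← map_mul]
    exact rel (GBRRel.tt_comm _ _ _ _ (by rw [Ne, Fin.ext_iff]; simp only; omega))
  · intro g i l hi hl a b
    rw [sG_of i hi, tG_of _ l hl]
    unfold gg
    simp only [← map_mul]
    exact rel (GBRRel.bt_comm _ _ _ (by simp only; omega))
  · intro g i hi
    rw [sG_of i hi, tG_of _ i (by omega), tG_of _ (i + 1) hi]
    unfold gg
    simp only [← map_mul]
    exact rel (GBRRel.bt_slide' _ _ _ _ (by simp only; omega) (by simp only; omega))
  · intro g i hi
    rw [sG_of i hi, tG_of _ i (by omega), tG_of _ (i + 1) hi]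
    unfold gg
    simp only [← map_mul]
    exact rel (GBRRel.bt_slide _ _ _ _ (by simp only; omega) (by simp only; omega))

theorem b_bi (i : Fin (n - 1)) : gg k G n ε (.b i) * gg k G n ε (.bi i) = 1 := by
  unfold gg
  rw [← map_mul, rel (GBRRel.b_inv_r _), map_one]
theorem bi_b (i : Fin (n - 1)) : gg k G n ε (.bi i) * gg k G n ε (.b i) = 1 := by
  unfold gg
  rw [← map_mul, rel (GBRRel.b_inv_l _), map_one]

theorem sG_unit (i : ℕ) (h : i + 1 < n) : IsUnit (sG k G n ε i) := by
  rw [sG_of i h]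
  exact ⟨⟨_, _, b_bi _, bi_b _⟩, rfl⟩

theorem sG_flip (i : Fin (n - 1)) : sG k G n ε (n - 2 - i) = gg k G n ε (.b i) := by
  have := i.2
  rw [sG_of _ (by omega)]
  congr 2; apply Fin.ext; simp only; omega
theorem tG_flip (g : G) (j : Fin n) : tG k G n ε g (n - 1 - j) = gg k G n ε (.t g j) := by
  have := j.2
  rw [tG_of _ _ (by omega)]
  congr 2; apply Fin.ext; simp only; omega

theorem gbr_ext {R : Type} [Ring R] [Algebra k R] {Φ Ψ : GBRAlg k G n ε →ₐ[k] R}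
    (h : ∀ x, Φ (gg k G n ε x) = Ψ (gg k G n ε x)) : Φ = Ψ := by
  apply RingQuot.ringQuot_ext'
  apply FreeAlgebra.hom_ext
  funext x
  exact h x

theorem gbr_ind (P : GBRAlg k G n ε → Prop) (hg : ∀ x, P (gg k G n ε x))
    (hk : ∀ c : k, P (algebraMap k _ c)) (ha : ∀ a b, P a → P b → P (a + b))
    (hm : ∀ a b, P a → P b → P (a * b)) (a : GBRAlg k G n ε) : P a := by
  obtain ⟨a, rfl⟩ := RingQuot.mkAlgHom_surjective k (GBRRel k G n ε) a
  induction a using FreeAlgebra.induction with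
  | grade0 c => rw [AlgHom.commutes]; exact hk c
  | grade1 x => exact hg x
  | mul a b iha ihb => rw [map_mul]; exact hm _ _ iha ihb
  | add a b iha ihb => rw [map_add]; exact ha _ _ iha ihb

theorem aug_gg (x : GBRGen n G) : GBRaug k G n ε (gg k G n ε x) =
    match x with
        | GBRGen.b _ => (1 : k)
        | GBRGen.bi _ => (1 : k)
        | GBRGen.p _ => (0 : k)
        | GBRGen.t _ _ => (1 : k) := by
  unfold GBRaug gg
  cases x <;> rw [RingQuot.liftAlgHom_mkAlgHom_apply, FreeAlgebra.lift_ι_apply]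

theorem aug_sG (i : ℕ) (h : i + 1 < n) : GBRaug k G n ε (sG k G n ε i) = 1 := by
  rw [sG_of i h, aug_gg]
theorem aug_tG (g : G) (i : ℕ) : GBRaug k G n ε (tG k G n ε g i) = 1 := by
  by_cases h : i < n
  · rw [tG_of g i h, aug_gg]
  · rw [tG_z g i (by omega), map_one]
theorem aug_pG (i : ℕ) : GBRaug k G n ε (pG k G n ε i) = 0 := by
  by_cases h : i < n
  · rw [pG_of i h, aug_gg]
  · rw [pG_z i (by omega), map_zero]

theorem pG_sq (j : ℕ) : pG k G n ε j * pG k G n ε j = ε • pG k G n ε j := by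
  by_cases h : j < n
  · rw [pG_of j h]
    unfold gg
    rw [← map_mul, rel (GBRRel.p_sq _), map_smul]
  · rw [pG_z j (by omega), mul_zero, smul_zero]

theorem pG_comm (j l : ℕ) : pG k G n ε j * pG k G n ε l = pG k G n ε l * pG k G n ε j := by
  by_cases h : j < n
  · by_cases h' : l < n
    · rw [pG_of j h, pG_of l h']
      unfold gg
      simp only [← map_mul]
      rcases lt_trichotomy j l with e | rfl | e
      · exact rel (GBRRel.pp_comm _ _ e)
      · rfl
      · exact (rel (GBRRel.pp_comm _ _ e)).symm
    · rw [pG_z l (by omega), mul_zero, zero_mul]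
  · rw [pG_z j (by omega), mul_zero, zero_mul]

theorem b_pG (i : Fin (n - 1)) (j : ℕ) : ∃ l, gg k G n ε (.b i) * pG k G n ε j = pG k G n ε l * gg k G n ε (.b i) := by
  have hi := i.2
  by_cases h : j < n
  · rw [pG_of j h]
    by_cases h1 : j = i
    · refine ⟨i + 1, ?_⟩
      rw [pG_of _ (by omega)]
      unfold gg
      simp only [← map_mul]
      exact rel (GBRRel.bp_slide _ _ _ h1 rfl)
    by_cases h2 : j = i + 1
    · refine ⟨i, ?_⟩
      rw [pG_of _ (by omega)]
      unfold gg
      simp only [← map_mul]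
      exact rel (GBRRel.bp_slide' _ _ _ rfl h2)
    refine ⟨j, ?_⟩
    rw [pG_of _ h]
    unfold gg
    simp only [← map_mul]
    exact rel (GBRRel.bp_comm _ _ ⟨h1, h2⟩)
  · exact ⟨j, by rw [pG_z j (by omega), mul_zero, zero_mul]⟩

theorem pG_b (i : Fin (n - 1)) (j : ℕ) : ∃ l, pG k G n ε j * gg k G n ε (.b i) = gg k G n ε (.b i) * pG k G n ε l := by
  have hi := i.2
  by_cases h : j < n
  · rw [pG_of j h]
    by_cases h1 : j = i
    · refine ⟨i + 1, ?_⟩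
      rw [pG_of _ (by omega)]
      unfold gg
      simp only [← map_mul]
      exact (rel (GBRRel.bp_slide' _ _ _ h1 rfl)).symm
    by_cases h2 : j = i + 1
    · refine ⟨i, ?_⟩
      rw [pG_of _ (by omega)]
      unfold gg
      simp only [← map_mul]
      exact (rel (GBRRel.bp_slide _ _ _ rfl h2)).symm
    refine ⟨j, ?_⟩
    rw [pG_of _ h]
    unfold gg
    simp only [← map_mul]
    exact (rel (GBRRel.bp_comm _ _ ⟨h1, h2⟩)).symm
  · exact ⟨j, by rw [pG_z j (by omega), mul_zero, zero_mul]⟩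

theorem t_pG (g : G) (i : Fin n) (j : ℕ) : gg k G n ε (.t g i) * pG k G n ε j = pG k G n ε j * gg k G n ε (.t g i) := by
  by_cases h : j < n
  · rw [pG_of j h]
    unfold gg
    simp only [← map_mul]
    by_cases h1 : i = ⟨j, h⟩
    · subst h1
      rw [rel (GBRRel.tp_absorb _ _), rel (GBRRel.pt_absorb _ _)]
    · exact rel (GBRRel.tp_comm _ _ _ h1)
  · rw [pG_z j (by omega), mul_zero, zero_mul]

theorem exists_f (hε : IsUnit ε) : ∃ f : GBRAlg k G n ε, GBRaug k G n ε f = 1 ∧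
    (∀ j, gg k G n ε (.p j) * f = 0) ∧ (∀ i, f * gg k G n ε (.b i) = gg k G n ε (.b i) * f) ∧
    (∀ i, f * gg k G n ε (.bi i) = gg k G n ε (.bi i) * f) ∧
    (∀ g i, f * gg k G n ε (.t g i) = gg k G n ε (.t g i) * f) := by
  obtain ⟨δ, hδ⟩ := hε.exists_left_inv
  obtain ⟨f, h1, h2, h3, h4, h5⟩ := exists_compl (GBRaug k G n ε) (pG k G n ε) ε δ hδ pG_sq pG_comm aug_pG n
  have h2' : ∀ j, pG k G n ε j * f = 0 := by
    intro j
    by_cases h : j < n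
    · exact h2 j h
    · rw [pG_z j (by omega), zero_mul]
  have h3' : ∀ j, f * pG k G n ε j = 0 := fun j => by rw [← h3, h2']
  have hb : ∀ i, f * gg k G n ε (.b i) = gg k G n ε (.b i) * f := by
    intro i
    refine compl_comm h2' h3' h4 h5 (fun j => ?_) (fun j => ?_)
    · obtain ⟨l, h⟩ := b_pG (k := k) (G := G) (ε := ε) i j
      exact ⟨l, _, h⟩
    · obtain ⟨l, h⟩ := pG_b (k := k) (G := G) (ε := ε) i j
      exact ⟨l, _, h⟩
  refine ⟨f, h1, fun j => ?_, hb, fun i => ?_, fun g i => ?_⟩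
  · rw [← h2' j, pG_of _ j.2]
  · calc f * gg k G n ε (.bi i) = gg k G n ε (.bi i) * gg k G n ε (.b i) * f * gg k G n ε (.bi i) := by
          rw [bi_b, one_mul]
      _ = gg k G n ε (.bi i) * f * (gg k G n ε (.b i) * gg k G n ε (.bi i)) := by
          rw [mul_assoc (gg k G n ε (.bi i)), ← hb]; simp only [mul_assoc]
      _ = _ := by rw [b_bi, mul_one]
  · exact compl_comm h2' h3' h4 h5 (fun j => ⟨j, _, t_pG g i j⟩) (fun j => ⟨j, _, (t_pG g i j).symm⟩)

variable (k G n ε)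

/-- images of generators in the group algebra -/
def piG : GBRGen n G → AA k G n
  | .b i => as k G n (n - 2 - i)
  | .bi i => Ring.inverse (as k G n (n - 2 - i))
  | .p _ => 0
  | .t g j => at' k G n g (n - 1 - j)

theorem piG_rel {x y : FreeAlgebra k (GBRGen n G)} (h : GBRRel k G n ε x y) :
    FreeAlgebra.lift k (piG k G n) x = FreeAlgebra.lift k (piG k G n) y := by
  have H := aa_rel k G n
  induction h with
  | b_inv_r i =>
    have := i.2
    simp only [map_mul, map_one, FreeAlgebra.lift_ι_apply, piG]
    exact Ring.mul_inverse_cancel _ (as_unit k G n _ (by omega))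
  | b_inv_l i =>
    have := i.2
    simp only [map_mul, map_one, FreeAlgebra.lift_ι_apply, piG]
    exact Ring.inverse_mul_cancel _ (as_unit k G n _ (by omega))
  | b_braid i j h =>
    have := i.2
    have := j.2
    simp only [map_mul, FreeAlgebra.lift_ι_apply, piG]
    exact H.braid _ _ (by unfold Adj; omega)
  | bb_comm i j h =>
    have := i.2
    have := j.2
    simp only [map_mul, FreeAlgebra.lift_ι_apply, piG]
    exact H.comm _ _ (by unfold Far; omega)
  | t_mul g h' j =>
    simp only [map_mul, FreeAlgebra.lift_ι_apply, piG]
    exact H.t_mul _ _ _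
  | t_one j =>
    simp only [map_one, FreeAlgebra.lift_ι_apply, piG]
    exact H.t_one _
  | tt_comm g h' j l h =>
    simp only [map_mul, FreeAlgebra.lift_ι_apply, piG]
    exact H.tt_comm _ _ _ _ (by rw [Ne, Fin.ext_iff] at h; omega)
  | bt_comm g i l h =>
    have := i.2
    have := l.2
    simp only [map_mul, FreeAlgebra.lift_ι_apply, piG]
    exact H.st_comm _ _ _ (by omega) (by omega)
  | bt_slide g i j j' h h' =>
    have := i.2
    simp only [map_mul, FreeAlgebra.lift_ι_apply, piG]
    have e1 : n - 1 - (j : ℕ) = n - 2 - i + 1 := by omega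
    have e2 : n - 1 - (j' : ℕ) = n - 2 - i := by omega
    rw [e1, e2]
    exact H.slide' _ _
  | bt_slide' g i j j' h h' =>
    have := i.2
    simp only [map_mul, FreeAlgebra.lift_ι_apply, piG]
    have e1 : n - 1 - (j : ℕ) = n - 2 - i + 1 := by omega
    have e2 : n - 1 - (j' : ℕ) = n - 2 - i := by omega
    rw [e1, e2]
    exact H.slide _ _
  | _ => simp [FreeAlgebra.lift_ι_apply, piG]

/-- the projection to the group algebra -/
def pip : GBRAlg k G n ε →ₐ[k] AA k G n :=
  RingQuot.liftAlgHom k ⟨FreeAlgebra.lift k (piG k G n), fun _ _ h => piG_rel k G n ε h⟩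

theorem pip_gg (x : GBRGen n G) : pip k G n ε (gg k G n ε x) = piG k G n x := by
  unfold pip gg
  rw [RingQuot.liftAlgHom_mkAlgHom_apply, FreeAlgebra.lift_ι_apply]

theorem pip_sG (i : ℕ) (h : i + 1 < n) : pip k G n ε (sG k G n ε i) = as k G n i := by
  rw [sG_of i h, pip_gg]
  change as k G n (n - 2 - (n - 2 - i)) = _
  congr 1; omega
theorem pip_tG (g : G) (i : ℕ) (h : i < n) : pip k G n ε (tG k G n ε g i) = at' k G n g i := by
  rw [tG_of g i h, pip_gg]
  change at' k G n g (n - 1 - (n - 1 - i)) = _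
  congr 1; omega

theorem exists_Psi : ∃ Ψ : AA k G n →ₐ[k] GBRAlg k G n ε, (∀ i, Ψ (as k G n i) = sG k G n ε i) ∧
    ∀ g j, Ψ (at' k G n g j) = tG k G n ε g j :=
  aa_lift k G n gbr_rel tG_z sG_z sG_unit

def Psi : AA k G n →ₐ[k] GBRAlg k G n ε := (exists_Psi k G n ε).choose
theorem Psi_s (i : ℕ) : Psi k G n ε (as k G n i) = sG k G n ε i := (exists_Psi k G n ε).choose_spec.1 i
theorem Psi_t (g : G) (i : ℕ) : Psi k G n ε (at' k G n g i) = tG k G n ε g i :=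
  (exists_Psi k G n ε).choose_spec.2 g i

theorem pip_Psi : (pip k G n ε).comp (Psi k G n ε) = AlgHom.id k _ := by
  apply aa_ext
  · intro i h
    rw [AlgHom.comp_apply, Psi_s, pip_sG _ _ _ _ i h]; rfl
  · intro g i h
    rw [AlgHom.comp_apply, Psi_t, pip_tG _ _ _ _ g i h]; rfl

theorem aA_as (i : ℕ) (h : i + 1 < n) : aA k G n (as k G n i) = 1 := by
  rw [as_of k G n i h, aA_single]
theorem aA_at (g : G) (i : ℕ) (h : i < n) : aA k G n (at' k G n g i) = 1 := by
  rw [at_of k G n g i h, aA_single]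

theorem aug_Psi : (GBRaug k G n ε).comp (Psi k G n ε) = aA k G n := by
  apply aa_ext
  · intro i h
    rw [AlgHom.comp_apply, Psi_s, aug_sG i h, aA_as k G n i h]
  · intro g i h
    rw [AlgHom.comp_apply, Psi_t, aug_tG, aA_at k G n g i h]

theorem map_inverse {A B : Type} [Ring A] [Ring B] (f : A →+* B) {a : A} {b : B} (ha : IsUnit a)
    (h : f a * b = 1) : f (Ring.inverse a) = b := by
  calc f (Ring.inverse a) = f (Ring.inverse a) * (f a * b) := by rw [h, mul_one]
    _ = f (Ring.inverse a * a) * b := by rw [map_mul, mul_assoc]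
    _ = b := by rw [Ring.inverse_mul_cancel _ ha, map_one, one_mul]

theorem pip_aug : (aA k G n).comp (pip k G n ε) = GBRaug k G n ε := by
  apply gbr_ext
  intro x
  rw [AlgHom.comp_apply, pip_gg, aug_gg]
  cases x with
  | b i =>
    have := i.2
    exact aA_as k G n _ (by omega)
  | bi i =>
    have := i.2
    refine map_inverse (aA k G n : AA k G n →+* k) (as_unit k G n _ (by omega)) ?_
    rw [mul_one]
    exact aA_as k G n _ (by omega)
  | p j => exact map_zero _
  | t g j =>
    have := j.2
    exact aA_at k G n _ _ (by omega)

theorem Psi_piG_b (i : Fin (n - 1)) : Psi k G n ε (piG k G n (.b i)) = gg k G n ε (.b i) := by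
  unfold piG
  simp only
  rw [Psi_s, sG_flip]
theorem Psi_piG_bi (i : Fin (n - 1)) : Psi k G n ε (piG k G n (.bi i)) = gg k G n ε (.bi i) := by
  have := i.2
  refine map_inverse (Psi k G n ε : AA k G n →+* GBRAlg k G n ε) (as_unit k G n _ (by omega)) ?_
  have : Psi k G n ε (as k G n (n - 2 - i)) = gg k G n ε (.b i) := Psi_piG_b k G n ε i
  rw [← b_bi i, ← this]; rfl
theorem Psi_piG_t (g : G) (i : Fin n) : Psi k G n ε (piG k G n (.t g i)) = gg k G n ε (.t g i) := by
  unfold piG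
  simp only
  rw [Psi_t, tG_flip]
theorem Psi_piG_p (i : Fin n) : Psi k G n ε (piG k G n (.p i)) = 0 := map_zero _

theorem pip_bij (hε : IsUnit ε) (q : ℕ) :
    Function.Bijective (torMap k (GBRaug k G n ε) (aA k G n) (pip k G n ε) (pip_aug k G n ε) q) := by
  obtain ⟨f, h1, h2, h3, h4, h5⟩ := exists_f (k := k) (G := G) (n := n) hε
  refine torMap_split (pip k G n ε) (Psi k G n ε) (pip_aug k G n ε) (aug_Psi k G n ε)
    (fun a => DFunLike.congr_fun (pip_Psi k G n ε) a) f h1 (fun a => ?_) q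
  induction a using gbr_ind with
  | hg x =>
    rw [pip_gg]
    cases x with
    | b i => rw [Psi_piG_b, h3]
    | bi i => rw [Psi_piG_bi, h4]
    | p i => rw [Psi_piG_p, h2, mul_zero]
    | t g i => rw [Psi_piG_t, h5]
  | hk c => rw [AlgHom.commutes, AlgHom.commutes, Algebra.commutes]
  | ha a b iha ihb => rw [map_add, map_add, mul_add, add_mul, iha, ihb]
  | hm a b iha ihb => rw [map_mul, map_mul, ← mul_assoc, iha, mul_assoc, ihb, mul_assoc]

end gbr
end BR
end

noncomputable section

namespace BR
section fin
variable (k G : Type) [CommRing k] [Group G] (n : ℕ) (ε : k)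

/-- the map between group algebras -/
def Th : AA k G n →ₐ[k] AA k G (n + 1) :=
  ((pip k G (n + 1) ε).comp (GBRincl k G (n + 1) ε : GBRAlg k G n ε →ₐ[k] GBRAlg k G (n + 1) ε)).comp
    (Psi k G n ε)

theorem incl_gg (x : GBRGen n G) : (GBRincl k G (n + 1) ε : GBRAlg k G n ε →ₐ[k] GBRAlg k G (n + 1) ε)
    (gg k G n ε x) = gg k G (n + 1) ε (GBRGenMap G (n + 1) x) := by
  unfold GBRincl gg
  erw [RingQuot.liftAlgHom_mkAlgHom_apply]
  rw [AlgHom.comp_apply]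
  erw [FreeAlgebra.lift_ι_apply]

theorem Th_as (i : ℕ) (h : i + 1 < n) : Th k G n ε (as k G n i) = as k G (n + 1) (i + 1) := by
  unfold Th
  rw [AlgHom.comp_apply, AlgHom.comp_apply, Psi_s, sG_of i h, incl_gg, pip_gg]
  change as k G (n + 1) (n + 1 - 2 - (n - 2 - i)) = _
  congr 1; omega

theorem Th_at (g : G) (i : ℕ) (h : i < n) : Th k G n ε (at' k G n g i) = at' k G (n + 1) g (i + 1) := by
  unfold Th
  rw [AlgHom.comp_apply, AlgHom.comp_apply, Psi_t, tG_of g i h, incl_gg, pip_gg]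
  change at' k G (n + 1) g (n + 1 - 1 - (n - 1 - i)) = _
  congr 1; omega

theorem Th_aug : (aA k G (n + 1)).comp (Th k G n ε) = aA k G n := by
  apply aa_ext
  · intro i h
    rw [AlgHom.comp_apply, Th_as _ _ _ _ i h, aA_as k G _ _ (by omega), aA_as k G n i h]
  · intro g i h
    rw [AlgHom.comp_apply, Th_at _ _ _ _ g i h, aA_at k G _ _ _ (by omega), aA_at k G n g i h]

theorem Th_pip : (Th k G n ε).comp (pip k G n ε) =
    (pip k G (n + 1) ε).comp (GBRincl k G (n + 1) ε : GBRAlg k G n ε →ₐ[k] GBRAlg k G (n + 1) ε) := by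
  apply gbr_ext
  intro x
  unfold Th
  simp only [AlgHom.comp_apply]
  rw [pip_gg]
  cases x with
  | b i => rw [Psi_piG_b]
  | bi i => rw [Psi_piG_bi]
  | p i =>
    rw [Psi_piG_p, incl_gg, pip_gg, map_zero, map_zero]; rfl
  | t g i => rw [Psi_piG_t]

theorem Th_bij (q : ℕ) (h : 2 * q + 2 ≤ n + 1) :
    Function.Bijective (torMap k (aA k G n) (aA k G (n + 1)) (Th k G n ε) (Th_aug k G n ε) q) :=
  stab_abs (ph k G n) (aA k G n) (aA_ph k G n) (ph_inj k G n) (oo k (zz G n)) (ph_z k G n) (ph_frac k G n)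
    (ph k G (n + 1)) (aA k G (n + 1)) (aA_ph k G (n + 1)) (ph_inj k G (n + 1)) (oo k (zz G (n + 1)))
    (ph_z k G (n + 1)) (ph_frac k G (n + 1)) (Th k G n ε) (Th_aug k G n ε)
    (fun i hi => Th_as k G n ε i hi) (fun g i hi => Th_at k G n ε g i hi) q h

theorem torMap_congr {A B : Type} [Ring A] [Algebra k A] [Ring B] [Algebra k B] {ε₁ : A →ₐ[k] k} {ε₂ : B →ₐ[k] k}
    {φ ψ : A →ₐ[k] B} (e : φ = ψ) (hφ : ε₂.comp φ = ε₁) (hψ : ε₂.comp ψ = ε₁) (q : ℕ) :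
    torMap k ε₁ ε₂ φ hφ q = torMap k ε₁ ε₂ ψ hψ q := by
  subst e; rfl

theorem final (hε : IsUnit ε) (q : ℕ) (h : 2 * q + 2 ≤ n + 1) (hc) :
    Function.Bijective (torMap k (GBRaug k G n ε) (GBRaug k G (n + 1) ε)
      (GBRincl k G (n + 1) ε : GBRAlg k G n ε →ₐ[k] GBRAlg k G (n + 1) ε) hc q) := by
  have b1 := pip_bij k G n ε hε q
  have b2 := pip_bij k G (n + 1) ε hε q
  have b3 := Th_bij k G n ε q h
  have hχ : (aA k G (n + 1)).comp ((Th k G n ε).comp (pip k G n ε)) = GBRaug k G n ε := by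
    rw [← AlgHom.comp_assoc, Th_aug, pip_aug]
  have hχ' : (aA k G (n + 1)).comp ((pip k G (n + 1) ε).comp
      (GBRincl k G (n + 1) ε : GBRAlg k G n ε →ₐ[k] GBRAlg k G (n + 1) ε)) = GBRaug k G n ε := by
    rw [← Th_pip]; exact hχ
  have e1 := torMap_comp (pip k G n ε) (Th k G n ε) (pip_aug k G n ε) (Th_aug k G n ε) hχ q
  have e2 := torMap_comp (GBRincl k G (n + 1) ε : GBRAlg k G n ε →ₐ[k] GBRAlg k G (n + 1) ε)
    (pip k G (n + 1) ε) hc (pip_aug k G (n + 1) ε) hχ' q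
  have e3 := torMap_congr k (Th_pip k G n ε) hχ hχ' q
  have key : ⇑(torMap k (GBRaug k G (n + 1) ε) (aA k G (n + 1)) (pip k G (n + 1) ε) (pip_aug k G (n + 1) ε) q) ∘
      ⇑(torMap k (GBRaug k G n ε) (GBRaug k G (n + 1) ε)
      (GBRincl k G (n + 1) ε : GBRAlg k G n ε →ₐ[k] GBRAlg k G (n + 1) ε) hc q) =
      ⇑(torMap k (aA k G n) (aA k G (n + 1)) (Th k G n ε) (Th_aug k G n ε) q) ∘
      ⇑(torMap k (GBRaug k G n ε) (aA k G n) (pip k G n ε) (pip_aug k G n ε) q) := by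
    funext X
    rw [Function.comp_apply, Function.comp_apply, ← e1, ← e2, e3]
  have b4 := b3.comp b1
  rw [← key] at b4
  exact (Function.Bijective.of_comp_iff' b2 _).1 b4

end fin
end BR

end


/-- **Homological stability for `G`-equivariant braided rook algebras.**
Let `G` be a group, `k` a commutative `G`-ring, and `ε ∈ k` invertible.  The morphism
`Tor_q^{GBR_{n-1}(ε)}(𝟙,𝟙) → Tor_q^{GBR_n(ε)}(𝟙,𝟙)` induced by the inclusion
`GBR_{n-1}(ε) → GBR_n(ε)` is an isomorphism for `n ≥ 2q+2`. -/
theorem equivariant_braided_rook_homological_stability (k G : Type) [CommRing k] [Group G]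
    (ρ : G →* RingAut k) (ε : k) (hε : IsUnit ε) (n q : ℕ) (h : 2 * q + 2 ≤ n) :
    Function.Bijective
      (torMap k (GBRaug k G (n - 1) ε) (GBRaug k G n ε) (GBRincl k G n ε)
        (GBRaug_incl k G n ε) q) := by
  obtain ⟨m, rfl⟩ : ∃ m, n = m + 1 := ⟨n - 1, by omega⟩
  exact BR.final k G m ε hε q h (GBRaug_incl k G (m + 1) ε)
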